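/- Let n > p ≥ 1 with d = n − p > 1. Let g₁,…,g_p be holomorphic on an open neighborhood Ω of 0 in ℂⁿ with g_i(0) = 0, G = (g₁,…,g_p) : Ω → ℂ^p, and let I be the ideal of O_n generated by the germs of the g_i. Assume Σ = G^{-1}(0) is a d-dimensional isolated complete intersection singularity (ICIS): O_n/I has Krull dimension d and, on some neighborhood of 0, the derivative DG(z) is surjective for every z ∈ G^{-1}(0) ∖ {0}. Let f = Σ_{i=1}^p g_i², assume that near 0 the critical locus S(f) coincides with G^{-1}(0), and assume j(f) = dim_ℂ I/J(f) < ∞. Define the smoothing F(u,b,z) = Σ_{i=1}^p (1 + Σ_{j=1}^n b_{ij} z_j)(g_i(z) − u_i)² for (u,b) ∈ ℂ^p × ℂ^{pn}, and f_{u,b} = F(u,b,·). Then there exists ε₀ > 0 such that for every ε ∈ (0, ε₀] there exist δ > 0 and a dense open subset U of the open ball of radius δ about 0 in ℂ^p × ℂ^{pn} such that for every (u,b) ∈ U: the set of critical points z of f_{u,b} in the open ε-ball about 0 with G(z) ≠ u is finite, each such critical point is nondegenerate (an A₁ point), and the number of these points equals j(f). In other words j(f) = dim_ℂ I/J(f)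 = #A₁(f), the number of A₁ singularities appearing in a smoothing of f. (Theorem 3.11 of the paper; by Lemma 3.3 and Proposition 3.1 the assumption f = Σ g_i² entails no loss of generality among f ∈ I² with j(f) < ∞.) -/

import Mathlib

open Filter Topology

set_option maxHeartbeats 1000000
set_option synthInstance.maxHeartbeats 400000

noncomputable section

/-- `ℂⁿ`. -/
abbrev Cn (n : ℕ) : Type := Fin n → ℂ

/-- `Filter.Germ l ℂ` is a `ℂ`-algebra via constant germs. -/
instance germAlgebra {α : Type*} (l : Filter α) : Algebra ℂ (Filter.Germ l ℂ) :=
  ((Filter.Germ.coeRingHom l).comp (Pi.constRingHom α ℂ)).toAlgebra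

/-- The local ring `O_n` of germs at `0` of holomorphic functions `ℂⁿ → ℂ`,
realized as the subalgebra of `Filter.Germ (𝓝 0) ℂ` consisting of germs
having a representative analytic on a neighborhood of `0`. -/
def On (n : ℕ) : Subalgebra ℂ (Filter.Germ (𝓝 (0 : Cn n)) ℂ) where
  carrier := {φ | ∃ f : Cn n → ℂ, AnalyticAt ℂ f 0 ∧ φ = ↑f}
  mul_mem' := by
    rintro a b ⟨f, hf, rfl⟩ ⟨g, hg, rfl⟩
    exact ⟨f * g, hf.mul hg, rfl⟩
  one_mem' := ⟨1, analyticAt_const, rfl⟩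
  add_mem' := by
    rintro a b ⟨f, hf, rfl⟩ ⟨g, hg, rfl⟩
    exact ⟨f + g, hf.add hg, rfl⟩
  zero_mem' := ⟨0, analyticAt_const, rfl⟩
  algebraMap_mem' := fun c => ⟨fun _ => c, analyticAt_const, rfl⟩

/-- The ideal of `O_n` generated by the germs at `0` of a set of functions. -/
def idealOfFuns {n : ℕ} (s : Set (Cn n → ℂ)) : Ideal (On n) :=
  Ideal.span {x : On n | ∃ f ∈ s, (x : Filter.Germ (𝓝 (0 : Cn n)) ℂ) = ↑f}

/-- The `i`-th partial derivative `∂f/∂zᵢ` of `f : ℂⁿ → ℂ`. -/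
def pder {n : ℕ} (f : Cn n → ℂ) (i : Fin n) : Cn n → ℂ :=
  fun z => fderiv ℂ f z (Pi.single i 1)

/-- The jacobian ideal `J(f)` of `O_n`, generated by the germs at `0` of the
partial derivatives of `f`. -/
def jacobianIdeal {n : ℕ} (f : Cn n → ℂ) : Ideal (On n) :=
  idealOfFuns (Set.range (pder f))

/-- For ideals `J ⊆ I` of `O_n`, the quotient `I/J`, realized as the
`ℂ`-subspace of `O_n ⧸ J` given by the image of `I`. -/
def quotIJ {n : ℕ} (I J : Ideal (On n)) : Submodule ℂ ((On n) ⧸ J) :=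
  (I.map (Ideal.Quotient.mk J)).restrictScalars ℂ

/-- `f` has a singularity of type `A(d)` at `x ∈ ℂⁿ` (with `r = n - d`):
there is a biholomorphism `φ` from a neighborhood of `0` in `ℂ^d × ℂ^r` onto a
neighborhood of `x` with `φ 0 = x` and `f (φ (z, w)) - f x = w₁² + ⋯ + w_r²`. -/
def HasAdSingularityAt (n d r : ℕ) (f : Cn n → ℂ) (x : Cn n) : Prop :=
  ∃ (V : Set ((Fin d → ℂ) × (Fin r → ℂ))) (W : Set (Cn n))
    (φ : (Fin d → ℂ) × (Fin r → ℂ) → Cn n) (ψ : Cn n → (Fin d → ℂ) × (Fin r → ℂ)),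
    IsOpen V ∧ IsOpen W ∧ (0 : (Fin d → ℂ) × (Fin r → ℂ)) ∈ V ∧ x ∈ W ∧
    φ 0 = x ∧ AnalyticOnNhd ℂ φ V ∧ AnalyticOnNhd ℂ ψ W ∧
    Set.MapsTo φ V W ∧ Set.MapsTo ψ W V ∧
    (∀ q ∈ V, ψ (φ q) = q) ∧ (∀ y ∈ W, φ (ψ y) = y) ∧
    ∀ q ∈ V, f (φ q) - f x = ∑ i, (q.2 i) ^ 2

/-! ### The polydisc algebra -/

/-- The `i`-th coordinate as a continuous function on a closed polydisc. -/
def coordFun (n : ℕ) (r : ℝ) (i : Fin n) : C(Metric.closedBall (0 : Cn n) r, ℂ) :=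
  ⟨fun x => x.1 i, (continuous_apply i).comp continuous_subtype_val⟩

/-- The closure of the polynomial functions in the continuous functions on a polydisc. -/
def polydiscSubalgebra (n : ℕ) (r : ℝ) :
    Subalgebra ℂ C(Metric.closedBall (0 : Cn n) r, ℂ) :=
  (Algebra.adjoin ℂ (Set.range (coordFun n r))).topologicalClosure

/-- The polydisc algebra. -/
def PolydiscAlg (n : ℕ) (r : ℝ) : Type := ↥(polydiscSubalgebra n r)

namespace PolydiscAlg

variable {n : ℕ} {r : ℝ}

instance : NormedCommRing (PolydiscAlg n r) :=
  inferInstanceAs (NormedCommRing ↥(polydiscSubalgebra n r))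

instance : NormedAlgebra ℂ (PolydiscAlg n r) :=
  inferInstanceAs (NormedAlgebra ℂ ↥(polydiscSubalgebra n r))

instance : CompleteSpace (PolydiscAlg n r) :=
  (Subalgebra.isClosed_topologicalClosure
    (Algebra.adjoin ℂ (Set.range (coordFun n r)))).completeSpace_coe

/-- The inclusion into continuous functions. -/
def toCM (n : ℕ) (r : ℝ) : PolydiscAlg n r →ₐ[ℂ] C(Metric.closedBall (0 : Cn n) r, ℂ) :=
  (polydiscSubalgebra n r).val

lemma norm_toCM (v : PolydiscAlg n r) : ‖toCM n r v‖ = ‖v‖ := rfl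

lemma toCM_injective : Function.Injective (toCM n r) := Subtype.val_injective

lemma continuous_toCM : Continuous (toCM n r) := continuous_subtype_val

/-- The coordinate functions in the polydisc algebra. -/
def X (i : Fin n) : PolydiscAlg n r :=
  ⟨coordFun n r i, Subalgebra.le_topologicalClosure _ (Algebra.subset_adjoin ⟨i, rfl⟩)⟩

/-- Evaluation at a point of the closed polydisc (zero for other points). -/
def ev (x : Cn n) : PolydiscAlg n r →L[ℂ] ℂ := by
  classical
  exact if h : x ∈ Metric.closedBall (0 : Cn n) r then
    { toFun := fun v => toCM n r v ⟨x, h⟩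
      map_add' := fun v w => by simp
      map_smul' := fun c v => by simp
      cont := (continuous_eval_const (F := C(Metric.closedBall (0 : Cn n) r, ℂ)) _).comp continuous_toCM } else 0

lemma ev_apply {x : Cn n} (h : x ∈ Metric.closedBall (0 : Cn n) r) (v : PolydiscAlg n r) :
    ev x v = toCM n r v ⟨x, h⟩ := by
  simp [ev, h]

lemma ev_mul {x : Cn n} (h : x ∈ Metric.closedBall (0 : Cn n) r) (v w : PolydiscAlg n r) :
    ev x (v * w) = ev x v * ev x w := by
  simp [ev_apply h]

lemma ev_one {x : Cn n} (h : x ∈ Metric.closedBall (0 : Cn n) r) :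
    ev x (1 : PolydiscAlg n r) = 1 := by
  simp [ev_apply h]

lemma ev_algebraMap {x : Cn n} (h : x ∈ Metric.closedBall (0 : Cn n) r) (c : ℂ) :
    ev x (algebraMap ℂ (PolydiscAlg n r) c) = c := by
  rw [Algebra.algebraMap_eq_smul_one, map_smul, ev_one h]; simp

lemma ev_X {x : Cn n} (h : x ∈ Metric.closedBall (0 : Cn n) r) (i : Fin n) :
    ev x (X i : PolydiscAlg n r) = x i := by
  rw [ev_apply h]; rfl

lemma ev_pow {x : Cn n} (h : x ∈ Metric.closedBall (0 : Cn n) r) (v : PolydiscAlg n r) (k : ℕ) :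
    ev x (v ^ k) = ev x v ^ k := by
  simp [ev_apply h]

lemma norm_ev_le (x : Cn n) (v : PolydiscAlg n r) : ‖ev x v‖ ≤ ‖v‖ := by
  by_cases h : x ∈ Metric.closedBall (0 : Cn n) r
  · rw [ev_apply h]; exact (toCM n r v).norm_coe_le_norm _
  · simp [ev, h]

lemma norm_le_of_ev {v : PolydiscAlg n r} {c : ℝ} (hc : 0 ≤ c)
    (h : ∀ x ∈ Metric.closedBall (0 : Cn n) r, ‖ev x v‖ ≤ c) : ‖v‖ ≤ c := by
  rw [← norm_toCM, ContinuousMap.norm_le _ hc]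
  intro x
  have := h x.1 x.2
  rwa [ev_apply x.2] at this

lemma ext_ev {v w : PolydiscAlg n r}
    (h : ∀ x ∈ Metric.closedBall (0 : Cn n) r, ev x v = ev x w) : v = w := by
  apply toCM_injective
  ext x
  have := h x.1 x.2
  rwa [ev_apply x.2, ev_apply x.2] at this

/-- Polynomials are dense in the polydisc algebra. -/
lemma closure_adjoin_X :
    closure (Algebra.adjoin ℂ (Set.range (X : Fin n → PolydiscAlg n r)) :
      Set (PolydiscAlg n r)) = Set.univ := by
  rw [Set.eq_univ_iff_forall]
  intro v
  have hind : Topology.IsInducing (toCM n r) := Topology.IsInducing.subtypeVal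
  rw [hind.closure_eq_preimage_closure_image]
  have hv : toCM n r v ∈ closure (Algebra.adjoin ℂ (Set.range (coordFun n r)) : Set _) := v.2
  refine closure_mono ?_ hv
  have : (Algebra.adjoin ℂ (Set.range (coordFun n r))) =
      (Algebra.adjoin ℂ (Set.range (X : Fin n → PolydiscAlg n r))).map (toCM n r) := by
    rw [AlgHom.map_adjoin]
    congr 1
    rw [← Set.range_comp]
    rfl
  rw [this]
  rintro _ ⟨w, hw, rfl⟩
  exact ⟨w, hw, rfl⟩

/-- Induction principle for closed properties in the polydisc algebra. -/
lemma induction_closed {P : PolydiscAlg n r → Prop} (hcl : IsClosed {v | P v})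
    (hX : ∀ i, P (X i)) (hC : ∀ c, P (algebraMap ℂ _ c))
    (hadd : ∀ v w, P v → P w → P (v + w)) (hmul : ∀ v w, P v → P w → P (v * w))
    (v : PolydiscAlg n r) : P v := by
  have h1 : (Algebra.adjoin ℂ (Set.range (X : Fin n → PolydiscAlg n r)) :
      Set (PolydiscAlg n r)) ⊆ {v | P v} := by
    intro w hw
    induction hw using Algebra.adjoin_induction with
    | mem x hx => obtain ⟨i, rfl⟩ := hx; exact hX i
    | algebraMap c => exact hC c
    | add x y _ _ hx hy => exact hadd _ _ hx hy
    | mul x y _ _ hx hy => exact hmul _ _ hx hy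
  have h2 := closure_minimal h1 hcl
  rw [closure_adjoin_X] at h2
  exact h2 (Set.mem_univ v)

/-- Functions on `ℂⁿ` which coincide on the polydisc with an element of the algebra. -/
def IsRep (r : ℝ) (f : Cn n → ℂ) (v : PolydiscAlg n r) : Prop :=
  ∀ x ∈ Metric.closedBall (0 : Cn n) r, ev x v = f x

/-- A function that is a uniform limit on the polydisc of members of the algebra. -/
lemma exists_isRep_of_tendstoUniformlyOn {f : Cn n → ℂ} (v : ℕ → PolydiscAlg n r)
    (h : TendstoUniformlyOn (fun k x => ev x (v k)) f atTop (Metric.closedBall (0 : Cn n) r)) :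
    ∃ w : PolydiscAlg n r, IsRep r f w := by
  have hcs : CauchySeq v := by
    rw [Metric.cauchySeq_iff']
    intro ε hε
    rw [Metric.tendstoUniformlyOn_iff] at h
    obtain ⟨N, hN⟩ := eventually_atTop.1 (h (ε / 3) (by positivity))
    refine ⟨N, fun k hk => ?_⟩
    rw [dist_eq_norm]
    have : ‖v k - v N‖ ≤ 2 * (ε / 3) := by
      refine norm_le_of_ev (by positivity) fun x hx => ?_
      rw [map_sub, ← dist_eq_norm]
      have h1 := hN k hk x hx
      have h2 := hN N le_rfl x hx
      have := dist_triangle_left (ev x (v k)) (ev x (v N)) (f x)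
      linarith
    linarith
  obtain ⟨w, hw⟩ := cauchySeq_tendsto_of_complete hcs
  refine ⟨w, fun x hx => ?_⟩
  have h1 : Tendsto (fun k => ev x (v k)) atTop (𝓝 (ev x w)) :=
    ((ev x).continuous.tendsto w).comp hw
  exact tendsto_nhds_unique h1 (h.tendsto_at hx)

lemma exists_isRep_homogeneous (k : ℕ) (q : ContinuousMultilinearMap ℂ (fun _ : Fin k => Cn n) ℂ) :
    ∃ w : PolydiscAlg n r, IsRep r (fun y => q fun _ => y) w := by
  classical
  refine ⟨∑ s : Fin k → Fin n, (q fun l => Pi.single (s l) 1) • ∏ l, X (s l), fun x hx => ?_⟩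
  have hx' : x = ∑ i, x i • (Pi.single i (1 : ℂ) : Cn n) := by
    conv_lhs => rw [pi_eq_sum_univ' x]
  have : (q fun _ => x) = ∑ s : Fin k → Fin n,
      (∏ l, x (s l)) * q fun l => Pi.single (s l) 1 := by
    conv_lhs => rw [hx']
    rw [ContinuousMultilinearMap.map_sum]
    refine Finset.sum_congr rfl fun s _ => ?_
    rw [ContinuousMultilinearMap.map_smul_univ, smul_eq_mul]
  beta_reduce
  rw [this, map_sum]
  refine Finset.sum_congr rfl fun s _ => ?_
  rw [map_smul, smul_eq_mul, mul_comm]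
  congr 1
  simp only [ev_apply hx, map_prod]
  simp only [ContinuousMap.coe_prod, Finset.prod_apply]
  rfl

/-- Germs of analytic functions are represented in polydisc algebras of small radius. -/
lemma exists_isRep {f : Cn n → ℂ} (hf : AnalyticAt ℂ f 0) :
    ∃ ρ > (0 : ℝ), ∀ r ≤ ρ, ∃ w : PolydiscAlg n r, IsRep r f w := by
  obtain ⟨p, R, hp⟩ := hf
  obtain ⟨R', hR'0, hR'⟩ := ENNReal.lt_iff_exists_nnreal_btwn.1 hp.r_pos
  have hu := hp.tendstoUniformlyOn hR'
  refine ⟨R' / 2, by have : (0 : ℝ) < R' := by exact_mod_cast hR'0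
                     positivity, fun r hr => ?_⟩
  choose w hw using fun k => exists_isRep_homogeneous (r := r) k (p k)
  refine exists_isRep_of_tendstoUniformlyOn (fun m => ∑ k ∈ Finset.range m, w k) ?_
  have hR0 : (0 : ℝ) < R' := by exact_mod_cast hR'0
  have hsub : Metric.closedBall (0 : Cn n) r ⊆ Metric.ball 0 R' := by
    refine (Metric.closedBall_subset_closedBall hr).trans
      (Metric.closedBall_subset_ball (by linarith))
  refine ((hu.mono hsub).congr ?_).congr_right ?_
  · refine Eventually.of_forall fun m x hx => ?_
    simp only [FormalMultilinearSeries.partialSum, map_sum]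
    exact Finset.sum_congr rfl fun k _ => (hw k x hx).symm
  · intro x _; simp

end PolydiscAlg

namespace PolydiscAlg

variable {n : ℕ} {r : ℝ}

/-! ### Substitution and division -/

/-- Composition with a self-map of the polydisc, on all continuous functions. -/
lemma exists_comp (θ : C(Metric.closedBall (0 : Cn n) r, Metric.closedBall (0 : Cn n) r))
    (hθ : ∀ i, ∃ w : PolydiscAlg n r, toCM n r w = (coordFun n r i).comp θ)
    (v : PolydiscAlg n r) : (toCM n r v).comp θ ∈ polydiscSubalgebra n r := by
  refine induction_closed (P := fun v => (toCM n r v).comp θ ∈ polydiscSubalgebra n r)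
    ?_ ?_ ?_ ?_ ?_ v
  · refine IsClosed.preimage (f := fun v : PolydiscAlg n r => (toCM n r v).comp θ) ?_
      (Subalgebra.isClosed_topologicalClosure _)
    exact (ContinuousMap.continuous_precomp θ).comp continuous_toCM
  · intro i
    obtain ⟨w, hw⟩ := hθ i
    have : (toCM n r (X i)).comp θ = toCM n r w := hw.symm
    rw [this]
    exact w.2
  · intro c
    have : (toCM n r (algebraMap ℂ _ c)).comp θ =
        algebraMap ℂ C(Metric.closedBall (0 : Cn n) r, ℂ) c := by
      ext x; simp
    rw [this]
    exact Subalgebra.algebraMap_mem _ c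
  · intro v w hv hw
    have : (toCM n r (v + w)).comp θ = (toCM n r v).comp θ + (toCM n r w).comp θ := by
      ext x; simp
    rw [this]
    exact add_mem hv hw
  · intro v w hv hw
    have : (toCM n r (v * w)).comp θ = (toCM n r v).comp θ * (toCM n r w).comp θ := by
      ext x; simp
    rw [this]
    exact mul_mem hv hw

/-- Substitution of constants `x j` for the coordinates `z j` with `j ∈ s`. -/
def substMap (s : Finset (Fin n)) (x z : Cn n) : Cn n := fun j => if j ∈ s then x j else z j

lemma substMap_empty (x z : Cn n) : substMap ∅ x z = z := by
  funext j; simp [substMap]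

lemma substMap_univ (x z : Cn n) : substMap Finset.univ x z = x := by
  funext j; simp [substMap]

lemma substMap_substMap_singleton (s : Finset (Fin n)) (i : Fin n) (x z : Cn n) :
    substMap s x (substMap {i} x z) = substMap (insert i s) x z := by
  funext j
  simp only [substMap, Finset.mem_insert, Finset.mem_singleton]
  by_cases h1 : j ∈ s <;> by_cases h2 : j = i <;> simp [h1, h2]

lemma substMap_mem {s : Finset (Fin n)} {x z : Cn n}
    (hx : x ∈ Metric.closedBall (0 : Cn n) r) (hz : z ∈ Metric.closedBall (0 : Cn n) r) :
    substMap s x z ∈ Metric.closedBall (0 : Cn n) r := by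
  rw [mem_closedBall_zero_iff] at *
  have hr : 0 ≤ r := (norm_nonneg _).trans hx
  rw [pi_norm_le_iff_of_nonneg hr]
  intro j
  unfold substMap
  split_ifs
  · exact (norm_le_pi_norm x j).trans hx
  · exact (norm_le_pi_norm z j).trans hz

lemma continuous_substMap (s : Finset (Fin n)) (x : Cn n) : Continuous (substMap s x) := by
  refine continuous_pi fun j => ?_
  unfold substMap
  split_ifs
  · exact continuous_const
  · exact continuous_apply j

/-- The substitution operator on the polydisc algebra. -/
lemma exists_subst (s : Finset (Fin n)) {x : Cn n} (hx : x ∈ Metric.closedBall (0 : Cn n) r) :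
    ∃ S : PolydiscAlg n r →L[ℂ] PolydiscAlg n r,
      ∀ v, ∀ z ∈ Metric.closedBall (0 : Cn n) r, ev z (S v) = ev (substMap s x z) v := by
  let θ : C(Metric.closedBall (0 : Cn n) r, Metric.closedBall (0 : Cn n) r) :=
    ⟨fun z => ⟨substMap s x z.1, substMap_mem hx z.2⟩,
      ((continuous_substMap s x).comp continuous_subtype_val).subtype_mk _⟩
  have hθ : ∀ i, ∃ w : PolydiscAlg n r, toCM n r w = (coordFun n r i).comp θ := by
    intro i
    by_cases hi : i ∈ s
    · refine ⟨algebraMap ℂ _ (x i), ?_⟩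
      ext z
      simp [coordFun, θ, substMap, hi]
    · refine ⟨X i, ?_⟩
      ext z
      simp only [coordFun, θ, substMap, ContinuousMap.comp_apply, ContinuousMap.coe_mk, hi,
        if_false]
      rfl
  have key := exists_comp θ hθ
  let S0 : PolydiscAlg n r →ₗ[ℂ] PolydiscAlg n r :=
    { toFun := fun v => ⟨(toCM n r v).comp θ, key v⟩
      map_add' := fun v w => Subtype.ext (by ext z; simp; rfl)
      map_smul' := fun c w => Subtype.ext (by ext z; simp; rfl) }
  have hS0 : ∀ v, ∀ z ∈ Metric.closedBall (0 : Cn n) r, ev z (S0 v) = ev (substMap s x z) v := by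
    intro v z hz
    rw [ev_apply hz, ev_apply (substMap_mem hx hz)]
    rfl
  refine ⟨S0.mkContinuous 1 fun v => ?_, hS0⟩
  rw [one_mul]
  refine norm_le_of_ev (norm_nonneg _) fun z hz => ?_
  rw [hS0 v z hz]
  exact norm_ev_le _ _

/-- Maximum principle: multiplication by `zᵢ - xᵢ` is bounded below. -/
lemma le_norm_mul_sub {x : Cn n} (hx : x ∈ Metric.ball (0 : Cn n) r) (i : Fin n)
    (v : PolydiscAlg n r) :
    (r - ‖x i‖) * ‖v‖ ≤ ‖(X i - algebraMap ℂ _ (x i)) * v‖ := by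
  have hxi : ‖x i‖ < r := (norm_le_pi_norm x i).trans_lt (by simpa using hx)
  have hr : 0 < r := (norm_nonneg _).trans_lt hxi
  have hxc := Metric.ball_subset_closedBall hx
  -- elements represented by entire functions
  have hdense : ∀ w ∈ (Algebra.adjoin ℂ (Set.range (X : Fin n → PolydiscAlg n r)) :
      Set (PolydiscAlg n r)), ∃ f : Cn n → ℂ, Differentiable ℂ f ∧ IsRep r f w := by
    intro w hw
    induction hw using Algebra.adjoin_induction with
    | mem x hx =>
      obtain ⟨i, rfl⟩ := hx
      exact ⟨fun z => z i, by fun_prop, fun z hz => ev_X hz i⟩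
    | algebraMap c => exact ⟨fun _ => c, by fun_prop, fun z hz => ev_algebraMap hz c⟩
    | add x y _ _ hx hy =>
      obtain ⟨f, hf, hf'⟩ := hx
      obtain ⟨g, hg, hg'⟩ := hy
      exact ⟨fun z => f z + g z, hf.add hg, fun z hz => by rw [map_add, hf' z hz, hg' z hz]⟩
    | mul x y _ _ hx hy =>
      obtain ⟨f, hf, hf'⟩ := hx
      obtain ⟨g, hg, hg'⟩ := hy
      exact ⟨fun z => f z * g z, hf.mul hg, fun z hz => by rw [ev_mul hz, hf' z hz, hg' z hz]⟩
  have hcl : IsClosed {v : PolydiscAlg n r |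
      (r - ‖x i‖) * ‖v‖ ≤ ‖(X i - algebraMap ℂ _ (x i)) * v‖} :=
    isClosed_le (by fun_prop) (by fun_prop)
  have hsub := closure_minimal (s := (Algebra.adjoin ℂ (Set.range (X : Fin n → PolydiscAlg n r)) :
      Set (PolydiscAlg n r))) ?_ hcl
  · rw [closure_adjoin_X] at hsub
    exact hsub (Set.mem_univ v)
  intro w hw
  obtain ⟨f, hf, hfw⟩ := hdense w hw
  have hpos : 0 < r - ‖x i‖ := by linarith
  rw [Set.mem_ofPred_eq, mul_comm, ← le_div_iff₀ hpos]
  refine norm_le_of_ev (by positivity) fun z hz => ?_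
  have hz' : ∀ j, ‖z j‖ ≤ r := fun j => (norm_le_pi_norm z j).trans (by simpa using hz)
  have hupd : ∀ ζ : ℂ, ‖ζ‖ ≤ r → Function.update z i ζ ∈ Metric.closedBall (0 : Cn n) r := by
    intro ζ hζ
    rw [mem_closedBall_zero_iff, pi_norm_le_iff_of_nonneg hr.le]
    intro j
    by_cases hj : j = i
    · subst hj; simpa using hζ
    · simpa [hj] using hz' j
  have hd : Differentiable ℂ fun ζ : ℂ => f (Function.update z i ζ) := by
    refine hf.comp ?_
    exact fun ζ => (hasFDerivAt_update z ζ).differentiableAt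
  have := Complex.norm_le_of_forall_mem_frontier_norm_le (U := Metric.ball (0 : ℂ) r)
    (f := fun ζ : ℂ => f (Function.update z i ζ)) Metric.isBounded_ball hd.diffContOnCl
    (C := ‖(X i - algebraMap ℂ _ (x i)) * w‖ / (r - ‖x i‖)) ?_ (z := z i) ?_
  · rw [Function.update_eq_self] at this
    rwa [hfw z hz]
  · intro ζ hζ
    rw [frontier_ball _ hr.ne', mem_sphere_zero_iff_norm] at hζ
    have hm := hupd ζ hζ.le
    rw [le_div_iff₀ hpos, ← hfw _ hm]
    have h1 := norm_ev_le (Function.update z i ζ) ((X i - algebraMap ℂ _ (x i)) * w)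
    rw [ev_mul hm, map_sub, ev_X hm, ev_algebraMap hm, norm_mul, Function.update_self] at h1
    have h2 : r - ‖x i‖ ≤ ‖ζ - x i‖ := by
      rw [← hζ]; exact norm_sub_norm_le _ _
    calc _ ≤ ‖(ev (Function.update z i ζ)) w‖ * ‖ζ - x i‖ := by gcongr
      _ = _ := mul_comm _ _
      _ ≤ _ := h1
  · rw [closure_ball _ hr.ne', mem_closedBall_zero_iff]
    exact hz' i

/-- Bounded division of `v - v|_{zᵢ = xᵢ}` by `zᵢ - xᵢ`. -/
lemma exists_div {x : Cn n} (hx : x ∈ Metric.ball (0 : Cn n) r) (i : Fin n) :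
    ∃ D : PolydiscAlg n r →L[ℂ] PolydiscAlg n r,
      ∀ v, ∀ z ∈ Metric.closedBall (0 : Cn n) r,
        (z i - x i) * ev z (D v) = ev z v - ev (substMap {i} x z) v := by
  have hxi : ‖x i‖ < r := (norm_le_pi_norm x i).trans_lt (by simpa using hx)
  have hxc := Metric.ball_subset_closedBall hx
  obtain ⟨S, hS⟩ := exists_subst {i} hxc
  have hpos : 0 < r - ‖x i‖ := by linarith
  let u : PolydiscAlg n r := X i - algebraMap ℂ _ (x i)
  let μ : PolydiscAlg n r →L[ℂ] PolydiscAlg n r := ContinuousLinearMap.mul ℂ _ u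
  have hμ : ∀ v, μ v = u * v := fun v => rfl
  have hanti : AntilipschitzWith (Real.toNNReal (r - ‖x i‖)⁻¹) μ := by
    refine AddMonoidHomClass.antilipschitz_of_bound μ fun v => ?_
    rw [Real.coe_toNNReal _ (by positivity), inv_mul_eq_div, le_div_iff₀ hpos, mul_comm]
    exact le_norm_mul_sub hx i v
  have hclosed : IsClosed (Set.range μ) := hanti.isClosed_range μ.uniformContinuous
  have hSmul : ∀ v w, S (v * w) = S v * S w := fun v w => ext_ev fun z hz => by
    rw [hS _ z hz, ev_mul hz, hS _ z hz, hS _ z hz, ev_mul (substMap_mem hxc hz)]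
  have hmem : ∀ v, v - S v ∈ Set.range μ := by
    refine induction_closed ?_ ?_ ?_ ?_ ?_
    · exact hclosed.preimage (by fun_prop : Continuous fun v => v - S v)
    · intro j
      by_cases hj : j = i
      · subst hj
        refine ⟨1, ?_⟩
        rw [hμ, mul_one]
        refine ext_ev fun z hz => ?_
        simp only [u, map_sub]
        rw [hS _ z hz, ev_X hz, ev_X (substMap_mem hxc hz), ev_algebraMap hz]
        simp [substMap]
      · refine ⟨0, ?_⟩
        rw [map_zero]
        refine ext_ev fun z hz => ?_
        rw [map_sub, hS _ z hz, ev_X hz, ev_X (substMap_mem hxc hz)]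
        simp [substMap, hj]
    · intro c
      refine ⟨0, ?_⟩
      rw [map_zero]
      refine ext_ev fun z hz => ?_
      rw [map_sub, hS _ z hz, ev_algebraMap hz, ev_algebraMap (substMap_mem hxc hz)]
      simp
    · rintro v w ⟨a, ha⟩ ⟨b, hb⟩
      exact ⟨a + b, by rw [map_add, ha, hb, map_add]; ring⟩
    · rintro v w ⟨a, ha⟩ ⟨b, hb⟩
      refine ⟨a * w + S v * b, ?_⟩
      rw [hμ] at *
      rw [hSmul]
      linear_combination w * ha + S v * hb
  choose D0 hD0 using hmem
  have hinj := hanti.injective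
  let D1 : PolydiscAlg n r →ₗ[ℂ] PolydiscAlg n r :=
    { toFun := D0
      map_add' := fun v w => hinj (by rw [map_add, hD0, hD0, hD0, map_add]; ring)
      map_smul' := fun c v => hinj (by
        rw [RingHom.id_apply, map_smul, hD0, hD0, map_smul, smul_sub]) }
  refine ⟨D1.mkContinuous ((r - ‖x i‖)⁻¹ * (1 + ‖S‖)) fun v => ?_, fun v z hz => ?_⟩
  · have h1 := le_norm_mul_sub hx i (D0 v)
    have h2 : (X i - algebraMap ℂ _ (x i)) * D0 v = v - S v := hD0 v
    rw [h2] at h1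
    have h3 : ‖v - S v‖ ≤ (1 + ‖S‖) * ‖v‖ := by
      refine (norm_sub_le _ _).trans ?_
      have := S.le_opNorm v
      linarith
    rw [mul_assoc, inv_mul_eq_div, le_div_iff₀ hpos, mul_comm]
    exact h1.trans h3
  · have h2 : (X i - algebraMap ℂ _ (x i)) * D0 v = v - S v := hD0 v
    have h3 := congrArg (ev z) h2
    rw [ev_mul hz, map_sub, map_sub, ev_X hz, ev_algebraMap hz, hS v z hz] at h3
    exact h3

/-- Gleason's decomposition in the polydisc algebra, with a partial substitution of the
first `k` variables. -/
lemma exists_gleason_partial {x : Cn n} (hx : x ∈ Metric.ball (0 : Cn n) r) :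
    ∃ D : Fin n → PolydiscAlg n r →L[ℂ] PolydiscAlg n r, ∀ k ≤ n, ∀ v,
      ∀ z ∈ Metric.closedBall (0 : Cn n) r,
        ev z v = ev (substMap (Finset.univ.filter fun j : Fin n => (j : ℕ) < k) x z) v
          + ∑ i ∈ Finset.univ.filter (fun j : Fin n => (j : ℕ) < k),
            (z i - x i) * ev z (D i v) := by
  have hxc := Metric.ball_subset_closedBall hx
  choose D hD using exists_div (r := r) hx
  choose S hS using fun s => exists_subst (r := r) s hxc
  refine ⟨fun i => (D i).comp (S (Finset.univ.filter fun j : Fin n => (j : ℕ) < i)),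
    fun k hk v z hz => ?_⟩
  induction k with
  | zero => simp [substMap_empty]
  | succ k ih =>
    have hkn : k < n := hk
    rw [ih hkn.le]
    have hins : (Finset.univ.filter fun j : Fin n => (j : ℕ) < k + 1) =
        insert ⟨k, hkn⟩ (Finset.univ.filter fun j : Fin n => (j : ℕ) < k) := by
      ext j
      simp only [Finset.mem_filter, Finset.mem_univ, true_and, Finset.mem_insert, Fin.ext_iff]
      omega
    rw [hins, Finset.sum_insert (by simp)]
    simp only [ContinuousLinearMap.comp_apply]
    rw [hD _ _ z hz, hS _ _ z hz, hS _ _ _ (substMap_mem hxc hz)]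
    rw [substMap_substMap_singleton]
    ring

/-- Gleason's decomposition in the polydisc algebra. -/
lemma exists_gleason {x : Cn n} (hx : x ∈ Metric.ball (0 : Cn n) r) :
    ∃ D : Fin n → PolydiscAlg n r →L[ℂ] PolydiscAlg n r, ∀ v,
      v = algebraMap ℂ _ (ev x v) + ∑ i, (X i - algebraMap ℂ _ (x i)) * D i v := by
  obtain ⟨D, hD⟩ := exists_gleason_partial hx
  refine ⟨D, fun v => ext_ev fun z hz => ?_⟩
  rw [hD n le_rfl v z hz, map_add, ev_algebraMap hz, map_sum]
  congr 1
  · rw [Finset.filter_true_of_mem fun j _ => j.2, substMap_univ]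
  · rw [Finset.filter_true_of_mem fun j _ => j.2]
    refine Finset.sum_congr rfl fun i _ => ?_
    rw [ev_mul hz, map_sub, ev_X hz, ev_algebraMap hz]

end PolydiscAlg

/-! ### Analytic families of operators with right inverses -/

section RightInverse

variable {X Y C P : Type*} [NormedAddCommGroup X] [NormedSpace ℂ X]
  [NormedAddCommGroup Y] [NormedSpace ℂ Y]
  [NormedAddCommGroup C] [NormedSpace ℂ C] [NormedAddCommGroup P] [NormedSpace ℂ P]

/-- The vanishing of `π` on the kernel of `L`, in terms of a right inverse of `L`. -/
lemma kernel_le_iff_of_rightInverse {L : X →L[ℂ] Y} {T : Y →L[ℂ] X}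
    (hT : L.comp T = ContinuousLinearMap.id ℂ Y) (π : X →L[ℂ] C) :
    (∀ x, L x = 0 → π x = 0) ↔ π.comp (ContinuousLinearMap.id ℂ X - T.comp L) = 0 := by
  have hLT : ∀ y, L (T y) = y := fun y => by
    simpa using congrArg (fun F : Y →L[ℂ] Y => F y) hT
  constructor
  · intro h
    ext x
    refine h _ ?_
    simp [hLT]
  · intro h x hx
    have := congrArg (fun F : X →L[ℂ] C => F x) h
    simpa [hx] using this

variable [CompleteSpace Y]

lemma exists_analyticAt_rightInverse {L₀ : X →L[ℂ] Y} {T₀ : Y →L[ℂ] X}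
    (hT : L₀.comp T₀ = ContinuousLinearMap.id ℂ Y) :
    ∃ T : (X →L[ℂ] Y) → (Y →L[ℂ] X), T L₀ = T₀ ∧
      ∀ᶠ L in 𝓝 L₀, AnalyticAt ℂ T L ∧ L.comp (T L) = ContinuousLinearMap.id ℂ Y := by
  let c : (X →L[ℂ] Y) →L[ℂ] (Y →L[ℂ] Y) := (ContinuousLinearMap.compL ℂ Y X Y).flip T₀
  have hc : ∀ L, c L = L.comp T₀ := fun L => rfl
  have hc0 : c L₀ = 1 := by rw [hc, hT]; rfl
  have hunit : ∀ᶠ L in 𝓝 L₀, IsUnit (c L) := by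
    have : ∀ᶠ M in 𝓝 (c L₀), IsUnit M := by
      rw [hc0]; exact Units.isOpen.mem_nhds isUnit_one
    exact c.continuous.continuousAt.eventually this
  refine ⟨fun L => T₀.comp (Ring.inverse (c L)), ?_, ?_⟩
  · beta_reduce
    rw [hc0, Ring.inverse_one]; rfl
  · filter_upwards [hunit] with L hL
    constructor
    · obtain ⟨u, hu⟩ := hL
      have h1 : AnalyticAt ℂ (Ring.inverse : (Y →L[ℂ] Y) → _) (c L) := by
        rw [← hu]; exact analyticAt_inverse u
      have h2 : AnalyticAt ℂ (fun L => Ring.inverse (c L)) L := h1.comp (c.analyticAt L)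
      exact ((ContinuousLinearMap.compL ℂ Y Y X T₀).analyticAt _).comp h2
    · have := Ring.mul_inverse_cancel _ hL
      rw [← ContinuousLinearMap.comp_assoc]
      exact this

/-- Independence propagates along a connected set of operators with right inverses. -/
lemma kernel_le_of_preconnected {B : Set P} (hB : IsOpen B) (hBc : IsPreconnected B)
    {L : P → X →L[ℂ] Y} (hL : AnalyticOnNhd ℂ L B)
    (hR : ∀ b ∈ B, ∃ T : Y →L[ℂ] X, (L b).comp T = ContinuousLinearMap.id ℂ Y)
    (π : X →L[ℂ] C) {b₀ : P} (hb₀ : b₀ ∈ B)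
    (h₀ : ∀ᶠ b in 𝓝 b₀, ∀ x, L b x = 0 → π x = 0) :
    ∀ b ∈ B, ∀ x, L b x = 0 → π x = 0 := by
  set S : Set P := {b | ∀ᶠ b' in 𝓝 b, ∀ x, L b' x = 0 → π x = 0} with hS
  have hSo : IsOpen S := by
    rw [isOpen_iff_mem_nhds]
    intro b hb
    exact eventually_eventually_nhds.2 hb
  have hsub : B ⊆ S := by
    refine hBc.subset_of_closure_inter_subset hSo ⟨b₀, hb₀, h₀⟩ ?_
    rintro b ⟨hbS, hbB⟩
    obtain ⟨T₀, hT₀⟩ := hR b hbB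
    obtain ⟨T, -, hT⟩ := exists_analyticAt_rightInverse hT₀
    have hev : ∀ᶠ b' in 𝓝 b, b' ∈ B ∧ AnalyticAt ℂ T (L b') ∧
        (L b').comp (T (L b')) = ContinuousLinearMap.id ℂ Y :=
      Filter.Eventually.and (hB.mem_nhds hbB) ((hL b hbB).continuousAt.eventually hT)
    obtain ⟨ε, hε, hball⟩ := Metric.eventually_nhds_iff_ball.1 hev
    let φ : P → X →L[ℂ] C := fun b' =>
      π.comp (ContinuousLinearMap.id ℂ X - (T (L b')).comp (L b'))
    have hφ : AnalyticOnNhd ℂ φ (Metric.ball b ε) := by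
      intro b' hb'
      obtain ⟨h1, h2, -⟩ := hball b' hb'
      have hLb := hL b' h1
      have hTL : AnalyticAt ℂ (fun b => T (L b)) b' := AnalyticAt.comp h2 hLb
      have hcomp : AnalyticAt ℂ (fun b => (T (L b)).comp (L b)) b' :=
        AnalyticAt.comp (f := fun b => (T (L b), L b))
          (g := fun q : (Y →L[ℂ] X) × (X →L[ℂ] Y) => q.1.comp q.2)
          ((ContinuousLinearMap.compL ℂ X Y X).analyticAt_bilinear _) (hTL.prod hLb)
      exact ((ContinuousLinearMap.compL ℂ X X C π).analyticAt _).comp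
        (analyticAt_const.sub hcomp)
    obtain ⟨b₁, hb₁, hb₁S⟩ : ∃ b₁ ∈ Metric.ball b ε, b₁ ∈ S := by
      obtain ⟨b₁, h1, h2⟩ := Metric.mem_closure_iff.1 hbS ε hε
      exact ⟨b₁, by rwa [Metric.mem_ball'], h1⟩
    have hz : φ =ᶠ[𝓝 b₁] 0 := by
      filter_upwards [hb₁S, Metric.isOpen_ball.mem_nhds hb₁] with b' h1 h2
      exact (kernel_le_iff_of_rightInverse (hball b' h2).2.2 π).1 h1
    have hzero := hφ.eqOn_zero_of_preconnected_of_eventuallyEq_zero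
      (convex_ball b ε).isPreconnected hb₁ hz
    filter_upwards [Metric.ball_mem_nhds b hε] with b' hb'
    exact (kernel_le_iff_of_rightInverse (hball b' hb').2.2 π).2 (hzero hb')
  intro b hb
  exact (hsub hb).self_of_nhds

end RightInverse

/-! ### Joint generalized eigenspaces of commuting operators -/

section JointEigenspaces

variable {A V σ : Type*} [CommRing A] [Algebra ℂ A] [AddCommGroup V] [Module ℂ V]

/-- Joint generalized eigenspaces for the action of `z i`. -/
def jointEig (ρ : A →ₐ[ℂ] Module.End ℂ V) (z : σ → A) (χ : σ → ℂ) : Submodule ℂ V :=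
  ⨅ i, (ρ (z i)).maxGenEigenspace (χ i)

variable (ρ : A →ₐ[ℂ] Module.End ℂ V) (z : σ → A) (χ : σ → ℂ)

lemma commute_rep (a b : A) : Commute (ρ a) (ρ b) := by
  show ρ a * ρ b = ρ b * ρ a
  rw [← map_mul, mul_comm, map_mul]

lemma mem_jointEig_iff (v : V) :
    v ∈ jointEig ρ z χ ↔ ∀ i, ∃ k : ℕ, (ρ ((z i - algebraMap ℂ A (χ i)) ^ k)) v = 0 := by
  simp only [jointEig, Submodule.mem_iInf, Module.End.mem_maxGenEigenspace, map_pow, map_sub,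
    AlgHom.commutes]
  rfl

lemma mapsTo_jointEig (a : A) : ∀ v ∈ jointEig ρ z χ, ρ a v ∈ jointEig ρ z χ := by
  intro v hv
  rw [mem_jointEig_iff] at *
  intro i
  obtain ⟨k, hk⟩ := hv i
  refine ⟨k, ?_⟩
  have := (commute_rep ρ ((z i - algebraMap ℂ A (χ i)) ^ k) a).eq
  have h2 := congrArg (fun f : Module.End ℂ V => f v) this
  simp only [Module.End.mul_apply] at h2
  rw [h2, hk, map_zero]

/-- Induction along the nilpotency order in a joint generalized eigenspace. -/
lemma jointEig_induction [Fintype σ] {Q : V → Prop} (h0 : Q 0)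
    (h : ∀ v ∈ jointEig ρ z χ, (∀ i, Q (ρ (z i - algebraMap ℂ A (χ i)) v)) → Q v) :
    ∀ v ∈ jointEig ρ z χ, Q v := by
  have key : ∀ (m : ℕ) (k : σ → ℕ), ∑ i, k i = m → ∀ v,
      (∀ i, (ρ ((z i - algebraMap ℂ A (χ i)) ^ k i)) v = 0) → Q v := by
    classical
    intro m
    induction m with
    | zero =>
      intro k hk v hv
      have hmem : v ∈ jointEig ρ z χ := (mem_jointEig_iff ρ z χ v).2 fun i => ⟨_, hv i⟩
      refine h v hmem fun i => ?_
      have : k i = 0 := by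
        have := Finset.sum_eq_zero_iff.1 hk i (Finset.mem_univ i)
        simpa using this
      have h1 := hv i
      rw [this, pow_zero, map_one] at h1
      have h2 : v = 0 := h1
      rw [h2, map_zero]
      exact h0
    | succ m ih =>
      intro k hk v hv
      have hmem : v ∈ jointEig ρ z χ := (mem_jointEig_iff ρ z χ v).2 fun i => ⟨_, hv i⟩
      refine h v hmem fun i => ?_
      by_cases hi : k i = 0
      · have h1 := hv i
        rw [hi, pow_zero, map_one] at h1
        have h2 : v = 0 := h1
        rw [h2, map_zero]
        exact h0
      · refine ih (Function.update k i (k i - 1)) ?_ _ ?_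
        · rw [Finset.sum_update_of_mem (Finset.mem_univ i)]
          rw [← Finset.add_sum_erase _ _ (Finset.mem_univ i), Finset.erase_eq] at hk
          omega
        · intro j
          by_cases hj : j = i
          · subst hj
            rw [Function.update_self, ← Module.End.mul_apply, ← map_mul, ← pow_succ,
              Nat.sub_add_cancel (Nat.one_le_iff_ne_zero.2 hi)]
            exact hv j
          · rw [Function.update_of_ne hj, ← Module.End.mul_apply, ← map_mul, mul_comm, map_mul,
              Module.End.mul_apply, hv j, map_zero]
  intro v hv
  choose k hk using (mem_jointEig_iff ρ z χ v).1 hv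
  exact key _ k rfl v hk

lemma exists_joint_eigenvector [Fintype σ] (h : jointEig ρ z χ ≠ ⊥) :
    ∃ v : V, v ≠ 0 ∧ ∀ i, ρ (z i) v = χ i • v := by
  obtain ⟨v, hv, hv0⟩ := Submodule.exists_mem_ne_zero_of_ne_bot h
  revert hv0
  refine jointEig_induction ρ z χ
    (Q := fun v => v ≠ 0 → ∃ v : V, v ≠ 0 ∧ ∀ i, ρ (z i) v = χ i • v) ?_ ?_ v hv
  · exact fun h => absurd rfl h
  · intro v _ ih hv0
    by_cases hall : ∀ i, ρ (z i - algebraMap ℂ A (χ i)) v = 0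
    · refine ⟨v, hv0, fun i => ?_⟩
      have := hall i
      rw [map_sub, LinearMap.sub_apply, AlgHom.commutes, sub_eq_zero] at this
      exact this
    · push Not at hall
      obtain ⟨i, hi⟩ := hall
      exact ih i hi

lemma finite_jointEig [FiniteDimensional ℂ V] : {χ : σ → ℂ | jointEig ρ z χ ≠ ⊥}.Finite := by
  refine WellFoundedGT.finite_ne_bot_of_iSupIndep ?_
  exact Module.End.independent_iInf_maxGenEigenspace_of_forall_mapsTo (fun i => ρ (z i))
    fun _ _ φ => Module.End.mapsTo_maxGenEigenspace_of_comm (commute_rep ρ _ _) φ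

lemma iSupIndep_jointEig : iSupIndep (jointEig ρ z) :=
  Module.End.independent_iInf_maxGenEigenspace_of_forall_mapsTo (fun i => ρ (z i))
    fun _ _ φ => Module.End.mapsTo_maxGenEigenspace_of_comm (commute_rep ρ _ _) φ

lemma isInternal_jointEig [FiniteDimensional ℂ V] [DecidableEq (σ → ℂ)] :
    DirectSum.IsInternal (jointEig ρ z) := by
  rw [DirectSum.isInternal_submodule_iff_iSupIndep_and_iSup_eq_top]
  refine ⟨iSupIndep_jointEig ρ z, ?_⟩
  exact Module.End.iSup_iInf_maxGenEigenspace_eq_top_of_iSup_maxGenEigenspace_eq_top_of_commute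
    (fun i => ρ (z i)) (fun i j _ => commute_rep ρ _ _)
    fun i => Module.End.iSup_maxGenEigenspace_eq_top _

/-- The action on a joint generalized eigenspace. -/
def jointEigRep : A →ₐ[ℂ] Module.End ℂ (jointEig ρ z χ) where
  toFun a := (ρ a).restrict (mapsTo_jointEig ρ z χ a)
  map_one' := by
    refine LinearMap.ext fun v => Subtype.ext ?_
    simp
  map_mul' a b := by
    refine LinearMap.ext fun v => Subtype.ext ?_
    simp
  map_zero' := by
    refine LinearMap.ext fun v => Subtype.ext ?_
    simp
  map_add' a b := by
    refine LinearMap.ext fun v => Subtype.ext ?_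
    simp
  commutes' c := by
    refine LinearMap.ext fun v => Subtype.ext ?_
    simp

lemma jointEigRep_apply (a : A) :
    jointEigRep ρ z χ a = (ρ a).restrict (mapsTo_jointEig ρ z χ a) := rfl

lemma isNilpotent_jointEigRep_X [FiniteDimensional ℂ V] (i : σ) :
    IsNilpotent (jointEigRep ρ z χ (z i - algebraMap ℂ A (χ i))) := by
  have hle : jointEig ρ z χ ≤ (ρ (z i)).maxGenEigenspace (χ i) := iInf_le _ i
  refine ⟨Module.finrank ℂ V, LinearMap.ext fun v => Subtype.ext ?_⟩
  have hv := hle v.2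
  rw [Module.End.maxGenEigenspace_eq_genEigenspace_finrank, Module.End.mem_genEigenspace_nat,
    LinearMap.mem_ker] at hv
  rw [← map_pow, jointEigRep_apply, LinearMap.coe_restrict_apply, map_pow, map_sub,
    AlgHom.commutes]
  exact hv

lemma isNilpotent_jointEigRep [FiniteDimensional ℂ V] (q : MvPolynomial σ ℂ) :
    IsNilpotent (jointEigRep ρ z χ
      (MvPolynomial.aeval z q - algebraMap ℂ A (MvPolynomial.eval χ q))) := by
  induction q using MvPolynomial.induction_on with
  | C a => simp
  | add p q hp hq =>
    have := Commute.isNilpotent_add (commute_rep (jointEigRep ρ z χ) _ _) hp hq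
    rw [← map_add] at this
    have e : MvPolynomial.aeval z (p + q) - algebraMap ℂ A (MvPolynomial.eval χ (p + q)) =
        (MvPolynomial.aeval z p - algebraMap ℂ A (MvPolynomial.eval χ p)) +
        (MvPolynomial.aeval z q - algebraMap ℂ A (MvPolynomial.eval χ q)) := by
      simp only [map_add]
      ring
    rwa [e]
  | mul_X p i hp =>
    have h1 := Commute.isNilpotent_mul_left (commute_rep (jointEigRep ρ z χ) (z i) _) hp
    have h2 := Commute.isNilpotent_mul_left
      (commute_rep (jointEigRep ρ z χ) (algebraMap ℂ A (MvPolynomial.eval χ p)) _)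
      (isNilpotent_jointEigRep_X ρ z χ i)
    rw [← map_mul] at h1 h2
    have := Commute.isNilpotent_add (commute_rep (jointEigRep ρ z χ) _ _) h1 h2
    rw [← map_add] at this
    have e : MvPolynomial.aeval z (p * .X i) - algebraMap ℂ A (MvPolynomial.eval χ (p * .X i)) =
        z i * (MvPolynomial.aeval z p - algebraMap ℂ A (MvPolynomial.eval χ p)) +
        algebraMap ℂ A (MvPolynomial.eval χ p) * (z i - algebraMap ℂ A (χ i)) := by
      simp only [map_mul, MvPolynomial.aeval_X, MvPolynomial.eval_X]
      ring
    rwa [e]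

lemma trace_jointEigRep [FiniteDimensional ℂ V] (q : MvPolynomial σ ℂ) :
    LinearMap.trace ℂ _ (jointEigRep ρ z χ (MvPolynomial.aeval z q)) =
      Module.finrank ℂ (jointEig ρ z χ) * MvPolynomial.eval χ q := by
  have h := LinearMap.isNilpotent_trace_of_isNilpotent (isNilpotent_jointEigRep ρ z χ q)
  rw [isNilpotent_iff_eq_zero, map_sub, map_sub, sub_eq_zero, AlgHom.commutes,
    Algebra.algebraMap_eq_smul_one, map_smul, LinearMap.trace_one, smul_eq_mul, mul_comm] at h
  exact h

/-- The trace formula for the joint spectrum. -/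
lemma trace_eq_sum_jointEig [FiniteDimensional ℂ V] (q : MvPolynomial σ ℂ) :
    LinearMap.trace ℂ V (ρ (MvPolynomial.aeval z q)) =
      ∑ χ ∈ (finite_jointEig ρ z).toFinset,
        (Module.finrank ℂ (jointEig ρ z χ) : ℂ) * MvPolynomial.eval χ q := by
  classical
  rw [LinearMap.trace_eq_sum_trace_restrict' (isInternal_jointEig ρ z) (finite_jointEig ρ z)
    (fun χ => mapsTo_jointEig ρ z χ _)]
  exact Finset.sum_congr rfl fun χ _ => trace_jointEigRep ρ z χ q

end JointEigenspaces

/-! ### Presentations over a commutative Banach algebra -/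

section Presentations

variable {H : Type*} [NormedCommRing H] [NormedAlgebra ℂ H]
  {ι κ : Type*} [Fintype ι] [Fintype κ] {p : ℕ}

/-- The operator `w ↦ ∑ k, w k • a k` depending linearly on the columns `a k`. -/
def colOpL : (κ → Fin p → H) →L[ℂ] (κ → H) →L[ℂ] (Fin p → H) :=
  LinearMap.mkContinuous₂
    (LinearMap.mk₂ ℂ (fun (a : κ → Fin p → H) (w : κ → H) => ∑ k, w k • a k)
      (fun a b w => by simp [smul_add, Finset.sum_add_distrib])
      (fun c a w => by
        rw [Finset.smul_sum]
        exact Finset.sum_congr rfl fun k _ => smul_comm (w k) c (a k))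
      (fun a v w => by simp [add_smul, Finset.sum_add_distrib])
      (fun c a w => by
        rw [Finset.smul_sum]
        exact Finset.sum_congr rfl fun k _ => smul_assoc _ _ _))
    (Fintype.card κ) (by
      intro a w
      simp only [LinearMap.mk₂_apply]
      refine (norm_sum_le _ _).trans ?_
      calc ∑ k, ‖w k • a k‖ ≤ ∑ _k : κ, ‖a‖ * ‖w‖ := by
            refine Finset.sum_le_sum fun k _ => ?_
            refine (pi_norm_le_iff_of_nonneg (by positivity)).2 fun i => ?_
            rw [Pi.smul_apply, smul_eq_mul, mul_comm ‖a‖]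
            exact (norm_mul_le _ _).trans (mul_le_mul (norm_le_pi_norm w k)
              ((norm_le_pi_norm (a k) i).trans (norm_le_pi_norm a k)) (norm_nonneg _)
              (norm_nonneg _))
        _ = Fintype.card κ * ‖a‖ * ‖w‖ := by
            rw [Finset.sum_const, nsmul_eq_mul, Finset.card_univ, mul_assoc])

/-- The operator `w ↦ ∑ k, w k • a k`. -/
def colOp (a : κ → Fin p → H) : (κ → H) →L[ℂ] (Fin p → H) :=
  (colOpL : (κ → Fin p → H) →L[ℂ] (κ → H) →L[ℂ] (Fin p → H)) a

lemma colOp_apply (a : κ → Fin p → H) (w : κ → H) : colOp a w = ∑ k, w k • a k := rfl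

/-- The operator `c ↦ ∑ k, c k • E k` on scalar vectors. -/
def frameOp (E : ι → Fin p → H) : (ι → ℂ) →L[ℂ] (Fin p → H) :=
  ∑ k, (ContinuousLinearMap.proj (R := ℂ) (φ := fun _ : ι => ℂ) k).smulRight (E k)

@[simp] lemma frameOp_apply (E : ι → Fin p → H) (c : ι → ℂ) :
    frameOp E c = ∑ k, c k • E k := by
  simp [frameOp]

/-- The operator `(c, w) ↦ ∑ c k • E k + ∑ w k • a k`. -/
def presOp (E : ι → Fin p → H) (a : κ → Fin p → H) : (ι → ℂ) × (κ → H) →L[ℂ] (Fin p → H) :=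
  (frameOp E).coprod (colOp a)

@[simp] lemma presOp_apply (E : ι → Fin p → H) (a : κ → Fin p → H) (x : (ι → ℂ) × (κ → H)) :
    presOp E a x = frameOp E x.1 + colOp a x.2 := rfl

/-- `presOp E a` has a bounded right inverse. -/
def HasRI (E : ι → Fin p → H) (a : κ → Fin p → H) : Prop :=
  ∃ T : (Fin p → H) →L[ℂ] (ι → ℂ) × (κ → H), (presOp E a).comp T = .id ℂ _

/-- `E` is linearly independent modulo the range of the column operator. -/
def IndepMod (E : ι → Fin p → H) (a : κ → Fin p → H) : Prop :=
  ∀ c w, frameOp E c + colOp a w = 0 → c = 0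

lemma analyticAt_presOp (E : ι → Fin p → H) (a : κ → Fin p → H) :
    AnalyticAt ℂ (fun a => presOp E a) a := by
  let Φ : (κ → Fin p → H) →L[ℂ] ((ι → ℂ) × (κ → H) →L[ℂ] (Fin p → H)) :=
    ((ContinuousLinearMap.compL ℂ ((ι → ℂ) × (κ → H)) (κ → H) (Fin p → H)).flip
      (.snd ℂ (ι → ℂ) (κ → H))).comp colOpL
  have : (fun a : κ → Fin p → H => presOp E a) = fun a =>
      (frameOp E).comp (.fst ℂ _ _) + Φ a := by
    funext a
    exact ContinuousLinearMap.ext fun x => rfl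
  rw [this]
  have hΦ := ContinuousLinearMap.analyticAt (𝕜 := ℂ) (E := κ → Fin p → H)
    (F := (ι → ℂ) × (κ → H) →L[ℂ] (Fin p → H)) Φ a
  exact analyticAt_const.add hΦ

/-- Functionals killing the range of the column operator. -/
def ann (a : κ → Fin p → H) : Submodule ℂ ((Fin p → H) →L[ℂ] ℂ) where
  carrier := {φ | ∀ w, φ (colOp a w) = 0}
  add_mem' := by
    intro φ ψ h1 h2 w
    rw [add_apply, h1, h2, add_zero]
  zero_mem' := fun w => rfl
  smul_mem' := by
    intro c φ h w
    rw [smul_apply, h, smul_zero]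

/-- The annihilator of the columns as a vector space. -/
def AnnSp (a : κ → Fin p → H) : Type _ := ↥(ann a)

instance (a : κ → Fin p → H) : AddCommGroup (AnnSp a) :=
  inferInstanceAs (AddCommGroup ↥(ann a))

instance (a : κ → Fin p → H) : Module ℂ (AnnSp a) :=
  inferInstanceAs (Module ℂ ↥(ann a))

namespace AnnSp

/-- The underlying functional. -/
def fn {a : κ → Fin p → H} (φ : AnnSp a) : (Fin p → H) →L[ℂ] ℂ := Subtype.val φ

/-- Constructor. -/
def mk {a : κ → Fin p → H} (φ : (Fin p → H) →L[ℂ] ℂ) (h : φ ∈ ann a) : AnnSp a := ⟨φ, h⟩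

@[simp] lemma fn_mk {a : κ → Fin p → H} (φ : (Fin p → H) →L[ℂ] ℂ) (h : φ ∈ ann a) :
    (mk φ h).fn = φ := rfl

lemma fn_mem {a : κ → Fin p → H} (φ : AnnSp a) : φ.fn ∈ ann a := Subtype.property φ

lemma ext {a : κ → Fin p → H} {φ ψ : AnnSp a} (h : ∀ v, φ.fn v = ψ.fn v) : φ = ψ :=
  Subtype.ext (ContinuousLinearMap.ext h)

lemma ext_fn {a : κ → Fin p → H} {φ ψ : AnnSp a} (h : φ.fn = ψ.fn) : φ = ψ :=
  Subtype.ext h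

lemma fn_zero {a : κ → Fin p → H} : (0 : AnnSp a).fn = 0 := rfl

end AnnSp

/-- Multiplication by `v` on `H^p`. -/
def mulOp (v : H) : (Fin p → H) →L[ℂ] (Fin p → H) :=
  ContinuousLinearMap.pi fun i =>
    (ContinuousLinearMap.mul ℂ H v).comp (.proj (R := ℂ) (φ := fun _ : Fin p => H) i)

@[simp] lemma mulOp_apply (v : H) (x : Fin p → H) : mulOp v x = v • x := rfl

lemma smul_colOp (a : κ → Fin p → H) (v : H) (w : κ → H) :
    v • colOp a w = colOp a (v • w) := by
  simp only [colOp_apply, Finset.smul_sum, Pi.smul_apply, smul_assoc]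

/-- The action of `H` on the annihilator. -/
def annRep (a : κ → Fin p → H) : H →ₐ[ℂ] Module.End ℂ (AnnSp a) where
  toFun v :=
    { toFun := fun φ => .mk (φ.fn.comp (mulOp v)) fun w => by
        rw [ContinuousLinearMap.comp_apply, mulOp_apply, smul_colOp]
        exact φ.fn_mem _
      map_add' := fun φ ψ => rfl
      map_smul' := fun c φ => rfl }
  map_one' := by
    refine LinearMap.ext fun φ => AnnSp.ext fun x => ?_
    change φ.fn ((1 : H) • x) = φ.fn x
    rw [one_smul]
  map_mul' u v := by
    refine LinearMap.ext fun φ => AnnSp.ext fun x => ?_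
    change φ.fn ((u * v) • x) = φ.fn (v • u • x)
    rw [smul_smul, mul_comm]
  map_zero' := by
    refine LinearMap.ext fun φ => AnnSp.ext fun x => ?_
    change φ.fn ((0 : H) • x) = 0
    rw [zero_smul, map_zero]
  map_add' u v := by
    refine LinearMap.ext fun φ => AnnSp.ext fun x => ?_
    change φ.fn ((u + v) • x) = φ.fn (u • x) + φ.fn (v • x)
    rw [add_smul, map_add]
  commutes' c := by
    refine LinearMap.ext fun φ => AnnSp.ext fun x => ?_
    change φ.fn ((algebraMap ℂ H c) • x) = c • φ.fn x
    rw [algebraMap_smul, map_smul]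

lemma annRep_apply (a : κ → Fin p → H) (v : H) (φ : AnnSp a) (x : Fin p → H) :
    (annRep a v φ).fn x = φ.fn (v • x) := rfl

/-- Evaluation of annihilators on the frame. -/
def annEval (E : ι → Fin p → H) (a : κ → Fin p → H) : AnnSp a →ₗ[ℂ] (ι → ℂ) where
  toFun φ k := φ.fn (E k)
  map_add' _ _ := rfl
  map_smul' _ _ := rfl

lemma annEval_injective {E : ι → Fin p → H} {a : κ → Fin p → H} (h : HasRI E a) :
    Function.Injective (annEval E a) := by
  obtain ⟨T, hT⟩ := h
  refine (injective_iff_map_eq_zero _).2 fun φ hφ => AnnSp.ext fun x => ?_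
  have hx : presOp E a (T x) = x := congrArg (fun S => S x) hT
  have hφ' : ∀ k, φ.fn (E k) = 0 := fun k => congrFun hφ k
  change φ.fn x = 0
  rw [← hx, presOp_apply, map_add, φ.fn_mem, frameOp_apply, map_sum]
  simp [hφ']

lemma finiteDimensional_ann {E : ι → Fin p → H} {a : κ → Fin p → H} (h : HasRI E a) :
    FiniteDimensional ℂ (AnnSp a) :=
  FiniteDimensional.of_injective _ (annEval_injective h)

lemma finrank_ann_le {E : ι → Fin p → H} {a : κ → Fin p → H} (h : HasRI E a) :
    Module.finrank ℂ (AnnSp a) ≤ Fintype.card ι := by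
  have := LinearMap.finrank_le_finrank_of_injective (annEval_injective h)
  rwa [Module.finrank_pi] at this

lemma indepMod_of_le_finrank {E : ι → Fin p → H} {a : κ → Fin p → H} (h : HasRI E a)
    (hle : Fintype.card ι ≤ Module.finrank ℂ (AnnSp a)) : IndepMod E a := by
  classical
  intro c w hcw
  have := finiteDimensional_ann h
  have hsurj : Function.Surjective (annEval E a) := by
    rw [← LinearMap.range_eq_top]
    refine Submodule.eq_top_of_finrank_eq ?_
    rw [LinearMap.finrank_range_of_inj (annEval_injective h), Module.finrank_pi]
    exact le_antisymm (finrank_ann_le h) hle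
  funext k
  obtain ⟨φ, hφ⟩ := hsurj (Pi.single k 1)
  have h1 := congrArg φ.fn hcw
  rw [map_add, φ.fn_mem, frameOp_apply, map_sum, map_zero, add_zero] at h1
  have h2 : ∀ l, φ.fn (c l • E l) = if l = k then c l else 0 := by
    intro l
    have : φ.fn (E l) = (Pi.single k 1 : ι → ℂ) l := congrFun hφ l
    rw [map_smul, this, Pi.single_apply]
    split_ifs <;> simp
  simpa [h2] using h1

lemma fst_rightInverse_frame {E : ι → Fin p → H} {a : κ → Fin p → H} (hI : IndepMod E a)
    {T : (Fin p → H) →L[ℂ] (ι → ℂ) × (κ → H)} (hT : (presOp E a).comp T = .id ℂ _)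
    (c : ι → ℂ) (w : κ → H) : (T (frameOp E c + colOp a w)).1 = c := by
  have hx : presOp E a (T (frameOp E c + colOp a w)) = frameOp E c + colOp a w :=
    congrArg (fun S => S (frameOp E c + colOp a w)) hT
  rw [presOp_apply] at hx
  rw [← sub_eq_zero]
  refine hI _ ((T (frameOp E c + colOp a w)).2 - w) ?_
  rw [map_sub, map_sub, ← sub_eq_zero.2 hx]
  abel

/-- The coordinate functionals belong to the annihilator. -/
lemma coord_mem_ann {E : ι → Fin p → H} {a : κ → Fin p → H} (hI : IndepMod E a)
    {T : (Fin p → H) →L[ℂ] (ι → ℂ) × (κ → H)} (hT : (presOp E a).comp T = .id ℂ _) (k : ι) :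
    (ContinuousLinearMap.proj (R := ℂ) (φ := fun _ : ι => ℂ) k).comp
      ((ContinuousLinearMap.fst ℂ (ι → ℂ) (κ → H)).comp T) ∈ ann a := by
  intro w
  have := fst_rightInverse_frame hI hT 0 w
  rw [map_zero, zero_add] at this
  change (T (colOp a w)).1 k = 0
  rw [this]
  rfl

lemma annEval_bijective {E : ι → Fin p → H} {a : κ → Fin p → H} (hI : IndepMod E a)
    (h : HasRI E a) : Function.Bijective (annEval E a) := by
  classical
  refine ⟨annEval_injective h, ?_⟩
  obtain ⟨T, hT⟩ := h
  intro c
  refine ⟨∑ k, c k • AnnSp.mk _ (coord_mem_ann hI hT k), ?_⟩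
  rw [map_sum]
  funext l
  rw [Finset.sum_apply]
  have : ∀ k, annEval E a (c k • AnnSp.mk _ (coord_mem_ann hI hT k)) l = if l = k then c k else 0 := by
    intro k
    rw [map_smul, Pi.smul_apply]
    have := fst_rightInverse_frame hI hT (Pi.single l 1) 0
    have h1 : frameOp E (Pi.single l 1) + colOp a 0 = E l := by
      rw [map_zero, add_zero, frameOp_apply, Finset.sum_eq_single l]
      · simp
      · intro b _ hb
        simp [hb]
      · simp
    rw [h1] at this
    change c k • (T (E l)).1 k = _
    rw [this, Pi.single_apply]
    by_cases hk : k = l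
    · subst hk; simp
    · simp [hk, Ne.symm hk]
  simp only [this]
  simp

lemma finrank_ann_eq {E : ι → Fin p → H} {a : κ → Fin p → H} (hI : IndepMod E a)
    (h : HasRI E a) : Module.finrank ℂ (AnnSp a) = Fintype.card ι := by
  rw [(LinearEquiv.ofBijective _ (annEval_bijective hI h)).finrank_eq, Module.finrank_pi]

/-- The trace of multiplication by `q` on the annihilator. -/
lemma trace_annRep {E : ι → Fin p → H} {a : κ → Fin p → H} (hI : IndepMod E a)
    {T : (Fin p → H) →L[ℂ] (ι → ℂ) × (κ → H)} (hT : (presOp E a).comp T = .id ℂ _) (q : H) :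
    LinearMap.trace ℂ _ (annRep a q) = ∑ k, (T (q • E k)).1 k := by
  classical
  have h : HasRI E a := ⟨T, hT⟩
  let e := LinearEquiv.ofBijective _ (annEval_bijective hI h)
  let b : Module.Basis ι ℂ (AnnSp a) := Module.Basis.ofEquivFun e
  rw [LinearMap.trace_eq_matrix_trace ℂ b, Matrix.trace]
  refine Finset.sum_congr rfl fun k _ => ?_
  rw [Matrix.diag_apply, LinearMap.toMatrix_apply]
  have hb : b k = AnnSp.mk _ (coord_mem_ann hI hT k) := by
    apply e.injective
    have : e (b k) = Pi.single k 1 := by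
      rw [Module.Basis.coe_ofEquivFun, LinearEquiv.apply_symm_apply]
    rw [this]
    funext l
    have := fst_rightInverse_frame hI hT (Pi.single l 1) 0
    have h1 : frameOp E (Pi.single l 1) + colOp a 0 = E l := by
      rw [map_zero, add_zero, frameOp_apply, Finset.sum_eq_single l]
      · simp
      · intro b _ hb
        simp [hb]
      · simp
    rw [h1] at this
    change _ = (T (E l)).1 k
    rw [this, Pi.single_apply, Pi.single_apply]
    simp [eq_comm]
  rw [hb]
  rfl

variable [CompleteSpace H]

lemma exists_analytic_rightInverse {E : ι → Fin p → H} {a₀ : κ → Fin p → H} (h : HasRI E a₀) :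
    ∃ T : (κ → Fin p → H) → ((Fin p → H) →L[ℂ] (ι → ℂ) × (κ → H)),
      ∀ᶠ a in 𝓝 a₀, AnalyticAt ℂ T a ∧ (presOp E a).comp (T a) = .id ℂ _ := by
  obtain ⟨T₀, hT₀⟩ := h
  obtain ⟨T, -, hT⟩ := exists_analyticAt_rightInverse hT₀
  refine ⟨fun a => T (presOp E a), ?_⟩
  have := (analyticAt_presOp E a₀).continuousAt.eventually hT
  filter_upwards [this] with a ha
  exact ⟨ha.1.comp (analyticAt_presOp E a), ha.2⟩

lemma eventually_hasRI {E : ι → Fin p → H} {a₀ : κ → Fin p → H} (h : HasRI E a₀) :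
    ∀ᶠ a in 𝓝 a₀, HasRI E a := by
  obtain ⟨T, hT⟩ := exists_analytic_rightInverse h
  filter_upwards [hT] with a ha using ⟨_, ha.2⟩

/-- Independence modulo the column operator propagates along preconnected families. -/
lemma indepMod_of_preconnected {P : Type*} [NormedAddCommGroup P] [NormedSpace ℂ P]
    {E : ι → Fin p → H} {B : Set P} (hB : IsOpen B) (hBc : IsPreconnected B)
    {a : P → κ → Fin p → H} (ha : AnalyticOnNhd ℂ a B) (hR : ∀ b ∈ B, HasRI E (a b))
    {b₀ : P} (hb₀ : b₀ ∈ B) (h₀ : ∀ᶠ b in 𝓝 b₀, IndepMod E (a b)) :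
    ∀ b ∈ B, IndepMod E (a b) := by
  have key := kernel_le_of_preconnected hB hBc (L := fun b => presOp E (a b))
    (fun b hb => (analyticAt_presOp E (a b)).comp (ha b hb)) hR
    (ContinuousLinearMap.fst ℂ (ι → ℂ) (κ → H)) hb₀ (by
      filter_upwards [h₀] with b hb x hx
      exact hb x.1 x.2 hx)
  intro b hb c w hcw
  exact key b hb (c, w) hcw

end Presentations

/-! ### The spectrum of the annihilator -/

lemma jointEig_eq_bot_of_finrank {A V σ : Type*} [CommRing A] [Algebra ℂ A] [AddCommGroup V]
    [Module ℂ V] [FiniteDimensional ℂ V] (ρ : A →ₐ[ℂ] Module.End ℂ V) (z : σ → A) (χ : σ → ℂ)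
    (h : Module.finrank ℂ (jointEig ρ z χ) = 0) : jointEig ρ z χ = ⊥ :=
  Submodule.finrank_eq_zero.1 h

section Spectrum

open PolydiscAlg

variable {n p : ℕ} {r : ℝ} {ι κ : Type*} [Fintype ι] [Fintype κ]

lemma PolydiscAlg.norm_X_le (hr : 0 ≤ r) (i : Fin n) : ‖(X i : PolydiscAlg n r)‖ ≤ r := by
  refine norm_le_of_ev hr fun x hx => ?_
  rw [ev_X hx]
  exact (norm_le_pi_norm x i).trans (by simpa using hx)

/-- A functional on the polydisc algebra on which the coordinates act by scalars. -/
lemma PolydiscAlg.functional_eq_ev (hr : 0 ≤ r) {ψ : PolydiscAlg n r →L[ℂ] ℂ} {χ : Cn n}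
    (h : ∀ i v, ψ (X i * v) = χ i * ψ v) (h0 : ψ ≠ 0) :
    χ ∈ Metric.closedBall (0 : Cn n) r ∧ ∀ v, ψ v = ψ 1 * ev χ v := by
  have hmem : χ ∈ Metric.closedBall (0 : Cn n) r := by
    have : NormOneClass (PolydiscAlg n r) := ⟨by
      refine le_antisymm (norm_le_of_ev zero_le_one fun x hx => by rw [ev_one hx, norm_one]) ?_
      have := norm_ev_le (0 : Cn n) (1 : PolydiscAlg n r)
      rwa [ev_one (by simpa using hr), norm_one] at this⟩
    rw [mem_closedBall_zero_iff, pi_norm_le_iff_of_nonneg hr]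
    intro i
    by_contra hi
    have hns : χ i ∉ spectrum ℂ (X i : PolydiscAlg n r) := fun hs =>
      hi ((spectrum.norm_le_norm_of_mem hs).trans (norm_X_le hr i))
    rw [spectrum.notMem_iff] at hns
    obtain ⟨u, hu⟩ := hns
    apply h0
    ext v
    have h1 : v = (algebraMap ℂ (PolydiscAlg n r) (χ i) - X i) * ((↑u⁻¹ : PolydiscAlg n r) * v) := by
      rw [← hu, ← mul_assoc, Units.mul_inv, one_mul]
    have h2 : ψ v = 0 := by
      rw [h1, sub_mul, map_sub, h, ← Algebra.smul_def, map_smul, smul_eq_mul, sub_self]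
    simpa using h2
  refine ⟨hmem, ?_⟩
  have key : ∀ v u, ψ (v * u) = ev χ v * ψ u := by
    intro v
    refine induction_closed (P := fun v => ∀ u, ψ (v * u) = ev χ v * ψ u) ?_ ?_ ?_ ?_ ?_ v
    · simp only [Set.ofPred_forall]
      refine isClosed_iInter fun u => isClosed_eq ?_ ?_
      · exact ψ.continuous.comp (continuous_id.mul continuous_const)
      · exact (ev χ).continuous.mul continuous_const
    · intro i u
      rw [h, ev_X hmem]
    · intro c u
      rw [← Algebra.smul_def, map_smul, ev_algebraMap hmem, smul_eq_mul]
    · intro v w hv hw u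
      rw [add_mul, map_add, hv, hw, map_add, add_mul]
    · intro v w hv hw u
      rw [mul_assoc, hv, hw, ev_mul hmem, mul_assoc]
  intro v
  rw [← mul_one v, key, mul_one, mul_comm]

/-- Points of the closed polydisc where the columns do not span. -/
def cokerPts (a : κ → Fin p → PolydiscAlg n r) : Set (Cn n) :=
  {x | x ∈ Metric.closedBall (0 : Cn n) r ∧
    ∃ c : Fin p → ℂ, c ≠ 0 ∧ ∀ k, ∑ i, c i * ev x (a k i) = 0}

/-- The functional `v ↦ ∑ i, c i * v i (x)`. -/
def evFun (c : Fin p → ℂ) (x : Cn n) : (Fin p → PolydiscAlg n r) →L[ℂ] ℂ :=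
  ∑ i, c i • (ev x).comp (.proj (R := ℂ) (φ := fun _ : Fin p => PolydiscAlg n r) i)

lemma evFun_apply (c : Fin p → ℂ) (x : Cn n) (v : Fin p → PolydiscAlg n r) :
    evFun c x v = ∑ i, c i * ev x (v i) := by
  simp [evFun, sum_apply]

lemma evFun_smul {x : Cn n} (hx : x ∈ Metric.closedBall (0 : Cn n) r) (c : Fin p → ℂ)
    (u : PolydiscAlg n r) (v : Fin p → PolydiscAlg n r) :
    evFun c x (u • v) = ev x u * evFun c x v := by
  simp only [evFun_apply, Pi.smul_apply, smul_eq_mul, ev_mul hx, Finset.mul_sum]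
  exact Finset.sum_congr rfl fun i _ => by ring

lemma evFun_mem_ann {x : Cn n} (hx : x ∈ Metric.closedBall (0 : Cn n) r) {c : Fin p → ℂ}
    {a : κ → Fin p → PolydiscAlg n r} :
    evFun c x ∈ ann a ↔ ∀ k, ∑ i, c i * ev x (a k i) = 0 := by
  classical
  constructor
  · intro h k
    have := h (Pi.single k 1)
    rw [colOp_apply, Finset.sum_eq_single k, Pi.single_eq_same, one_smul, evFun_apply] at this
    · exact this
    · intro b _ hb
      rw [Pi.single_eq_of_ne hb, zero_smul]
    · simp
  · intro h w
    rw [colOp_apply, map_sum]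
    refine Finset.sum_eq_zero fun k _ => ?_
    rw [evFun_smul hx, evFun_apply, h k, mul_zero]

lemma evFun_ne_zero {x : Cn n} (hx : x ∈ Metric.closedBall (0 : Cn n) r) {c : Fin p → ℂ}
    (hc : c ≠ 0) : (evFun c x : (Fin p → PolydiscAlg n r) →L[ℂ] ℂ) ≠ 0 := by
  obtain ⟨i, hi⟩ := Function.ne_iff.1 hc
  intro h
  apply hi
  have h1 := congrArg (fun φ => φ (Pi.single i 1)) h
  simp only [evFun_apply] at h1
  rw [Finset.sum_eq_single i, Pi.single_eq_same, ev_one hx, mul_one] at h1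
  · exact h1
  · intro b _ hb
    rw [Pi.single_eq_of_ne hb, map_zero, mul_zero]
  · simp

/-- Joint eigenvectors in the annihilator are evaluations. -/
lemma eigenvector_eq_evFun (hr : 0 ≤ r) {φ : (Fin p → PolydiscAlg n r) →L[ℂ] ℂ} {χ : Cn n}
    (h : ∀ i v, φ ((X i : PolydiscAlg n r) • v) = χ i * φ v) (h0 : φ ≠ 0) :
    χ ∈ Metric.closedBall (0 : Cn n) r ∧ ∃ c : Fin p → ℂ, c ≠ 0 ∧ φ = evFun c χ := by
  classical
  let S : Fin p → PolydiscAlg n r →L[ℂ] (Fin p → PolydiscAlg n r) :=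
    fun k => ContinuousLinearMap.single ℂ (fun _ : Fin p => PolydiscAlg n r) k
  have hS : ∀ k v, S k v = Pi.single k v := fun k v => rfl
  have hψ : ∀ k i v, (φ.comp (S k)) (X i * v) = χ i * (φ.comp (S k)) v := by
    intro k i v
    rw [ContinuousLinearMap.comp_apply, ContinuousLinearMap.comp_apply, ← h, hS, hS,
      ← smul_eq_mul, Pi.single_smul]
  have hdec : ∀ v, φ v = ∑ k, φ.comp (S k) (v k) := by
    intro v
    conv_lhs => rw [← Finset.univ_sum_single v]
    rw [map_sum]
    rfl
  have hex : ∃ k, φ.comp (S k) ≠ 0 := by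
    by_contra hcon
    push Not at hcon
    apply h0
    ext v
    rw [hdec]
    simp [hcon]
  obtain ⟨k₀, hk₀⟩ := hex
  have hmem := (functional_eq_ev hr (hψ k₀) hk₀).1
  have hall : ∀ k v, φ.comp (S k) v = φ.comp (S k) 1 * ev χ v := by
    intro k
    by_cases hk : φ.comp (S k) = 0
    · intro v
      simp [hk]
    · exact (functional_eq_ev hr (hψ k) hk).2
  have heq : φ = evFun (fun k => φ.comp (S k) 1) χ := by
    ext v
    rw [hdec, evFun_apply]
    exact Finset.sum_congr rfl fun k _ => hall k _
  refine ⟨hmem, _, ?_, heq⟩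
  intro hc
  apply h0
  rw [heq, hc]
  ext v
  simp [evFun_apply]

/-- Multiplicity of a point in the annihilator. -/
def mult (a : κ → Fin p → PolydiscAlg n r) (x : Cn n) : ℕ :=
  Module.finrank ℂ (jointEig (annRep a) (X : Fin n → PolydiscAlg n r) x)

lemma jointEig_ne_bot_iff (hr : 0 ≤ r) (a : κ → Fin p → PolydiscAlg n r) (x : Cn n) :
    jointEig (annRep a) (X : Fin n → PolydiscAlg n r) x ≠ ⊥ ↔ x ∈ cokerPts a := by
  constructor
  · intro h
    obtain ⟨φ, hφ0, hφ⟩ := exists_joint_eigenvector _ _ _ h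
    have h1 : ∀ i v, φ.fn ((X i : PolydiscAlg n r) • v) = x i * φ.fn v := by
      intro i v
      have := congrArg (fun ψ : AnnSp a => ψ.fn v) (hφ i)
      exact this
    obtain ⟨hx, c, hc, hc'⟩ := eigenvector_eq_evFun hr h1 (fun h => hφ0 (AnnSp.ext_fn h))
    refine ⟨hx, c, hc, ?_⟩
    rw [← evFun_mem_ann hx, ← hc']
    exact φ.fn_mem
  · rintro ⟨hx, c, hc, h⟩
    rw [← evFun_mem_ann hx] at h
    rw [Submodule.ne_bot_iff]
    refine ⟨AnnSp.mk _ h, ?_, fun h' => evFun_ne_zero hx hc (congrArg AnnSp.fn h')⟩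
    rw [mem_jointEig_iff]
    intro i
    refine ⟨1, AnnSp.ext fun v => ?_⟩
    rw [pow_one, annRep_apply]
    change evFun c x _ = 0
    rw [evFun_smul hx, map_sub, ev_X hx, ev_algebraMap hx, sub_self, zero_mul]

lemma finite_cokerPts (hr : 0 ≤ r) {E : ι → Fin p → PolydiscAlg n r}
    {a : κ → Fin p → PolydiscAlg n r} (h : HasRI E a) : (cokerPts a).Finite := by
  have := finiteDimensional_ann h
  have h1 := finite_jointEig (annRep a) (X : Fin n → PolydiscAlg n r)
  exact h1.subset fun x hx => (jointEig_ne_bot_iff hr a x).2 hx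

lemma mult_eq_zero (hr : 0 ≤ r) {a : κ → Fin p → PolydiscAlg n r} {x : Cn n}
    (hx : x ∉ cokerPts a) : mult a x = 0 := by
  rw [← jointEig_ne_bot_iff hr, not_not] at hx
  rw [mult, hx, finrank_bot]

lemma mult_pos (hr : 0 ≤ r) {E : ι → Fin p → PolydiscAlg n r}
    {a : κ → Fin p → PolydiscAlg n r} (h : HasRI E a) {x : Cn n}
    (hx : x ∈ cokerPts a) : 0 < mult a x := by
  have := finiteDimensional_ann h
  rw [← jointEig_ne_bot_iff hr] at hx
  exact Nat.pos_of_ne_zero fun h0 =>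
    hx (jointEig_eq_bot_of_finrank _ _ _ h0)

/-- The trace formula for the annihilator. -/
lemma trace_annRep_eq_sum (hr : 0 ≤ r) {E : ι → Fin p → PolydiscAlg n r}
    {a : κ → Fin p → PolydiscAlg n r} (h : HasRI E a) (q : MvPolynomial (Fin n) ℂ) :
    LinearMap.trace ℂ _ (annRep a (MvPolynomial.aeval X q)) =
      ∑ x ∈ (finite_cokerPts hr h).toFinset, (mult a x : ℂ) * MvPolynomial.eval x q := by
  have := finiteDimensional_ann h
  refine (trace_eq_sum_jointEig (annRep a) X q).trans
    (Finset.sum_congr ?_ fun _ _ => rfl)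
  ext x
  simp [jointEig_ne_bot_iff hr]

lemma sum_mult (hr : 0 ≤ r) {E : ι → Fin p → PolydiscAlg n r}
    {a : κ → Fin p → PolydiscAlg n r} (h : HasRI E a) :
    ∑ x ∈ (finite_cokerPts hr h).toFinset, mult a x = Module.finrank ℂ (AnnSp a) := by
  have := finiteDimensional_ann h
  have h1 := trace_annRep_eq_sum hr h 1
  rw [map_one, map_one] at h1
  have : Module.Free ℂ (AnnSp a) := Module.Free.of_divisionRing ℂ (AnnSp a)
  have h2 := (LinearMap.trace_one ℂ (AnnSp a)).symm.trans h1
  simp only [map_one, mul_one] at h2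
  exact_mod_cast h2.symm

end Spectrum

/-! ### Variation of the spectrum -/

section Cluster

open PolydiscAlg

variable {n p : ℕ} {r : ℝ} {ι κ : Type*} [Fintype ι] [Fintype κ]

lemma PolydiscAlg.continuousOn_ev (v : PolydiscAlg n r) :
    ContinuousOn (fun x => ev x v) (Metric.closedBall (0 : Cn n) r) := by
  rw [continuousOn_iff_continuous_domRestrict]
  refine (toCM n r v).continuous.congr fun x => ?_
  rw [Set.domRestrict_apply, ev_apply x.2]

lemma PolydiscAlg.tendsto_ev {α : Type*} {l : Filter α} {v : α → PolydiscAlg n r} {x : α → Cn n}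
    {v₀ : PolydiscAlg n r} {x₀ : Cn n} (hv : Tendsto v l (𝓝 v₀)) (hx : Tendsto x l (𝓝 x₀))
    (hmem : ∀ᶠ t in l, x t ∈ Metric.closedBall (0 : Cn n) r)
    (hx₀ : x₀ ∈ Metric.closedBall (0 : Cn n) r) :
    Tendsto (fun t => ev (x t) (v t)) l (𝓝 (ev x₀ v₀)) := by
  have h1 : Tendsto (fun t => ev (x t) v₀) l (𝓝 (ev x₀ v₀)) :=
    (continuousOn_ev v₀ x₀ hx₀).tendsto.comp (tendsto_nhdsWithin_iff.2 ⟨hx, hmem⟩)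
  have h2 : Tendsto (fun t => ev (x t) (v t - v₀)) l (𝓝 0) := by
    refine squeeze_zero_norm (fun t => norm_ev_le _ _) ?_
    have := (hv.sub_const v₀).norm
    simpa using this
  have h3 := h2.add h1
  rw [zero_add] at h3
  refine h3.congr fun t => ?_
  rw [← map_add, sub_add_cancel]

lemma isClosed_cokerGraph :
    IsClosed {q : (κ → Fin p → PolydiscAlg n r) × Cn n | q.2 ∈ cokerPts q.1} := by
  refine isClosed_of_closure_subset fun q hq => ?_
  obtain ⟨u, hu, hlim⟩ := mem_closure_iff_seq_limit.1 hq
  choose hmem c hc hcu using hu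
  rw [nhds_prod_eq, tendsto_prod_iff'] at hlim
  obtain ⟨hl1, hl2⟩ := hlim
  have hq2 : q.2 ∈ Metric.closedBall (0 : Cn n) r :=
    Metric.isClosed_closedBall.mem_of_tendsto hl2 (Eventually.of_forall hmem)
  let e : ℕ → Fin p → ℂ := fun m => (‖c m‖⁻¹ : ℂ) • c m
  have he : ∀ m, e m ∈ Metric.sphere (0 : Fin p → ℂ) 1 := by
    intro m
    rw [mem_sphere_zero_iff_norm, norm_smul, norm_inv, Complex.norm_real, norm_norm,
      inv_mul_cancel₀ (norm_ne_zero_iff.2 (hc m))]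
  obtain ⟨c₀, hc₀, φ, hφ, hlim⟩ := (isCompact_sphere (0 : Fin p → ℂ) 1).tendsto_subseq he
  refine ⟨hq2, c₀, ?_, fun k => ?_⟩
  · rintro rfl
    simp at hc₀
  · have h1 : Tendsto (fun m => ∑ i, e (φ m) i * ev (u (φ m)).2 ((u (φ m)).1 k i)) atTop
        (𝓝 (∑ i, c₀ i * ev q.2 (q.1 k i))) := by
      refine tendsto_finsetSum _ fun i _ => ((tendsto_pi_nhds.1 hlim) i).mul ?_
      refine tendsto_ev ?_ (hl2.comp hφ.tendsto_atTop) (Eventually.of_forall fun m => hmem _) hq2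
      exact tendsto_pi_nhds.1 (tendsto_pi_nhds.1 (hl1.comp hφ.tendsto_atTop) k) i
    refine tendsto_nhds_unique h1 ?_
    refine tendsto_const_nhds.congr fun m => ?_
    have : ∑ i, e (φ m) i * ev (u (φ m)).2 ((u (φ m)).1 k i) =
        (‖c (φ m)‖⁻¹ : ℂ) * ∑ i, c (φ m) i * ev (u (φ m)).2 ((u (φ m)).1 k i) := by
      rw [Finset.mul_sum]
      exact Finset.sum_congr rfl fun i _ => by simp [e, mul_assoc]
    rw [this, hcu, mul_zero]

lemma eventually_notMem_cokerPts {K : Set (Cn n)} (hK : IsCompact K)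
    {a₀ : κ → Fin p → PolydiscAlg n r} (h : ∀ x ∈ K, x ∉ cokerPts a₀) :
    ∀ᶠ a in 𝓝 a₀, ∀ x ∈ K, x ∉ cokerPts a := by
  refine hK.eventually_forall_of_forall_eventually fun x hx => ?_
  exact isClosed_cokerGraph.isOpen_compl.mem_nhds (h x hx)

/-- Spectrum points stay inside any neighborhood of the spectrum. -/
lemma eventually_cokerPts_subset {O : Set (Cn n)} (hO : IsOpen O)
    {a₀ : κ → Fin p → PolydiscAlg n r} (h : cokerPts a₀ ⊆ O) :
    ∀ᶠ a in 𝓝 a₀, cokerPts a ⊆ O := by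
  have hK : IsCompact (Metric.closedBall (0 : Cn n) r \ O) :=
    (isCompact_closedBall _ _).diff hO
  filter_upwards [eventually_notMem_cokerPts hK fun x hx hx' => hx.2 (h hx')] with a ha x hx
  by_contra hxO
  exact ha x ⟨hx.1, hxO⟩ hx

lemma support_mult_subset (hr : 0 ≤ r) (a : κ → Fin p → PolydiscAlg n r) :
    Function.support (mult a) ⊆ cokerPts a := by
  intro x hx
  by_contra h
  exact hx (mult_eq_zero hr h)

lemma finsum_mult_eq (hr : 0 ≤ r) {E : ι → Fin p → PolydiscAlg n r}
    {a : κ → Fin p → PolydiscAlg n r} (h : HasRI E a) (F : Cn n → ℂ) :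
    ∑ᶠ x, (mult a x : ℂ) * F x = ∑ x ∈ (finite_cokerPts hr h).toFinset, (mult a x : ℂ) * F x := by
  refine finsum_eq_sum_of_support_subset _ fun x hx => ?_
  rw [Set.Finite.coe_toFinset]
  refine support_mult_subset hr a fun h0 => hx ?_
  simp [h0]

lemma exists_analytic_trace (hr : 0 ≤ r) {E : ι → Fin p → PolydiscAlg n r}
    {a₀ : κ → Fin p → PolydiscAlg n r} (h : HasRI E a₀) (q : MvPolynomial (Fin n) ℂ) :
    ∃ F : (κ → Fin p → PolydiscAlg n r) → ℂ, AnalyticAt ℂ F a₀ ∧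
      ∀ᶠ a in 𝓝 a₀, IndepMod E a → F a = ∑ᶠ x, (mult a x : ℂ) * MvPolynomial.eval x q := by
  obtain ⟨T, hT⟩ := exists_analytic_rightInverse h
  refine ⟨fun a => ∑ k, (T a ((MvPolynomial.aeval X q : PolydiscAlg n r) • E k)).1 k, ?_, ?_⟩
  · refine Finset.analyticAt_fun_sum _ fun k _ => ?_
    let Φ : ((Fin p → PolydiscAlg n r) →L[ℂ] (ι → ℂ) × (κ → PolydiscAlg n r)) →L[ℂ] ℂ :=
      ((ContinuousLinearMap.proj (R := ℂ) (φ := fun _ : ι => ℂ) k).comp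
        (ContinuousLinearMap.fst ℂ (ι → ℂ) (κ → PolydiscAlg n r))).comp
        (ContinuousLinearMap.apply ℂ _ ((MvPolynomial.aeval X q : PolydiscAlg n r) • E k))
    have hΦ := ContinuousLinearMap.analyticAt (𝕜 := ℂ)
      (E := (Fin p → PolydiscAlg n r) →L[ℂ] (ι → ℂ) × (κ → PolydiscAlg n r)) (F := ℂ) Φ (T a₀)
    exact hΦ.comp hT.self_of_nhds.1
  · filter_upwards [hT] with a ha hI
    have hRI : HasRI E a := ⟨_, ha.2⟩
    rw [finsum_mult_eq hr hRI, ← trace_annRep hI ha.2, trace_annRep_eq_sum hr hRI]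

/-- A polynomial taking prescribed values on a finite set of points. -/
lemma exists_eval_eq (S : Finset (Cn n)) (F : Cn n → ℂ) :
    ∃ q : MvPolynomial (Fin n) ℂ, ∀ x ∈ S, MvPolynomial.eval x q = F x := by
  classical
  have h1 : ∀ x : Cn n, ∃ q : MvPolynomial (Fin n) ℂ, MvPolynomial.eval x q = 1 ∧
      ∀ y ∈ S, y ≠ x → MvPolynomial.eval y q = 0 := by
    intro x
    have h2 : ∀ y : Cn n, ∃ q : MvPolynomial (Fin n) ℂ, MvPolynomial.eval x q = 1 ∧
        (y ≠ x → MvPolynomial.eval y q = 0) := by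
      intro y
      by_cases hy : y = x
      · exact ⟨1, by simp, fun h => absurd hy h⟩
      · obtain ⟨i, hi⟩ := Function.ne_iff.1 hy
        refine ⟨MvPolynomial.C (x i - y i)⁻¹ * (MvPolynomial.X i - MvPolynomial.C (y i)), ?_, ?_⟩
        · simp [inv_mul_cancel₀ (sub_ne_zero.2 (Ne.symm hi))]
        · simp
    choose q hq1 hq2 using h2
    refine ⟨∏ y ∈ S, q y, ?_, ?_⟩
    · rw [map_prod]
      exact Finset.prod_eq_one fun y _ => hq1 y
    · intro y hy hyx
      rw [map_prod]
      exact Finset.prod_eq_zero hy (hq2 y hyx)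
  choose q hq1 hq2 using h1
  refine ⟨∑ x ∈ S, MvPolynomial.C (F x) * q x, fun x hx => ?_⟩
  rw [map_sum, Finset.sum_eq_single x]
  · simp [hq1]
  · intro y _ hyx
    simp [hq2 y x hx hyx.symm]
  · exact fun h => absurd hx h

/-- Number of spectrum points in a set, with multiplicity. -/
def clusterMult (a : κ → Fin p → PolydiscAlg n r) (S : Set (Cn n)) : ℕ := ∑ᶠ x ∈ S, mult a x

lemma clusterMult_cast (hr : 0 ≤ r) {E : ι → Fin p → PolydiscAlg n r}
    {a : κ → Fin p → PolydiscAlg n r} (h : HasRI E a) (S : Set (Cn n)) :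
    (clusterMult a S : ℂ) = ∑ x ∈ (finite_cokerPts hr h).toFinset,
      (mult a x : ℂ) * S.indicator 1 x := by
  classical
  have : clusterMult a S = ∑ x ∈ (finite_cokerPts hr h).toFinset, S.indicator (mult a) x := by
    rw [clusterMult, finsum_mem_def]
    refine finsum_eq_sum_of_support_subset _ fun x hx => ?_
    rw [Set.Finite.coe_toFinset]
    refine support_mult_subset hr a fun h0 => hx ?_
    simp [Set.indicator, h0]
  rw [this]
  push_cast
  refine Finset.sum_congr rfl fun x _ => ?_
  by_cases hx : x ∈ S <;> simp [hx]

/-- Conservation of the number of spectrum points. -/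
lemma eventually_clusterMult_eq (hr : 0 ≤ r) {E : ι → Fin p → PolydiscAlg n r}
    {a₀ : κ → Fin p → PolydiscAlg n r} (h : HasRI E a₀) (hI₀ : IndepMod E a₀)
    {S : Set (Cn n)} (hS : ∀ x ∈ cokerPts a₀, x ∉ frontier S) :
    ∀ᶠ a in 𝓝 a₀, IndepMod E a → clusterMult a S = clusterMult a₀ S := by
  classical
  set N := Fintype.card ι
  obtain ⟨q, hq⟩ := exists_eval_eq (finite_cokerPts hr h).toFinset (S.indicator 1)
  obtain ⟨F, hF, hFe⟩ := exists_analytic_trace hr h q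
  set η : ℝ := 1 / (2 * (N + 1)) with hη
  have hη0 : 0 < η := by positivity
  let O : Set (Cn n) := interior {x | ‖MvPolynomial.eval x q - S.indicator 1 x‖ < η}
  have hO : cokerPts a₀ ⊆ O := by
    intro x hx
    rw [mem_interior_iff_mem_nhds]
    have hc : ContinuousAt (fun x => MvPolynomial.eval x q - S.indicator (1 : Cn n → ℂ) x) x := by
      refine ((MvPolynomial.continuous_eval q).continuousAt).sub ?_
      exact (ContinuousOn.continuousAt_indicator continuousOn_const (hS x hx) : ContinuousAt
        (S.indicator fun _ => (1 : ℂ)) x)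
    have h0 : ‖MvPolynomial.eval x q - S.indicator (1 : Cn n → ℂ) x‖ < η := by
      rw [hq x (by simpa using hx), sub_self, norm_zero]
      exact hη0
    exact hc.norm.eventually_lt_const h0
  have hFa : F a₀ = clusterMult a₀ S := by
    rw [hFe.self_of_nhds hI₀, finsum_mult_eq hr h, clusterMult_cast hr h]
    exact Finset.sum_congr rfl fun x hx => by rw [hq x hx]
  have hFc : ∀ᶠ a in 𝓝 a₀, ‖F a - F a₀‖ < 1 / 2 := by
    have := (hF.continuousAt.sub_const (F a₀)).norm
    simp only [sub_self, norm_zero] at this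
    exact this.eventually_lt_const (by norm_num)
  filter_upwards [eventually_hasRI h, eventually_cokerPts_subset isOpen_interior hO, hFe, hFc]
    with a hR haO haF haC hI
  have h1 : ‖F a - clusterMult a S‖ ≤ N * η := by
    rw [haF hI, finsum_mult_eq hr hR, clusterMult_cast hr hR, ← Finset.sum_sub_distrib]
    refine (norm_sum_le _ _).trans ?_
    have hN : (N : ℝ) = ∑ x ∈ (finite_cokerPts hr hR).toFinset, (mult a x : ℝ) := by
      rw [show N = _ from (finrank_ann_eq hI hR).symm, ← sum_mult hr hR]
      push_cast
      rfl
    rw [hN, Finset.sum_mul]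
    refine Finset.sum_le_sum fun x hx => ?_
    rw [← mul_sub, norm_mul, Complex.norm_natCast]
    refine mul_le_mul_of_nonneg_left ?_ (Nat.cast_nonneg _)
    have hxO : x ∈ {x | ‖MvPolynomial.eval x q - S.indicator 1 x‖ < η} :=
      interior_subset (haO (by simpa using hx))
    exact le_of_lt hxO
  have h2 : N * η < 1 / 2 := by
    rw [hη, mul_one_div, div_lt_div_iff₀ (by positivity) (by norm_num)]
    linarith
  have h3 : ‖((clusterMult a S : ℤ) - (clusterMult a₀ S : ℤ) : ℂ)‖ < 1 := by
    have : ((clusterMult a S : ℤ) - (clusterMult a₀ S : ℤ) : ℂ) =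
        (F a - F a₀) - (F a - clusterMult a S) := by
      rw [hFa]
      push_cast
      ring
    rw [this]
    refine (norm_sub_le _ _).trans_lt ?_
    linarith
  rw [← Int.cast_sub, Complex.norm_intCast] at h3
  have h4 : |(clusterMult a S : ℤ) - (clusterMult a₀ S : ℤ)| < 1 := by exact_mod_cast h3
  rw [Int.abs_lt_one_iff, sub_eq_zero] at h4
  exact_mod_cast h4

end Cluster

/-! ### Analyticity of the evaluation functionals -/

namespace PolydiscAlg

variable {n : ℕ} {r : ℝ}

lemma analyticAt_ev {x : Cn n} (hx : x ∈ Metric.ball (0 : Cn n) r) :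
    AnalyticAt ℂ (fun y => (ev y : PolydiscAlg n r →L[ℂ] ℂ)) x := by
  obtain ⟨D, hD⟩ := exists_gleason hx
  let mX : Fin n → PolydiscAlg n r →L[ℂ] PolydiscAlg n r := fun i =>
    ContinuousLinearMap.mul ℂ (PolydiscAlg n r) (X i)
  let pr : Fin n → (Fin n → PolydiscAlg n r) →L[ℂ] PolydiscAlg n r := fun i =>
    .proj (R := ℂ) (φ := fun _ : Fin n => PolydiscAlg n r) i
  let sn := ContinuousLinearMap.snd ℂ ℂ (Fin n → PolydiscAlg n r)
  let L₀ : ℂ × (Fin n → PolydiscAlg n r) →L[ℂ] PolydiscAlg n r :=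
    (ContinuousLinearMap.toSpanSingleton ℂ 1).comp
      (ContinuousLinearMap.fst ℂ ℂ (Fin n → PolydiscAlg n r)) +
      ∑ i, (mX i).comp ((pr i).comp sn)
  let L : Cn n → (ℂ × (Fin n → PolydiscAlg n r) →L[ℂ] PolydiscAlg n r) := fun y =>
    L₀ - ∑ i, y i • (pr i).comp sn
  have hL : ∀ y w, L y w = algebraMap ℂ _ w.1 + ∑ i, (X i - algebraMap ℂ _ (y i)) * w.2 i := by
    intro y w
    have h1 : L y w = w.1 • (1 : PolydiscAlg n r) + ∑ i, X i * w.2 i - ∑ i, y i • w.2 i := by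
      simp only [L, L₀, sub_apply, add_apply, sum_apply, smul_apply]
      rfl
    rw [h1, Algebra.algebraMap_eq_smul_one, add_sub_assoc, ← Finset.sum_sub_distrib]
    congr 1
    refine Finset.sum_congr rfl fun i _ => ?_
    rw [sub_mul, ← Algebra.smul_def]
  have hLa : AnalyticAt ℂ L x := by
    refine analyticAt_const.sub (Finset.analyticAt_fun_sum _ fun i _ => ?_)
    exact ((ContinuousLinearMap.proj (R := ℂ) (φ := fun _ : Fin n => ℂ) i).analyticAt x).smul
      analyticAt_const
  let T₀ : PolydiscAlg n r →L[ℂ] ℂ × (Fin n → PolydiscAlg n r) :=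
    (ev x).prod (ContinuousLinearMap.pi D)
  have hT₀ : (L x).comp T₀ = ContinuousLinearMap.id ℂ _ := by
    ext1 v
    rw [ContinuousLinearMap.comp_apply, hL]
    exact (hD v).symm
  obtain ⟨T, -, hT⟩ := exists_analyticAt_rightInverse hT₀
  have h1 : AnalyticAt ℂ (fun y => (ContinuousLinearMap.fst ℂ ℂ (Fin n → PolydiscAlg n r)).comp
      (T (L y))) x := by
    have h2 : AnalyticAt ℂ (fun y => T (L y)) x := hT.self_of_nhds.1.comp hLa
    let Φ : (PolydiscAlg n r →L[ℂ] ℂ × (Fin n → PolydiscAlg n r)) →L[ℂ] (PolydiscAlg n r →L[ℂ] ℂ) :=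
      ContinuousLinearMap.compL ℂ _ _ _ (ContinuousLinearMap.fst ℂ ℂ (Fin n → PolydiscAlg n r))
    have hΦ := ContinuousLinearMap.analyticAt (𝕜 := ℂ)
      (E := PolydiscAlg n r →L[ℂ] ℂ × (Fin n → PolydiscAlg n r))
      (F := PolydiscAlg n r →L[ℂ] ℂ) Φ (T (L x))
    exact AnalyticAt.comp (g := Φ) (f := fun y => T (L y)) hΦ h2
  refine h1.congr ?_
  filter_upwards [hLa.continuousAt.eventually hT, Metric.isOpen_ball.mem_nhds hx] with y hy hyb
  have hyc := Metric.ball_subset_closedBall hyb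
  ext1 v
  have h3 : L y (T (L y) v) = v := congrArg (fun S => S v) hy.2
  conv_rhs => rw [← h3, hL]
  rw [map_add, ev_algebraMap hyc, map_sum, Finset.sum_eq_zero, add_zero]
  · rfl
  · intro i _
    rw [ev_mul hyc, map_sub, ev_X hyc, ev_algebraMap hyc, sub_self, zero_mul]

/-- Directional derivative at an interior point. -/
def dev (x d : Cn n) (v : PolydiscAlg n r) : ℂ := fderiv ℂ (fun y => ev y v) x d

lemma differentiableAt_ev {x : Cn n} (hx : x ∈ Metric.ball (0 : Cn n) r) (v : PolydiscAlg n r) :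
    DifferentiableAt ℂ (fun y => ev y v) x :=
  (analyticAt_ev hx).differentiableAt.clm_apply (differentiableAt_const v)

lemma dev_mul {x : Cn n} (hx : x ∈ Metric.ball (0 : Cn n) r) (d : Cn n) (v w : PolydiscAlg n r) :
    dev x d (v * w) = ev x v * dev x d w + ev x w * dev x d v := by
  have h : (fun y => ev y (v * w)) =ᶠ[𝓝 x] fun y => ev y v * ev y w := by
    filter_upwards [Metric.isOpen_ball.mem_nhds hx] with y hy
    exact ev_mul (Metric.ball_subset_closedBall hy) v w
  rw [dev, h.fderiv_eq, fderiv_fun_mul (differentiableAt_ev hx v) (differentiableAt_ev hx w)]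
  rfl

lemma dev_add {x : Cn n} (hx : x ∈ Metric.ball (0 : Cn n) r) (d : Cn n) (v w : PolydiscAlg n r) :
    dev x d (v + w) = dev x d v + dev x d w := by
  simp only [dev, map_add]
  rw [fderiv_fun_add (differentiableAt_ev hx v) (differentiableAt_ev hx w)]
  rfl

lemma dev_sum {x : Cn n} (hx : x ∈ Metric.ball (0 : Cn n) r) (d : Cn n) {σ : Type*}
    (s : Finset σ) (v : σ → PolydiscAlg n r) :
    dev x d (∑ i ∈ s, v i) = ∑ i ∈ s, dev x d (v i) := by
  simp only [dev, map_sum]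
  rw [fderiv_fun_sum fun i _ => differentiableAt_ev hx (v i), sum_apply]

lemma dev_algebraMap {x : Cn n} (hx : x ∈ Metric.ball (0 : Cn n) r) (d : Cn n) (c : ℂ) :
    dev x d (algebraMap ℂ (PolydiscAlg n r) c) = 0 := by
  have h : (fun y => ev y (algebraMap ℂ (PolydiscAlg n r) c)) =ᶠ[𝓝 x] fun y => c := by
    filter_upwards [Metric.isOpen_ball.mem_nhds hx] with y hy
    exact ev_algebraMap (Metric.ball_subset_closedBall hy) c
  rw [dev, h.fderiv_eq]
  simp

lemma dev_X {x : Cn n} (hx : x ∈ Metric.ball (0 : Cn n) r) (d : Cn n) (i : Fin n) :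
    dev x d (X i : PolydiscAlg n r) = d i := by
  have h : (fun y => ev y (X i : PolydiscAlg n r)) =ᶠ[𝓝 x]
      fun y => ContinuousLinearMap.proj (R := ℂ) (φ := fun _ : Fin n => ℂ) i y := by
    filter_upwards [Metric.isOpen_ball.mem_nhds hx] with y hy
    exact ev_X (Metric.ball_subset_closedBall hy) i
  rw [dev, h.fderiv_eq, ContinuousLinearMap.fderiv]
  rfl

lemma dev_eq_sum {x : Cn n} (hx : x ∈ Metric.ball (0 : Cn n) r) (d : Cn n)
    {D : Fin n → PolydiscAlg n r →L[ℂ] PolydiscAlg n r} (hD : ∀ v,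
      v = algebraMap ℂ _ (ev x v) + ∑ i, (X i - algebraMap ℂ _ (x i)) * D i v)
    (v : PolydiscAlg n r) : dev x d v = ∑ i, d i * ev x (D i v) := by
  have hxc := Metric.ball_subset_closedBall hx
  conv_lhs => rw [hD v]
  rw [dev_add hx, dev_algebraMap hx, zero_add, dev_sum hx]
  refine Finset.sum_congr rfl fun i _ => ?_
  have h1 : dev x d (X i - algebraMap ℂ (PolydiscAlg n r) (x i)) = d i := by
    have := dev_add hx d (X i - algebraMap ℂ (PolydiscAlg n r) (x i)) (algebraMap ℂ _ (x i))
    rw [sub_add_cancel, dev_X hx, dev_algebraMap hx, add_zero] at this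
    exact this.symm
  rw [dev_mul hx, h1, map_sub, ev_X hxc, ev_algebraMap hxc, sub_self, zero_mul, zero_add, mul_comm]

/-! ### Restriction to a smaller polydisc -/

variable {ε : ℝ}

/-- Restriction to a smaller polydisc. -/
def res (h : r ≤ ε) : PolydiscAlg n ε →L[ℂ] PolydiscAlg n r :=
  LinearMap.mkContinuous
    { toFun := fun v => ⟨(toCM n ε v).comp ⟨Set.inclusion (Metric.closedBall_subset_closedBall h),
        continuous_inclusion _⟩, by
        refine induction_closed (P := fun v => (toCM n ε v).comp
          ⟨Set.inclusion (Metric.closedBall_subset_closedBall h), continuous_inclusion _⟩ ∈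
          polydiscSubalgebra n r) ?_ ?_ ?_ ?_ ?_ v
        · refine IsClosed.preimage (f := fun v : PolydiscAlg n ε => (toCM n ε v).comp
            ⟨Set.inclusion (Metric.closedBall_subset_closedBall h), continuous_inclusion _⟩) ?_
            (Subalgebra.isClosed_topologicalClosure _)
          exact (ContinuousMap.continuous_precomp _).comp continuous_toCM
        · exact fun i => (X i : PolydiscAlg n r).2
        · exact fun c => (algebraMap ℂ (PolydiscAlg n r) c).2
        · exact fun v w hv hw => add_mem hv hw
        · exact fun v w hv hw => mul_mem hv hw⟩
      map_add' := fun v w => rfl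
      map_smul' := fun c v => rfl } 1 (fun v => by
        rw [one_mul]
        refine norm_le_of_ev (norm_nonneg _) fun x hx => ?_
        rw [ev_apply hx]
        exact (toCM n ε v).norm_coe_le_norm _)

lemma ev_res (h : r ≤ ε) {x : Cn n} (hx : x ∈ Metric.closedBall (0 : Cn n) r)
    (v : PolydiscAlg n ε) : ev x (res h v) = ev x v := by
  rw [ev_apply hx, ev_apply (Metric.closedBall_subset_closedBall h hx)]
  rfl

lemma res_mul (h : r ≤ ε) (v w : PolydiscAlg n ε) : res h (v * w) = res h v * res h w := rfl

lemma res_algebraMap (h : r ≤ ε) (c : ℂ) :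
    res h (algebraMap ℂ (PolydiscAlg n ε) c) = algebraMap ℂ _ c := rfl

lemma res_X (h : r ≤ ε) (i : Fin n) : res h (X i : PolydiscAlg n ε) = X i := rfl

lemma denseRange_res (h : r ≤ ε) : DenseRange (res h : PolydiscAlg n ε → PolydiscAlg n r) := by
  intro v
  have h1 : (Algebra.adjoin ℂ (Set.range (X : Fin n → PolydiscAlg n r)) :
      Set (PolydiscAlg n r)) ⊆ Set.range (res h) := by
    intro w hw
    induction hw using Algebra.adjoin_induction with
    | mem x hx => obtain ⟨i, rfl⟩ := hx; exact ⟨X i, rfl⟩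
    | algebraMap c => exact ⟨algebraMap ℂ _ c, rfl⟩
    | add x y _ _ hx hy =>
      obtain ⟨a, rfl⟩ := hx
      obtain ⟨b, rfl⟩ := hy
      exact ⟨a + b, map_add _ _ _⟩
    | mul x y _ _ hx hy =>
      obtain ⟨a, rfl⟩ := hx
      obtain ⟨b, rfl⟩ := hy
      exact ⟨a * b, rfl⟩
  refine closure_mono h1 ?_
  rw [closure_adjoin_X]
  trivial

/-- Gleason decompositions compatible with restriction. -/
lemma exists_gleason_res (h : r ≤ ε) {x : Cn n} (hx : x ∈ Metric.ball (0 : Cn n) r) :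
    ∃ (D : Fin n → PolydiscAlg n ε →L[ℂ] PolydiscAlg n ε)
      (D' : Fin n → PolydiscAlg n r →L[ℂ] PolydiscAlg n r),
      (∀ v, v = algebraMap ℂ _ (ev x v) + ∑ i, (X i - algebraMap ℂ _ (x i)) * D i v) ∧
      ∀ i v, res h (D i v) = D' i (res h v) := by
  have hx' := Metric.ball_subset_ball h hx
  obtain ⟨D, hD⟩ := exists_gleason_partial hx'
  obtain ⟨D', hD'⟩ := exists_gleason_partial hx
  refine ⟨D, D', fun v => ext_ev fun z hz => ?_, fun i v => ?_⟩
  · rw [hD n le_rfl v z hz, map_add, ev_algebraMap hz, map_sum]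
    congr 1
    · rw [Finset.filter_true_of_mem fun j _ => j.2, substMap_univ]
    · rw [Finset.filter_true_of_mem fun j _ => j.2]
      refine Finset.sum_congr rfl fun i _ => ?_
      rw [ev_mul hz, map_sub, ev_X hz, ev_algebraMap hz]
  · have hxi : 0 < r - ‖x i‖ := by
      have := (norm_le_pi_norm x i).trans_lt (mem_ball_zero_iff.1 hx)
      linarith
    have hins : (Finset.univ.filter fun j : Fin n => (j : ℕ) < i + 1) =
        insert i (Finset.univ.filter fun j : Fin n => (j : ℕ) < i) := by
      ext j
      simp only [Finset.mem_filter, Finset.mem_univ, true_and, Finset.mem_insert, Fin.ext_iff]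
      omega
    have hni : i ∉ Finset.univ.filter fun j : Fin n => (j : ℕ) < i := by simp
    have key : (X i - algebraMap ℂ _ (x i)) * (res h (D i v) - D' i (res h v)) = 0 := by
      refine ext_ev fun z hz => ?_
      have hxc := Metric.ball_subset_closedBall hx
      have hzε := Metric.closedBall_subset_closedBall h hz
      have e1 := hD (i + 1) i.2 v z hzε
      have e2 := hD i i.2.le v z hzε
      rw [hins, Finset.sum_insert hni] at e1
      have e1' := hD' (i + 1) i.2 (res h v) z hz
      have e2' := hD' i i.2.le (res h v) z hz
      rw [hins, Finset.sum_insert hni, ev_res h hz, ev_res h (substMap_mem hxc hz)] at e1'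
      rw [ev_res h hz, ev_res h (substMap_mem hxc hz)] at e2'
      rw [ev_mul hz, map_sub, map_sub, ev_X hz, ev_algebraMap hz, ev_res h hz, map_zero]
      linear_combination -e1 + e2 + e1' - e2'
    have h2 := le_norm_mul_sub hx i (res h (D i v) - D' i (res h v))
    rw [key, norm_zero] at h2
    have h3 : ‖res h (D i v) - D' i (res h v)‖ ≤ 0 := by
      by_contra hcon
      push Not at hcon
      exact absurd h2 (not_le.2 (mul_pos hxi hcon))
    exact sub_eq_zero.1 (norm_le_zero_iff.1 h3)

end PolydiscAlg

/-! ### Restriction of annihilators -/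

lemma finrank_le_of_injective_jointEig {A V σ W : Type*} [CommRing A] [Algebra ℂ A]
    [AddCommGroup V] [Module ℂ V] [FiniteDimensional ℂ V] [AddCommGroup W] [Module ℂ W]
    (ρ : A →ₐ[ℂ] Module.End ℂ V) (z : σ → A) (χ : σ → ℂ) (Θ : W →ₗ[ℂ] jointEig ρ z χ)
    (h : Function.Injective Θ) :
    Module.finrank ℂ W ≤ Module.finrank ℂ (jointEig ρ z χ) :=
  LinearMap.finrank_le_finrank_of_injective h

section Restriction

open PolydiscAlg

variable {n p : ℕ} {r ε : ℝ} {ι κ : Type*} [Fintype ι] [Fintype κ]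

/-- Restriction of vectors. -/
def resV (h : r ≤ ε) : (Fin p → PolydiscAlg n ε) →L[ℂ] (Fin p → PolydiscAlg n r) :=
  ContinuousLinearMap.pi fun i =>
    (res h).comp (.proj (R := ℂ) (φ := fun _ : Fin p => PolydiscAlg n ε) i)

lemma resV_apply (h : r ≤ ε) (v : Fin p → PolydiscAlg n ε) (i : Fin p) :
    resV h v i = res h (v i) := rfl

lemma resV_smul (h : r ≤ ε) (u : PolydiscAlg n ε) (v : Fin p → PolydiscAlg n ε) :
    resV h (u • v) = res h u • resV h v := rfl

lemma denseRange_resV (h : r ≤ ε) :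
    DenseRange (resV h : (Fin p → PolydiscAlg n ε) → Fin p → PolydiscAlg n r) :=
  DenseRange.piMap fun _ => denseRange_res h

/-- Restriction of columns. -/
def resCols (h : r ≤ ε) (a : κ → Fin p → PolydiscAlg n ε) : κ → Fin p → PolydiscAlg n r :=
  fun k => resV h (a k)

lemma resV_colOp (h : r ≤ ε) (a : κ → Fin p → PolydiscAlg n ε) (w : κ → PolydiscAlg n ε) :
    resV h (colOp a w) = colOp (resCols h a) fun k => res h (w k) := by
  rw [colOp_apply, colOp_apply, map_sum]
  rfl

lemma eq_zero_of_comp_resV (h : r ≤ ε) {ψ : (Fin p → PolydiscAlg n r) →L[ℂ] ℂ}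
    (hψ : ∀ v, ψ (resV h v) = 0) : ψ = 0 := by
  have := (denseRange_resV (p := p) h).equalizer ψ.continuous
    (continuous_const (y := (0 : ℂ))) (funext hψ)
  exact ContinuousLinearMap.ext fun v => congrFun this v

lemma mem_ann_of_comp_resV (h : r ≤ ε) {a : κ → Fin p → PolydiscAlg n ε}
    {ψ : (Fin p → PolydiscAlg n r) →L[ℂ] ℂ} (hψ : ψ.comp (resV h) ∈ ann a) :
    ψ ∈ ann (resCols h a) := by
  intro w
  have h1 : DenseRange fun (w : κ → PolydiscAlg n ε) (k : κ) => res h (w k) :=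
    DenseRange.piMap fun _ => denseRange_res h
  have := h1.equalizer (ψ.continuous.comp (colOp (resCols h a)).continuous)
    (continuous_const (y := (0 : ℂ))) (funext fun w => by
      have := hψ w
      rw [ContinuousLinearMap.comp_apply, resV_colOp] at this
      exact this)
  exact congrFun this w

/-- Functionals supported at an interior point extend to smaller polydiscs. -/
lemma exists_factor_res (h : r ≤ ε) {x : Cn n} (hx : x ∈ Metric.ball (0 : Cn n) r)
    (a : κ → Fin p → PolydiscAlg n ε) :
    ∀ φ ∈ jointEig (annRep a) (X : Fin n → PolydiscAlg n ε) x,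
      ∃ ψ : (Fin p → PolydiscAlg n r) →L[ℂ] ℂ, ψ.comp (resV h) = φ.fn := by
  classical
  obtain ⟨D, D', hD, hDD⟩ := exists_gleason_res h hx
  refine jointEig_induction (annRep a) (X : Fin n → PolydiscAlg n ε) x
    ⟨0, ContinuousLinearMap.zero_comp _⟩ fun φ _ hφ => ?_
  choose ψ hψ using hφ
  let pr : Fin p → (Fin p → PolydiscAlg n r) →L[ℂ] PolydiscAlg n r := fun i =>
    .proj (R := ℂ) (φ := fun _ : Fin p => PolydiscAlg n r) i
  let D'' : Fin n → (Fin p → PolydiscAlg n r) →L[ℂ] (Fin p → PolydiscAlg n r) := fun i =>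
    ContinuousLinearMap.pi fun k => (D' i).comp (pr k)
  refine ⟨∑ k, φ.fn (Pi.single k 1) • (ev x).comp (pr k) + ∑ i, (ψ i).comp (D'' i),
    ContinuousLinearMap.ext fun v => ?_⟩
  have h1 : v = ∑ k, ev x (v k) • (Pi.single k 1 : Fin p → PolydiscAlg n ε) +
      ∑ i, (X i - algebraMap ℂ (PolydiscAlg n ε) (x i)) • (fun k => D i (v k)) := by
    funext k
    rw [Pi.add_apply, Finset.sum_apply, Finset.sum_apply, Finset.sum_eq_single k]
    · rw [Pi.smul_apply, Pi.single_eq_same, ← Algebra.algebraMap_eq_smul_one]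
      exact hD (v k)
    · intro b _ hb
      rw [Pi.smul_apply, Pi.single_eq_of_ne hb.symm, smul_zero]
    · simp
  conv_rhs => rw [h1]
  rw [map_add, map_sum, map_sum, ContinuousLinearMap.comp_apply, add_apply, sum_apply, sum_apply]
  congr 1
  · refine Finset.sum_congr rfl fun k _ => ?_
    rw [map_smul, smul_apply, ContinuousLinearMap.comp_apply, smul_eq_mul, smul_eq_mul, mul_comm]
    congr 1
    exact ev_res h (Metric.ball_subset_closedBall hx) (v k)
  · refine Finset.sum_congr rfl fun i _ => ?_
    have h2 := congrArg (fun S => S fun k => D i (v k)) (hψ i)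
    have h3 : D'' i (resV h v) = resV h fun k => D i (v k) := by
      funext k
      exact (hDD i (v k)).symm
    rw [ContinuousLinearMap.comp_apply, h3]
    exact h2

lemma mult_le_mult_resCols (h : r ≤ ε) {x : Cn n} (hx : x ∈ Metric.ball (0 : Cn n) r)
    (a : κ → Fin p → PolydiscAlg n ε) {E : ι → Fin p → PolydiscAlg n r}
    (hR : HasRI E (resCols h a)) : mult a x ≤ mult (resCols h a) x := by
  have := finiteDimensional_ann hR
  choose ψ hψ using exists_factor_res h hx a
  have hmem : ∀ φ hφ, ψ φ hφ ∈ ann (resCols h a) := fun φ hφ =>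
    mem_ann_of_comp_resV h (by rw [hψ]; exact φ.fn_mem)
  have huniq : ∀ {ψ₁ ψ₂ : (Fin p → PolydiscAlg n r) →L[ℂ] ℂ},
      ψ₁.comp (resV h) = ψ₂.comp (resV h) → ψ₁ = ψ₂ := by
    intro ψ₁ ψ₂ h12
    rw [← sub_eq_zero]
    refine eq_zero_of_comp_resV h fun v => ?_
    rw [sub_apply, sub_eq_zero]
    exact congrArg (fun S => S v) h12
  have hann : ∀ φ hφ, AnnSp.mk (ψ φ hφ) (hmem φ hφ) ∈
      jointEig (annRep (resCols h a))
        (X : Fin n → PolydiscAlg n r) x := by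
    intro φ hφ
    rw [mem_jointEig_iff]
    intro i
    obtain ⟨k, hk⟩ := (mem_jointEig_iff _ _ _ _).1 hφ i
    refine ⟨k, AnnSp.ext_fn (eq_zero_of_comp_resV h fun v => ?_)⟩
    rw [annRep_apply]
    have h1 := congrArg (fun S : AnnSp a => S.fn v) hk
    have h2 : res h ((X i - algebraMap ℂ (PolydiscAlg n ε) (x i)) ^ k) =
        (X i - algebraMap ℂ (PolydiscAlg n r) (x i)) ^ k := by
      refine ext_ev fun z hz => ?_
      rw [ev_res h hz, ev_pow hz, ev_pow (Metric.closedBall_subset_closedBall h hz), map_sub,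
        map_sub, ev_X hz, ev_X (Metric.closedBall_subset_closedBall h hz), ev_algebraMap hz,
        ev_algebraMap (Metric.closedBall_subset_closedBall h hz)]
    rw [← h2, ← resV_smul]
    have h3 := congrArg (fun S => S (((X i - algebraMap ℂ (PolydiscAlg n ε) (x i)) ^ k) • v))
      (hψ φ hφ)
    exact h3.trans h1
  let Θ : jointEig (annRep a) (X : Fin n → PolydiscAlg n ε) x →ₗ[ℂ]
      jointEig (annRep (resCols h a))
        (X : Fin n → PolydiscAlg n r) x :=
    { toFun := fun φ => ⟨AnnSp.mk (ψ φ.1 φ.2) (hmem _ _), hann _ _⟩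
      map_add' := fun φ₁ φ₂ => Subtype.ext (AnnSp.ext_fn (huniq (by
        change (ψ (φ₁ + φ₂).1 (φ₁ + φ₂).2).comp (resV h) =
          (ψ φ₁.1 φ₁.2 + ψ φ₂.1 φ₂.2).comp (resV h)
        rw [ContinuousLinearMap.add_comp, hψ, hψ, hψ]
        rfl)))
      map_smul' := fun c φ => Subtype.ext (AnnSp.ext_fn (huniq (by
        change (ψ (c • φ).1 (c • φ).2).comp (resV h) = (c • ψ φ.1 φ.2).comp (resV h)
        rw [ContinuousLinearMap.smul_comp, hψ, hψ]
        rfl))) }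
  have hinj : Function.Injective Θ := by
    intro φ₁ φ₂ h12
    have h1 : ψ φ₁.1 φ₁.2 = ψ φ₂.1 φ₂.2 := congrArg (fun S => S.1.fn) h12
    apply Subtype.ext
    apply AnnSp.ext_fn
    rw [← hψ φ₁.1 φ₁.2, ← hψ φ₂.1 φ₂.2, h1]
  exact finrank_le_of_injective_jointEig _ _ _ Θ hinj

/-- The spectrum in a smaller open polydisc is controlled by the restricted annihilator. -/
lemma clusterMult_ball_le (hr : 0 ≤ r) (h : r ≤ ε) (a : κ → Fin p → PolydiscAlg n ε)
    {E : ι → Fin p → PolydiscAlg n r}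
    (hR : HasRI E (resCols h a)) :
    clusterMult a (Metric.ball 0 r) ≤ Module.finrank ℂ (AnnSp (resCols h a)) := by
  classical
  rw [← sum_mult hr hR, clusterMult, finsum_mem_def]
  refine (finsum_eq_sum_of_support_subset (s := (finite_cokerPts hr hR).toFinset) _ ?_).trans_le ?_
  · intro x hx
    rw [Function.mem_support] at hx
    rw [Set.Finite.coe_toFinset]
    refine support_mult_subset hr _ fun h0 => hx ?_
    by_cases hxr : x ∈ Metric.ball (0 : Cn n) r
    · rw [Set.indicator_of_mem hxr]
      exact Nat.eq_zero_of_le_zero ((mult_le_mult_resCols h hxr a hR).trans_eq h0)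
    · rw [Set.indicator_of_notMem hxr]
  · refine Finset.sum_le_sum fun x _ => ?_
    by_cases hxr : x ∈ Metric.ball (0 : Cn n) r
    · rw [Set.indicator_of_mem hxr]
      exact mult_le_mult_resCols h hxr a hR
    · rw [Set.indicator_of_notMem hxr]
      exact Nat.zero_le _

end Restriction

/-! ### Columns attached to a pair -/

section Pairs

variable {H : Type*} [NormedCommRing H] [NormedAlgebra ℂ H] {n p : ℕ}

/-- Pairs consisting of a matrix and a vector. -/
abbrev PairSp (n p : ℕ) (H : Type*) : Type _ := (Fin n → Fin p → H) × (Fin p → H)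

/-- The rows of the matrix together with the Koszul relations of the vector. -/
def pairCols : PairSp n p H →L[ℂ] (Fin n ⊕ Fin p × Fin p → Fin p → H) :=
  let S : Fin p → H →L[ℂ] (Fin p → H) := ContinuousLinearMap.single ℂ (fun _ : Fin p => H)
  let pr : Fin p → (Fin p → H) →L[ℂ] H := fun k =>
    .proj (R := ℂ) (φ := fun _ : Fin p => H) k
  ContinuousLinearMap.pi (Sum.elim
    (fun j => (ContinuousLinearMap.proj (R := ℂ) (φ := fun _ : Fin n => Fin p → H) j).comp
      (.fst ℂ _ _))
    (fun ik => ((S ik.2).comp (pr ik.1) - (S ik.1).comp (pr ik.2)).comp (.snd ℂ _ _)))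

@[simp] lemma pairCols_inl (l : PairSp n p H) (j : Fin n) : pairCols l (.inl j) = l.1 j := rfl

lemma pairCols_inr (l : PairSp n p H) (i k : Fin p) :
    pairCols l (.inr (i, k)) = Pi.single k (l.2 i) - Pi.single i (l.2 k) := rfl

lemma analyticAt_pairCols (l : PairSp n p H) :
    AnalyticAt ℂ (pairCols : PairSp n p H → Fin n ⊕ Fin p × Fin p → Fin p → H) l :=
  ContinuousLinearMap.analyticAt (𝕜 := ℂ) (E := PairSp n p H)
    (F := Fin n ⊕ Fin p × Fin p → Fin p → H) pairCols l

lemma map_pairCols_inr {φ : (Fin p → H) →L[ℂ] ℂ} {l : PairSp n p H}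
    (h : φ ∈ ann (pairCols l)) (i k : Fin p) :
    φ (Pi.single k (l.2 i)) = φ (Pi.single i (l.2 k)) := by
  classical
  have := h (Pi.single (.inr (i, k)) 1)
  rw [colOp_apply, Finset.sum_eq_single (Sum.inr (i, k)), Pi.single_eq_same, one_smul,
    pairCols_inr, map_sub, sub_eq_zero] at this
  · exact this
  · intro b _ hb
    rw [Pi.single_eq_of_ne hb, zero_smul]
  · simp

lemma map_pairCols_inl {φ : (Fin p → H) →L[ℂ] ℂ} {l : PairSp n p H}
    (h : φ ∈ ann (pairCols l)) (j : Fin n) : φ (l.1 j) = 0 := by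
  classical
  have := h (Pi.single (.inl j) 1)
  rwa [colOp_apply, Finset.sum_eq_single (Sum.inl j), Pi.single_eq_same, one_smul,
    pairCols_inl] at this
  · intro b _ hb
    rw [Pi.single_eq_of_ne hb, zero_smul]
  · simp

end Pairs

lemma finrank_jointEig_le_one {A V σ : Type*} [CommRing A] [Algebra ℂ A] [AddCommGroup V]
    [Module ℂ V] (ρ : A →ₐ[ℂ] Module.End ℂ V) (z : σ → A) (χ : σ → ℂ) (v₀ : V)
    (h : ∀ v ∈ jointEig ρ z χ, ∃ c : ℂ, v = c • v₀) :
    Module.finrank ℂ (jointEig ρ z χ) ≤ 1 := by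
  have hle : jointEig ρ z χ ≤ Submodule.span ℂ {v₀} := by
    intro v hv
    obtain ⟨c, rfl⟩ := h v hv
    exact Submodule.smul_mem _ _ (Submodule.mem_span_singleton_self _)
  refine (Submodule.finrank_mono hle).trans ?_
  refine (finrank_span_le_card {v₀}).trans ?_
  simp

section Simple

open PolydiscAlg

variable {n p : ℕ} {r : ℝ}

lemma evFun_single {x : Cn n} (c : Fin p → ℂ) (k : Fin p) (v : PolydiscAlg n r) :
    evFun c x (Pi.single k v) = c k * ev x v := by
  rw [evFun_apply, Finset.sum_eq_single k, Pi.single_eq_same]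
  · intro b _ hb
    rw [Pi.single_eq_of_ne hb, map_zero, mul_zero]
  · simp

lemma evFun_mem_ann_pairCols {x : Cn n} (hx : x ∈ Metric.closedBall (0 : Cn n) r) {c : Fin p → ℂ}
    {l : PairSp n p (PolydiscAlg n r)} :
    evFun c x ∈ ann (pairCols l) ↔ (∀ j, ∑ i, c i * ev x (l.1 j i) = 0) ∧
      ∀ i k, c k * ev x (l.2 i) = c i * ev x (l.2 k) := by
  rw [evFun_mem_ann hx]
  constructor
  · intro h
    refine ⟨fun j => h (.inl j), fun i k => ?_⟩
    have := h (.inr (i, k))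
    rwa [← evFun_apply, pairCols_inr, map_sub, evFun_single, evFun_single, sub_eq_zero] at this
  · rintro ⟨h1, h2⟩ (j | ⟨i, k⟩)
    · exact h1 j
    · rw [← evFun_apply, pairCols_inr, map_sub, evFun_single, evFun_single, sub_eq_zero]
      exact h2 i k

/-- A nonzero vector proportional to `h`. -/
lemma exists_smul_of_koszul {c h : Fin p → ℂ} (hh : h ≠ 0) (H : ∀ i k, c k * h i = c i * h k) :
    ∃ s : ℂ, c = s • h := by
  obtain ⟨i, hi⟩ := Function.ne_iff.1 hh
  refine ⟨c i / h i, funext fun k => ?_⟩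
  rw [Pi.smul_apply, smul_eq_mul, div_mul_eq_mul_div, eq_div_iff hi, H]

/-- A nondegenerate zero of `M h` off the zeros of `h` has multiplicity at most one. -/
lemma mult_pairCols_le_one (l : PairSp n p (PolydiscAlg n r)) {x : Cn n}
    (hx : x ∈ Metric.ball (0 : Cn n) r) (hh : (fun i => ev x (l.2 i)) ≠ (0 : Fin p → ℂ))
    (hz : ∀ j, ∑ i, ev x (l.2 i) * ev x (l.1 j i) = 0)
    (hnd : ∀ d, (∀ j, dev x d (∑ i, l.2 i * l.1 j i) = 0) → d = 0) :
    mult (pairCols l) x ≤ 1 := by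
  classical
  have hxc := Metric.ball_subset_closedBall hx
  have hr : 0 ≤ r := (norm_nonneg x).trans (by simpa using hxc)
  set η : Fin p → ℂ := fun i => ev x (l.2 i) with hη
  have hψ : (evFun η x : (Fin p → PolydiscAlg n r) →L[ℂ] ℂ) ∈ ann (pairCols l) :=
    (evFun_mem_ann_pairCols hxc).2 ⟨hz, fun i k => mul_comm _ _⟩
  obtain ⟨D, hD⟩ := exists_gleason hx
  have key : ∀ φ ∈ jointEig (annRep (pairCols l)) (X : Fin n → PolydiscAlg n r) x,
      ∃ c : ℂ, φ.fn = c • evFun η x := by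
    refine jointEig_induction _ _ _ ⟨0, (zero_smul ℂ (evFun η x : (Fin p → PolydiscAlg n r) →L[ℂ] ℂ)).symm⟩ fun φ _ ih => ?_
    choose d hd using ih
    have hd' : ∀ i v, φ.fn ((X i - algebraMap ℂ (PolydiscAlg n r) (x i)) • v) =
        d i * evFun η x v := fun i v => congrArg (fun S => S v) (hd i)
    obtain ⟨A, hA⟩ : ∃ A : Fin p → ℂ, ∀ k, φ.fn (Pi.single k 1) = A k := ⟨_, fun _ => rfl⟩
    have hform : ∀ k v, φ.fn (Pi.single k v) = A k * ev x v + η k * dev x d v := by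
      intro k v
      have h1 : (Pi.single k v : Fin p → PolydiscAlg n r) = ev x v • (Pi.single k 1 : Fin p → PolydiscAlg n r) +
          ∑ i, (X i - algebraMap ℂ (PolydiscAlg n r) (x i)) • (Pi.single k (D i v) : Fin p → PolydiscAlg n r) := by
        rw [← Pi.single_smul, ← Algebra.algebraMap_eq_smul_one]
        simp only [← Pi.single_smul]
        conv_lhs => rw [hD v]
        rw [Pi.single_add]
        congr 1
        exact map_sum (AddMonoidHom.single (fun _ : Fin p => PolydiscAlg n r) k) _ _
      rw [h1, map_add, map_sum, map_smul, hA, smul_eq_mul, mul_comm, dev_eq_sum hx d hD v]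
      simp only [hd', evFun_single]
      rw [Finset.mul_sum]
      congr 1
      exact Finset.sum_congr rfl fun i _ => by ring
    obtain ⟨s, hs⟩ : ∃ s : ℂ, (fun k => A k - dev x d (l.2 k)) = s • η := by
      refine exists_smul_of_koszul hh fun i k => ?_
      have := map_pairCols_inr φ.fn_mem i k
      rw [hform, hform] at this
      linear_combination this
    have hs' : ∀ k, A k = dev x d (l.2 k) + s * η k := fun k => by
      have := congrFun hs k
      rw [Pi.smul_apply, smul_eq_mul] at this
      linear_combination this
    have hd0 : d = 0 := by
      refine hnd d fun j => ?_
      have h1 := map_pairCols_inl φ.fn_mem j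
      have h2 : l.1 j = ∑ k, Pi.single k (l.1 j k) := (Finset.univ_sum_single _).symm
      rw [h2, map_sum] at h1
      simp only [hform, hs'] at h1
      rw [dev_sum hx]
      simp only [dev_mul hx]
      calc ∑ i, (ev x (l.2 i) * dev x d (l.1 j i) + ev x (l.1 j i) * dev x d (l.2 i))
          = ∑ k, ((dev x d (l.2 k) + s * η k) * ev x (l.1 j k) + η k * dev x d (l.1 j k)) -
            s * ∑ i, ev x (l.2 i) * ev x (l.1 j i) := by
            rw [Finset.mul_sum, ← Finset.sum_sub_distrib]
            exact Finset.sum_congr rfl fun i _ => by simp only [hη]; ring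
        _ = 0 := by rw [h1, hz, mul_zero, sub_zero]
    refine ⟨s, ContinuousLinearMap.ext fun v => ?_⟩
    have h2 : v = ∑ k, Pi.single k (v k) := (Finset.univ_sum_single _).symm
    rw [smul_apply, evFun_apply, smul_eq_mul, Finset.mul_sum]
    conv_lhs => rw [h2, map_sum]
    refine Finset.sum_congr rfl fun k _ => ?_
    rw [hform, hs', hd0]
    simp [dev]
    ring
  refine finrank_jointEig_le_one _ _ _ (AnnSp.mk _ hψ) fun φ hφ => ?_
  obtain ⟨c, hc⟩ := key φ hφ
  exact ⟨c, AnnSp.ext_fn hc⟩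

end Simple

/-! ### A criterion for right inverses -/

section Machine

variable {H : Type*} [NormedCommRing H] [NormedAlgebra ℂ H]
  {ι κ : Type*} [Fintype ι] [Fintype κ] {n p : ℕ}

/-- If a power of every variable kills the cokernel and the cokernel is spanned by `E` up to low
order monomials, then there is a bounded right inverse. -/
lemma hasRI_of_monomials {E : ι → Fin p → H} {a : κ → Fin p → H} (X : Fin n → H) (e : H →L[ℂ] ℂ)
    (D : Fin n → H →L[ℂ] H) (hD : ∀ v, v = algebraMap ℂ H (e v) + ∑ i, X i * D i v) (K : ℕ)
    (h1 : ∀ j k, ∃ w, colOp a w = X j ^ K • (Pi.single k 1 : Fin p → H))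
    (h2 : ∀ m : Fin n → ℕ, (∀ i, m i < K) → ∀ k, ∃ x : (ι → ℂ) × (κ → H),
      presOp E a x = (∏ i, X i ^ m i) • (Pi.single k 1 : Fin p → H)) : HasRI E a := by
  classical
  have hdec : ∀ v : Fin p → H, v = ∑ k, v k • (Pi.single k 1 : Fin p → H) := by
    intro v
    conv_lhs => rw [← Finset.univ_sum_single v]
    refine Finset.sum_congr rfl fun k _ => ?_
    rw [← Pi.single_smul, smul_eq_mul, mul_one]
  let pr : Fin p → (Fin p → H) →L[ℂ] H := fun k =>
    .proj (R := ℂ) (φ := fun _ : Fin p => H) k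
  have big : ∀ m : Fin n → ℕ, (∃ j, K ≤ m j) →
      ∃ T : (Fin p → H) →L[ℂ] (ι → ℂ) × (κ → H),
        ∀ v, presOp E a (T v) = (∏ i, X i ^ m i) • v := by
    rintro m ⟨j, hj⟩
    choose w hw using h1 j
    obtain ⟨u, hu⟩ : ∃ u, ∏ i, X i ^ m i = u * X j ^ K := by
      rw [← Finset.mul_prod_erase _ _ (Finset.mem_univ j)]
      refine ⟨X j ^ (m j - K) * ∏ x ∈ Finset.univ.erase j, X x ^ m x, ?_⟩
      rw [mul_right_comm, ← pow_add, Nat.sub_add_cancel hj]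
    let S : Fin p → H →L[ℂ] (κ → H) := fun k =>
      ContinuousLinearMap.pi fun l => (ContinuousLinearMap.mul ℂ H (w k l * u))
    have hS : ∀ k v, S k v = v • u • w k := by
      intro k v
      funext l
      change w k l * u * v = v * (u * w k l)
      ring
    refine ⟨(ContinuousLinearMap.inr ℂ (ι → ℂ) (κ → H)).comp (∑ k, (S k).comp (pr k)),
      fun v => ?_⟩
    rw [ContinuousLinearMap.comp_apply, presOp_apply, ContinuousLinearMap.inr_apply, map_zero,
      zero_add, sum_apply, map_sum]
    conv_rhs => rw [hdec v, Finset.smul_sum]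
    refine Finset.sum_congr rfl fun k _ => ?_
    rw [ContinuousLinearMap.comp_apply, hS, ← smul_colOp, ← smul_colOp, hw, hu]
    simp only [smul_smul]
    congr 1
    change v k * (u * X j ^ K) = _
    ring
  have key : ∀ (N : ℕ) (m : Fin n → ℕ), n * K + 1 ≤ N + ∑ i, m i →
      ∃ T : (Fin p → H) →L[ℂ] (ι → ℂ) × (κ → H),
        ∀ v, presOp E a (T v) = (∏ i, X i ^ m i) • v := by
    intro N
    induction N with
    | zero =>
      intro m hm
      obtain ⟨j, hj⟩ : ∃ j, K ≤ m j := by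
        by_contra! hlt
        have : ∑ i, m i ≤ ∑ _i : Fin n, K := Finset.sum_le_sum fun i _ => (hlt i).le
        simp at this
        omega
      exact big m ⟨j, hj⟩
    | succ N ih =>
      intro m hm
      by_cases hK : ∃ j, K ≤ m j
      · exact big m hK
      · push Not at hK
        have hm' : ∀ i, n * K + 1 ≤ N + ∑ l, (m + Pi.single i 1 : Fin n → ℕ) l := by
          intro i
          simp only [Pi.add_apply, Finset.sum_add_distrib, Finset.sum_pi_single', Finset.mem_univ,
            if_true]
          omega
        choose T hT using fun i => ih _ (hm' i)
        choose x hx using h2 m hK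
        refine ⟨∑ k, (e.comp (pr k)).smulRight (x k) +
          ∑ i, (T i).comp (ContinuousLinearMap.pi fun k => (D i).comp (pr k)), fun v => ?_⟩
        have hv : v = ∑ k, e (v k) • (Pi.single k 1 : Fin p → H) +
            ∑ i, X i • fun k => D i (v k) := by
          conv_lhs => rw [hdec v]
          funext k
          rw [Finset.sum_apply, Pi.add_apply, Finset.sum_apply, Finset.sum_apply,
            Finset.sum_eq_single k, Finset.sum_eq_single k]
          · rw [Pi.smul_apply, Pi.smul_apply, Pi.single_eq_same, smul_eq_mul, mul_one,
              ← Algebra.algebraMap_eq_smul_one]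
            exact hD (v k)
          · intro b _ hb
            rw [Pi.smul_apply, Pi.single_eq_of_ne hb.symm, smul_zero]
          · simp
          · intro b _ hb
            rw [Pi.smul_apply, Pi.single_eq_of_ne hb.symm, smul_zero]
          · simp
        conv_rhs => rw [hv, smul_add, Finset.smul_sum, Finset.smul_sum]
        rw [add_apply, map_add, sum_apply, sum_apply, map_sum, map_sum]
        congr 1
        · refine Finset.sum_congr rfl fun k _ => ?_
          rw [ContinuousLinearMap.smulRight_apply, map_smul, hx]
          exact smul_comm _ _ _
        · refine Finset.sum_congr rfl fun i _ => ?_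
          rw [ContinuousLinearMap.comp_apply, hT, smul_smul]
          congr 1
          simp only [Pi.add_apply, pow_add, Finset.prod_mul_distrib]
          congr 1
          rw [Finset.prod_eq_single i]
          · simp
          · intro b _ hb
            simp [hb]
          · simp
  obtain ⟨T, hT⟩ := key (n * K + 1) 0 (by simp)
  exact ⟨T, ContinuousLinearMap.ext fun v => (hT v).trans (by simp)⟩

end Machine

/-! ### An upper bound for Fermat type modules -/

section FermatUpper

variable {Q V σ : Type*} [AddCommGroup Q] [Module ℂ Q] [AddCommGroup V] [Module ℂ V]
  [FiniteDimensional ℂ V] [DecidableEq σ]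

lemma sum_choose_succ (N p : ℕ) :
    ∑ k ∈ Finset.range (p + 1), (N + 1).choose k =
      ∑ k ∈ Finset.range (p + 1), N.choose k + ∑ k ∈ Finset.range p, N.choose k := by
  rw [Finset.sum_range_succ', Finset.sum_range_succ' (fun k => N.choose k)]
  simp only [Nat.choose_succ_succ', Finset.sum_add_distrib, Nat.choose_zero_right]
  ring

lemma exists_span_of_card_succ {W : Submodule ℂ V} {a : σ → V →ₗ[ℂ] ℂ} {c : σ → V}
    {J : Finset σ} (hW : Module.finrank ℂ W ≤ J.card + 1) (hc : ∀ j ∈ J, c j ∈ W)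
    (hND : ∀ x : σ → ℂ, (∀ j ∈ J, ∑ k ∈ J, x k * a j (c k) = 0) → ∀ k ∈ J, x k = 0) :
    (∀ j₀ ∈ J, ∃ v ∈ W, ∀ j ∈ J, a j v = if j = j₀ then 1 else 0) ∧
      ∃ v₀ ∈ W, (∀ j ∈ J, a j v₀ = 0) ∧
        ∀ v ∈ W, ∃ u ∈ Submodule.span ℂ (c '' J), ∃ s : ℂ, v = u + s • v₀ := by
  let L : (J → ℂ) →ₗ[ℂ] (J → ℂ) :=
    { toFun := fun x j => ∑ k, x k * a j (c k)
      map_add' := fun x y => funext fun j => by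
        simp [add_mul, Finset.sum_add_distrib]
      map_smul' := fun s x => funext fun j => by
        simp [Finset.mul_sum, mul_assoc] }
  have hL : Function.Injective L := by
    refine (injective_iff_map_eq_zero _).2 fun x hx => ?_
    have := hND (fun k => if h : k ∈ J then x ⟨k, h⟩ else 0) fun j hj => by
      have h1 : ∑ k : J, x k * a j (c k) = 0 := congrFun hx ⟨j, hj⟩
      rw [← h1, ← Finset.sum_coe_sort J]
      exact Finset.sum_congr rfl fun k _ => by simp
    funext k
    simpa using this k k.2
  have hLs : Function.Surjective L := LinearMap.injective_iff_surjective.1 hL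
  have hLa : ∀ (x : J → ℂ) (j : J), a j (∑ k, x k • c k) = L x j := fun x j => by
    rw [map_sum]
    exact Finset.sum_congr rfl fun k _ => by rw [map_smul, smul_eq_mul]
  have hcW : ∀ x : J → ℂ, ∑ k, x k • c k ∈ W := fun x =>
    W.sum_mem fun k _ => W.smul_mem _ (hc k k.2)
  refine ⟨fun j₀ hj₀ => ?_, ?_⟩
  · obtain ⟨x, hx⟩ := hLs (Pi.single ⟨j₀, hj₀⟩ 1)
    refine ⟨_, hcW x, fun j hj => ?_⟩
    rw [hLa x ⟨j, hj⟩, hx, Pi.single_apply]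
    simp
  · have hli : LinearIndependent ℂ fun k : J => c k := by
      rw [Fintype.linearIndependent_iff]
      intro x hx
      have : L x = 0 := funext fun j => by rw [← hLa, hx, map_zero]; rfl
      exact fun k => congrFun (hL (this.trans (map_zero L).symm)) k
    have hspan : Submodule.span ℂ (Set.range fun k : J => c k) =
        Submodule.span ℂ (c '' J) := by
      congr 1
      ext v
      simp
    have hfr : Module.finrank ℂ (Submodule.span ℂ (c '' J)) = J.card := by
      rw [← hspan, finrank_span_eq_card hli, Fintype.card_coe]
    let K : Submodule ℂ V := W ⊓ ⨅ j : J, LinearMap.ker (a j)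
    have hK : ∀ v, v ∈ K ↔ v ∈ W ∧ ∀ j ∈ J, a j v = 0 := fun v => by
      simp [K]
    have hSW : Submodule.span ℂ (c '' J) ≤ W := Submodule.span_le.2 (by
      rintro _ ⟨j, hj, rfl⟩
      exact hc j hj)
    have hdisj : Disjoint K (Submodule.span ℂ (c '' J)) := by
      rw [Submodule.disjoint_def]
      intro v hv1 hv2
      rw [← hspan, Submodule.mem_span_range_iff_exists_fun] at hv2
      obtain ⟨x, rfl⟩ := hv2
      have : L x = 0 := funext fun j => by rw [← hLa]; exact ((hK _).1 hv1).2 j j.2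
      rw [hL (this.trans (map_zero L).symm)]
      simp
    have hle : Module.finrank ℂ K ≤ 1 := by
      have h1 := Submodule.finrank_sup_add_finrank_inf_eq K (Submodule.span ℂ (c '' J))
      rw [hdisj.eq_bot, finrank_bot, hfr] at h1
      have h2 : Module.finrank ℂ (K ⊔ Submodule.span ℂ (c '' J) : Submodule ℂ V) ≤
          Module.finrank ℂ W := Submodule.finrank_mono (sup_le inf_le_left hSW)
      omega
    obtain ⟨v₀, hv₀⟩ := finrank_le_one_iff.1 hle
    refine ⟨v₀, ((hK _).1 v₀.2).1, ((hK _).1 v₀.2).2, fun v hv => ?_⟩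
    obtain ⟨x, hx⟩ := hLs fun j => a j v
    have hmem : v - ∑ k, x k • c k ∈ K := by
      refine (hK _).2 ⟨W.sub_mem hv (hcW x), fun j hj => ?_⟩
      rw [map_sub, hLa x ⟨j, hj⟩, hx, sub_self]
    obtain ⟨s, hs⟩ := hv₀ ⟨_, hmem⟩
    refine ⟨∑ k, x k • c k, ?_, s, ?_⟩
    · rw [← hspan]
      exact Submodule.mem_span_range_iff_exists_fun ℂ |>.2 ⟨x, rfl⟩
    · have := congrArg Subtype.val hs
      change s • (v₀ : V) = v - _ at this
      rw [this]
      abel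

lemma fermat_upper (w : σ → Module.End ℂ Q) (hw : ∀ i j, Commute (w i) (w j))
    (a : σ → V →ₗ[ℂ] ℂ) : ∀ (M p : ℕ) (J : Finset σ) (Z : Submodule ℂ Q) (ι : V →ₗ[ℂ] Q)
    (W : Submodule ℂ V) (c : σ → V), J.card + p = M → p ≤ J.card + 1 →
    (∀ m, ∀ z ∈ Z, w m z ∈ Z) → Module.finrank ℂ W ≤ p → (∀ j ∈ J, c j ∈ W) →
    (∀ j ∈ J, w j (ι (c j)) ∈ Z) →
    (∀ v ∈ W, ∀ v' ∈ W, ∑ j ∈ J, a j v • w j (ι v') - ∑ j ∈ J, a j v' • w j (ι v) ∈ Z) →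
    (∀ m, ∃ b : σ → ℂ, ∀ v ∈ W, w m (ι v) - ∑ j ∈ J, b j • w j (ι v) ∈ Z) →
    (∀ T ⊆ J, T.card ≤ p → ∀ x : σ → ℂ, (∀ j ∈ T, ∑ k ∈ T, x k * a j (c k) = 0) →
      ∀ k ∈ T, x k = 0) →
    ∃ s : Finset Q, s.card ≤ ∑ k ∈ Finset.range p, J.card.choose k ∧
      (∀ m, ∀ y ∈ Z ⊔ Submodule.span ℂ (s : Set Q), w m y ∈ Z ⊔ Submodule.span ℂ (s : Set Q)) ∧
      (∀ v ∈ W, ι v ∈ Z ⊔ Submodule.span ℂ (s : Set Q)) ∧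
      ∃ l : ℕ, ∀ m, ∀ y ∈ Z ⊔ Submodule.span ℂ (s : Set Q), (w m ^ l) y ∈ Z := by
  classical
  intro M
  induction M using Nat.strong_induction_on with
  | _ M ih =>
  intro p J Z ι W c hM hpJ hZ hWp hc h1 h2 h3 hND
  rcases p with _ | p
  · have hW : W = ⊥ := Submodule.finrank_eq_zero.1 (Nat.le_zero.1 hWp)
    refine ⟨∅, by simp, ?_, ?_, 0, ?_⟩
    · simpa using hZ
    · intro v hv
      rw [hW, Submodule.mem_bot] at hv
      rw [hv, map_zero]
      exact Submodule.zero_mem _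
    · simp
  rcases Nat.lt_or_ge J.card (p + 1) with hlt | hge
  · have hJ : J.card = p := by omega
    obtain ⟨hdual, v₀, hv₀W, hv₀, hdec⟩ :=
      exists_span_of_card_succ (a := a) (c := c) (J := J) (W := W) (by omega) hc
        (hND J subset_rfl (by omega))
    have hwJ : ∀ j ∈ J, w j (ι v₀) ∈ Z := by
      intro j hj
      obtain ⟨v, hv, hvj⟩ := hdual j hj
      have := h2 v hv v₀ hv₀W
      rw [Finset.sum_congr rfl fun k hk => by rw [hvj k hk],
        Finset.sum_congr (s₁ := J) (f := fun k => a k v₀ • w k (ι v)) rfl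
          (g := fun _ => 0) fun k hk => by rw [hv₀ k hk, zero_smul]] at this
      simpa [hj] using this
    have hwm : ∀ m, w m (ι v₀) ∈ Z := by
      intro m
      obtain ⟨b, hb⟩ := h3 m
      have := hb v₀ hv₀W
      have h4 : ∑ j ∈ J, b j • w j (ι v₀) ∈ Z :=
        Z.sum_mem fun j hj => Z.smul_mem _ (hwJ j hj)
      simpa using Z.add_mem this h4
    set Z' := Z ⊔ Submodule.span ℂ {ι v₀} with hZ'
    have hZZ' : Z ≤ Z' := le_sup_left
    have hZ'w : ∀ m, ∀ z ∈ Z', w m z ∈ Z := by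
      intro m z hz
      obtain ⟨z₁, hz₁, z₂, hz₂, rfl⟩ := Submodule.mem_sup.1 hz
      obtain ⟨t, rfl⟩ := Submodule.mem_span_singleton.1 hz₂
      rw [map_add, map_smul]
      exact Z.add_mem (hZ m _ hz₁) (Z.smul_mem _ (hwm m))
    have hW'W : Submodule.span ℂ (c '' J) ≤ W := Submodule.span_le.2 (by
      rintro _ ⟨j, hj, rfl⟩
      exact hc j hj)
    obtain ⟨s, hs, hs1, hs2, l, hl⟩ := ih (J.card + p) (by omega) p J Z' ι
      (Submodule.span ℂ (c '' J)) c rfl (by omega) (fun m z hz => hZZ' (hZ'w m z hz))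
      (by
        have := finrank_span_finset_le_card (R := ℂ) (J.image c)
        rw [Finset.coe_image] at this
        exact this.trans (Finset.card_image_le.trans hJ.le))
      (fun j hj => Submodule.subset_span ⟨j, hj, rfl⟩) (fun j hj => hZZ' (h1 j hj))
      (fun v hv v' hv' => hZZ' (h2 v (hW'W hv) v' (hW'W hv')))
      (fun m => (h3 m).imp fun b hb v hv => hZZ' (hb v (hW'W hv)))
      (fun T hT hTc => hND T hT (by omega))
    have hsp : Z ⊔ Submodule.span ℂ ((insert (ι v₀) s : Finset Q) : Set Q) =
        Z' ⊔ Submodule.span ℂ (s : Set Q) := by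
      rw [Finset.coe_insert, Submodule.span_insert, ← sup_assoc]
    refine ⟨insert (ι v₀) s, ?_, ?_, ?_, l + 1, ?_⟩
    · refine (Finset.card_insert_le _ _).trans ?_
      rw [Finset.sum_range_succ, hJ, Nat.choose_self]
      rw [hJ] at hs
      omega
    · rw [hsp]
      exact hs1
    · rw [hsp]
      intro v hv
      obtain ⟨u, hu, t, rfl⟩ := hdec v hv
      rw [map_add, map_smul]
      refine Submodule.add_mem _ (hs2 u hu) (Submodule.smul_mem _ _ (Submodule.mem_sup_left ?_))
      exact Submodule.mem_sup_right (Submodule.mem_span_singleton_self _)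
    · rw [hsp]
      intro m y hy
      rw [pow_succ', Module.End.mul_apply]
      exact hZ'w m _ (hl m y hy)
  · obtain ⟨n, hn⟩ : J.Nonempty := Finset.card_pos.1 (by omega)
    have hJ' : (J.erase n).card + 1 = J.card := Finset.card_erase_add_one hn
    have hsplit : ∀ (f : σ → Q), ∑ j ∈ J, f j = f n + ∑ j ∈ J.erase n, f j := fun f =>
      (Finset.add_sum_erase J f hn).symm
    have hann : a n (c n) ≠ 0 := by
      intro h0
      have := hND {n} (by simpa using hn) (by simp) (fun _ => 1) (by simp [h0]) n (by simp)
      simp at this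
    have hwι : ∀ i j v, w i (w j (ι v)) = w j (w i (ι v)) := fun i j v =>
      congrArg (fun S : Module.End ℂ Q => S (ι v)) (hw i j).eq
    have hsq : ∀ v ∈ W, w n (w n (ι v)) +
        ∑ j ∈ J.erase n, (a j (c n) / a n (c n)) • w j (w n (ι v)) ∈ Z := by
      intro v hv
      have h4 := hZ n _ (h2 (c n) (hc n hn) v hv)
      have h5 : w n (∑ j ∈ J, a j v • w j (ι (c n))) ∈ Z := by
        rw [map_sum]
        refine Z.sum_mem fun j _ => ?_
        rw [map_smul, hwι]
        exact Z.smul_mem _ (hZ _ _ (h1 n hn))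
      have h6 := Z.smul_mem (a n (c n))⁻¹ (Z.add_mem h4 h5)
      rw [map_sub, sub_add_cancel, hsplit, map_add, map_smul, smul_add, smul_smul,
        inv_mul_cancel₀ hann, one_smul, map_sum, Finset.smul_sum] at h6
      convert h6 using 3 with j _
      rw [map_smul, smul_smul, hwι, div_eq_inv_mul]
    let c' : σ → V := fun j => c j - (a n (c j) / a n (c n)) • c n
    let W' : Submodule ℂ V := W ⊓ LinearMap.ker (a n)
    have hW' : ∀ v ∈ W', v ∈ W ∧ a n v = 0 := fun v hv => by simpa [W'] using hv
    obtain ⟨s2, hs2, hs21, hs22, l2, hl2⟩ := ih ((J.erase n).card + p) (by omega) p (J.erase n) Z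
      ((w n).comp ι) W' c' rfl (by omega) hZ
      (by
        have : Module.finrank ℂ W' < Module.finrank ℂ W := by
          refine Submodule.finrank_lt_finrank_of_lt (lt_of_le_of_ne inf_le_left fun h => hann ?_)
          have := hc n hn
          rw [← h] at this
          exact (hW' _ this).2
        omega)
      (fun j hj => by
        refine Submodule.mem_inf.2 ⟨W.sub_mem (hc j (Finset.mem_of_mem_erase hj))
          (W.smul_mem _ (hc n hn)), ?_⟩
        rw [LinearMap.mem_ker, map_sub, map_smul, smul_eq_mul, div_mul_cancel₀ _ hann, sub_self])
      (fun j hj => by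
        change w j (w n (ι (c j - _))) ∈ Z
        rw [map_sub, map_smul, map_sub, map_sub, map_smul, map_smul]
        refine Z.sub_mem ?_ (Z.smul_mem _ (hZ _ _ (h1 n hn)))
        rw [hwι]
        exact hZ _ _ (h1 j (Finset.mem_of_mem_erase hj)))
      (fun v hv v' hv' => by
        have := hZ n _ (h2 v (hW' v hv).1 v' (hW' v' hv').1)
        rw [hsplit, hsplit, (hW' v hv).2, (hW' v' hv').2, zero_smul, zero_smul, zero_add, zero_add,
          map_sub, map_sum, map_sum] at this
        convert this using 3
        · rw [map_smul, hwι]; rfl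
        · rw [map_smul, hwι]; rfl)
      (fun m => by
        obtain ⟨b, hb⟩ := h3 m
        refine ⟨fun j => b j - b n * (a j (c n) / a n (c n)), fun v hv => ?_⟩
        have h4 := hZ n _ (hb v (hW' v hv).1)
        have h5 := Z.smul_mem (b n) (hsq v (hW' v hv).1)
        have h6 := Z.add_mem h4 h5
        convert h6 using 1
        rw [hsplit, map_sub, map_add, map_sum, smul_add, map_smul, Finset.smul_sum]
        simp only [sub_smul, Finset.sum_sub_distrib, map_smul, smul_smul, LinearMap.comp_apply,
          hwι n]
        abel)
      (fun T hT hTc x hx => by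
        have hnT : n ∉ T := fun h => by simpa using hT h
        have := hND (insert n T)
          (Finset.insert_subset hn (hT.trans (Finset.erase_subset _ _)))
          ((Finset.card_insert_le _ _).trans (by omega))
          (fun k => if k = n then -(∑ l ∈ T, x l * a n (c l)) / a n (c n) else x k) ?_
        · intro k hk
          have := this k (Finset.mem_insert_of_mem hk)
          rwa [if_neg] at this
          rintro rfl
          exact hnT hk
        · intro j hj
          have hsum : ∑ k ∈ T, (if k = n then (-(∑ l ∈ T, x l * a n (c l)) / a n (c n)) else x k) *
              a j (c k) = ∑ k ∈ T, x k * a j (c k) :=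
            Finset.sum_congr rfl fun k hk => by rw [if_neg (by rintro rfl; exact hnT hk)]
          rw [Finset.sum_insert hnT, if_pos rfl, hsum]
          rcases Finset.mem_insert.1 hj with rfl | hj
          · rw [div_mul_cancel₀ _ hann, neg_add_cancel]
          · rw [← hx j hj]
            simp only [c', map_sub, map_smul, smul_eq_mul, mul_sub, Finset.sum_sub_distrib]
            rw [neg_div, Finset.sum_div, neg_mul, Finset.sum_mul, sub_eq_neg_add]
            congr 2
            exact Finset.sum_congr rfl fun k _ => by ring)
    set Z2 := Z ⊔ Submodule.span ℂ (s2 : Set Q) with hZ2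
    have hZZ2 : Z ≤ Z2 := le_sup_left
    have hnW : ∀ v ∈ W, w n (ι v) ∈ Z2 := by
      intro v hv
      have h4 : v - (a n v / a n (c n)) • c n ∈ W' := by
        refine Submodule.mem_inf.2 ⟨W.sub_mem hv (W.smul_mem _ (hc n hn)), ?_⟩
        rw [LinearMap.mem_ker, map_sub, map_smul, smul_eq_mul, div_mul_cancel₀ _ hann, sub_self]
      have h5 := Z2.add_mem (hs22 _ h4) (Z2.smul_mem (a n v / a n (c n)) (hZZ2 (h1 n hn)))
      rw [LinearMap.comp_apply, map_sub, map_sub, map_smul, map_smul, sub_add_cancel] at h5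
      exact h5
    obtain ⟨s1, hs1, hs11, hs12, l1, hl1⟩ := ih ((J.erase n).card + (p + 1)) (by omega) (p + 1)
      (J.erase n) Z2 ι W c rfl (by omega) hs21 hWp
      (fun j hj => hc j (Finset.mem_of_mem_erase hj))
      (fun j hj => hZZ2 (h1 j (Finset.mem_of_mem_erase hj)))
      (fun v hv v' hv' => by
        have h4 := hZZ2 (h2 v hv v' hv')
        rw [hsplit, hsplit] at h4
        have h5 := Z2.sub_mem (Z2.smul_mem (a n v') (hnW v hv)) (Z2.smul_mem (a n v) (hnW v' hv'))
        convert Z2.add_mem h4 h5 using 1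
        abel)
      (fun m => by
        obtain ⟨b, hb⟩ := h3 m
        refine ⟨b, fun v hv => ?_⟩
        have h4 := hZZ2 (hb v hv)
        rw [hsplit] at h4
        convert Z2.add_mem h4 (Z2.smul_mem (b n) (hnW v hv)) using 1
        abel)
      (fun T hT => hND T (hT.trans (Finset.erase_subset _ _)))
    have hsp : Z ⊔ Submodule.span ℂ ((s1 ∪ s2 : Finset Q) : Set Q) =
        Z2 ⊔ Submodule.span ℂ (s1 : Set Q) := by
      rw [Finset.coe_union, Submodule.span_union, sup_comm (Submodule.span ℂ (s1 : Set Q)),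
        ← sup_assoc]
    refine ⟨s1 ∪ s2, ?_, ?_, ?_, l2 + l1, ?_⟩
    · refine (Finset.card_union_le _ _).trans ?_
      rw [← hJ', sum_choose_succ]
      exact Nat.add_le_add hs1 hs2
    · rw [hsp]
      exact hs11
    · rw [hsp]
      exact hs12
    · rw [hsp]
      intro m y hy
      rw [pow_add, Module.End.mul_apply]
      exact hl2 m _ (hl1 m y hy)

end FermatUpper

/-! ### Pairs of Fermat type -/

section Fermat

variable {n p : ℕ}

/-- Points on the rational normal curve. -/
def vcol (n p : ℕ) (j : Fin n) (k : Fin p) : ℂ := ((j : ℕ) : ℂ) ^ (k : ℕ)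

lemma vcol_indep {T : Finset (Fin n)} (hT : T.card ≤ p) {x : Fin n → ℂ}
    (h : ∀ l : Fin p, ∑ k ∈ T, x k * vcol n p k l = 0) : ∀ k ∈ T, x k = 0 := by
  intro k hk
  let q : Polynomial ℂ := ∏ j ∈ T.erase k, (Polynomial.X - Polynomial.C ((j : ℕ) : ℂ))
  have hq : q.natDegree < p := by
    rw [Polynomial.natDegree_finsetProd_X_sub_C_eq_card, Finset.card_erase_of_mem hk]
    have := Finset.card_pos.2 ⟨k, hk⟩
    omega
  have h1 : ∑ j ∈ T, x j * q.eval ((j : ℕ) : ℂ) = 0 := by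
    simp only [Polynomial.eval_eq_sum_range' hq, Finset.mul_sum]
    rw [Finset.sum_comm]
    refine Finset.sum_eq_zero fun l hl => ?_
    have := h ⟨l, Finset.mem_range.1 hl⟩
    rw [← mul_zero (q.coeff l), ← this, Finset.mul_sum]
    exact Finset.sum_congr rfl fun j _ => by simp only [vcol]; ring
  rw [Finset.sum_eq_single k] at h1
  · refine (mul_eq_zero.1 h1).resolve_right ?_
    rw [Polynomial.eval_prod]
    refine Finset.prod_ne_zero_iff.2 fun j hj => ?_
    simp only [Polynomial.eval_sub, Polynomial.eval_X, Polynomial.eval_C, sub_ne_zero]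
    intro h2
    exact (Finset.mem_erase.1 hj).1 (Fin.ext (Nat.cast_injective h2.symm))
  · intro j hj hjk
    rw [Polynomial.eval_prod, Finset.prod_eq_zero (Finset.mem_erase.2 ⟨hjk, hj⟩), mul_zero]
    simp
  · exact fun h2 => absurd hk h2

lemma vcol_gram {T : Finset (Fin n)} (hT : T.card ≤ p) {x : Fin n → ℂ}
    (h : ∀ j ∈ T, ∑ k ∈ T, x k * ∑ l, vcol n p j l * vcol n p k l = 0) :
    ∀ k ∈ T, x k = 0 := by
  refine vcol_indep hT ?_
  obtain ⟨v, hv⟩ : ∃ v : Fin p → ℂ, ∀ l, ∑ k ∈ T, x k * vcol n p k l = v l :=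
    ⟨_, fun _ => rfl⟩
  simp only [hv]
  have h1 : ∀ j ∈ T, ∑ l, vcol n p j l * v l = 0 := by
    intro j hj
    rw [← h j hj]
    simp only [← hv, Finset.mul_sum]
    rw [Finset.sum_comm]
    exact Finset.sum_congr rfl fun k _ => Finset.sum_congr rfl fun l _ => by ring
  have h2 : ∑ l, star (v l) * v l = 0 := by
    have : ∀ l, star (v l) = ∑ k ∈ T, star (x k) * vcol n p k l := by
      intro l
      rw [← hv, star_sum]
      exact Finset.sum_congr rfl fun k _ => by simp [vcol]
    simp only [this, Finset.sum_mul]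
    rw [Finset.sum_comm]
    refine Finset.sum_eq_zero fun k hk => ?_
    rw [← mul_zero (star (x k)), ← h1 k hk, Finset.mul_sum]
    exact Finset.sum_congr rfl fun l _ => by ring
  intro l
  have h3 : ∑ l, (Complex.normSq (v l) : ℂ) = 0 := by
    rw [← h2]
    exact Finset.sum_congr rfl fun l _ => Complex.normSq_eq_conj_mul_self
  have h4 : ∑ l, Complex.normSq (v l) = 0 := by exact_mod_cast h3
  exact Complex.normSq_eq_zero.1
    ((Finset.sum_eq_zero_iff_of_nonneg fun l _ => Complex.normSq_nonneg _).1 h4 l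
      (Finset.mem_univ l))

variable {H : Type*} [NormedCommRing H] [NormedAlgebra ℂ H]

/-- The pair of Fermat type built from elements `x j`. -/
def fermatPair (p : ℕ) (x : Fin n → H) : PairSp n p H :=
  (fun j k => vcol n p j k • x j, fun k => ∑ j, vcol n p j k • x j)

/-- Weights times a monomial. -/
def monoMap (u : H) : (Fin p → ℂ) →ₗ[ℂ] (Fin p → H) where
  toFun v k := v k • u
  map_add' v v' := funext fun k => add_smul _ _ _
  map_smul' c v := funext fun k => by simp [smul_smul]

lemma exists_hasRI_fermat (X : Fin n → H) (e : H →L[ℂ] ℂ)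
    (D : Fin n → H →L[ℂ] H) (hD : ∀ v, v = algebraMap ℂ H (e v) + ∑ i, X i * D i v)
    (K : ℕ) (hK : 0 < K) (hpn : p ≤ n + 1) :
    ∃ (N : ℕ) (E : Fin N → Fin p → H),
      N ≤ K ^ n * ∑ k ∈ Finset.range p, n.choose k ∧
      HasRI E (pairCols (fermatPair p fun j => X j ^ K)) := by
  classical
  set a := pairCols (fermatPair p fun j => X j ^ K) with ha
  let Z : Submodule ℂ (Fin p → H) := LinearMap.range (colOp a).toLinearMap
  have hZsmul : ∀ (u : H), ∀ z ∈ Z, u • z ∈ Z := by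
    rintro u _ ⟨w, rfl⟩
    exact ⟨u • w, (smul_colOp a u w).symm⟩
  have hcol : ∀ i, a i ∈ Z := fun i => ⟨Pi.single i 1, by
    rw [ContinuousLinearMap.coe_coe, colOp_apply, Finset.sum_eq_single i]
    · rw [Pi.single_eq_same, one_smul]
    · intro b _ hb
      rw [Pi.single_eq_of_ne hb, zero_smul]
    · simp⟩
  let w : Fin n → Module.End ℂ (Fin p → H) := fun j => (mulOp (X j ^ K)).toLinearMap
  have hw : ∀ j v, w j v = X j ^ K • v := fun j v => rfl
  have hwpow : ∀ j l v, (w j ^ l) v = X j ^ (K * l) • v := by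
    intro j l
    induction l with
    | zero => simp
    | succ l ih =>
      intro v
      rw [pow_succ, Module.End.mul_apply, ih, hw, smul_smul, ← pow_add]
      rfl
  let al : Fin n → (Fin p → ℂ) →ₗ[ℂ] ℂ := fun j =>
    ∑ l, vcol n p j l • LinearMap.proj l
  have hal : ∀ j v, al j v = ∑ l, vcol n p j l * v l := by
    intro j v
    simp [al]
  have main : ∀ u : H, ∃ s : Finset (Fin p → H), s.card ≤ ∑ k ∈ Finset.range p, n.choose k ∧
      (∀ k, u • (Pi.single k 1 : Fin p → H) ∈ Z ⊔ Submodule.span ℂ (s : Set (Fin p → H))) ∧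
      (∀ m, ∀ y ∈ Z ⊔ Submodule.span ℂ (s : Set (Fin p → H)),
        X m ^ K • y ∈ Z ⊔ Submodule.span ℂ (s : Set (Fin p → H))) ∧
      ∃ l : ℕ, ∀ j k, X j ^ (K * l) • u • (Pi.single k 1 : Fin p → H) ∈ Z := by
    intro u
    have hι : ∀ k, monoMap u (Pi.single k 1) = u • (Pi.single k 1 : Fin p → H) := by
      intro k
      funext i
      change (Pi.single k 1 : Fin p → ℂ) i • u = u * (Pi.single k 1 : Fin p → H) i
      by_cases hik : i = k
      · subst hik; simp
      · simp [hik]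
    obtain ⟨s, hs, hs1, hs2, l, hl⟩ := fermat_upper w
      (fun i j => by
        refine LinearMap.ext fun v => ?_
        change X i ^ K • X j ^ K • v = X j ^ K • X i ^ K • v
        rw [smul_comm]) al (n + p) p Finset.univ Z (monoMap u) ⊤ (vcol n p) (by simp) (by simpa)
      (fun m z hz => hZsmul _ z hz) (by simp) (by simp)
      (fun j _ => by
        convert hZsmul u _ (hcol (.inl j)) using 1
        funext k
        change X j ^ K * (vcol n p j k • u) = u * (vcol n p j k • X j ^ K)
        rw [mul_smul_comm, mul_smul_comm, mul_comm])
      (fun v _ v' _ => by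
        have hh : ∀ v v' : Fin p → ℂ, ∑ j, al j v • w j (monoMap u v') =
            u • ∑ l, ∑ k, (v l * v' k) • (Pi.single k ((fermatPair p fun j => X j ^ K).2 l) :
              Fin p → H) := by
          intro v v'
          funext i
          simp only [Finset.sum_apply, Pi.smul_apply, hw, hal, smul_eq_mul]
          have : ∀ l, ∑ k, (v l * v' k) • (Pi.single k ((fermatPair p fun j => X j ^ K).2 l) :
              Fin p → H) i = (v l * v' i) • (fermatPair p fun j => X j ^ K).2 l := by
            intro l
            rw [Finset.sum_eq_single i]
            · simp
            · intro b _ hb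
              simp [Pi.single_eq_of_ne hb.symm]
            · simp
          simp only [this]
          simp only [fermatPair, monoMap, LinearMap.coe_mk, AddHom.coe_mk, Finset.smul_sum,
            Finset.mul_sum, Finset.sum_smul, smul_smul]
          rw [Finset.sum_comm]
          refine Finset.sum_congr rfl fun l _ => Finset.sum_congr rfl fun j _ => ?_
          rw [mul_smul_comm, mul_smul_comm, smul_smul, mul_comm u]
          congr 1
          ring
        rw [hh, hh, ← smul_sub]
        refine hZsmul u _ ?_
        have hsw : ∑ l, ∑ k, (v' l * v k) • (Pi.single k ((fermatPair p fun j => X j ^ K).2 l) :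
              Fin p → H) = ∑ l, ∑ k, (v l * v' k) •
              (Pi.single l ((fermatPair p fun j => X j ^ K).2 k) : Fin p → H) := by
          rw [Finset.sum_comm]
          exact Finset.sum_congr rfl fun k _ => Finset.sum_congr rfl fun l _ => by
            rw [mul_comm]
        rw [hsw, ← Finset.sum_sub_distrib]
        refine Z.sum_mem fun l _ => ?_
        rw [← Finset.sum_sub_distrib]
        refine Z.sum_mem fun k _ => ?_
        rw [← smul_sub]
        exact Z.smul_mem _ (hcol (.inr (l, k))))
      (fun m => ⟨Pi.single m 1, fun v _ => by
        rw [Finset.sum_eq_single m]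
        · simp
        · intro b _ hb
          rw [Pi.single_eq_of_ne hb, zero_smul]
        · simp⟩)
      (fun T _ hT x hx => vcol_gram hT (by simpa only [hal] using hx))
    refine ⟨s, by simpa using hs, fun k => ?_, hs1, l, fun j k => ?_⟩
    · rw [← hι]
      exact hs2 _ trivial
    · rw [← hι, ← hwpow]
      exact hl j _ (hs2 _ trivial)
  choose s hs1 hs2 hs3 l hl using main
  let mono : (Fin n → Fin K) → H := fun m => ∏ i, X i ^ (m i : ℕ)
  let S : Finset (Fin p → H) := Finset.univ.biUnion fun m => s (mono m)
  refine ⟨S.card, fun i => S.equivFin.symm i, ?_, ?_⟩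
  · refine (Finset.card_biUnion_le_card_mul _ _ _ fun m _ => hs1 (mono m)).trans ?_
    simp
  · refine hasRI_of_monomials X e D hD (max (K * l 1) K) ?_ ?_
    · intro j k
      have h1 := hl 1 j k
      rw [one_smul] at h1
      have h2 := hZsmul (X j ^ (max (K * l 1) K - K * l 1)) _ h1
      rw [smul_smul, ← pow_add, Nat.sub_add_cancel (le_max_left _ _)] at h2
      exact h2
    · intro m _ k
      let r : Fin n → Fin K := fun i => ⟨m i % K, Nat.mod_lt _ hK⟩
      have h1 : ∀ t : Finset (Fin n), (∏ i ∈ t, X i ^ (K * (m i / K))) • mono r •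
          (Pi.single k 1 : Fin p → H) ∈ Z ⊔ Submodule.span ℂ (s (mono r) : Set (Fin p → H)) := by
        intro t
        induction t using Finset.induction_on with
        | empty => simpa using hs2 (mono r) k
        | insert i t hi ih =>
          rw [Finset.prod_insert hi, mul_smul, pow_mul]
          generalize m i / K = b
          induction b with
          | zero => simpa using ih
          | succ b ihb =>
            rw [pow_succ', mul_smul]
            exact hs3 _ _ _ ihb
      have h2 := h1 Finset.univ
      have h3 : (∏ i, X i ^ (K * (m i / K))) • mono r • (Pi.single k 1 : Fin p → H) =
          (∏ i, X i ^ m i) • (Pi.single k 1 : Fin p → H) := by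
        rw [smul_smul, ← Finset.prod_mul_distrib]
        congr 1
        refine Finset.prod_congr rfl fun i _ => ?_
        rw [← pow_add, Nat.div_add_mod]
      rw [h3] at h2
      obtain ⟨_, ⟨y, rfl⟩, v, hv, hyv⟩ := Submodule.mem_sup.1 h2
      have hv' : v ∈ Submodule.span ℂ
          (Set.range fun i => ((S.equivFin.symm i : S) : Fin p → H)) := by
        refine Submodule.span_mono (fun x hx => ?_) hv
        refine ⟨S.equivFin ⟨x, Finset.mem_biUnion.2 ⟨r, Finset.mem_univ _, hx⟩⟩, by simp⟩
      obtain ⟨c, rfl⟩ := (Submodule.mem_span_range_iff_exists_fun ℂ).1 hv'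
      refine ⟨(c, y), ?_⟩
      rw [← hyv, presOp_apply, frameOp_apply, add_comm]
      rfl

end Fermat

/-! ### Persistence of nondegenerate cokernel points -/

section Persist

open PolydiscAlg

variable {n p : ℕ} {r : ℝ}

/-- The vector `M h` of a pair `(M, h)`. -/
def pairVec {H : Type*} [NormedCommRing H] (l : PairSp n p H) (j : Fin n) : H :=
  ∑ i, l.2 i * l.1 j i

lemma analyticAt_pairVec {H : Type*} [NormedCommRing H] [NormedAlgebra ℂ H] (l : PairSp n p H)
    (j : Fin n) : AnalyticAt ℂ (fun l : PairSp n p H => pairVec l j) l := by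
  refine Finset.analyticAt_fun_sum _ fun i _ => ?_
  have h1 := ContinuousLinearMap.analyticAt (𝕜 := ℂ) (E := PairSp n p H) (F := H)
    ((ContinuousLinearMap.proj (R := ℂ) (φ := fun _ : Fin p => H) i).comp
      (.snd ℂ (Fin n → Fin p → H) (Fin p → H))) l
  have h2 := ContinuousLinearMap.analyticAt (𝕜 := ℂ) (E := PairSp n p H) (F := H)
    ((ContinuousLinearMap.proj (R := ℂ) (φ := fun _ : Fin p => H) i).comp
      ((ContinuousLinearMap.proj (R := ℂ) (φ := fun _ : Fin n => Fin p → H) j).comp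
      (.fst ℂ (Fin n → Fin p → H) (Fin p → H)))) l
  exact h1.mul h2

lemma mem_cokerPts_of_pairVec {l : PairSp n p (PolydiscAlg n r)} {x : Cn n}
    (hx : x ∈ Metric.closedBall (0 : Cn n) r) (hh : (fun i => ev x (l.2 i)) ≠ (0 : Fin p → ℂ))
    (hz : ∀ j, ev x (pairVec l j) = 0) : x ∈ cokerPts (pairCols l) := by
  refine ⟨hx, _, hh, ?_⟩
  rw [← evFun_mem_ann hx, evFun_mem_ann_pairCols hx]
  refine ⟨fun j => ?_, fun i k => mul_comm _ _⟩
  rw [← hz j, pairVec, map_sum]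
  exact Finset.sum_congr rfl fun i _ => (ev_mul hx _ _).symm

lemma eventually_exists_cokerPts {l : PairSp n p (PolydiscAlg n r)} {x : Cn n}
    (hx : x ∈ Metric.ball (0 : Cn n) r) (hh : (fun i => ev x (l.2 i)) ≠ (0 : Fin p → ℂ))
    (hz : ∀ j, ev x (pairVec l j) = 0)
    (hnd : ∀ d, (∀ j, dev x d (pairVec l j) = 0) → d = 0) {O : Set (Cn n)} (hO : O ∈ 𝓝 x) :
    ∀ᶠ l' in 𝓝 l, ∃ y ∈ O, y ∈ cokerPts (pairCols l') := by
  let L := PairSp n p (PolydiscAlg n r)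
  let Φ₂ : L × Cn n → Cn n := fun q j => ev q.2 (pairVec q.1 j)
  have hΦ₂ : AnalyticAt ℂ Φ₂ (l, x) := by
    refine analyticAt_pi_iff.2 fun j => ?_
    have h1 : AnalyticAt ℂ (fun q : L × Cn n => (ev q.2 : PolydiscAlg n r →L[ℂ] ℂ)) (l, x) :=
      AnalyticAt.comp (g := fun y => (ev y : PolydiscAlg n r →L[ℂ] ℂ)) (f := Prod.snd)
        (analyticAt_ev hx) analyticAt_snd
    have h2 : AnalyticAt ℂ (fun q : L × Cn n => pairVec q.1 j) (l, x) :=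
      AnalyticAt.comp (g := fun l => pairVec l j) (f := Prod.fst)
        (analyticAt_pairVec l j) analyticAt_fst
    exact ((ContinuousLinearMap.id ℂ (PolydiscAlg n r →L[ℂ] ℂ)).analyticAt_bilinear
      (ev x, pairVec l j)).comp₂ h1 h2
  let Φ : L × Cn n → L × Cn n := fun q => (q.1, Φ₂ q)
  have hΦ : HasStrictFDerivAt Φ ((ContinuousLinearMap.fst ℂ L (Cn n)).prod
      (fderiv ℂ Φ₂ (l, x))) (l, x) :=
    hasStrictFDerivAt_fst.prodMk hΦ₂.hasStrictFDerivAt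
  have hder : ∀ d j, fderiv ℂ Φ₂ (l, x) (0, d) j = dev x d (pairVec l j) := by
    intro d j
    have h1 : HasFDerivAt (fun y : Cn n => Φ₂ (l, y))
        ((fderiv ℂ Φ₂ (l, x)).comp (.inr ℂ L (Cn n))) x :=
      HasFDerivAt.comp x hΦ₂.differentiableAt.hasFDerivAt (hasFDerivAt_prodMk_right l x)
    have h2 := (hasFDerivAt_pi'.1 h1 j).fderiv
    rw [dev]
    change _ = fderiv ℂ (fun y => Φ₂ (l, y) j) x d
    rw [h2]
    rfl
  have hinj : Function.Injective
      ((fderiv ℂ Φ₂ (l, x)).comp (.inr ℂ L (Cn n))).toLinearMap := by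
    refine (injective_iff_map_eq_zero _).2 fun d hd => hnd d fun j => ?_
    rw [← hder]
    exact congrFun hd j
  have hsurj := LinearMap.injective_iff_surjective.1 hinj
  have hrange : ((ContinuousLinearMap.fst ℂ L (Cn n)).prod (fderiv ℂ Φ₂ (l, x))).range = ⊤ := by
    refine LinearMap.range_eq_top.2 fun ⟨l', w⟩ => ?_
    obtain ⟨d, hd⟩ := hsurj (w - fderiv ℂ Φ₂ (l, x) (l', 0))
    refine ⟨(l', d), Prod.ext rfl ?_⟩
    change fderiv ℂ Φ₂ (l, x) (l', d) = w
    have hd' : fderiv ℂ Φ₂ (l, x) (0, d) = w - fderiv ℂ Φ₂ (l, x) (l', 0) := hd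
    have : ((l', d) : L × Cn n) = (l', 0) + (0, d) := by simp
    rw [this, map_add, hd', add_sub_cancel]
  have hmap := hΦ.map_nhds_eq_of_surj hrange
  have hzero : Φ (l, x) = (l, 0) := Prod.ext rfl (funext hz)
  rw [hzero] at hmap
  have hhc : ∀ᶠ q : L × Cn n in 𝓝 (l, x), (fun i => ev q.2 (q.1.2 i)) ≠ (0 : Fin p → ℂ) := by
    have h1 : ContinuousAt (fun q : L × Cn n => fun i => ev q.2 (q.1.2 i)) (l, x) := by
      refine continuousAt_pi.2 fun i => ?_
      refine tendsto_ev ?_ (continuous_snd.continuousAt) ?_ (Metric.ball_subset_closedBall hx)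
      · exact ((continuous_apply i).comp (continuous_snd.comp continuous_fst)).continuousAt
      · have : ∀ᶠ q : L × Cn n in 𝓝 (l, x), q.2 ∈ Metric.ball (0 : Cn n) r :=
          continuous_snd.continuousAt.eventually (Metric.isOpen_ball.mem_nhds hx)
        exact this.mono fun q hq => Metric.ball_subset_closedBall hq
    exact h1.eventually_ne hh
  have hOc : ∀ᶠ q : L × Cn n in 𝓝 (l, x), q.2 ∈ O ∩ Metric.ball 0 r :=
    continuous_snd.continuousAt.eventually
      (inter_mem hO (Metric.isOpen_ball.mem_nhds hx))
  have h1 : Φ '' {q | (fun i => ev q.2 (q.1.2 i)) ≠ (0 : Fin p → ℂ) ∧ q.2 ∈ O ∩ Metric.ball 0 r}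
      ∈ 𝓝 ((l, 0) : L × Cn n) := by
    rw [← hmap]
    exact image_mem_map (hhc.and hOc)
  have h2 : ContinuousAt (fun l' : L => ((l', 0) : L × Cn n)) l :=
    (Continuous.prodMk_left (0 : Cn n)).continuousAt
  filter_upwards [h2.eventually h1] with l' hl'
  obtain ⟨⟨l'', y⟩, ⟨hy1, hy2, hy3⟩, hy4⟩ := hl'
  obtain rfl : l'' = l' := congrArg Prod.fst hy4
  exact ⟨y, hy2, mem_cokerPts_of_pairVec (Metric.ball_subset_closedBall hy3) hy1
    fun j => congrFun (congrArg Prod.snd hy4) j⟩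

lemma eventually_exists_finset_cokerPts {l : PairSp n p (PolydiscAlg n r)} (S : Finset (Cn n))
    (hS : ∀ x ∈ S, x ∈ Metric.ball (0 : Cn n) r ∧
      (fun i => ev x (l.2 i)) ≠ (0 : Fin p → ℂ) ∧ (∀ j, ev x (pairVec l j) = 0) ∧
      ∀ d, (∀ j, dev x d (pairVec l j) = 0) → d = 0) :
    ∀ᶠ l' in 𝓝 l, ∃ S' : Finset (Cn n), S'.card = S.card ∧ ↑S' ⊆ cokerPts (pairCols l') := by
  classical
  obtain ⟨U, hU, hdis⟩ := S.finite_toSet.t2_separation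
  have h1 : ∀ᶠ l' in 𝓝 l, ∀ x ∈ S, ∃ y ∈ U x, y ∈ cokerPts (pairCols l') := by
    rw [Filter.eventually_all_finset]
    intro x hx
    obtain ⟨h1, h2, h3, h4⟩ := hS x hx
    exact eventually_exists_cokerPts h1 h2 h3 h4 ((hU x).2.mem_nhds (hU x).1)
  filter_upwards [h1] with l' hl'
  choose! y hy1 hy2 using hl'
  refine ⟨S.image y, Finset.card_image_of_injOn fun x hx x' hx' hxx' => ?_, ?_⟩
  · by_contra hne
    refine Set.disjoint_left.1 (hdis hx hx' hne) (hy1 x hx) ?_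
    rw [hxx']
    exact hy1 x' hx'
  · intro z hz
    obtain ⟨x, hx, rfl⟩ := Finset.mem_image.1 (Finset.mem_coe.1 hz)
    exact hy2 x hx

lemma card_le_finrank_ann {ι κ : Type*} [Fintype ι] [Fintype κ] (hr : 0 ≤ r)
    {E : ι → Fin p → PolydiscAlg n r} {a : κ → Fin p → PolydiscAlg n r} (h : HasRI E a)
    {S : Finset (Cn n)} (hS : ↑S ⊆ cokerPts a) : S.card ≤ Module.finrank ℂ (AnnSp a) := by
  rw [← sum_mult hr h, Finset.card_eq_sum_ones]
  refine (Finset.sum_le_sum_of_subset (f := fun _ => 1) (t := (finite_cokerPts hr h).toFinset)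
    fun x hx => by simpa using hS hx).trans
    (Finset.sum_le_sum fun x hx => mult_pos hr h (by simpa using hx))

end Persist

/-! ### Generic perturbations of Fermat pairs -/

section FermatGeneric

variable {n p : ℕ}

/-- The pairing of a vector with a point of the rational normal curve. -/
def vpair (n p : ℕ) (j : Fin n) : (Fin p → ℂ) →ₗ[ℂ] ℂ := ∑ l, vcol n p j l • LinearMap.proj l

lemma vpair_apply (j : Fin n) (v : Fin p → ℂ) : vpair n p j v = ∑ l, vcol n p j l * v l := by
  simp [vpair]

/-- Linear combinations of points of the rational normal curve. -/
def vcomb (n p : ℕ) : (Fin n → ℂ) →ₗ[ℂ] (Fin p → ℂ) :=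
  ∑ j, (LinearMap.proj j : (Fin n → ℂ) →ₗ[ℂ] ℂ).smulRight (vcol n p j)

lemma vcomb_apply (w : Fin n → ℂ) (l : Fin p) : vcomb n p w l = ∑ j, w j * vcol n p j l := by
  simp [vcomb]

open Classical in
/-- The system selecting coordinates off `T` and pairings on `T`. -/
def vsys (n p : ℕ) (T : Finset (Fin n)) : (Fin n → ℂ) →ₗ[ℂ] (Fin n → ℂ) :=
  LinearMap.pi fun j => if j ∈ T then (vpair n p j).comp (vcomb n p) else LinearMap.proj j

lemma vsys_of_mem {T : Finset (Fin n)} {j : Fin n} (hj : j ∈ T) (w : Fin n → ℂ) :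
    vsys n p T w j = vpair n p j (vcomb n p w) := by
  simp [vsys, hj]

lemma vsys_of_notMem {T : Finset (Fin n)} {j : Fin n} (hj : j ∉ T) (w : Fin n → ℂ) :
    vsys n p T w j = w j := by
  simp [vsys, hj]

lemma vsys_injective {T : Finset (Fin n)} (hT : T.card ≤ p) :
    Function.Injective (vsys n p T) := by
  refine (injective_iff_map_eq_zero _).2 fun w hw => ?_
  have h1 : ∀ j ∉ T, w j = 0 := fun j hj => by
    rw [← vsys_of_notMem (p := p) hj w, hw]
    rfl
  have h2 := vcol_gram hT (x := w) fun j hj => by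
    have h3 := vsys_of_mem (p := p) hj w
    rw [hw, vpair_apply] at h3
    simp only [vcomb_apply, Finset.mul_sum, Pi.zero_apply] at h3
    rw [h3, Finset.sum_comm]
    refine Finset.sum_subset_zero_on_sdiff (Finset.subset_univ T) ?_ ?_
    · intro k hk
      refine Finset.sum_eq_zero fun l _ => ?_
      rw [h1 k (by simpa using hk)]
      ring
    · intro k _
      rw [Finset.mul_sum]
      exact Finset.sum_congr rfl fun l _ => by ring
  funext j
  by_cases hj : j ∈ T
  · exact h2 j hj
  · exact h1 j hj

/-- `w` solves the perturbed Fermat system with parameters `(μ, u)` on the stratum `T` without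
degenerating. -/
structure FermatSol (T : Finset (Fin n)) (μ : Fin n → ℂ) (u : Fin p → ℂ) (w : Fin n → ℂ) :
    Prop where
  eq_of_notMem : ∀ j ∉ T, w j = μ j
  pair_eq_zero : ∀ j ∈ T, vpair n p j (vcomb n p w - u) = 0
  ne_zero : ∀ j, w j ≠ 0
  ne_of_mem : ∀ j ∈ T, w j ≠ μ j
  pair_ne_zero : ∀ j ∉ T, vpair n p j (vcomb n p w - u) ≠ 0

lemma FermatSol.smul {T : Finset (Fin n)} {μ : Fin n → ℂ} {u : Fin p → ℂ} {w : Fin n → ℂ}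
    (h : FermatSol T μ u w) {s : ℂ} (hs : s ≠ 0) : FermatSol T (s • μ) (s • u) (s • w) where
  eq_of_notMem j hj := by simp [h.eq_of_notMem j hj]
  pair_eq_zero j hj := by
    rw [map_smul, ← smul_sub, map_smul, h.pair_eq_zero j hj, smul_zero]
  ne_zero j := by simp [hs, h.ne_zero j]
  ne_of_mem j hj := by simp [hs, h.ne_of_mem j hj]
  pair_ne_zero j hj := by
    rw [map_smul, ← smul_sub, map_smul]
    exact smul_ne_zero hs (h.pair_ne_zero j hj)

lemma exists_fermatSol (n p : ℕ) : ∃ (μ : Fin n → ℂ) (u : Fin p → ℂ),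
    ∀ T : Finset (Fin n), T.card < p → ∃ w, FermatSol T μ u w := by
  classical
  let R : Finset (Fin n) → (Fin n → ℂ) × (Fin p → ℂ) →ₗ[ℂ] (Fin n → ℂ) := fun T => LinearMap.pi fun j =>
    if j ∈ T then (vpair n p j).comp (.snd ℂ _ _) else (LinearMap.proj j).comp (.fst ℂ _ _)
  have hR1 : ∀ T j v, j ∈ T → R T v j = vpair n p j v.2 := fun T j v hj => by simp [R, hj]
  have hR2 : ∀ T j v, j ∉ T → R T v j = v.1 j := fun T j v hj => by simp [R, hj]
  have hsol : ∀ T : {T : Finset (Fin n) // T.card < p}, ∃ S : (Fin n → ℂ) × (Fin p → ℂ) →ₗ[ℂ] (Fin n → ℂ),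
      ∀ v, vsys n p T (S v) = R T v := by
    rintro ⟨T, hT⟩
    let e := LinearEquiv.ofInjectiveEndo (vsys n p T) (vsys_injective hT.le)
    refine ⟨e.symm.toLinearMap.comp (R T), fun v => ?_⟩
    exact e.apply_symm_apply (R T v)
  choose S hS using hsol
  have huniq : ∀ (T : {T : Finset (Fin n) // T.card < p}) v w, vsys n p T w = R T v →
      S T v = w := fun T v w h => vsys_injective T.2.le ((hS T v).trans h.symm)
  let f : {T : Finset (Fin n) // T.card < p} × Fin n × Bool → Module.Dual ℂ ((Fin n → ℂ) × (Fin p → ℂ)) := fun q =>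
    if q.2.2 then (LinearMap.proj q.2.1).comp (S q.1) else
      if q.2.1 ∈ q.1.1 then (LinearMap.proj q.2.1).comp (S q.1 - .fst ℂ _ _)
      else (vpair n p q.2.1).comp ((vcomb n p).comp (S q.1) - .snd ℂ _ _)
  have hex : ∀ q, ∃ v, f q v ≠ 0 := by
    rintro ⟨T, j, b⟩
    have key : ∀ ν : Fin n → ℂ, (∀ k ∉ T.1, ν k = 1) →
        S T (ν, vcomb n p 1) = 1 := by
      intro ν hν
      refine huniq _ _ _ (funext fun k => ?_)
      by_cases hk : k ∈ T.1
      · rw [vsys_of_mem hk, hR1 _ _ _ hk]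
      · rw [vsys_of_notMem hk, hR2 _ _ _ hk]
        exact (hν k hk).symm
    cases b
    · by_cases hj : j ∈ T.1
      · refine ⟨(fun k => if k ∈ T.1 then 0 else 1, vcomb n p 1), ?_⟩
        simp only [f, hj, if_true, Bool.false_eq_true, if_false, LinearMap.comp_apply,
          LinearMap.sub_apply]
        rw [key _ fun k hk => by simp [hk]]
        simp [hj]
      · have hc : (insert j T.1).card ≤ p := (Finset.card_insert_le _ _).trans T.2
        obtain ⟨w, hw⟩ := LinearMap.injective_iff_surjective.1 (vsys_injective hc) (Pi.single j 1)
        have h0 : S T (0, vcomb n p w) = 0 := by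
          refine huniq _ _ _ (funext fun k => ?_)
          by_cases hk : k ∈ T.1
          · rw [hR1 _ _ _ hk, map_zero]
            have h1 := vsys_of_mem (p := p) (Finset.mem_insert_of_mem hk : k ∈ insert j T.1) w
            rw [hw, Pi.single_eq_of_ne (by rintro rfl; exact hj hk)] at h1
            exact h1
          · rw [hR2 _ _ _ hk, map_zero]
        refine ⟨(0, vcomb n p w), ?_⟩
        simp only [f, hj, Bool.false_eq_true, if_false, LinearMap.comp_apply,
          LinearMap.sub_apply, h0, map_zero, LinearMap.snd_apply, zero_sub, map_neg]
        have h1 := vsys_of_mem (p := p) (Finset.mem_insert_self j T.1) w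
        rw [hw, Pi.single_eq_same] at h1
        rw [← h1]
        simp
    · refine ⟨(1, vcomb n p 1), ?_⟩
      simp only [f, if_true, LinearMap.comp_apply]
      rw [key 1 fun k _ => rfl]
      simp
  obtain ⟨v, hv⟩ := Module.Dual.exists_forall_ne_zero_of_forall_exists f hex
  refine ⟨v.1, v.2, fun T hT => ⟨S ⟨T, hT⟩ v, ?_, ?_, ?_, ?_, ?_⟩⟩
  · intro j hj
    rw [← hR2 T j v hj, ← hS ⟨T, hT⟩ v, vsys_of_notMem hj]
  · intro j hj
    rw [map_sub, ← hR1 T j v hj, ← hS ⟨T, hT⟩ v, vsys_of_mem hj, sub_self]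
  · intro j
    simpa [f] using hv (⟨T, hT⟩, j, true)
  · intro j hj
    simpa [f, hj, sub_eq_zero] using hv (⟨T, hT⟩, j, false)
  · intro j hj
    simpa [f, hj] using hv (⟨T, hT⟩, j, false)

end FermatGeneric

/-! ### The cokernel of a Fermat pair -/

section FermatCount

open PolydiscAlg

variable {n p : ℕ} {r : ℝ}

/-- Perturbed pair of Fermat type. -/
def fermatPert {H : Type*} [NormedCommRing H] [NormedAlgebra ℂ H] (x : Fin n → H)
    (μ : Fin n → ℂ) (u : Fin p → ℂ) : PairSp n p H :=
  (fun j k => vcol n p j k • (x j - algebraMap ℂ H (μ j)),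
    fun k => ∑ j, vcol n p j k • x j - algebraMap ℂ H (u k))

lemma exists_finset_roots {K : ℕ} (hK : 0 < K) {a : ℂ} (ha : a ≠ 0) :
    ∃ R : Finset ℂ, R.card = K ∧ ∀ z ∈ R, z ^ K = a := by
  obtain ⟨ρ, hρ⟩ := IsAlgClosed.exists_pow_nat_eq a hK
  have hρ0 : ρ ≠ 0 := by
    rintro rfl
    rw [zero_pow hK.ne'] at hρ
    exact ha hρ.symm
  have hζ := Complex.isPrimitiveRoot_exp K hK.ne'
  refine ⟨(Finset.range K).image fun i => ρ * Complex.exp (2 * Real.pi * Complex.I / K) ^ i,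
    ?_, ?_⟩
  · rw [Finset.card_image_of_injOn, Finset.card_range]
    intro i hi j hj hij
    exact hζ.pow_inj (by simpa using hi) (by simpa using hj) (mul_left_cancel₀ hρ0 hij)
  · intro z hz
    obtain ⟨i, -, rfl⟩ := Finset.mem_image.1 hz
    rw [mul_pow, hρ, ← pow_mul, mul_comm i K, pow_mul, hζ.pow_eq_one, one_pow, mul_one]

lemma ev_fermatPert_snd {z : Cn n} (hz : z ∈ Metric.closedBall (0 : Cn n) r) (K : ℕ)
    (μ : Fin n → ℂ) (u : Fin p → ℂ) (k : Fin p) :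
    ev z ((fermatPert (fun j => (X j : PolydiscAlg n r) ^ K) μ u).2 k) =
      (vcomb n p (fun j => z j ^ K) - u) k := by
  simp only [fermatPert, map_sub, map_sum, map_smul, ev_pow hz, ev_X hz, ev_algebraMap hz,
    Pi.sub_apply, vcomb_apply, smul_eq_mul]
  congr 1
  exact Finset.sum_congr rfl fun j _ => mul_comm _ _

lemma pairVec_fermatPert {H : Type*} [NormedCommRing H] [NormedAlgebra ℂ H] (x : Fin n → H)
    (μ : Fin n → ℂ) (u : Fin p → ℂ) (j : Fin n) :
    pairVec (fermatPert x μ u) j =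
      (x j - algebraMap ℂ H (μ j)) * ∑ k, vcol n p j k • (fermatPert x μ u).2 k := by
  rw [pairVec, Finset.mul_sum]
  refine Finset.sum_congr rfl fun k _ => ?_
  change _ * (vcol n p j k • (x j - algebraMap ℂ H (μ j))) = _
  rw [mul_smul_comm, mul_smul_comm, mul_comm]

lemma dev_smul {x : Cn n} (hx : x ∈ Metric.ball (0 : Cn n) r) (d : Cn n) (c : ℂ)
    (v : PolydiscAlg n r) : dev x d (c • v) = c * dev x d v := by
  rw [Algebra.smul_def, dev_mul hx, dev_algebraMap hx, mul_zero, add_zero,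
    ev_algebraMap (Metric.ball_subset_closedBall hx)]

lemma dev_sub {x : Cn n} (hx : x ∈ Metric.ball (0 : Cn n) r) (d : Cn n)
    (v w : PolydiscAlg n r) : dev x d (v - w) = dev x d v - dev x d w := by
  have := dev_add hx d (v - w) w
  rw [sub_add_cancel] at this
  rw [this, add_sub_cancel_right]

lemma dev_X_pow {x : Cn n} (hx : x ∈ Metric.ball (0 : Cn n) r) (d : Cn n) (j : Fin n) (K : ℕ) :
    dev x d ((X j : PolydiscAlg n r) ^ (K + 1)) = (K + 1) * x j ^ K * d j := by
  have hxc := Metric.ball_subset_closedBall hx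
  induction K with
  | zero => simp [dev_X hx]
  | succ K ih =>
    rw [pow_succ, dev_mul hx, ih, dev_X hx, ev_pow hxc, ev_X hxc]
    push_cast
    ring

lemma FermatSol.nondegenerate (hpn : p ≤ n) {K : ℕ} (hK : 0 < K) {T : Finset (Fin n)}
    (hT : T.card < p) {μ : Fin n → ℂ} {u : Fin p → ℂ} {w : Fin n → ℂ} (h : FermatSol T μ u w)
    {z : Cn n} (hzr : z ∈ Metric.ball (0 : Cn n) r) (hz : ∀ j, z j ^ K = w j)
    (l : PairSp n p (PolydiscAlg n r))
    (hl : l = fermatPert (fun j => (X j : PolydiscAlg n r) ^ K) μ u) :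
    (fun i => ev z (l.2 i)) ≠ (0 : Fin p → ℂ) ∧ (∀ j, ev z (pairVec l j) = 0) ∧
      ∀ d, (∀ j, dev z d (pairVec l j) = 0) → d = 0 := by
  subst hl
  have hzc := Metric.ball_subset_closedBall hzr
  have hw : (fun j => z j ^ K) = w := funext hz
  set l := fermatPert (p := p) (fun j => (X j : PolydiscAlg n r) ^ K) μ u with hl
  have h2 : (fun i => ev z (l.2 i)) = vcomb n p w - u := by
    funext i
    rw [hl, ev_fermatPert_snd hzc, hw]
  have h3 : ∀ j, ev z (∑ k, vcol n p j k • l.2 k) = vpair n p j (vcomb n p w - u) := by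
    intro j
    rw [map_sum, vpair_apply, ← h2]
    simp
  have h4 : ∀ j, ev z ((X j : PolydiscAlg n r) ^ K - algebraMap ℂ _ (μ j)) = w j - μ j := by
    intro j
    rw [map_sub, ev_pow hzc, ev_X hzc, ev_algebraMap hzc, hz]
  refine ⟨?_, fun j => ?_, fun d hd => ?_⟩
  · rw [h2]
    intro h0
    obtain ⟨j, hj⟩ : ∃ j, j ∉ T := by
      by_contra! hall
      have : T = Finset.univ := Finset.eq_univ_iff_forall.2 hall
      rw [this, Finset.card_univ, Fintype.card_fin] at hT
      omega
    exact h.pair_ne_zero j hj (by rw [h0, map_zero])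
  · rw [hl, pairVec_fermatPert, ev_mul hzc, ← hl, h3, h4]
    by_cases hj : j ∈ T
    · rw [h.pair_eq_zero j hj, mul_zero]
    · rw [h.eq_of_notMem j hj, sub_self, zero_mul]
  · obtain ⟨K, rfl⟩ : ∃ K', K = K' + 1 := ⟨K - 1, by omega⟩
    set ν : Fin n → ℂ := fun j => (K + 1) * z j ^ K * d j with hν
    have h5 : ∀ j, dev z d (∑ k, vcol n p j k • l.2 k) = vpair n p j (vcomb n p ν) := by
      intro j
      rw [dev_sum hzr, vpair_apply]
      refine Finset.sum_congr rfl fun k _ => ?_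
      rw [dev_smul hzr, vcomb_apply]
      change _ * dev z d (∑ j, vcol n p j k • (X j : PolydiscAlg n r) ^ (K + 1) -
        algebraMap ℂ _ (u k)) = _
      rw [dev_sub hzr, dev_algebraMap hzr, sub_zero, dev_sum hzr]
      congr 1
      refine Finset.sum_congr rfl fun j _ => ?_
      rw [dev_smul hzr, dev_X_pow hzr, mul_comm]
    have h6 : ∀ j, (w j - μ j) * vpair n p j (vcomb n p ν) +
        vpair n p j (vcomb n p w - u) * ν j = 0 := by
      intro j
      rw [← hd j, hl, pairVec_fermatPert, dev_mul hzr, ← hl, h3, h4, h5, dev_sub hzr,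
        dev_algebraMap hzr, sub_zero, dev_X_pow hzr]
    have h7 : vsys n p T ν = 0 := by
      funext j
      by_cases hj : j ∈ T
      · rw [vsys_of_mem hj]
        have := h6 j
        rw [h.pair_eq_zero j hj, zero_mul, add_zero] at this
        exact (mul_eq_zero.1 this).resolve_left (sub_ne_zero.2 (h.ne_of_mem j hj))
      · rw [vsys_of_notMem hj]
        have := h6 j
        rw [h.eq_of_notMem j hj, sub_self, zero_mul, zero_add] at this
        exact (mul_eq_zero.1 this).resolve_left (h.pair_ne_zero j hj)
    have h8 : ν = 0 := vsys_injective hT.le (h7.trans (map_zero _).symm)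
    funext j
    have h9 : (K + 1) * z j ^ K * d j = 0 := congrFun h8 j
    refine (mul_eq_zero.1 h9).resolve_left ?_
    have hz0 : z j ≠ 0 := by
      intro h0
      apply h.ne_zero j
      rw [← hz j, h0, zero_pow (Nat.succ_ne_zero K)]
    exact mul_ne_zero (by exact_mod_cast Nat.succ_ne_zero K) (pow_ne_zero _ hz0)

lemma card_filter_card_lt (n p : ℕ) :
    (Finset.univ.filter fun T : Finset (Fin n) => T.card < p).card =
      ∑ k ∈ Finset.range p, n.choose k := by
  rw [Finset.card_eq_sum_card_fiberwise (f := Finset.card) (t := Finset.range p)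
    (fun T hT => by simpa using hT)]
  refine Finset.sum_congr rfl fun k hk => ?_
  have : (Finset.univ.filter fun T : Finset (Fin n) => T.card < p).filter (fun T => T.card = k) =
      Finset.powersetCard k Finset.univ := by
    ext T
    simp only [Finset.mem_filter, Finset.mem_univ, true_and, Finset.mem_powersetCard,
      Finset.subset_univ]
    exact ⟨fun h => h.2, fun h => ⟨h ▸ Finset.mem_range.1 hk, h⟩⟩
  rw [this, Finset.card_powersetCard, Finset.card_univ, Fintype.card_fin]

lemma frequently_fermat (hr : 0 < r) (hpn : p ≤ n) {K : ℕ} (hK : 0 < K) :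
    ∃ᶠ l in 𝓝 (fermatPair p fun j => (X j : PolydiscAlg n r) ^ K), ∀ᶠ l' in 𝓝 l,
      ∃ S : Finset (Cn n), S.card = K ^ n * ∑ k ∈ Finset.range p, n.choose k ∧
        ↑S ⊆ cokerPts (pairCols l') := by
  classical
  obtain ⟨μ, u, hsol⟩ := exists_fermatSol n p
  choose! w hw using hsol
  have hcont : Tendsto (fun s : ℂ => fermatPert (fun j => (X j : PolydiscAlg n r) ^ K)
      (s • μ) (s • u)) (𝓝[≠] 0) (𝓝 (fermatPair p fun j => (X j : PolydiscAlg n r) ^ K)) := by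
    have h1 : Continuous fun s : ℂ => fermatPert (fun j => (X j : PolydiscAlg n r) ^ K)
        (s • μ) (s • u) := by
      have hal : Continuous (algebraMap ℂ (PolydiscAlg n r)) := continuous_algebraMap _ _
      refine .prodMk (continuous_pi fun j => continuous_pi fun k => ?_)
        (continuous_pi fun k => ?_)
      · exact (continuous_const.sub (hal.comp (by fun_prop : Continuous fun s : ℂ =>
          (s • μ) j))).const_smul (vcol n p j k)
      · exact continuous_const.sub (hal.comp (by fun_prop : Continuous fun s : ℂ => (s • u) k))
    have h2 := (h1.tendsto 0).mono_left (nhdsWithin_le_nhds (s := {0}ᶜ))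
    convert h2 using 2
    simp [fermatPert, fermatPair]
  refine hcont.frequently (Eventually.frequently ?_)
  have hsmall : ∀ᶠ s : ℂ in 𝓝[≠] 0, ∀ T, ∀ j, ‖s * w T j‖ < r ^ K := by
    refine nhdsWithin_le_nhds ?_
    refine eventually_all.2 fun T => eventually_all.2 fun j => ?_
    have : ContinuousAt (fun s : ℂ => ‖s * w T j‖) 0 := by fun_prop
    refine this.eventually_lt continuousAt_const ?_
    rw [zero_mul, norm_zero]
    positivity
  filter_upwards [hsmall, self_mem_nhdsWithin] with s hs hs0
  have hs0 : s ≠ 0 := hs0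
  set 𝒯 := Finset.univ.filter fun T : Finset (Fin n) => T.card < p with h𝒯
  have hws : ∀ T ∈ 𝒯, FermatSol T (s • μ) (s • u) (s • w T) := fun T hT =>
    (hw T (by simpa [h𝒯] using hT)).smul hs0
  have hroots : ∀ T ∈ 𝒯, ∀ j, ∃ R : Finset ℂ, R.card = K ∧ ∀ z ∈ R, z ^ K = (s • w T) j :=
    fun T hT j => exists_finset_roots hK ((hws T hT).ne_zero j)
  choose! R hR1 hR2 using hroots
  let P : Finset (Fin n) → Finset (Cn n) := fun T => Fintype.piFinset (R T)
  have hP : ∀ T ∈ 𝒯, ∀ z ∈ P T, ∀ j, z j ^ K = (s • w T) j := fun T hT z hz j =>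
    hR2 T hT j _ (Fintype.mem_piFinset.1 hz j)
  have hdisj : ∀ T ∈ 𝒯, ∀ T' ∈ 𝒯, T ≠ T' → Disjoint (P T) (P T') := by
    intro T hT T' hT' hne
    rw [Finset.disjoint_left]
    intro z hz hz'
    have aux : ∀ T ∈ 𝒯, z ∈ P T → ∀ j, j ∈ T ↔ z j ^ K ≠ (s • μ) j := by
      intro T hT hz j
      rw [hP T hT z hz]
      exact ⟨(hws T hT).ne_of_mem j, fun h => by
        by_contra hj
        exact h ((hws T hT).eq_of_notMem j hj)⟩
    exact hne (Finset.ext fun j => (aux T hT hz j).trans (aux T' hT' hz' j).symm)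
  have hcard : (𝒯.biUnion P).card = K ^ n * ∑ k ∈ Finset.range p, n.choose k := by
    rw [Finset.card_biUnion hdisj, Finset.sum_congr rfl (g := fun _ => K ^ n), Finset.sum_const,
      card_filter_card_lt, smul_eq_mul, mul_comm]
    intro T hT
    rw [Fintype.card_piFinset, Finset.prod_congr rfl fun j _ => hR1 T hT j, Finset.prod_const,
      Finset.card_univ, Fintype.card_fin]
  rw [← hcard]
  refine eventually_exists_finset_cokerPts _ fun z hz => ?_
  obtain ⟨T, hT, hzT⟩ := Finset.mem_biUnion.1 hz
  have hzr : z ∈ Metric.ball (0 : Cn n) r := by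
    rw [mem_ball_zero_iff, pi_norm_lt_iff hr]
    intro j
    have h1 := hs T j
    have h2 : z j ^ K = s * w T j := hP T hT z hzT j
    rw [← h2, norm_pow] at h1
    exact lt_of_pow_lt_pow_left₀ K hr.le h1
  exact ⟨hzr, (hws T hT).nondegenerate hpn hK (by simpa [h𝒯] using hT) hzr (hP T hT z hzT) _ rfl⟩

end FermatCount

open PolydiscAlg in
/-- Division by the coordinates at the origin. -/
lemma PolydiscAlg.exists_gleason_zero {n : ℕ} {r : ℝ} (hr : 0 < r) :
    ∃ D : Fin n → PolydiscAlg n r →L[ℂ] PolydiscAlg n r,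
      ∀ v, v = algebraMap ℂ _ (ev 0 v) + ∑ i, X i * D i v := by
  obtain ⟨D, hD⟩ := exists_gleason (n := n) (r := r) (x := 0) (by simpa using hr)
  refine ⟨D, fun v => ?_⟩
  simpa using hD v

open PolydiscAlg in
/-- The Fermat pair has a presentation which is free near it. -/
lemma fermat_free {n p : ℕ} {r : ℝ} (hr : 0 < r) (hpn : p ≤ n) {K : ℕ} (hK : 0 < K) :
    ∃ (N : ℕ) (E : Fin N → Fin p → PolydiscAlg n r),
      ∀ᶠ l in 𝓝 (fermatPair p fun j => (X j : PolydiscAlg n r) ^ K),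
        HasRI E (pairCols l) ∧ IndepMod E (pairCols l) := by
  obtain ⟨D, hD⟩ := exists_gleason_zero (n := n) hr
  obtain ⟨N, E, hN, hE⟩ := exists_hasRI_fermat (p := p) X (ev 0) D hD K hK (by omega)
  refine ⟨N, E, ?_⟩
  have h1 := (pairCols (n := n) (p := p) (H := PolydiscAlg n r)).continuous.continuousAt.eventually
    (eventually_hasRI hE)
  obtain ⟨δ, hδ, hB⟩ := Metric.eventually_nhds_iff_ball.1 h1
  obtain ⟨l, hl, hlB⟩ := ((frequently_fermat (r := r) hr hpn hK).and_eventually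
    (Metric.ball_mem_nhds _ hδ)).exists
  have h2 : ∀ᶠ l' in 𝓝 l, IndepMod E (pairCols l') := by
    filter_upwards [hl, Metric.isOpen_ball.mem_nhds hlB] with l' ⟨S, hS, hS'⟩ hl'
    have hRI := hB l' hl'
    refine indepMod_of_le_finrank hRI ?_
    have := card_le_finrank_ann hr.le hRI hS'
    rw [Fintype.card_fin]
    omega
  have h3 := indepMod_of_preconnected (a := fun l : PairSp n p (PolydiscAlg n r) => pairCols l)
    Metric.isOpen_ball (convex_ball _ _).isPreconnected
    (fun l _ => analyticAt_pairCols l) hB hlB h2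
  filter_upwards [Metric.ball_mem_nhds _ hδ] with l' hl'
  exact ⟨hB l' hl', h3 l' hl'⟩

section Free

open PolydiscAlg

variable {n p : ℕ} {r ε : ℝ} {ι κ : Type*} [Fintype ι] [Fintype κ]

lemma PolydiscAlg.norm_res_le (h : r ≤ ε) (v : PolydiscAlg n ε) :
    ‖res h v‖ ≤ ‖v‖ :=
  norm_le_of_ev (norm_nonneg v) fun x hx => by
    rw [ev_res h hx]
    exact norm_ev_le x v

lemma PolydiscAlg.res_pow (h : r ≤ ε) (v : PolydiscAlg n ε) (k : ℕ) :
    res h (v ^ k) = res h v ^ k := by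
  induction k with
  | zero => simpa using res_algebraMap (n := n) h 1
  | succ k ih => rw [pow_succ, pow_succ, res_mul, ih]

lemma PolydiscAlg.res_one (h : r ≤ ε) : res h (1 : PolydiscAlg n ε) = 1 := by
  simpa using res_algebraMap (n := n) h 1

lemma PolydiscAlg.res_prod {σ : Type*} (s : Finset σ) (h : r ≤ ε) (v : σ → PolydiscAlg n ε) :
    res h (∏ i ∈ s, v i) = ∏ i ∈ s, res h (v i) := by
  classical
  induction s using Finset.induction_on with
  | empty => simpa using res_one (n := n) h
  | insert a s ha ih => rw [Finset.prod_insert ha, Finset.prod_insert ha, res_mul, ih]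

lemma resV_single_one (h : r ≤ ε) (k : Fin p) :
    resV h (Pi.single k (1 : PolydiscAlg n ε)) = Pi.single k 1 := by
  funext i
  rw [resV_apply]
  rcases eq_or_ne i k with rfl | hik
  · rw [Pi.single_eq_same, Pi.single_eq_same, res_one]
  · rw [Pi.single_eq_of_ne hik, Pi.single_eq_of_ne hik, map_zero]

/-- Restriction of a frame. -/
lemma resV_presOp (h : r ≤ ε) (E : ι → Fin p → PolydiscAlg n ε)
    (a : κ → Fin p → PolydiscAlg n ε) (x : (ι → ℂ) × (κ → PolydiscAlg n ε)) :
    resV h (presOp E a x) =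
      presOp (fun k => resV h (E k)) (resCols h a) (x.1, fun k => res h (x.2 k)) := by
  rw [presOp_apply, presOp_apply, map_add, resV_colOp, frameOp_apply, frameOp_apply, map_sum]
  simp only [map_smul]

lemma hasRI_res (hr : 0 < r) (h : r ≤ ε) {E : ι → Fin p → PolydiscAlg n ε}
    {a : κ → Fin p → PolydiscAlg n ε} (K : ℕ)
    (h1 : ∀ j k, ∃ w, colOp a w = (X j : PolydiscAlg n ε) ^ K • (Pi.single k 1 : Fin p → PolydiscAlg n ε))
    (h2 : ∀ m : Fin n → ℕ, (∀ i, m i < K) → ∀ k, ∃ x : (ι → ℂ) × (κ → PolydiscAlg n ε),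
      presOp E a x = (∏ i, (X i : PolydiscAlg n ε) ^ m i) • (Pi.single k 1 : Fin p → PolydiscAlg n ε)) :
    HasRI (fun k => resV h (E k)) (resCols h a) := by
  obtain ⟨D, hD⟩ := exists_gleason_zero (n := n) hr
  refine hasRI_of_monomials X (ev 0) D hD K (fun j k => ?_) fun m hm k => ?_
  · obtain ⟨w, hw⟩ := h1 j k
    refine ⟨fun k => res h (w k), ?_⟩
    rw [← resV_colOp, hw, resV_smul, resV_single_one, res_pow, res_X]
  · obtain ⟨x, hx⟩ := h2 m hm k
    refine ⟨(x.1, fun k => res h (x.2 k)), ?_⟩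
    rw [← resV_presOp, hx, resV_smul, resV_single_one, res_prod]
    simp only [res_pow, res_X]

lemma IndepMod.of_res (h : r ≤ ε) {E : ι → Fin p → PolydiscAlg n ε}
    {a : κ → Fin p → PolydiscAlg n ε} (hI : IndepMod (fun k => resV h (E k)) (resCols h a)) :
    IndepMod E a := by
  intro c w hcw
  have := resV_presOp h E a (c, w)
  rw [presOp_apply, hcw, map_zero] at this
  exact hI c _ this.symm

/-- The columns of a Fermat pair of higher order are divisible by the coordinates, modulo columns
generating the monomials. -/
lemma fermat_factor {H : Type*} [NormedCommRing H] [NormedAlgebra ℂ H] (X : Fin n → H)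
    {a : κ → Fin p → H} (K : ℕ)
    (h1 : ∀ j k, ∃ w, colOp a w = X j ^ K • (Pi.single k 1 : Fin p → H)) :
    ∃ W : Fin n ⊕ Fin p × Fin p → Fin n → κ → H, ∀ q,
      pairCols (fermatPair p fun j => X j ^ (K + 1)) q = ∑ j, X j • colOp a (W q j) := by
  choose w hw using h1
  refine ⟨Sum.elim (fun j l => if l = j then ∑ k, vcol n p j k • w j k else 0)
    (fun ik l => vcol n p l ik.1 • w l ik.2 - vcol n p l ik.2 • w l ik.1), ?_⟩
  have hs : ∀ j k, X j • (X j ^ K • (Pi.single k 1 : Fin p → H)) =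
      Pi.single k (X j ^ (K + 1)) := by
    intro j k
    rw [smul_smul, ← pow_succ', ← Pi.single_smul, smul_eq_mul, mul_one]
  rintro (j | ⟨i, k⟩)
  · rw [pairCols_inl, Finset.sum_eq_single j]
    · rw [Sum.elim_inl, if_pos rfl, map_sum, Finset.smul_sum]
      simp only [map_smul, hw]
      simp only [smul_comm (X j) (_ : ℂ), hs]
      funext k
      simp [fermatPair, Finset.sum_apply, Pi.single_apply]
    · intro l _ hl
      rw [Sum.elim_inl, if_neg hl, map_zero, smul_zero]
    · simp
  · rw [pairCols_inr]
    simp only [Sum.elim_inr, map_sub, map_smul, hw, smul_sub, smul_comm (X _) (_ : ℂ), hs,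
      Finset.sum_sub_distrib]
    funext l
    simp [fermatPair, Finset.sum_apply, Pi.single_apply, Finset.sum_ite_irrel]

end Free

section Perturb

variable {H : Type*} [NormedCommRing H] [NormedAlgebra ℂ H] [CompleteSpace H]
  {ι κ : Type*} [Fintype ι] [Fintype κ] {n p : ℕ}

lemma exists_equiv_perturb (X : Fin n → H) {a₀ a₁ : κ → Fin p → H} (W : κ → Fin n → κ → H)
    (hW : ∀ q, a₁ q = ∑ j, X j • colOp a₀ (W q j)) {α β : ℂ}
    (hαβ : ‖β‖ * (∑ q, ∑ j, ‖X j‖ * ‖W q j‖) < ‖α‖) :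
    ∃ S : (κ → H) ≃L[ℂ] (κ → H), ∀ w, colOp (α • a₀ + β • a₁) w = colOp a₀ (S w) := by
  set M := ∑ q, ∑ j, ‖X j‖ * ‖W q j‖ with hM
  have hM0 : 0 ≤ M := Finset.sum_nonneg fun q _ => Finset.sum_nonneg fun j _ => by positivity
  have hα : α ≠ 0 := by
    rintro rfl
    rw [norm_zero] at hαβ
    exact absurd hαβ (not_lt.2 (by positivity))
  let C : (κ → H) →L[ℂ] (κ → H) := LinearMap.mkContinuous
    { toFun := fun w => ∑ q, ∑ j, (w q * X j) • W q j
      map_add' := fun w w' => by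
        simp only [Pi.add_apply, add_mul, add_smul, Finset.sum_add_distrib]
      map_smul' := fun c w => by
        simp only [Pi.smul_apply, smul_mul_assoc, Finset.smul_sum, smul_assoc, RingHom.id_apply] }
    M (fun w => by
      change ‖∑ q, ∑ j, (w q * X j) • W q j‖ ≤ _
      rw [hM, Finset.sum_mul]
      refine (norm_sum_le _ _).trans (Finset.sum_le_sum fun q _ => ?_)
      rw [Finset.sum_mul]
      refine (norm_sum_le _ _).trans (Finset.sum_le_sum fun j _ => ?_)
      refine (norm_smul_le _ _).trans ?_
      calc ‖w q * X j‖ * ‖W q j‖ ≤ (‖w‖ * ‖X j‖) * ‖W q j‖ := by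
            gcongr
            exact (norm_mul_le _ _).trans (by gcongr; exact norm_le_pi_norm w q)
        _ = _ := by ring)
  have hC : ∀ w, C w = ∑ q, ∑ j, (w q * X j) • W q j := fun w => rfl
  have hCn : ‖-(α⁻¹ * β) • C‖ < 1 := by
    have h1 : ‖C‖ ≤ M := LinearMap.mkContinuous_norm_le _ hM0 _
    calc ‖-(α⁻¹ * β) • C‖ ≤ ‖-(α⁻¹ * β)‖ * ‖C‖ :=
          ContinuousLinearMap.opNorm_smul_le _ _
      _ ≤ ‖α‖⁻¹ * ‖β‖ * M := by
          rw [norm_neg, norm_mul, norm_inv]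
          gcongr
      _ < 1 := by
          rw [mul_assoc, inv_mul_lt_iff₀ (norm_pos_iff.2 hα), mul_one]
          exact hαβ
  let u := Units.oneSub (-(α⁻¹ * β) • C) hCn
  refine ⟨(ContinuousLinearEquiv.smulLeft (Units.mk0 α hα)).trans
    (ContinuousLinearEquiv.unitsEquiv ℂ (κ → H) u), fun w => ?_⟩
  have h2 : ((ContinuousLinearEquiv.smulLeft (Units.mk0 α hα)).trans
    (ContinuousLinearEquiv.unitsEquiv ℂ (κ → H) u)) w = α • w + β • C w := by
    change (α • w) - (-(α⁻¹ * β) • C) (α • w) = _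
    rw [smul_apply, map_smul, smul_smul, neg_mul, neg_smul, sub_neg_eq_add]
    congr 2
    field_simp
  rw [h2, map_add, map_smul, map_smul, hC, map_sum]
  have h3 : ∀ q, colOp a₀ (∑ j, (w q * X j) • W q j) = w q • a₁ q := by
    intro q
    rw [map_sum, hW, Finset.smul_sum]
    exact Finset.sum_congr rfl fun j _ => by rw [← smul_colOp, smul_smul]
  simp only [h3, colOp_apply, Pi.add_apply, Pi.smul_apply, smul_add, Finset.sum_add_distrib,
    Finset.smul_sum]
  congr 1 <;> exact Finset.sum_congr rfl fun q _ => smul_comm _ _ _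

end Perturb

section Equivalence

variable {H : Type*} [NormedCommRing H] [NormedAlgebra ℂ H]
  {ι κ : Type*} [Fintype ι] [Fintype κ] {p : ℕ}

lemma HasRI.of_equiv {E : ι → Fin p → H} {a b : κ → Fin p → H} (S : (κ → H) ≃L[ℂ] (κ → H))
    (hS : ∀ w, colOp b w = colOp a (S w)) (h : HasRI E a) : HasRI E b := by
  obtain ⟨T, hT⟩ := h
  refine ⟨(((ContinuousLinearMap.fst ℂ _ _).comp T).prod
    ((S.symm : (κ → H) →L[ℂ] (κ → H)).comp ((ContinuousLinearMap.snd ℂ _ _).comp T))),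
    ContinuousLinearMap.ext fun x => ?_⟩
  have h1 : presOp E a (T x) = x := congrArg (fun S => S x) hT
  change frameOp E (T x).1 + colOp b (S.symm (T x).2) = x
  rw [hS, S.apply_symm_apply]
  exact h1

lemma IndepMod.of_equiv {E : ι → Fin p → H} {a b : κ → Fin p → H} (S : (κ → H) ≃L[ℂ] (κ → H))
    (hS : ∀ w, colOp b w = colOp a (S w)) (h : IndepMod E a) : IndepMod E b := by
  intro c w hcw
  rw [hS] at hcw
  exact h c _ hcw

end Equivalence

section Mult

open PolydiscAlg

variable {n p : ℕ} {r ε : ℝ} {ι κ : Type*} [Fintype ι] [Fintype κ]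

/-- Annihilators over a small polydisc killed by powers of the coordinates are supported at the
origin. -/
lemma finrank_ann_le_mult (h : r ≤ ε) {a : κ → Fin p → PolydiscAlg n ε}
    {E : ι → Fin p → PolydiscAlg n ε} (hR : HasRI E a) (K : ℕ)
    (hK : ∀ j k, ∃ w, colOp (resCols h a) w =
      (X j : PolydiscAlg n r) ^ K • (Pi.single k 1 : Fin p → PolydiscAlg n r)) :
    Module.finrank ℂ (AnnSp (resCols h a)) ≤ mult a 0 := by
  have := finiteDimensional_ann hR
  have hmem : ∀ ψ : AnnSp (resCols h a), ψ.fn.comp (resV h) ∈ ann a := by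
    intro ψ w
    rw [ContinuousLinearMap.comp_apply, resV_colOp]
    exact ψ.fn_mem _
  have hjoint : ∀ ψ : AnnSp (resCols h a), AnnSp.mk _ (hmem ψ) ∈
      jointEig (annRep a) (X : Fin n → PolydiscAlg n ε) 0 := by
    intro ψ
    rw [mem_jointEig_iff]
    refine fun j => ⟨K, AnnSp.ext fun v => ?_⟩
    rw [annRep_apply, AnnSp.fn_mk, AnnSp.fn_zero, ContinuousLinearMap.comp_apply, resV_smul,
      Pi.zero_apply, map_zero, sub_zero, res_pow, res_X]
    have h1 : (X j : PolydiscAlg n r) ^ K • resV h v = ∑ k, resV h v k •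
        ((X j : PolydiscAlg n r) ^ K • (Pi.single k 1 : Fin p → PolydiscAlg n r)) := by
      conv_lhs => rw [pi_eq_sum_univ' (resV h v), Finset.smul_sum]
      refine Finset.sum_congr rfl fun k _ => ?_
      rw [smul_comm]
    rw [h1, map_sum]
    refine Finset.sum_eq_zero fun k _ => ?_
    obtain ⟨w, hw⟩ := hK j k
    rw [← hw, smul_colOp]
    exact ψ.fn_mem _
  let Θ : AnnSp (resCols h a) →ₗ[ℂ] jointEig (annRep a) (X : Fin n → PolydiscAlg n ε) 0 :=
    { toFun := fun ψ => ⟨AnnSp.mk _ (hmem ψ), hjoint ψ⟩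
      map_add' := fun _ _ => rfl
      map_smul' := fun _ _ => rfl }
  refine finrank_le_of_injective_jointEig _ _ _ Θ
    ((injective_iff_map_eq_zero _).2 fun ψ hψ => ?_)
  have h1 : AnnSp.mk _ (hmem ψ) = 0 := congrArg Subtype.val hψ
  refine AnnSp.ext_fn (eq_zero_of_comp_resV h fun v => ?_)
  exact congrArg (fun φ : AnnSp a => φ.fn v) h1

end Mult

section Free

open PolydiscAlg

variable {n p : ℕ} {r ε : ℝ} {ι κ : Type*} [Fintype ι] [Fintype κ]

/-- Restriction of columns as a continuous linear map. -/
def resColsL (h : r ≤ ε) :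
    (κ → Fin p → PolydiscAlg n ε) →L[ℂ] (κ → Fin p → PolydiscAlg n r) :=
  ContinuousLinearMap.pi fun k =>
    (resV h).comp (.proj (R := ℂ) (φ := fun _ : κ => Fin p → PolydiscAlg n ε) k)

lemma mult_le_clusterMult (hr : 0 ≤ ε) {E : ι → Fin p → PolydiscAlg n ε}
    {a : κ → Fin p → PolydiscAlg n ε} (h : HasRI E a) {S : Set (Cn n)} {x : Cn n} (hx : x ∈ S) :
    mult a x ≤ clusterMult a S := by
  have hfin : (Function.support (mult a)).Finite :=
    (finite_cokerPts hr h).subset (support_mult_subset hr a)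
  rw [clusterMult, finsum_mem_def]
  have h1 : (Function.support (S.indicator (mult a))).Finite :=
    by
    rw [Set.support_indicator]
    exact hfin.subset Set.inter_subset_right
  have := single_le_finsum x h1 fun _ => Nat.zero_le _
  rwa [Set.indicator_of_mem hx] at this

/-- A frame of monomials which is independent over all small polydiscs stays independent under
deformations of the pair. -/
theorem free_of_monomials (hε : 0 < ε) (hpn : p ≤ n) {E : ι → Fin p → PolydiscAlg n ε}
    (l₀ : PairSp n p (PolydiscAlg n ε)) (K : ℕ)
    (h1 : ∀ j k, ∃ w, colOp (pairCols l₀) w =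
      (X j : PolydiscAlg n ε) ^ K • (Pi.single k 1 : Fin p → PolydiscAlg n ε))
    (h2 : ∀ m : Fin n → ℕ, (∀ i, m i < K) → ∀ k,
      ∃ x : (ι → ℂ) × (Fin n ⊕ Fin p × Fin p → PolydiscAlg n ε),
        presOp E (pairCols l₀) x =
          (∏ i, (X i : PolydiscAlg n ε) ^ m i) • (Pi.single k 1 : Fin p → PolydiscAlg n ε))
    (hI : ∀ r (h : r ≤ ε), 0 < r →
      IndepMod (fun k => resV h (E k)) (resCols h (pairCols l₀))) :
    ∀ᶠ l in 𝓝 l₀, HasRI E (pairCols l) ∧ IndepMod E (pairCols l) := by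
  classical
  -- the presentation has a right inverse
  have hRI₀ : HasRI E (pairCols l₀) := by
    obtain ⟨D, hD⟩ := exists_gleason_zero (n := n) hε
    exact hasRI_of_monomials X (ev 0) D hD K h1 h2
  have hRIev := (pairCols (n := n) (p := p)
    (H := PolydiscAlg n ε)).continuous.continuousAt.eventually (eventually_hasRI hRI₀)
  -- the Fermat pair and the end point of the path
  set F₀ : PairSp n p (PolydiscAlg n ε) := fermatPair p fun j => X j ^ (K + 1) with hF₀
  obtain ⟨N, EF, hEF⟩ := fermat_free (r := ε) hε hpn (Nat.succ_pos K)
  obtain ⟨W, hW⟩ := fermat_factor (X : Fin n → PolydiscAlg n ε) K h1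
  set M := ∑ q, ∑ j, ‖W q j‖ with hM
  have hM0 : 0 ≤ M := Finset.sum_nonneg fun q _ => Finset.sum_nonneg fun j _ => norm_nonneg _
  obtain ⟨t, ht0, ht1, hFt⟩ : ∃ t : ℝ, 0 < t ∧ t ≤ 1 ∧
      ∀ᶠ l in 𝓝 (F₀ + (t : ℂ) • l₀), HasRI EF (pairCols l) ∧ IndepMod EF (pairCols l) := by
    have hcont : Tendsto (fun t : ℝ => F₀ + (t : ℂ) • l₀) (𝓝[>] 0) (𝓝 F₀) := by
      have : Continuous fun t : ℝ => F₀ + (t : ℂ) • l₀ := by fun_prop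
      have h3 := this.tendsto 0
      simp only [Complex.ofReal_zero, zero_smul, add_zero] at h3
      exact h3.mono_left nhdsWithin_le_nhds
    have h4 := hcont.eventually (eventually_eventually_nhds.2 hEF)
    have h5 : ∀ᶠ t : ℝ in 𝓝[>] 0, t ∈ Set.Ioc (0 : ℝ) 1 := Ioc_mem_nhdsGT one_pos
    obtain ⟨t, ht, ht'⟩ := (h4.and h5).exists
    exact ⟨t, ht'.1, ht'.2, ht⟩
  set l₁ := F₀ + (t : ℂ) • l₀ with hl₁
  have hRI₁ := hFt.self_of_nhds.1
  have hI₁ := hFt.self_of_nhds.2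
  -- the small radius
  obtain ⟨r, hr0, hrε, hrM, hrs⟩ : ∃ r : ℝ, 0 < r ∧ r ≤ ε ∧ r * M < t ∧
      ∀ x ∈ cokerPts (pairCols l₁), ‖x‖ ≠ r := by
    have h3 : ∀ᶠ r : ℝ in 𝓝[>] 0, r ∈ Set.Ioc (0 : ℝ) ε := Ioc_mem_nhdsGT hε
    have h4 : ∀ᶠ r : ℝ in 𝓝[>] 0, r * M < t := by
      have : Tendsto (fun r : ℝ => r * M) (𝓝[>] 0) (𝓝 (0 * M)) :=
        ((continuous_id.mul continuous_const).tendsto 0).mono_left nhdsWithin_le_nhds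
      rw [zero_mul] at this
      exact this.eventually (gt_mem_nhds ht0)
    have h5 : ∀ᶠ r : ℝ in 𝓝[>] 0, ∀ x ∈ cokerPts (pairCols l₁), ‖x‖ ≠ r := by
      rw [(finite_cokerPts hε.le hRI₁).eventually_all]
      intro x _
      by_cases hx : ‖x‖ = 0
      · filter_upwards [self_mem_nhdsWithin] with r hr
        rw [hx]
        exact (ne_of_gt hr).symm
      · have : ∀ᶠ r : ℝ in 𝓝 0, r ≠ ‖x‖ := eventually_ne_nhds (Ne.symm hx)
        filter_upwards [this.filter_mono nhdsWithin_le_nhds] with r hr using hr.symm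
    obtain ⟨r, ⟨hr, hr'⟩, hr''⟩ := ((h3.and h4).and h5).exists
    exact ⟨r, hr.1, hr.2, hr', hr''⟩
  set Er : ι → Fin p → PolydiscAlg n r := fun k => resV hrε (E k) with hEr
  have hRr : HasRI Er (resCols hrε (pairCols l₀)) := hasRI_res hr0 hrε K h1 h2
  have hIr : IndepMod Er (resCols hrε (pairCols l₀)) := hI r hrε hr0
  -- equivalences along the path
  have hpath : ∀ σ ∈ Set.Icc (0 : ℝ) 1, ∃ S : (Fin n ⊕ Fin p × Fin p → PolydiscAlg n r) ≃L[ℂ]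
      (Fin n ⊕ Fin p × Fin p → PolydiscAlg n r), ∀ w,
      colOp (resCols hrε (pairCols ((1 - σ) • l₀ + σ • l₁))) w =
        colOp (resCols hrε (pairCols l₀)) (S w) := by
    intro σ hσ
    have hW' : ∀ q, resCols hrε (pairCols F₀) q = ∑ j, (X j : PolydiscAlg n r) •
        colOp (resCols hrε (pairCols l₀)) (fun k => res hrε (W q j k)) := by
      intro q
      change resV hrε (pairCols F₀ q) = _
      rw [hW q, map_sum]
      exact Finset.sum_congr rfl fun j _ => by rw [resV_smul, resV_colOp, res_X]
    have hα : ‖((σ : ℝ) : ℂ)‖ * (∑ q, ∑ j, ‖(X j : PolydiscAlg n r)‖ *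
        ‖fun k => res hrε (W q j k)‖) < ‖((1 - σ + σ * t : ℝ) : ℂ)‖ := by
      rw [Complex.norm_real, Complex.norm_real, Real.norm_of_nonneg hσ.1,
        Real.norm_of_nonneg (by nlinarith [hσ.1, hσ.2])]
      have h3 : (∑ q, ∑ j, ‖(X j : PolydiscAlg n r)‖ * ‖fun k => res hrε (W q j k)‖) ≤ r * M := by
        rw [hM, Finset.mul_sum]
        refine Finset.sum_le_sum fun q _ => ?_
        rw [Finset.mul_sum]
        refine Finset.sum_le_sum fun j _ => ?_
        refine mul_le_mul (norm_X_le hr0.le j) ?_ (norm_nonneg _) hr0.le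
        refine (pi_norm_le_iff_of_nonneg (norm_nonneg _)).2 fun k => ?_
        exact (norm_res_le hrε _).trans (norm_le_pi_norm (W q j) k)
      rcases hσ.1.eq_or_lt with h0 | h0
      · rw [← h0]
        norm_num
      · nlinarith [hσ.2]
    obtain ⟨S, hS⟩ := exists_equiv_perturb (X : Fin n → PolydiscAlg n r) _ hW' hα
    refine ⟨S, fun w => ?_⟩
    rw [← hS]
    refine congrArg (fun b => colOp b w) ?_
    have h3 : (1 - σ) • l₀ + σ • l₁ = ((1 - σ + σ * t : ℝ) : ℂ) • l₀ + (σ : ℂ) • F₀ := by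
      rw [hl₁, ← Complex.coe_smul, ← Complex.coe_smul]
      push_cast
      module
    rw [h3, map_add, map_smul, map_smul]
    exact ((resColsL hrε).map_add _ _).trans (by rw [map_smul, map_smul]; rfl)
  have hRpath : ∀ l ∈ segment ℝ l₀ l₁, HasRI Er (resCols hrε (pairCols l)) := by
    intro l hl
    rw [segment_eq_image] at hl
    obtain ⟨σ, hσ, rfl⟩ := hl
    obtain ⟨S, hS⟩ := hpath σ hσ
    exact hRr.of_equiv S hS
  obtain ⟨S₁, hS₁⟩ := hpath 1 (by simp)
  simp only [sub_self, zero_smul, one_smul, zero_add] at hS₁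
  have hIr₁ : IndepMod Er (resCols hrε (pairCols l₁)) := hIr.of_equiv S₁ hS₁
  have hRr₁ : HasRI Er (resCols hrε (pairCols l₁)) := hRr.of_equiv S₁ hS₁
  -- multiplicity at the origin of the end point
  have hmult : Fintype.card ι ≤ mult (pairCols l₁) 0 := by
    rw [← finrank_ann_eq hIr₁ hRr₁]
    refine finrank_ann_le_mult hrε hRI₁ K fun j k => ?_
    obtain ⟨w, hw⟩ := h1 j k
    refine ⟨S₁.symm fun k => res hrε (w k), ?_⟩
    rw [hS₁, S₁.apply_symm_apply, ← resV_colOp, hw, resV_smul, resV_single_one, res_pow, res_X]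
  -- independence near the end point, over the small polydisc
  let Φ : PairSp n p (PolydiscAlg n ε) →L[ℂ] (Fin n ⊕ Fin p × Fin p → Fin p → PolydiscAlg n r) :=
    (resColsL hrε).comp pairCols
  have hΦ : ∀ l, Φ l = resCols hrε (pairCols l) := fun l => rfl
  have hRr₁' := Φ.continuous.continuousAt.eventually (eventually_hasRI hRr₁)
  have hIr₁' : ∀ᶠ l in 𝓝 l₁, IndepMod Er (Φ l) := by
    have h3 := (pairCols (n := n) (p := p)
      (H := PolydiscAlg n ε)).continuous.continuousAt.eventually
        (eventually_clusterMult_eq hε.le hRI₁ hI₁ (S := Metric.ball 0 r) (by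
          intro x hx hx'
          rw [frontier_ball _ hr0.ne'] at hx'
          exact hrs x hx (by simpa using hx')))
    filter_upwards [h3, hFt, hRr₁'] with l hl hl' hRl
    refine indepMod_of_le_finrank hRl (hmult.trans ?_)
    have h4 := mult_le_clusterMult hε.le hRI₁ (Metric.mem_ball_self hr0 : (0 : Cn n) ∈ _)
    rw [← hl hl'.2] at h4
    exact h4.trans (clusterMult_ball_le hr0.le hrε _ hRl)
  -- propagation along a thickened segment
  let O : Set (PairSp n p (PolydiscAlg n ε)) := interior {l | HasRI Er (Φ l)}
  have hO : segment ℝ l₀ l₁ ⊆ O := fun l hl => mem_interior_iff_mem_nhds.2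
    (Φ.continuous.continuousAt.eventually (eventually_hasRI (hRpath l hl)))
  have hcomp : IsCompact (segment ℝ l₀ l₁) := by
    rw [segment_eq_image]
    exact isCompact_Icc.image (by fun_prop)
  obtain ⟨δ, hδ, hδO⟩ := hcomp.exists_thickening_subset_open isOpen_interior hO
  have hprop := indepMod_of_preconnected (a := fun l => Φ l) Metric.isOpen_thickening
    ((convex_segment l₀ l₁).thickening δ).isPreconnected
    (fun l _ => ContinuousLinearMap.analyticAt Φ l)
    (fun l hl => (interior_subset (hδO hl) : l ∈ {l | HasRI Er (Φ l)}))
    (Metric.self_subset_thickening hδ _ (right_mem_segment ℝ l₀ l₁)) hIr₁'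
  filter_upwards [hRIev, Metric.isOpen_thickening.mem_nhds
    (Metric.self_subset_thickening hδ _ (left_mem_segment ℝ l₀ l₁))] with l hl hl'
  exact ⟨hl, (hprop l hl').of_res hrε⟩

end Free

section Germs

open PolydiscAlg

variable {n m : ℕ} {r ε : ℝ}

namespace On

/-- The germ of an analytic function. -/
def mk (f : Cn n → ℂ) (hf : AnalyticAt ℂ f 0) : On n := ⟨(f : Germ (𝓝 (0 : Cn n)) ℂ), f, hf, rfl⟩

lemma mk_eq_mk {f g : Cn n → ℂ} {hf : AnalyticAt ℂ f 0} {hg : AnalyticAt ℂ g 0} :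
    mk f hf = mk g hg ↔ f =ᶠ[𝓝 0] g := by
  rw [← Germ.coe_eq]
  exact Subtype.ext_iff

lemma exists_mk (φ : On n) : ∃ (f : Cn n → ℂ) (hf : AnalyticAt ℂ f 0), φ = mk f hf := by
  obtain ⟨φ, f, hf, h⟩ := φ
  exact ⟨f, hf, Subtype.ext h⟩

lemma mk_mul {f g : Cn n → ℂ} (hf : AnalyticAt ℂ f 0) (hg : AnalyticAt ℂ g 0) :
    mk f hf * mk g hg = mk (fun z => f z * g z) (hf.mul hg) := rfl

lemma mk_add {f g : Cn n → ℂ} (hf : AnalyticAt ℂ f 0) (hg : AnalyticAt ℂ g 0) :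
    mk f hf + mk g hg = mk (fun z => f z + g z) (hf.add hg) := rfl

lemma zero_eq_mk : (0 : On n) = mk (fun _ => 0) analyticAt_const := rfl

lemma one_eq_mk : (1 : On n) = mk (fun _ => 1) analyticAt_const := rfl

lemma algebraMap_eq_mk (c : ℂ) : algebraMap ℂ (On n) c = mk (fun _ => c) analyticAt_const := rfl

/-- The value of a germ at the origin. -/
def value : On n →ₐ[ℂ] ℂ where
  toFun φ := (φ : Germ (𝓝 (0 : Cn n)) ℂ).value
  map_one' := rfl
  map_zero' := rfl
  map_mul' φ ψ := by
    obtain ⟨f, hf, rfl⟩ := exists_mk φ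
    obtain ⟨g, hg, rfl⟩ := exists_mk ψ
    rfl
  map_add' φ ψ := by
    obtain ⟨f, hf, rfl⟩ := exists_mk φ
    obtain ⟨g, hg, rfl⟩ := exists_mk ψ
    rfl
  commutes' c := rfl

@[simp] lemma value_mk {f : Cn n → ℂ} (hf : AnalyticAt ℂ f 0) : value (mk f hf) = f 0 := rfl

lemma isUnit_iff (φ : On n) : IsUnit φ ↔ value φ ≠ 0 := by
  constructor
  · intro h
    exact (h.map value).ne_zero
  · intro h
    obtain ⟨f, hf, rfl⟩ := exists_mk φ
    rw [value_mk] at h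
    refine IsUnit.of_mul_eq_one (mk _ (hf.inv h)) ?_
    rw [mk_mul, one_eq_mk, mk_eq_mk]
    filter_upwards [hf.continuousAt.eventually_ne h] with z hz
    exact mul_inv_cancel₀ hz

instance : Nontrivial (On n) :=
  ⟨0, 1, fun h => by
    have := congrArg value h
    rw [map_zero, map_one] at this
    exact zero_ne_one this⟩

instance : IsLocalRing (On n) :=
  IsLocalRing.of_nonunits_add fun a b ha hb => by
    rw [mem_nonunits_iff, isUnit_iff, not_not] at *
    rw [map_add, ha, hb, add_zero]

lemma analyticAt_coord (i : Fin n) (x : Cn n) : AnalyticAt ℂ (fun z : Cn n => z i) x :=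
  ContinuousLinearMap.analyticAt (𝕜 := ℂ) (E := Cn n) (F := ℂ)
    (ContinuousLinearMap.proj (R := ℂ) (φ := fun _ : Fin n => ℂ) i) x

/-- The coordinate germs. -/
def X (i : Fin n) : On n := mk (fun z => z i) (analyticAt_coord i 0)

/-- Composition of germs with an analytic map germ. -/
def pullback (Φ : Cn n → Cn m) (hΦ : AnalyticAt ℂ Φ 0) (h0 : Φ 0 = 0) : On m →ₐ[ℂ] On n where
  toFun φ := ⟨(φ : Germ (𝓝 (0 : Cn m)) ℂ).compTendsto Φ
      (by simpa [h0] using hΦ.continuousAt.tendsto), by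
    obtain ⟨f, hf, rfl⟩ := exists_mk φ
    exact ⟨f ∘ Φ, AnalyticAt.comp (by rwa [h0]) hΦ, rfl⟩⟩
  map_one' := rfl
  map_zero' := rfl
  map_mul' φ ψ := by
    obtain ⟨f, hf, rfl⟩ := exists_mk φ
    obtain ⟨g, hg, rfl⟩ := exists_mk ψ
    rfl
  map_add' φ ψ := by
    obtain ⟨f, hf, rfl⟩ := exists_mk φ
    obtain ⟨g, hg, rfl⟩ := exists_mk ψ
    rfl
  commutes' c := rfl

lemma pullback_mk {Φ : Cn n → Cn m} (hΦ : AnalyticAt ℂ Φ 0) (h0 : Φ 0 = 0) {f : Cn m → ℂ}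
    (hf : AnalyticAt ℂ f 0) (hf' : AnalyticAt ℂ f (Φ 0)) :
    pullback Φ hΦ h0 (mk f hf) = mk (fun z => f (Φ z)) (AnalyticAt.comp hf' hΦ) := rfl

end On

namespace PolydiscAlg

lemma analyticAt_ev_apply {x : Cn n} (hx : x ∈ Metric.ball (0 : Cn n) r) (v : PolydiscAlg n r) :
    AnalyticAt ℂ (fun y => ev y v) x :=
  (((ContinuousLinearMap.id ℂ (PolydiscAlg n r →L[ℂ] ℂ)).analyticAt_bilinear (ev x, v)).comp₂
    (analyticAt_ev hx) analyticAt_const)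

/-- The germ at the origin. -/
def germ (hr : 0 < r) : PolydiscAlg n r →ₐ[ℂ] On n where
  toFun v := On.mk (fun z => ev z v) (analyticAt_ev_apply (Metric.mem_ball_self hr) v)
  map_one' := by
    rw [On.one_eq_mk, On.mk_eq_mk]
    filter_upwards [Metric.closedBall_mem_nhds 0 hr] with z hz using ev_one hz
  map_zero' := by
    rw [On.zero_eq_mk, On.mk_eq_mk]
    filter_upwards with z using map_zero _
  map_mul' v w := by
    rw [On.mk_mul, On.mk_eq_mk]
    filter_upwards [Metric.closedBall_mem_nhds 0 hr] with z hz using ev_mul hz v w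
  map_add' v w := by
    rw [On.mk_add, On.mk_eq_mk]
    filter_upwards with z using map_add _ _ _
  commutes' c := by
    rw [On.algebraMap_eq_mk, On.mk_eq_mk]
    filter_upwards [Metric.closedBall_mem_nhds 0 hr] with z hz using ev_algebraMap hz c

lemma germ_eq_mk (hr : 0 < r) (v : PolydiscAlg n r) : germ hr v =
    On.mk (fun z => ev z v) (analyticAt_ev_apply (Metric.mem_ball_self hr) v) := rfl

lemma germ_eq_mk_iff (hr : 0 < r) {v : PolydiscAlg n r} {f : Cn n → ℂ}
    {hf : AnalyticAt ℂ f 0} : germ hr v = On.mk f hf ↔ (fun z => ev z v) =ᶠ[𝓝 0] f :=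
  On.mk_eq_mk (hf := analyticAt_ev_apply (Metric.mem_ball_self hr) v)

lemma germ_injective (hr : 0 < r) : Function.Injective (germ hr : PolydiscAlg n r → On n) := by
  refine (injective_iff_map_eq_zero (germ hr)).2 fun v hv => ?_
  rw [On.zero_eq_mk, germ_eq_mk_iff] at hv
  have h1 : Set.EqOn (fun z => ev z v) 0 (Metric.ball (0 : Cn n) r) :=
    AnalyticOnNhd.eqOn_zero_of_preconnected_of_eventuallyEq_zero
      (fun z hz => analyticAt_ev_apply hz v) (convex_ball _ _).isPreconnected
      (Metric.mem_ball_self hr) hv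
  refine ext_ev fun x hx => ?_
  rw [map_zero]
  have h2 := (h1.of_subset_closure (t := Metric.closedBall (0 : Cn n) r) (continuousOn_ev v)
    continuousOn_const Metric.ball_subset_closedBall (closure_ball (0 : Cn n) hr.ne').ge)
  exact h2 hx

lemma germ_res (hr : 0 < r) (h : r ≤ ε) (v : PolydiscAlg n ε) :
    germ hr (res h v) = germ (hr.trans_le h) v := by
  rw [germ_eq_mk, germ_eq_mk, On.mk_eq_mk]
  filter_upwards [Metric.closedBall_mem_nhds 0 hr] with z hz using ev_res h hz v

lemma germ_X (hr : 0 < r) (i : Fin n) : germ hr (X i) = On.X i := by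
  rw [germ_eq_mk, On.X, On.mk_eq_mk]
  filter_upwards [Metric.closedBall_mem_nhds 0 hr] with z hz using ev_X hz i

lemma value_germ (hr : 0 < r) (v : PolydiscAlg n r) : On.value (germ hr v) = ev 0 v := rfl

lemma exists_germ (φ : On n) : ∃ ρ > (0 : ℝ), ∀ r (hr : 0 < r), r ≤ ρ →
    ∃ v : PolydiscAlg n r, germ hr v = φ := by
  obtain ⟨f, hf, rfl⟩ := On.exists_mk φ
  obtain ⟨ρ, hρ, h⟩ := exists_isRep hf
  refine ⟨ρ, hρ, fun r hr hrρ => ?_⟩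
  obtain ⟨w, hw⟩ := h r hrρ
  refine ⟨w, (germ_eq_mk_iff hr).2 ?_⟩
  filter_upwards [Metric.closedBall_mem_nhds 0 hr] with z hz using hw z hz

lemma exists_germ_family {σ : Type*} [Finite σ] (φ : σ → On n) : ∃ ρ > (0 : ℝ),
    ∀ r (hr : 0 < r), r ≤ ρ → ∃ v : σ → PolydiscAlg n r, ∀ s, germ hr (v s) = φ s := by
  choose ρ hρ h using fun s => exists_germ (φ s)
  obtain ⟨ρ₀, hρ₀, hle⟩ : ∃ ρ₀ > (0 : ℝ), ∀ s, ρ₀ ≤ ρ s := by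
    have h1 : ∀ᶠ t : ℝ in 𝓝[>] 0, ∀ s, t ≤ ρ s :=
      eventually_all.2 fun s => nhdsWithin_le_nhds (Iic_mem_nhds (hρ s))
    obtain ⟨t, ht, ht'⟩ := (h1.and self_mem_nhdsWithin).exists
    exact ⟨t, ht', ht⟩
  refine ⟨ρ₀, hρ₀, fun r hr hrρ => ?_⟩
  choose v hv using fun s => h s r hr (hrρ.trans (hle s))
  exact ⟨v, hv⟩

end PolydiscAlg

end Germs

section Preparation

open PolydiscAlg

variable {n m : ℕ} {r : ℝ} {ι : Type*} [Fintype ι]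

/-- Coefficients of the expansion of a function with respect to a generating family of the
fibre algebra, as analytic functions of the fibre coordinates. -/
lemma exists_fibre_coeff {E : ι → Fin 1 → PolydiscAlg n r} {φ : Fin m → PolydiscAlg n r}
    (hr : 0 < r) (h : HasRI E (fun k (_ : Fin 1) => φ k)) (h0 : ∀ k, ev 0 (φ k) = 0) :
    ∃ c : Cn m → PolydiscAlg n r →L[ℂ] (ι → ℂ), AnalyticAt ℂ c 0 ∧
      (∀ᶠ z in 𝓝 (0 : Cn n), ∀ v,
        ev z v = ∑ i, c (fun k => ev z (φ k)) v i * ev z (E i 0)) ∧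
      (∀ᶠ y in 𝓝 (0 : Cn m),
        IndepMod E (fun k (_ : Fin 1) => φ k - algebraMap ℂ (PolydiscAlg n r) (y k)) →
          ∀ w : Fin m → PolydiscAlg n r,
            c y (∑ k, w k * (φ k - algebraMap ℂ (PolydiscAlg n r) (y k))) = 0) := by
  obtain ⟨T, hT⟩ := exists_analytic_rightInverse h
  let a : Cn m → Fin m → Fin 1 → PolydiscAlg n r :=
    fun y k _ => φ k - algebraMap ℂ (PolydiscAlg n r) (y k)
  have ha : ∀ y, AnalyticAt ℂ a y := by
    intro y
    refine analyticAt_pi_iff.2 fun k => analyticAt_pi_iff.2 fun _ => ?_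
    refine analyticAt_const.sub ?_
    refine AnalyticAt.comp (g := fun c : ℂ => algebraMap ℂ (PolydiscAlg n r) c)
      (f := fun y : Cn m => y k) ?_ (On.analyticAt_coord k y)
    exact ContinuousLinearMap.analyticAt (𝕜 := ℂ) (E := ℂ) (F := PolydiscAlg n r)
      (Algebra.linearMap ℂ (PolydiscAlg n r)).toContinuousLinearMap _
  have ha0 : a 0 = fun k (_ : Fin 1) => φ k := by
    funext k _
    change φ k - algebraMap ℂ _ ((0 : Cn m) k) = φ k
    rw [Pi.zero_apply, map_zero, sub_zero]
  have hTa : ∀ᶠ y in 𝓝 (0 : Cn m), AnalyticAt ℂ T (a y) ∧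
      (presOp E (a y)).comp (T (a y)) = .id ℂ _ := by
    have h1 := hT
    rw [← ha0] at h1
    exact (ha 0).continuousAt.eventually h1
  let dg : PolydiscAlg n r →L[ℂ] (Fin 1 → PolydiscAlg n r) :=
    ContinuousLinearMap.pi fun _ => .id ℂ _
  let Ψ : ((Fin 1 → PolydiscAlg n r) →L[ℂ] (ι → ℂ) × (Fin m → PolydiscAlg n r)) →L[ℂ]
      (PolydiscAlg n r →L[ℂ] (ι → ℂ)) :=
    (ContinuousLinearMap.compL ℂ (PolydiscAlg n r) ((ι → ℂ) × (Fin m → PolydiscAlg n r))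
      (ι → ℂ) (ContinuousLinearMap.fst ℂ _ _)).comp
      ((ContinuousLinearMap.compL ℂ (PolydiscAlg n r) (Fin 1 → PolydiscAlg n r)
      ((ι → ℂ) × (Fin m → PolydiscAlg n r))).flip dg)
  have hΨ : ∀ t v, Ψ t v = (t (fun _ => v)).1 := fun t v => rfl
  refine ⟨fun y => Ψ (T (a y)), ?_, ?_, ?_⟩
  · refine AnalyticAt.comp (g := Ψ) (f := fun y => T (a y))
      (ContinuousLinearMap.analyticAt (𝕜 := ℂ)
        (E := (Fin 1 → PolydiscAlg n r) →L[ℂ] (ι → ℂ) × (Fin m → PolydiscAlg n r))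
        (F := PolydiscAlg n r →L[ℂ] (ι → ℂ)) Ψ _) ?_
    exact AnalyticAt.comp (g := T) (f := a) hTa.self_of_nhds.1 (ha 0)
  · have hφ : ContinuousAt (fun z : Cn n => (fun k => ev z (φ k) : Cn m)) 0 :=
      continuousAt_pi.2 fun k =>
        (analyticAt_ev_apply (Metric.mem_ball_self hr) (φ k)).continuousAt
    have h00 : (fun k => ev (0 : Cn n) (φ k) : Cn m) = 0 := funext h0
    rw [← h00] at hTa
    have h1 := hφ.eventually hTa
    filter_upwards [h1, Metric.closedBall_mem_nhds 0 hr] with z hz hzr v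
    set y : Cn m := fun k => ev z (φ k) with hy
    have h2 : presOp E (a y) (T (a y) (fun _ => v)) = fun _ => v :=
      DFunLike.congr_fun hz.2 _
    have h3 := congrArg (ev z) (congrFun h2 0)
    rw [presOp_apply, frameOp_apply, colOp_apply, Pi.add_apply, map_add, Finset.sum_apply,
      Finset.sum_apply, map_sum, map_sum] at h3
    rw [← h3, hΨ]
    have h4 : ∀ k, ev z (((T (a y) (fun _ => v)).2 k • a y k) 0) = 0 := by
      intro k
      rw [Pi.smul_apply, smul_eq_mul, ev_mul hzr]
      change _ * ev z (φ k - algebraMap ℂ _ (y k)) = 0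
      rw [map_sub, ev_algebraMap hzr, hy, sub_self, mul_zero]
    rw [Finset.sum_eq_zero (s := Finset.univ) fun k _ => h4 k, add_zero]
    refine Finset.sum_congr rfl fun i _ => ?_
    rw [Pi.smul_apply, map_smul, smul_eq_mul]
  · filter_upwards [hTa] with y hy hI w
    rw [hΨ]
    have := fst_rightInverse_frame hI hy.2 0 w
    rw [map_zero, zero_add] at this
    convert this using 3
    funext q
    rw [colOp_apply, Finset.sum_apply]
    rfl

namespace On

lemma exists_lift_span {φ : Fin m → On n} {x : On n} (h : x ∈ Ideal.span (Set.range φ)) :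
    ∃ w : Fin m → On n, ∑ k, w k * φ k = x := by
  obtain ⟨w, hw⟩ := (Submodule.mem_span_range_iff_exists_fun (On n)).1 h
  exact ⟨w, hw⟩

/-- The map with given components. -/
lemma analyticAt_map {φ : Fin m → Cn n → ℂ} (hφ : ∀ k, AnalyticAt ℂ (φ k) 0) :
    AnalyticAt ℂ (fun z k => φ k z : Cn n → Cn m) 0 :=
  analyticAt_pi_iff.2 hφ

/-- If a family of germs generates an ideal of definition, then every germ is a combination
of short monomials whose coefficients are analytic functions of the family. -/
theorem exists_preparation {φ : Fin m → Cn n → ℂ} (hφ : ∀ k, AnalyticAt ℂ (φ k) 0)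
    (h0 : (fun k => φ k 0) = (0 : Cn m)) (K : ℕ)
    (hK : ∀ j, (X j : On n) ^ K ∈ Ideal.span (Set.range fun k => mk (φ k) (hφ k))) (v : On n) :
    ∃ c : (Fin n → Fin K) → On m,
      v = ∑ e, pullback (fun z k => φ k z) (analyticAt_map hφ) h0 (c e) *
        ∏ i, (X i : On n) ^ (e i : ℕ) := by
  choose w hw using fun j => exists_lift_span (hK j)
  obtain ⟨ρ, hρ, hl⟩ := exists_germ_family
    (fun s : Fin m ⊕ Fin n × Fin m ⊕ Unit => Sum.elim (fun k => mk (φ k) (hφ k))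
      (Sum.elim (fun q => w q.1 q.2) fun _ => v) s)
  obtain ⟨L, hL⟩ := hl ρ hρ le_rfl
  let E : (Fin n → Fin K) → Fin 1 → PolydiscAlg n ρ := fun e _ => ∏ i, PolydiscAlg.X i ^ (e i : ℕ)
  obtain ⟨D, hD⟩ := exists_gleason_zero (n := n) hρ
  have hRI : HasRI E (fun k (_ : Fin 1) => L (.inl k)) := by
    refine hasRI_of_monomials PolydiscAlg.X (ev 0) D hD K ?_ ?_
    · intro j k
      refine ⟨fun l => L (.inr (.inl (j, l))), ?_⟩
      funext q
      apply germ_injective hρ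
      rw [colOp_apply, Finset.sum_apply, map_sum, Pi.smul_apply, Subsingleton.elim q k,
        Pi.single_eq_same, smul_eq_mul, mul_one, map_pow, germ_X, ← hw j]
      refine Finset.sum_congr rfl fun l _ => ?_
      rw [Pi.smul_apply, smul_eq_mul, map_mul, hL, hL]
      rfl
    · intro e he k
      classical
      let e' : Fin n → Fin K := fun i => ⟨e i, he i⟩
      refine ⟨(fun b => if b = e' then 1 else 0, 0), ?_⟩
      rw [presOp_apply, map_zero, add_zero, frameOp_apply]
      simp only [ite_smul, one_smul, zero_smul, Finset.sum_ite_eq', Finset.mem_univ, if_true]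
      funext q
      rw [Pi.smul_apply, Subsingleton.elim q k, Pi.single_eq_same, smul_eq_mul, mul_one]
  have hLφ : ∀ k, (fun z => ev z (L (.inl k))) =ᶠ[𝓝 0] φ k := fun k =>
    (germ_eq_mk_iff (hf := hφ k) hρ).1 (hL (.inl k))
  obtain ⟨c, hc, hcv, -⟩ := exists_fibre_coeff hρ hRI fun k =>
    ((hLφ k).self_of_nhds).trans (congrFun h0 k)
  have hca : ∀ e, AnalyticAt ℂ (fun y => c y (L (.inr (.inr ()))) e) 0 := by
    intro e
    have h1 : AnalyticAt ℂ (fun y => c y (L (.inr (.inr ())))) 0 :=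
      ((ContinuousLinearMap.id ℂ (PolydiscAlg n ρ →L[ℂ] ((Fin n → Fin K) → ℂ))).analyticAt_bilinear
        (c 0, L (.inr (.inr ())))).comp₂ hc analyticAt_const
    exact analyticAt_pi_iff.1 h1 e
  refine ⟨fun e => mk _ (hca e), ?_⟩
  have h2 : v = germ hρ (L (.inr (.inr ()))) := (hL (.inr (.inr ()))).symm
  have h3 : ∀ e, ∏ i, (X i : On n) ^ (e i : ℕ) = germ hρ (E e 0) := by
    intro e
    rw [map_prod]
    exact Finset.prod_congr rfl fun i _ => by rw [map_pow, germ_X]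
  have h4 : AnalyticAt ℂ (fun z : Cn n => ∑ e, c (fun k => φ k z) (L (.inr (.inr ()))) e *
      ev z (E e 0)) 0 := by
    refine Finset.analyticAt_fun_sum _ fun e _ => AnalyticAt.mul ?_
      (analyticAt_ev_apply (Metric.mem_ball_self hρ) _)
    have h5 := hca e
    rw [← h0] at h5
    exact AnalyticAt.comp (g := fun y => c y (L (.inr (.inr ()))) e)
      (f := fun z : Cn n => (fun k => φ k z : Cn m)) h5 (analyticAt_map hφ)
  have h6 : ∑ e, pullback (fun z k => φ k z) (analyticAt_map hφ) h0 (mk _ (hca e)) *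
      ∏ i, (X i : On n) ^ (e i : ℕ) = mk _ h4 := by
    refine Subtype.ext ?_
    rw [AddSubmonoidClass.coe_finsetSum]
    have h7 : (↑(mk _ h4) : Germ (𝓝 (0 : Cn n)) ℂ) = ∑ e : Fin n → Fin K,
      ((fun z : Cn n => c (fun k => φ k z) (L (.inr (.inr ()))) e * ev z (E e 0) : Cn n → ℂ) :
        Germ (𝓝 (0 : Cn n)) ℂ) := by
      have := map_sum (Germ.coeRingHom (𝓝 (0 : Cn n)) (R := ℂ)) (fun e : Fin n → Fin K =>
        (fun z : Cn n => c (fun k => φ k z) (L (.inr (.inr ()))) e * ev z (E e 0) : Cn n → ℂ))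
        Finset.univ
      refine Eq.trans ?_ this
      refine congrArg (fun f : Cn n → ℂ => (f : Germ (𝓝 (0 : Cn n)) ℂ)) ?_
      funext z
      rw [Finset.sum_apply]
    rw [h7]
    refine Finset.sum_congr rfl fun e _ => ?_
    rw [h3]
    rfl
  rw [h6, h2, germ_eq_mk_iff]
  filter_upwards [hcv, eventually_all.2 hLφ] with z hz hz'
  rw [hz, funext hz']

end On

end Preparation

section Noetherian

open PolydiscAlg

variable {n m : ℕ}

namespace On

lemma analyticAt_substMap (s : Finset (Fin n)) : AnalyticAt ℂ (substMap s (0 : Cn n)) 0 := by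
  refine analyticAt_pi_iff.2 fun j => ?_
  by_cases hj : j ∈ s
  · exact (analyticAt_const (v := (0 : ℂ))).congr (Eventually.of_forall fun z => by simp [substMap, hj])
  · exact (analyticAt_coord j 0).congr (Eventually.of_forall fun z => by simp [substMap, hj])

lemma substMap_zero (s : Finset (Fin n)) : substMap s (0 : Cn n) 0 = 0 := by
  funext j
  simp [substMap]

lemma exists_gleason_partial {k : ℕ} (hk : k ≤ n) (φ : On n) : ∃ q : Fin n → On n,
    φ = pullback _ (analyticAt_substMap (Finset.univ.filter fun j : Fin n => (j : ℕ) < k))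
      (substMap_zero _) φ +
      ∑ i ∈ Finset.univ.filter (fun j : Fin n => (j : ℕ) < k), X i * q i := by
  obtain ⟨ρ, hρ, h⟩ := exists_germ φ
  obtain ⟨v, rfl⟩ := h ρ hρ le_rfl
  obtain ⟨D, hD⟩ := PolydiscAlg.exists_gleason_partial (n := n) (Metric.mem_ball_self hρ)
  refine ⟨fun i => germ hρ (D i v), ?_⟩
  have hv := analyticAt_ev_apply (Metric.mem_ball_self hρ) v
  have h1 := (analyticAt_substMap (Finset.univ.filter fun j : Fin n => (j : ℕ) < k))
  rw [← substMap_zero (Finset.univ.filter fun j : Fin n => (j : ℕ) < k)] at hv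
  have h2 : pullback _ h1 (substMap_zero _) (germ hρ v) = mk _ (hv.comp h1) := rfl
  rw [h2, ← sub_eq_iff_eq_add']
  have h3 : ∀ i, X i * germ hρ (D i v) = germ hρ (PolydiscAlg.X i * D i v) := by
    intro i
    rw [map_mul, germ_X]
  simp_rw [h3]
  rw [← map_sum, sub_eq_iff_eq_add, germ_eq_mk, germ_eq_mk, mk_add, mk_eq_mk]
  filter_upwards [Metric.closedBall_mem_nhds 0 hρ] with z hz
  rw [hD k hk v z hz, map_sum, add_comm]
  refine congrArg₂ _ (Finset.sum_congr rfl fun i _ => ?_) rfl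
  rw [ev_mul hz, ev_X hz, Pi.zero_apply, sub_zero]

/-- The projection forgetting the last coordinate. -/
lemma analyticAt_init : AnalyticAt ℂ (fun (z : Cn (n + 1)) (j : Fin n) => z j.castSucc) 0 :=
  analyticAt_pi_iff.2 fun j => analyticAt_coord j.castSucc 0

lemma analyticAt_cons : AnalyticAt ℂ (fun y : Cn n => (Fin.cons 0 y : Cn (n + 1))) 0 := by
  refine analyticAt_pi_iff.2 fun j => ?_
  refine Fin.cases ?_ (fun i => ?_) j
  · exact analyticAt_const
  · exact analyticAt_coord i 0

lemma exists_pow_last {f : Cn (n + 1) → ℂ} (hf : AnalyticAt ℂ f 0)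
    (hne : ¬ ∀ᶠ t in 𝓝 (0 : ℂ), f (Pi.single (Fin.last n) t) = 0) :
    ∃ (K : ℕ) (u : On (n + 1)) (q : Fin n → On (n + 1)),
      X (Fin.last n) ^ K = u * mk f hf + ∑ j, q j * X j.castSucc := by
  set S := Finset.univ.filter fun j : Fin (n + 1) => (j : ℕ) < n with hS
  obtain ⟨q, hq⟩ := exists_gleason_partial (Nat.le_succ n) (mk f hf)
  have hh : AnalyticAt ℂ (fun t : ℂ => f (Pi.single (Fin.last n) t)) 0 := by
    refine AnalyticAt.comp (g := f) (f := fun t : ℂ => (Pi.single (Fin.last n) t : Cn (n + 1))) ?_ ?_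
    · simpa using hf
    · exact ContinuousLinearMap.analyticAt (𝕜 := ℂ) (E := ℂ) (F := Cn (n + 1))
        (ContinuousLinearMap.single ℂ (fun _ : Fin (n + 1) => ℂ) (Fin.last n)) 0
  obtain ⟨K, u, hu, hu0, hfu⟩ := hh.exists_eventuallyEq_pow_smul_nonzero_iff.2 hne
  have hul : AnalyticAt ℂ (fun z : Cn (n + 1) => u (z (Fin.last n))) 0 :=
    AnalyticAt.comp (g := u) (f := fun z : Cn (n + 1) => z (Fin.last n)) hu (analyticAt_coord _ 0)
  have hunit : IsUnit (mk _ hul) := (isUnit_iff _).2 (by rw [value_mk]; exact hu0)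
  obtain ⟨w, hw⟩ := hunit.exists_left_inv
  have hsub : ∀ z : Cn (n + 1), substMap S 0 z = Pi.single (Fin.last n) (z (Fin.last n)) := by
    intro z
    funext j
    refine Fin.lastCases ?_ (fun i => ?_) j
    · simp [substMap, hS]
    · simp [substMap, hS]
  have hp : pullback _ (analyticAt_substMap S) (substMap_zero _) (mk f hf) =
      X (Fin.last n) ^ K * mk _ hul := by
    have h1 : (X (Fin.last n) : On (n + 1)) ^ K =
        mk (fun z => z (Fin.last n) ^ K) ((analyticAt_coord _ 0).pow K) := rfl
    rw [h1, mk_mul, pullback_mk _ _ _ (by rw [substMap_zero]; exact hf), mk_eq_mk]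
    have h2 : Tendsto (fun z : Cn (n + 1) => z (Fin.last n)) (𝓝 0) (𝓝 0) :=
      (continuous_apply (Fin.last n)).tendsto' _ _ rfl
    filter_upwards [h2.eventually hfu] with z hz
    rw [hsub, hz, sub_zero, smul_eq_mul]
  refine ⟨K, w, fun j => - (w * q j.castSucc), ?_⟩
  have h3 : ∑ i ∈ S, X i * q i = ∑ j : Fin n, X j.castSucc * q j.castSucc := by
    rw [hS, Finset.sum_filter, Fin.sum_univ_castSucc]
    simp
  rw [← hS, hp, h3] at hq
  have h4 : ∑ j : Fin n, -(w * q j.castSucc) * X j.castSucc =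
      - (w * ∑ j : Fin n, X j.castSucc * q j.castSucc) := by
    rw [Finset.mul_sum, ← Finset.sum_neg_distrib]
    exact Finset.sum_congr rfl fun j _ => by ring
  rw [h4, hq]
  linear_combination (-(X (Fin.last n) ^ K)) * hw

theorem isNoetherian_quotient [IsNoetherianRing (On n)] {f : Cn (n + 1) → ℂ}
    (hf : AnalyticAt ℂ f 0) (hf0 : f 0 = 0)
    (hne : ¬ ∀ᶠ t in 𝓝 (0 : ℂ), f (Pi.single (Fin.last n) t) = 0) :
    IsNoetherian (On (n + 1)) (On (n + 1) ⧸ Ideal.span {mk f hf}) := by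
  obtain ⟨K, u, q, hK⟩ := exists_pow_last hf hne
  let φ : Fin (n + 1) → Cn (n + 1) → ℂ := Fin.cons f fun j z => z j.castSucc
  have hφ : ∀ k, AnalyticAt ℂ (φ k) 0 := by
    intro k
    refine Fin.cases ?_ (fun i => ?_) k
    · exact hf
    · exact analyticAt_coord _ 0
  have h0 : (fun k => φ k 0) = (0 : Cn (n + 1)) := by
    funext k
    refine Fin.cases ?_ (fun i => ?_) k
    · exact hf0
    · rfl
  have hmem0 : mk f hf ∈ Ideal.span (Set.range fun k => mk (φ k) (hφ k)) :=
    Ideal.subset_span ⟨0, rfl⟩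
  have hmem1 : ∀ j : Fin n, X j.castSucc ∈ Ideal.span (Set.range fun k => mk (φ k) (hφ k)) :=
    fun j => Ideal.subset_span ⟨j.succ, rfl⟩
  have hpow : ∀ j, (X j : On (n + 1)) ^ (K + 1) ∈
      Ideal.span (Set.range fun k => mk (φ k) (hφ k)) := by
    intro j
    refine Fin.lastCases ?_ (fun i => ?_) j
    · rw [pow_succ, hK]
      refine Ideal.mul_mem_right _ _ (Ideal.add_mem _ (Ideal.mul_mem_left _ _ hmem0) ?_)
      exact Ideal.sum_mem _ fun i _ => Ideal.mul_mem_left _ _ (hmem1 i)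
    · rw [pow_succ]
      exact Ideal.mul_mem_left _ _ (hmem1 i)
  let π : On n →ₐ[ℂ] On (n + 1) := pullback _ analyticAt_init rfl
  let _ : Algebra (On n) (On (n + 1)) := π.toRingHom.toAlgebra
  have key : ∀ c : On (n + 1), ∃ c' : On n,
      pullback (fun z k => φ k z) (analyticAt_map hφ) h0 c - π c' ∈ Ideal.span {mk f hf} := by
    intro c
    obtain ⟨q, hq⟩ := exists_gleason_partial (Nat.le_add_left 1 n) c
    refine ⟨pullback _ analyticAt_cons (by funext j; exact Fin.cases rfl (fun _ => rfl) j) c, ?_⟩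
    have h1 : Finset.univ.filter (fun j : Fin (n + 1) => (j : ℕ) < 1) = {0} := by
      ext j
      rw [Finset.mem_filter, Finset.mem_singleton, Fin.ext_iff]
      simp only [Finset.mem_univ, true_and, Fin.val_zero]
      omega
    rw [h1, Finset.sum_singleton] at hq
    have h2 : pullback (fun z k => φ k z) (analyticAt_map hφ) h0 (X 0) = mk f hf := rfl
    have h3 : pullback (fun z k => φ k z) (analyticAt_map hφ) h0
        (pullback _ (analyticAt_substMap {0}) (substMap_zero _) c) =
        π (pullback _ analyticAt_cons (by funext j; exact Fin.cases rfl (fun _ => rfl) j) c) := by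
      obtain ⟨c, hc, rfl⟩ := exists_mk c
      refine Subtype.ext ?_
      refine congrArg (fun f : Cn (n + 1) → ℂ => (f : Germ (𝓝 (0 : Cn (n + 1))) ℂ)) ?_
      funext z
      refine congrArg c ?_
      funext j
      refine Fin.cases ?_ (fun i => ?_) j
      · simp [substMap]
      · simp [substMap, φ]
    rw [← h3]
    nth_rewrite 1 [hq]
    rw [map_add, map_mul, h2, add_sub_cancel_left]
    exact Ideal.mul_mem_right _ _ (Ideal.subset_span rfl)
  have hfin : Module.Finite (On n) (On (n + 1) ⧸ Ideal.span {mk f hf}) := by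
    classical
    refine ⟨⟨Finset.univ.image fun e : Fin (n + 1) → Fin (K + 1) =>
      Ideal.Quotient.mk (Ideal.span {mk f hf}) (∏ i, (X i : On (n + 1)) ^ (e i : ℕ)), ?_⟩⟩
    rw [eq_top_iff]
    rintro x -
    obtain ⟨v, rfl⟩ := Ideal.Quotient.mk_surjective x
    obtain ⟨c, hc⟩ := exists_preparation hφ h0 (K + 1) hpow v
    choose c' hc' using fun e => key (c e)
    have h1 : Ideal.Quotient.mk (Ideal.span {mk f hf}) v = ∑ e, c' e •
        Ideal.Quotient.mk (Ideal.span {mk f hf}) (∏ i, (X i : On (n + 1)) ^ (e i : ℕ)) := by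
      have h2 : ∀ e, c' e • Ideal.Quotient.mk (Ideal.span {mk f hf})
          (∏ i, (X i : On (n + 1)) ^ (e i : ℕ)) =
          Ideal.Quotient.mk (Ideal.span {mk f hf})
            (π (c' e) * ∏ i, (X i : On (n + 1)) ^ (e i : ℕ)) := fun e => rfl
      simp_rw [h2]
      rw [← map_sum, Ideal.Quotient.eq, hc, ← Finset.sum_sub_distrib]
      refine Ideal.sum_mem _ fun e _ => ?_
      rw [← sub_mul]
      exact Ideal.mul_mem_right _ _ (hc' e)
    rw [h1]
    refine Submodule.sum_mem _ fun e _ => Submodule.smul_mem _ _ (Submodule.subset_span ?_)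
    simp
  have : IsNoetherian (On n) (On (n + 1) ⧸ Ideal.span {mk f hf}) :=
    isNoetherian_of_isNoetherianRing_of_finite _ _
  exact isNoetherian_of_tower (On n) this

lemma fg_of_mem {J : Ideal (On n)} {x : On n} (hx : x ∈ J)
    (h : IsNoetherian (On n) (On n ⧸ Ideal.span {x})) : J.FG := by
  refine Submodule.fg_of_fg_map_of_fg_inf_ker (Submodule.mkQ (Ideal.span {x})) (h.noetherian _) ?_
  rw [Submodule.ker_mkQ, inf_eq_right.2 ((Ideal.span_singleton_le_iff_mem J).2 hx)]
  exact ⟨{x}, by simp [Ideal.span]⟩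

instance isNoetherianRing_zero : IsNoetherianRing (On 0) := by
  refine isNoetherianRing_of_surjective ℂ (On 0) (algebraMap ℂ (On 0)) fun x => ?_
  obtain ⟨f, hf, rfl⟩ := exists_mk x
  refine ⟨f 0, ?_⟩
  rw [algebraMap_eq_mk, mk_eq_mk]
  exact Eventually.of_forall fun z => congrArg f (Subsingleton.elim _ _)

lemma isNoetherianRing_succ [IsNoetherianRing (On n)] : IsNoetherianRing (On (n + 1)) := by
  refine (isNoetherianRing_iff_ideal_fg _).2 fun J => ?_
  by_cases hJ : J = ⊥
  · rw [hJ]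
    exact Submodule.fg_bot
  obtain ⟨x, hxJ, hx0⟩ := Submodule.exists_mem_ne_zero_of_ne_bot hJ
  obtain ⟨f, hf, rfl⟩ := exists_mk x
  by_cases hf0 : f 0 = 0
  swap
  · rw [J.eq_top_of_isUnit_mem hxJ ((isUnit_iff _).2 hf0)]
    exact ⟨{1}, by simp⟩
  -- a direction in which `f` does not vanish identically
  obtain ⟨ρ, hρ, hfρ⟩ := hf.exists_ball_analyticOnNhd
  obtain ⟨a, ha, hfa⟩ : ∃ a ∈ Metric.ball (0 : Cn (n + 1)) ρ, f a ≠ 0 := by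
    by_contra hcon
    push Not at hcon
    apply hx0
    rw [zero_eq_mk, mk_eq_mk]
    filter_upwards [Metric.ball_mem_nhds 0 hρ] with z hz using hcon z hz
  have ha0 : a ≠ 0 := by
    rintro rfl
    exact hfa hf0
  have he0 : (Pi.single (Fin.last n) 1 : Cn (n + 1)) ≠ 0 := by
    intro h
    have := congrFun h (Fin.last n)
    simp at this
  obtain ⟨A, hA⟩ := SeparatingDual.exists_continuousLinearEquiv_apply_eq (R := ℂ) he0 ha0
  have hAan : AnalyticAt ℂ (fun z => A z) 0 :=
    ContinuousLinearMap.analyticAt (𝕜 := ℂ) (E := Cn (n + 1)) (F := Cn (n + 1))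
      (A : Cn (n + 1) →L[ℂ] Cn (n + 1)) 0
  have hBan : AnalyticAt ℂ (fun z => A.symm z) 0 :=
    ContinuousLinearMap.analyticAt (𝕜 := ℂ) (E := Cn (n + 1)) (F := Cn (n + 1))
      (A.symm : Cn (n + 1) →L[ℂ] Cn (n + 1)) 0
  let θ := pullback (fun z => A z) hAan (map_zero A)
  let θ' := pullback (fun z => A.symm z) hBan (map_zero A.symm)
  have hθ : ∀ y, θ' (θ y) = y := by
    intro y
    obtain ⟨y, hy, rfl⟩ := exists_mk y
    refine Subtype.ext ?_
    refine congrArg (fun f : Cn (n + 1) → ℂ => (f : Germ (𝓝 (0 : Cn (n + 1))) ℂ)) ?_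
    funext z
    exact congrArg y (A.apply_symm_apply z)
  have hfA : AnalyticAt ℂ (fun z => f (A z)) 0 :=
    AnalyticAt.comp (g := f) (f := fun z => A z) (by rwa [map_zero]) hAan
  have hne : ¬ ∀ᶠ t in 𝓝 (0 : ℂ), f (A (Pi.single (Fin.last n) t)) = 0 := by
    intro hev
    have h1 : ∀ t : ℂ, A (Pi.single (Fin.last n) t) = t • a := by
      intro t
      rw [← hA, ← map_smul, ← Pi.single_smul, smul_eq_mul, mul_one]
    simp_rw [h1] at hev
    have h2 : IsPreconnected {t : ℂ | t • a ∈ Metric.ball (0 : Cn (n + 1)) ρ} := by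
      have h3 : {t : ℂ | t • a ∈ Metric.ball (0 : Cn (n + 1)) ρ} =
          Metric.ball 0 (ρ / ‖a‖) := by
        ext t
        change t • a ∈ Metric.ball (0 : Cn (n + 1)) ρ ↔ _
        rw [mem_ball_zero_iff, mem_ball_zero_iff, norm_smul, lt_div_iff₀ (norm_pos_iff.2 ha0)]
      rw [h3]
      exact (convex_ball _ _).isPreconnected
    have h4 : Set.EqOn (fun t : ℂ => f (t • a)) 0
        {t : ℂ | t • a ∈ Metric.ball (0 : Cn (n + 1)) ρ} := by
      refine AnalyticOnNhd.eqOn_zero_of_preconnected_of_eventuallyEq_zero (𝕜 := ℂ) (z₀ := 0) ?_ h2 ?_ hev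
      · intro t ht
        refine AnalyticAt.comp (g := f) (f := fun t : ℂ => t • a) (hfρ _ ht) ?_
        exact ContinuousLinearMap.analyticAt (𝕜 := ℂ) (E := ℂ) (F := Cn (n + 1))
          ((ContinuousLinearMap.id ℂ ℂ).smulRight a) t
      · rw [Set.mem_ofPred_eq, zero_smul]
        exact Metric.mem_ball_self hρ
    have h5 := @h4 1 (by rw [Set.mem_ofPred_eq]; rwa [one_smul])
    apply hfa
    simpa using h5
  have hfg : (J.map (θ : On (n + 1) →+* On (n + 1))).FG := by
    refine fg_of_mem (x := mk _ hfA) (Ideal.mem_map_of_mem _ hxJ)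
      (isNoetherian_quotient hfA (by rw [map_zero]; exact hf0) hne)
  have hJ' : J = (J.map (θ : On (n + 1) →+* On (n + 1))).map
      (θ' : On (n + 1) →+* On (n + 1)) := by
    rw [Ideal.map_map]
    have : ((θ' : On (n + 1) →+* On (n + 1)).comp (θ : On (n + 1) →+* On (n + 1))) =
        RingHom.id _ := RingHom.ext hθ
    rw [this, Ideal.map_id]
  rw [hJ']
  exact hfg.map _

instance isNoetherianRing : ∀ n : ℕ, IsNoetherianRing (On n)
  | 0 => isNoetherianRing_zero
  | n + 1 => haveI := isNoetherianRing n; isNoetherianRing_succ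

end On

end Noetherian

section GermPresentation

open PolydiscAlg

variable {n p : ℕ}

/-- The columns of the matrix `M` together with the Koszul columns of `h`. -/
def koszulCols {R : Type*} [CommRing R] (M : Fin n → Fin p → R) (h : Fin p → R) :
    Fin n ⊕ Fin p × Fin p → Fin p → R :=
  Sum.elim M fun q => Pi.single q.2 (h q.1) - Pi.single q.1 (h q.2)

/-- The cokernel of the columns of `M` and the Koszul columns of `h`. -/
abbrev KoszulCoker (M : Fin n → Fin p → On n) (h : Fin p → On n) : Type :=
  (Fin p → On n) ⧸ Submodule.span (On n) (Set.range (koszulCols M h))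

namespace On

/-- On a finite-dimensional module over the ring of germs, germs vanishing at the origin act
nilpotently. -/
lemma exists_pow_smul_eq_zero {Q : Type*} [AddCommGroup Q] [Module (On n) Q] [Module ℂ Q]
    [IsScalarTower ℂ (On n) Q] [Module.Finite ℂ Q] {x : On n} (hx : value x = 0) :
    ∃ K : ℕ, ∀ q : Q, x ^ K • q = 0 := by
  let f : Module.End ℂ Q := Algebra.lsmul ℂ ℂ Q x
  have hfi : IsIntegral ℂ f := Algebra.IsIntegral.isIntegral f
  obtain ⟨R, hR, hnd⟩ := Polynomial.exists_eq_pow_rootMultiplicity_mul_and_not_dvd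
    (minpoly ℂ f) (minpoly.ne_zero hfi) 0
  rw [map_zero, sub_zero] at hR hnd
  refine ⟨(minpoly ℂ f).rootMultiplicity 0, fun q => ?_⟩
  have hu : IsUnit (Polynomial.aeval x R) := by
    rw [isUnit_iff, ← Polynomial.aeval_algHom_apply, hx]
    intro h0
    apply hnd
    rw [Polynomial.X_dvd_iff, Polynomial.coeff_zero_eq_aeval_zero]
    simpa using h0
  have h1 : Polynomial.aeval x (minpoly ℂ f) • q = 0 := by
    have h2 : Algebra.lsmul ℂ ℂ Q (Polynomial.aeval x (minpoly ℂ f)) = 0 := by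
      rw [← Polynomial.aeval_algHom_apply]
      exact minpoly.aeval ℂ f
    exact DFunLike.congr_fun h2 q
  rw [hR, map_mul, map_pow, Polynomial.aeval_X, mul_comm, mul_smul] at h1
  exact hu.smul_eq_zero.1 h1

end On

lemma germ_single {r : ℝ} (hr : 0 < r) (k i : Fin p) (v : PolydiscAlg n r) :
    germ hr ((Pi.single k v : Fin p → PolydiscAlg n r) i) =
      (Pi.single k (germ hr v) : Fin p → On n) i :=
  Pi.apply_single (fun _ => germ hr) (fun _ => map_zero _) k v i

lemma germ_pairCols {r : ℝ} (hr : 0 < r) {M : Fin n → Fin p → On n} {h : Fin p → On n}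
    {l : PairSp n p (PolydiscAlg n r)} (h1 : ∀ j i, germ hr (l.1 j i) = M j i)
    (h2 : ∀ i, germ hr (l.2 i) = h i) (s : Fin n ⊕ Fin p × Fin p) (i : Fin p) :
    germ hr (pairCols l s i) = koszulCols M h s i := by
  rcases s with j | ⟨a, b⟩
  · exact h1 j i
  · rw [pairCols_inr, Pi.sub_apply, map_sub, germ_single, germ_single, h2, h2]
    rfl

/-- A finite-dimensional cokernel of germs admits a presentation by convergent power series
which stays free of constant rank under perturbation of the pair. -/
theorem exists_free_presentation (hpn : p ≤ n) (M : Fin n → Fin p → On n) (h : Fin p → On n)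
    [Module.Finite ℂ (KoszulCoker M h)] :
    ∃ ρ > (0 : ℝ), ∀ r (hr : 0 < r), r ≤ ρ → ∀ l₀ : PairSp n p (PolydiscAlg n r),
      (∀ j i, germ hr (l₀.1 j i) = M j i) → (∀ i, germ hr (l₀.2 i) = h i) →
      ∃ E : Fin (Module.finrank ℂ (KoszulCoker M h)) → Fin p → PolydiscAlg n r,
        ∀ᶠ l in 𝓝 l₀, HasRI E (pairCols l) ∧ IndepMod E (pairCols l) := by
  classical
  set N := Submodule.span (On n) (Set.range (koszulCols M h)) with hN
  let b := Module.finBasis ℂ (KoszulCoker M h)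
  choose e he using fun k => Submodule.Quotient.mk_surjective N (b k)
  choose K₀ hK₀ using fun j => On.exists_pow_smul_eq_zero (Q := KoszulCoker M h) (x := (On.X j : On n)) rfl
  obtain ⟨K, hK⟩ : ∃ K, ∀ j, K₀ j ≤ K :=
    ⟨Finset.univ.sup K₀, fun j => Finset.le_sup (Finset.mem_univ j)⟩
  have hpow : ∀ j k, ∃ w : Fin n ⊕ Fin p × Fin p → On n,
      ∑ s, w s • koszulCols M h s = (On.X j : On n) ^ K • (Pi.single k 1 : Fin p → On n) := by
    intro j k
    refine (Submodule.mem_span_range_iff_exists_fun (On n)).1 ?_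
    rw [← Submodule.Quotient.mk_eq_zero, Submodule.Quotient.mk_smul]
    obtain ⟨t, ht⟩ := Nat.exists_eq_add_of_le (hK j)
    rw [ht, pow_add, mul_comm, mul_smul, hK₀, smul_zero]
  choose w hw using hpow
  have hshort : ∀ (m : Fin n → Fin K) (k : Fin p),
      ∃ (c : Fin (Module.finrank ℂ (KoszulCoker M h)) → ℂ) (v : Fin n ⊕ Fin p × Fin p → On n),
        ∑ l, c l • e l + ∑ s, v s • koszulCols M h s =
          (∏ i, (On.X i : On n) ^ (m i : ℕ)) • (Pi.single k 1 : Fin p → On n) := by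
    intro m k
    set x := (∏ i, (On.X i : On n) ^ (m i : ℕ)) • (Pi.single k 1 : Fin p → On n)
    refine ⟨fun l => b.repr (Submodule.Quotient.mk x) l, ?_⟩
    have h1 : x - ∑ l, b.repr (Submodule.Quotient.mk x) l • e l ∈ N := by
      rw [← Submodule.Quotient.mk_eq_zero, Submodule.Quotient.mk_sub, sub_eq_zero]
      have h2 : (Submodule.Quotient.mk (∑ l, b.repr (Submodule.Quotient.mk x) l • e l) :
          KoszulCoker M h) = ∑ l, b.repr (Submodule.Quotient.mk x) l • b l := by
        have h3 := map_sum (N.mkQ.restrictScalars ℂ)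
          (fun l => b.repr (Submodule.Quotient.mk x) l • e l) Finset.univ
        refine h3.trans (Finset.sum_congr rfl fun l _ => ?_)
        rw [map_smul]
        exact congrArg _ (he l)
      exact (b.sum_repr _).symm.trans h2.symm
    obtain ⟨v, hv⟩ := (Submodule.mem_span_range_iff_exists_fun (On n)).1 h1
    exact ⟨v, by rw [hv, add_sub_cancel]⟩
  choose c v hcv using hshort
  obtain ⟨ρ, hρ, hlift⟩ := exists_germ_family
    (fun s : (Fin (Module.finrank ℂ (KoszulCoker M h)) × Fin p) ⊕
      (Fin n × Fin p × (Fin n ⊕ Fin p × Fin p)) ⊕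
      ((Fin n → Fin K) × Fin p × (Fin n ⊕ Fin p × Fin p)) =>
      Sum.elim (fun q => e q.1 q.2)
        (Sum.elim (fun q => w q.1 q.2.1 q.2.2) fun q => v q.1 q.2.1 q.2.2) s)
  refine ⟨ρ, hρ, fun r hr hrρ l₀ hM hh => ?_⟩
  obtain ⟨L, hL⟩ := hlift r hr hrρ
  have hcol : ∀ s i, germ hr (pairCols l₀ s i) = koszulCols M h s i := germ_pairCols hr hM hh
  let E : Fin (Module.finrank ℂ (KoszulCoker M h)) → Fin p → PolydiscAlg n r :=
    fun k i => L (.inl (k, i))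
  have hE : ∀ k i, germ hr (E k i) = e k i := fun k i => hL (.inl (k, i))
  refine ⟨E, free_of_monomials hr hpn l₀ K ?_ ?_ ?_⟩
  · intro j k
    refine ⟨fun s => L (.inr (.inl (j, k, s))), ?_⟩
    funext i
    apply germ_injective hr
    have h1 := congrFun (hw j k) i
    rw [Finset.sum_apply, Pi.smul_apply] at h1
    rw [colOp_apply, Finset.sum_apply, map_sum, Pi.smul_apply, smul_eq_mul, map_mul, map_pow,
      germ_X, germ_single, map_one, ← smul_eq_mul, ← h1]
    refine Finset.sum_congr rfl fun s _ => ?_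
    rw [Pi.smul_apply, smul_eq_mul, map_mul, hcol, hL]
    rfl
  · intro m hm k
    let m' : Fin n → Fin K := fun i => ⟨m i, hm i⟩
    refine ⟨(c m' k, fun s => L (.inr (.inr (m', k, s)))), ?_⟩
    funext i
    apply germ_injective hr
    have h1 := congrFun (hcv m' k) i
    rw [Pi.add_apply, Finset.sum_apply, Finset.sum_apply, Pi.smul_apply] at h1
    rw [presOp_apply, frameOp_apply, colOp_apply, Pi.add_apply, Finset.sum_apply,
      Finset.sum_apply, map_add, map_sum, map_sum, Pi.smul_apply, smul_eq_mul, map_mul, map_prod,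
      germ_single, map_one, ← smul_eq_mul]
    refine Eq.trans (congrArg₂ _ ?_ ?_) (h1.trans ?_)
    · refine Finset.sum_congr rfl fun l _ => ?_
      rw [Pi.smul_apply, map_smul, hE]
      rfl
    · refine Finset.sum_congr rfl fun s _ => ?_
      rw [Pi.smul_apply, smul_eq_mul, map_mul, hcol, hL]
      rfl
    · refine congrArg (· • _) (Finset.prod_congr rfl fun i _ => ?_)
      rw [map_pow, germ_X]
  · intro r' hr'r hr' a u hau
    have h1 : ∑ l, a l • e l ∈ N := by
      have h2 : ∑ l, a l • e l = - ∑ s, germ hr' (u s) • koszulCols M h s := by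
        rw [eq_neg_iff_add_eq_zero]
        funext i
        have h3 := congrArg (germ hr') (congrFun hau i)
        rw [frameOp_apply, colOp_apply, Pi.add_apply, Finset.sum_apply, Finset.sum_apply,
          map_add, map_sum, map_sum, Pi.zero_apply, map_zero] at h3
        rw [Pi.add_apply, Finset.sum_apply, Finset.sum_apply, Pi.zero_apply, ← h3]
        refine congrArg₂ _ (Finset.sum_congr rfl fun l _ => ?_)
          (Finset.sum_congr rfl fun s _ => ?_)
        · rw [Pi.smul_apply, Pi.smul_apply, map_smul, ← hE]
          exact congrArg _ (germ_res hr' hr'r _).symm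
        · rw [Pi.smul_apply, Pi.smul_apply, smul_eq_mul, smul_eq_mul, map_mul, ← hcol]
          exact congrArg _ (germ_res hr' hr'r _).symm
      rw [h2]
      exact Submodule.neg_mem _ (Submodule.sum_mem _ fun s _ =>
        Submodule.smul_mem _ _ (Submodule.subset_span ⟨s, rfl⟩))
    have h4 : ∑ l, a l • b l = 0 := by
      have h3 := map_sum (N.mkQ.restrictScalars ℂ) (fun l => a l • e l) Finset.univ
      have h5 : (N.mkQ.restrictScalars ℂ) (∑ l, a l • e l) = 0 :=
        (Submodule.Quotient.mk_eq_zero N).2 h1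
      rw [h5] at h3
      refine Eq.trans (Finset.sum_congr rfl fun l _ => ?_) h3.symm
      rw [map_smul]
      exact congrArg _ (he l).symm
    exact funext (Fintype.linearIndependent_iff.1 b.linearIndependent a h4)

end GermPresentation

section KoszulExact

open PolydiscAlg

variable {n p : ℕ}

/-- Syzygies of a weakly regular sequence are generated by the Koszul relations. -/
lemma exists_koszul_of_regular {R : Type*} [CommRing R] : ∀ {p : ℕ} (x : Fin p → R),
    (∀ (i : Fin p) (a : R), x i * a ∈ Ideal.span (x '' {j | j < i}) →
      a ∈ Ideal.span (x '' {j | j < i})) →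
    ∀ s : Fin p → R, ∑ i, s i * x i = 0 →
      ∃ A : Fin p → Fin p → R, (∀ i, A i i = 0) ∧ (∀ i l, A i l = - A l i) ∧
        ∀ i, s i = ∑ l, A i l * x l
  | 0, _, _, _, _ => ⟨0, fun i => i.elim0, fun i => i.elim0, fun i => i.elim0⟩
  | p + 1, x, hx, s, hs => by
    have himg : x '' {j | j < Fin.last p} = Set.range fun j : Fin p => x j.castSucc := by
      ext y
      constructor
      · rintro ⟨j, hj, rfl⟩
        exact ⟨j.castPred hj.ne, by simp⟩
      · rintro ⟨j, rfl⟩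
        exact ⟨j.castSucc, Fin.castSucc_lt_last j, rfl⟩
    have h1 : x (Fin.last p) * s (Fin.last p) ∈
        Ideal.span (Set.range fun j : Fin p => x j.castSucc) := by
      rw [Fin.sum_univ_castSucc] at hs
      have : x (Fin.last p) * s (Fin.last p) = - ∑ i : Fin p, s i.castSucc * x i.castSucc := by
        linear_combination hs
      rw [this]
      exact neg_mem (Ideal.sum_mem _ fun i _ => Ideal.mul_mem_left _ _ (Ideal.subset_span ⟨i, rfl⟩))
    have h2 := hx (Fin.last p) (s (Fin.last p)) (by rw [himg]; exact h1)
    rw [himg] at h2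
    obtain ⟨t, ht⟩ := (Submodule.mem_span_range_iff_exists_fun R).1 h2
    simp only [smul_eq_mul] at ht
    obtain ⟨A, hA0, hA1, hA2⟩ := exists_koszul_of_regular (fun j : Fin p => x j.castSucc)
      (by
        intro i a ha
        have h3 : (fun j : Fin p => x j.castSucc) '' {j | j < i} = x '' {j | j < i.castSucc} := by
          ext y
          constructor
          · rintro ⟨j, hj, rfl⟩
            exact ⟨j.castSucc, hj, rfl⟩
          · rintro ⟨j, hj, rfl⟩
            refine ⟨j.castPred (ne_of_lt (hj.trans (Fin.castSucc_lt_last i))), ?_, by simp⟩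
            exact Fin.castSucc_lt_castSucc_iff.1 (by simpa using hj)
        rw [h3] at ha ⊢
        exact hx i.castSucc a ha)
      (fun i => s i.castSucc + t i * x (Fin.last p))
      (by
        rw [Fin.sum_univ_castSucc, ← ht, Finset.sum_mul] at hs
        rw [← hs, ← Finset.sum_add_distrib]
        exact Finset.sum_congr rfl fun i _ => by ring)
    refine ⟨fun i l => Fin.lastCases (Fin.lastCases 0 (fun l => t l) l)
      (fun i => Fin.lastCases (- t i) (fun l => A i l) l) i, ?_, ?_, ?_⟩
    · intro i
      refine Fin.lastCases ?_ (fun i => ?_) i <;> simp [hA0]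
    · intro i l
      refine Fin.lastCases ?_ (fun i => ?_) i <;> refine Fin.lastCases ?_ (fun l => ?_) l
      · simp
      · simp
      · simp
      · simpa using hA1 i l
    · intro i
      refine Fin.lastCases ?_ (fun i => ?_) i
      · rw [Fin.sum_univ_castSucc]
        simp [ht]
      · rw [Fin.sum_univ_castSucc]
        simp [← hA2]

namespace On

lemma eq_zero_of_X_mul {i : Fin n} {a : On n} (h : X i * a = 0) : a = 0 := by
  obtain ⟨ρ, hρ, hl⟩ := exists_germ a
  obtain ⟨v, rfl⟩ := hl ρ hρ le_rfl
  have h1 : PolydiscAlg.X i * v = 0 := by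
    apply germ_injective hρ
    rw [map_mul, germ_X, h, map_zero]
  have h2 := le_norm_mul_sub (n := n) (r := ρ) (x := 0) (Metric.mem_ball_self hρ) i v
  rw [Pi.zero_apply, norm_zero, sub_zero, map_zero, sub_zero, h1, norm_zero] at h2
  have h3 : v = 0 := norm_le_zero_iff.1 (by nlinarith [norm_nonneg v])
  rw [h3, map_zero]

lemma regular_coord (hpn : p ≤ n) (i : Fin p) (a : On n)
    (ha : X (Fin.castLE hpn i) * a ∈
      Ideal.span ((fun j : Fin p => (X (Fin.castLE hpn j) : On n)) '' {j | j < i})) :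
    a ∈ Ideal.span ((fun j : Fin p => (X (Fin.castLE hpn j) : On n)) '' {j | j < i}) := by
  obtain ⟨q, hq⟩ := exists_gleason_partial (k := (i : ℕ)) (i.2.le.trans hpn) a
  set S := Finset.univ.filter fun j : Fin n => (j : ℕ) < i with hS
  set σ := pullback _ (analyticAt_substMap S) (substMap_zero S) with hσ
  have hσi : σ (X (Fin.castLE hpn i)) = X (Fin.castLE hpn i) := by
    refine Subtype.ext ?_
    refine congrArg (fun f : Cn n → ℂ => (f : Germ (𝓝 (0 : Cn n)) ℂ)) ?_
    funext z
    simp [substMap, hS]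
  have hσj : ∀ j ∈ S, σ (X j) = 0 := by
    intro j hj
    refine Subtype.ext ?_
    refine congrArg (fun f : Cn n → ℂ => (f : Germ (𝓝 (0 : Cn n)) ℂ)) ?_
    funext z
    simp [substMap, hj]
  have h1 : σ (X (Fin.castLE hpn i) * a) = 0 := by
    have h2 : Ideal.span ((fun j : Fin p => (X (Fin.castLE hpn j) : On n)) '' {j | j < i}) ≤
        RingHom.ker (σ : On n →+* On n) := by
      rw [Ideal.span_le]
      rintro _ ⟨j, hj, rfl⟩
      refine hσj _ ?_
      rw [hS, Finset.mem_filter]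
      exact ⟨Finset.mem_univ _, hj⟩
    exact h2 ha
  rw [map_mul, hσi] at h1
  rw [hq, eq_zero_of_X_mul h1, zero_add]
  refine Ideal.sum_mem _ fun j hj => Ideal.mul_mem_right _ _ (Ideal.subset_span ?_)
  rw [hS, Finset.mem_filter] at hj
  exact ⟨⟨j, hj.2.trans i.2⟩, hj.2, rfl⟩

end On

end KoszulExact

section KoszulExactness

open PolydiscAlg

variable {n p : ℕ}

namespace On

lemma sum_mk {σ : Type*} (s : Finset σ) {f : σ → Cn n → ℂ} (hf : ∀ e, AnalyticAt ℂ (f e) 0) :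
    ∑ e ∈ s, mk (f e) (hf e) =
      mk (fun z => ∑ e ∈ s, f e z) (Finset.analyticAt_fun_sum _ fun e _ => hf e) := by
  refine Subtype.ext ?_
  rw [AddSubmonoidClass.coe_finsetSum]
  have := map_sum (Germ.coeRingHom (𝓝 (0 : Cn n)) (R := ℂ)) f s
  refine Eq.trans this.symm ?_
  refine congrArg (fun f : Cn n → ℂ => (f : Germ (𝓝 (0 : Cn n)) ℂ)) ?_
  funext z
  rw [Finset.sum_apply]

lemma exists_value_add (φ : On n) :
    ∃ q : Fin n → On n, φ = algebraMap ℂ (On n) (value φ) + ∑ i, X i * q i := by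
  obtain ⟨q, hq⟩ := exists_gleason_partial le_rfl φ
  have h1 : (Finset.univ.filter fun j : Fin n => (j : ℕ) < n) = Finset.univ := by
    simp
  have h2 : pullback _ (analyticAt_substMap (Finset.univ.filter fun j : Fin n => (j : ℕ) < n))
      (substMap_zero _) φ = algebraMap ℂ (On n) (value φ) := by
    obtain ⟨f, hf, rfl⟩ := exists_mk φ
    refine Subtype.ext ?_
    refine congrArg (fun f : Cn n → ℂ => (f : Germ (𝓝 (0 : Cn n)) ℂ)) ?_
    funext z
    simp only [Function.comp_apply, h1, substMap_univ]
    rfl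
  refine ⟨q, hq.trans ?_⟩
  rw [h2]
  simp only [h1]

/-- A quotient by the ideal of an `n`-tuple containing powers of the coordinates is
finite-dimensional. -/
lemma finite_koszulCoker_one {φ : Fin n → On n} (h0 : ∀ k, value (φ k) = 0) (K : ℕ)
    (hK : ∀ j, (X j : On n) ^ K ∈ Ideal.span (Set.range φ)) :
    Module.Finite ℂ (KoszulCoker (fun j (_ : Fin 1) => φ j) 0) := by
  choose f hf hφ using fun k => exists_mk (φ k)
  obtain rfl : φ = fun k => mk (f k) (hf k) := funext hφ
  have hf0 : (fun k => f k 0) = (0 : Cn n) := funext h0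
  set N := Submodule.span (On n) (Set.range (koszulCols (fun j (_ : Fin 1) => mk (f j) (hf j)) 0))
    with hN
  have hmem : ∀ x ∈ Ideal.span (Set.range fun k => mk (f k) (hf k)),
      (fun _ : Fin 1 => x) ∈ N := by
    intro x hx
    obtain ⟨w, rfl⟩ := exists_lift_span hx
    have : (fun _ : Fin 1 => ∑ k, w k * mk (f k) (hf k)) =
        ∑ k, w k • koszulCols (fun j (_ : Fin 1) => mk (f j) (hf j)) 0 (.inl k) := by
      funext i
      rw [Finset.sum_apply]
      rfl
    rw [this]
    exact Submodule.sum_mem _ fun k _ => Submodule.smul_mem _ _ (Submodule.subset_span ⟨_, rfl⟩)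
  let Ψ : ((Fin n → Fin K) → ℂ) →ₗ[ℂ] (Fin 1 → On n) :=
    { toFun := fun a _ => ∑ e, a e • ∏ i, (X i : On n) ^ (e i : ℕ)
      map_add' := fun a b => by
        funext i
        simp only [Pi.add_apply, add_smul, Finset.sum_add_distrib]
      map_smul' := fun t a => by
        funext i
        simp only [Pi.smul_apply, smul_eq_mul, mul_smul, Finset.smul_sum, RingHom.id_apply] }
  refine Module.Finite.of_surjective ((N.mkQ.restrictScalars ℂ).comp Ψ) fun x => ?_
  obtain ⟨v, rfl⟩ := Submodule.Quotient.mk_surjective N x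
  obtain ⟨c, hc⟩ := exists_preparation hf hf0 K hK (v 0)
  refine ⟨fun e => value (c e), ?_⟩
  refine ((Submodule.Quotient.eq N).2 ?_).symm
  have hv : v - Ψ (fun e => value (c e)) =
      fun _ => v 0 - ∑ e, value (c e) • ∏ i, (X i : On n) ^ (e i : ℕ) := by
    funext i
    rw [Subsingleton.elim i 0]
    rfl
  rw [hv]
  refine hmem _ ?_
  rw [hc, ← Finset.sum_sub_distrib]
  refine Ideal.sum_mem _ fun e _ => ?_
  rw [Algebra.smul_def, ← sub_mul]
  refine Ideal.mul_mem_right _ _ ?_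
  obtain ⟨q, hq⟩ := exists_value_add (c e)
  have h1 : pullback (fun z k => f k z) (analyticAt_map hf) hf0 (c e) =
      algebraMap ℂ (On n) (value (c e)) + ∑ i, mk (f i) (hf i) *
        pullback (fun z k => f k z) (analyticAt_map hf) hf0 (q i) := by
    conv_lhs => rw [hq]
    rw [map_add, AlgHom.commutes, map_sum]
    refine congrArg _ (Finset.sum_congr rfl fun i _ => ?_)
    rw [map_mul]
    rfl
  rw [h1, add_sub_cancel_left]
  exact Ideal.sum_mem _ fun i _ => Ideal.mul_mem_right _ _ (Ideal.subset_span ⟨i, rfl⟩)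

end On

lemma pairCols_zero_inr {H : Type*} [NormedCommRing H] [NormedAlgebra ℂ H]
    (l : PairSp n p H) (hl : l.2 = 0) (q : Fin p × Fin p) : pairCols l (.inr q) = 0 := by
  rw [pairCols_inr, hl]
  simp

lemma HasRI.of_pairCols {H ι : Type*} [Fintype ι] [NormedCommRing H] [NormedAlgebra ℂ H]
    {E : ι → Fin p → H} {l : PairSp n p H} (hl : l.2 = 0) (h : HasRI E (pairCols l)) :
    HasRI E l.1 := by
  obtain ⟨T, hT⟩ := h
  let R : (Fin n ⊕ Fin p × Fin p → H) →L[ℂ] (Fin n → H) :=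
    ContinuousLinearMap.pi fun j =>
      ContinuousLinearMap.proj (R := ℂ) (φ := fun _ : Fin n ⊕ Fin p × Fin p => H) (.inl j)
  refine ⟨((ContinuousLinearMap.fst ℂ _ _).prod (R.comp (ContinuousLinearMap.snd ℂ _ _))).comp T,
    ?_⟩
  ext1 v
  have h1 := congrArg (fun S => S v) hT
  simp only [ContinuousLinearMap.comp_apply, presOp_apply, colOp_apply, Fintype.sum_sum_type,
    pairCols_zero_inr l hl, smul_zero, Finset.sum_const_zero, add_zero, pairCols_inl] at h1
  simp only [ContinuousLinearMap.comp_apply, presOp_apply, colOp_apply]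
  exact h1

lemma IndepMod.of_pairCols {H ι : Type*} [Fintype ι] [NormedCommRing H] [NormedAlgebra ℂ H]
    {E : ι → Fin p → H} {l : PairSp n p H} (h : IndepMod E (pairCols l)) : IndepMod E l.1 := by
  intro c w hw
  refine h c (Sum.elim w 0) ?_
  rw [← hw, colOp_apply, colOp_apply, Fintype.sum_sum_type]
  simp

/-- Syzygies of a part of a system of parameters are generated by the Koszul relations. -/
theorem On.exists_koszul (hpn : p ≤ n) {φ : Fin n → On n} (h0 : ∀ k, value (φ k) = 0) (K : ℕ)
    (hK : ∀ j, (X j : On n) ^ K ∈ Ideal.span (Set.range φ)) (s : Fin p → On n)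
    (hs : ∑ i, s i * φ (Fin.castLE hpn i) = 0) :
    ∃ A : Fin p → Fin p → On n, (∀ i, A i i = 0) ∧ (∀ i l, A i l = - A l i) ∧
      ∀ i, s i = ∑ l, A i l * φ (Fin.castLE hpn l) := by
  rcases Nat.eq_zero_or_pos n with rfl | hn
  · obtain rfl : p = 0 := by omega
    exact ⟨0, fun i => i.elim0, fun i => i.elim0, fun i => i.elim0⟩
  have := finite_koszulCoker_one h0 K hK
  obtain ⟨ρ, hρ, hfree⟩ := exists_free_presentation hn (fun j (_ : Fin 1) => φ j) 0
  obtain ⟨ρ', hρ', hl⟩ := exists_germ_family (fun q : Fin n ⊕ Fin p => Sum.elim φ s q)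
  have hr : 0 < min ρ ρ' := lt_min hρ hρ'
  set r := min ρ ρ' with hrdef
  obtain ⟨L, hL⟩ := hl r hr (min_le_right _ _)
  let lam : Cn n → PairSp n 1 (PolydiscAlg n r) :=
    fun y => (fun k _ => L (.inl k) - algebraMap ℂ (PolydiscAlg n r) (y k), 0)
  have hlam0 : lam 0 = (fun k _ => L (.inl k), 0) := by
    simp [lam]
  obtain ⟨E, hE⟩ := hfree r hr (min_le_left _ _) (fun k _ => L (.inl k), 0)
    (fun j _ => hL (.inl j)) (fun i => map_zero _)
  have hLv : ∀ k, ev 0 (L (.inl k)) = 0 := by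
    intro k
    rw [← value_germ hr, hL]
    exact h0 k
  have hlamc : Continuous lam := by
    refine Continuous.prodMk (continuous_pi fun k => continuous_pi fun _ =>
      continuous_const.sub ?_) continuous_const
    exact (continuous_algebraMap ℂ (PolydiscAlg n r)).comp (continuous_apply k)
  have hRI : HasRI E (fun k (_ : Fin 1) => L (.inl k)) :=
    HasRI.of_pairCols (l := ((fun k _ => L (.inl k), 0) : PairSp n 1 (PolydiscAlg n r))) rfl
      hE.self_of_nhds.1
  have hInd : ∀ᶠ y in 𝓝 (0 : Cn n),
      IndepMod E (fun k (_ : Fin 1) => L (.inl k) - algebraMap ℂ (PolydiscAlg n r) (y k)) := by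
    rw [← hlam0] at hE
    filter_upwards [hlamc.continuousAt.eventually hE] with y hy
    exact IndepMod.of_pairCols (l := lam y) hy.2
  obtain ⟨c, hc, hcA, hcB⟩ := exists_fibre_coeff hr hRI hLv
  have hca : ∀ v e, AnalyticAt ℂ (fun y => c y v e) 0 := by
    intro v e
    have h1 : AnalyticAt ℂ (fun y => c y v) 0 :=
      ((ContinuousLinearMap.id ℂ (PolydiscAlg n r →L[ℂ] (_ → ℂ))).analyticAt_bilinear
        (c 0, v)).comp₂ hc analyticAt_const
    exact analyticAt_pi_iff.1 h1 e
  have hsL : ∑ i, L (.inr i) * L (.inl (Fin.castLE hpn i)) = 0 := by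
    apply germ_injective hr
    rw [map_sum, map_zero, ← hs]
    exact Finset.sum_congr rfl fun i _ => by rw [map_mul, hL, hL]; rfl
  have hrel : ∀ᶠ y in 𝓝 (0 : Cn n), ∑ i : Fin p, y (Fin.castLE hpn i) • c y (L (.inr i)) = 0 := by
    filter_upwards [hcB, hInd] with y hy1 hy2
    have hy3 := hy1 hy2 (fun k => ∑ i : Fin p, if Fin.castLE hpn i = k then L (.inr i) else 0)
    have h4 : ∑ k, (∑ i : Fin p, if Fin.castLE hpn i = k then L (.inr i) else 0) *
        (L (.inl k) - algebraMap ℂ (PolydiscAlg n r) (y k)) =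
        - ∑ i : Fin p, y (Fin.castLE hpn i) • L (.inr i) := by
      simp only [Finset.sum_mul, ite_mul, zero_mul]
      rw [Finset.sum_comm]
      simp only [Finset.sum_ite_eq, Finset.mem_univ, if_true, mul_sub]
      rw [Finset.sum_sub_distrib, hsL, zero_sub]
      exact congrArg _ (Finset.sum_congr rfl fun i _ => by rw [Algebra.smul_def, mul_comm])
    rw [h4, map_neg, neg_eq_zero, map_sum] at hy3
    rw [← hy3]
    exact Finset.sum_congr rfl fun i _ => (map_smul _ _ _).symm
  have hCe : ∀ e, ∑ i : Fin p, mk _ (hca (L (.inr i)) e) * (X (Fin.castLE hpn i) : On n) = 0 := by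
    intro e
    have h1 : ∀ i : Fin p, mk _ (hca (L (.inr i)) e) * (X (Fin.castLE hpn i) : On n) =
        mk _ ((hca (L (.inr i)) e).mul (analyticAt_coord (Fin.castLE hpn i) 0)) := fun i => rfl
    simp only [h1]
    rw [sum_mk, zero_eq_mk, mk_eq_mk]
    filter_upwards [hrel] with y hy
    have h2 := congrFun hy e
    rw [Finset.sum_apply, Pi.zero_apply] at h2
    rw [← h2]
    exact Finset.sum_congr rfl fun i _ => mul_comm _ _
  choose A hA0 hA1 hA2 using fun e => exists_koszul_of_regular
    (fun i : Fin p => (X (Fin.castLE hpn i) : On n)) (regular_coord hpn) _ (hCe e)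
  let Φ : Cn n → Cn n := fun z k => ev z (L (.inl k))
  have hΦ : AnalyticAt ℂ Φ 0 := analyticAt_map (φ := fun k z => ev z (L (.inl k)))
    fun k => analyticAt_ev_apply (Metric.mem_ball_self hr) _
  have hΦ0 : Φ 0 = 0 := funext hLv
  have hexp : ∀ v, germ hr v = ∑ e, pullback Φ hΦ hΦ0 (mk _ (hca v e)) * germ hr (E e 0) := by
    intro v
    have h1 : ∀ e, AnalyticAt ℂ (fun z => c (Φ z) v e * ev z (E e 0)) 0 := by
      intro e
      refine AnalyticAt.mul ?_ (analyticAt_ev_apply (Metric.mem_ball_self hr) _)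
      have h5 : AnalyticAt ℂ (fun y => c y v e) (Φ 0) :=
        (congrArg (AnalyticAt ℂ (fun y => c y v e)) hΦ0).mpr (hca v e)
      exact AnalyticAt.comp (g := fun y => c y v e) (f := Φ) h5 hΦ
    have h2 : ∀ e, pullback Φ hΦ hΦ0 (mk _ (hca v e)) * germ hr (E e 0) = mk _ (h1 e) :=
      fun e => rfl
    simp only [h2]
    rw [sum_mk, germ_eq_mk_iff]
    filter_upwards [hcA] with z hz using hz v
  refine ⟨fun i l => ∑ e, pullback Φ hΦ hΦ0 (A e i l) * germ hr (E e 0), ?_, ?_, ?_⟩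
  · intro i
    simp [hA0]
  · intro i l
    rw [← Finset.sum_neg_distrib]
    exact Finset.sum_congr rfl fun e _ => by rw [hA1, map_neg]; ring
  · intro i
    have h1 : s i = germ hr (L (.inr i)) := (hL (.inr i)).symm
    have h2 : ∀ l : Fin p, φ (Fin.castLE hpn l) = pullback Φ hΦ hΦ0 (X (Fin.castLE hpn l)) :=
      fun l => (hL (.inl _)).symm.trans rfl
    rw [h1, hexp]
    simp only [hA2, map_sum, map_mul, Finset.sum_mul]
    rw [Finset.sum_comm]
    refine Finset.sum_congr rfl fun l _ => Finset.sum_congr rfl fun e _ => ?_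
    rw [h2]
    ring

end KoszulExactness

section Parameters

lemma exists_parameters_of_ringKrullDim {R : Type*} [CommRing R] [IsNoetherianRing R]
    [IsLocalRing R] {d : ℕ} (hdim : ringKrullDim R = d) :
    ∃ ℓ : Fin d → R, (∀ k, ¬ IsUnit (ℓ k)) ∧
      ∀ x : R, ¬ IsUnit x → ∃ K, x ^ K ∈ Ideal.span (Set.range ℓ) := by
  have hh : (IsLocalRing.maximalIdeal R).height = d := by
    have := IsLocalRing.maximalIdeal_height_eq_ringKrullDim (R := R)
    rw [hdim] at this
    exact_mod_cast this
  obtain ⟨s, hs, hcard⟩ := Ideal.exists_finset_card_eq_height_of_isNoetherianRing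
    (IsLocalRing.maximalIdeal R)
  rw [hh] at hcard
  have hcard' : s.card = d := by exact_mod_cast hcard
  let e : Fin d ≃ s := (Fin.castOrderIso hcard'.symm).toEquiv.trans s.equivFin.symm
  have hspan : Ideal.span (Set.range fun k => (e k : R)) = Ideal.span (s : Set R) := by
    refine congrArg _ (Set.ext fun x => ⟨?_, fun hx => ⟨e.symm ⟨x, hx⟩, by simp⟩⟩)
    rintro ⟨k, rfl⟩
    exact (e k).2
  have hrad : IsLocalRing.maximalIdeal R ≤ (Ideal.span (s : Set R)).radical := by
    rw [Ideal.radical_eq_sInf]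
    refine le_sInf fun J hJ => ?_
    exact hs.2 ⟨hJ.2, hJ.1⟩ (IsLocalRing.le_maximalIdeal hJ.2.ne_top)
  refine ⟨fun k => e k, fun k => ?_, fun x hx => ?_⟩
  · exact (IsLocalRing.mem_maximalIdeal _).1 (hs.1.2 (Ideal.subset_span (e k).2))
  · rw [hspan]
    exact hrad ((IsLocalRing.mem_maximalIdeal _).2 hx)

namespace On

variable {n p : ℕ}

lemma mem_maximalIdeal_iff (φ : On n) : φ ∈ IsLocalRing.maximalIdeal (On n) ↔ value φ = 0 := by
  rw [IsLocalRing.mem_maximalIdeal, mem_nonunits_iff, isUnit_iff, not_not]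

lemma value_X (j : Fin n) : value (X j : On n) = 0 := rfl

/-- Extension of the generators of an ideal of the expected codimension to a system of
parameters. -/
theorem exists_parameters (g : Fin p → On n) (hg : ∀ i, value (g i) = 0) {d : ℕ}
    (hdim : ringKrullDim (On n ⧸ Ideal.span (Set.range g)) = d) (hpd : p + d = n) (hpn : p ≤ n) :
    ∃ φ : Fin n → On n, (∀ k, value (φ k) = 0) ∧ (∀ i, φ (Fin.castLE hpn i) = g i) ∧
      ∃ K, ∀ j, (X j : On n) ^ K ∈ Ideal.span (Set.range φ) := by
  set I := Ideal.span (Set.range g) with hI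
  have hIm : I ≤ IsLocalRing.maximalIdeal (On n) := by
    rw [hI, Ideal.span_le]
    rintro _ ⟨i, rfl⟩
    exact (mem_maximalIdeal_iff _).2 (hg i)
  have hIne : I ≠ ⊤ := fun h => (IsLocalRing.maximalIdeal.isMaximal (On n)).ne_top
    (top_le_iff.1 (h ▸ hIm))
  have hnt : Nontrivial (On n ⧸ I) := Ideal.Quotient.nontrivial_iff.2 hIne
  have hloc : IsLocalRing (On n ⧸ I) :=
    IsLocalRing.of_surjective' (Ideal.Quotient.mk I) Ideal.Quotient.mk_surjective
  have hunit : ∀ x : On n, value x = 0 → ¬ IsUnit (Ideal.Quotient.mk I x) := by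
    intro x hx h
    obtain ⟨y, hy⟩ := h.exists_right_inv
    obtain ⟨y, rfl⟩ := Ideal.Quotient.mk_surjective y
    rw [← map_mul, ← map_one (Ideal.Quotient.mk I), Ideal.Quotient.eq] at hy
    have h1 := (mem_maximalIdeal_iff _).1 (hIm hy)
    rw [map_sub, map_mul, hx, zero_mul, map_one] at h1
    norm_num at h1
  obtain ⟨ℓ', hℓ'1, hℓ'2⟩ := exists_parameters_of_ringKrullDim (R := On n ⧸ I) hdim
  choose ℓ hℓ using fun k => Ideal.Quotient.mk_surjective (I := I) (ℓ' k)
  subst hpd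
  refine ⟨Fin.append g ℓ, fun k => ?_, fun i => Fin.append_left g ℓ i, ?_⟩
  · refine Fin.addCases (fun i => ?_) (fun i => ?_) k
    · rw [Fin.append_left, hg]
    · rw [Fin.append_right]
      by_contra h2
      refine hℓ'1 i ?_
      rw [← hℓ]
      exact ((isUnit_iff _).2 h2).map (Ideal.Quotient.mk I)
  · have hpow : ∀ j, ∃ K, (X j : On (p + d)) ^ K ∈ Ideal.span (Set.range (Fin.append g ℓ)) := by
      intro j
      obtain ⟨K, hK⟩ := hℓ'2 _ (hunit (X j) (value_X j))
      refine ⟨K, ?_⟩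
      have h4 : Ideal.span (Set.range ℓ') = (Ideal.span (Set.range ℓ)).map (Ideal.Quotient.mk I) := by
        rw [Ideal.map_span, ← Set.range_comp]
        exact congrArg _ (congrArg _ (funext hℓ).symm)
      rw [h4, ← map_pow] at hK
      have h6 := (Ideal.mem_quotient_iff_mem_sup).1 hK
      refine (sup_le ?_ ?_ : Ideal.span (Set.range ℓ) ⊔ I ≤ _) h6
      · rw [Ideal.span_le]
        rintro _ ⟨i, rfl⟩
        exact Ideal.subset_span ⟨Fin.natAdd p i, Fin.append_right g ℓ i⟩
      · rw [hI, Ideal.span_le]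
        rintro _ ⟨i, rfl⟩
        exact Ideal.subset_span ⟨Fin.castAdd d i, Fin.append_left g ℓ i⟩
    choose K hK using hpow
    refine ⟨Finset.univ.sup K, fun j => ?_⟩
    exact Ideal.mem_of_dvd _ (pow_dvd_pow _ (Finset.le_sup (Finset.mem_univ j))) (hK j)

end On

end Parameters

section QuotientComparison

variable {n p : ℕ}

lemma idealOfFuns_range {σ : Type*} (f : σ → Cn n → ℂ) (hf : ∀ k, AnalyticAt ℂ (f k) 0) :
    idealOfFuns (Set.range f) = Ideal.span (Set.range fun k => On.mk (f k) (hf k)) := by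
  refine congrArg Ideal.span (Set.ext fun x => ⟨?_, ?_⟩)
  · rintro ⟨_, ⟨k, rfl⟩, hx⟩
    exact ⟨k, Subtype.ext hx.symm⟩
  · rintro ⟨k, rfl⟩
    exact ⟨f k, ⟨k, rfl⟩, rfl⟩

lemma koszul_mem_span {M : Fin n → Fin p → On n} {h : Fin p → On n} {A : Fin p → Fin p → On n}
    (hA : ∀ i l, A i l = - A l i) {s : Fin p → On n} (hs : ∀ i, s i = ∑ l, A i l * h l) :
    s ∈ Submodule.span (On n) (Set.range (koszulCols M h)) := by
  have h2 : algebraMap ℂ (On n) 2⁻¹ * 2 = 1 := by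
    have : (2 : On n) = algebraMap ℂ (On n) 2 := (map_ofNat _ 2).symm
    rw [this, ← map_mul, inv_mul_cancel₀ two_ne_zero, map_one]
  have h1 : s = ∑ q : Fin p × Fin p, (algebraMap ℂ (On n) 2⁻¹ * A q.2 q.1) •
      koszulCols M h (.inr q) := by
    funext m
    rw [Finset.sum_apply, Fintype.sum_prod_type]
    simp only [koszulCols, Sum.elim_inr, Pi.smul_apply, Pi.sub_apply, smul_eq_mul, mul_sub,
      Finset.sum_sub_distrib, Pi.single_apply, mul_ite, mul_zero, Finset.sum_ite_eq,
      Finset.mem_univ, if_true]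
    rw [Finset.sum_comm (f := fun x x_1 => if m = x then _ else _)]
    simp only [Finset.sum_ite_eq, Finset.mem_univ, if_true]
    rw [hs, ← Finset.sum_sub_distrib]
    refine Finset.sum_congr rfl fun l _ => ?_
    rw [hA l m]
    linear_combination (- A m l * h l) * h2
  rw [h1]
  exact Submodule.sum_mem _ fun q _ => Submodule.smul_mem _ _ (Submodule.subset_span ⟨_, rfl⟩)

/-- The cokernel of the presentation matrix computes `I/J` as soon as the syzygies of the
generators of `I` are the Koszul relations. -/
def koszulCokerEquiv (M : Fin n → Fin p → On n) (g : Fin p → On n)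
    (hK : ∀ s : Fin p → On n, ∑ i, s i * g i = 0 →
      ∃ A : Fin p → Fin p → On n, (∀ i l, A i l = - A l i) ∧ ∀ i, s i = ∑ l, A i l * g l) :
    KoszulCoker M g ≃ₗ[ℂ] quotIJ (Ideal.span (Set.range g))
      (Ideal.span (Set.range fun j => ∑ i, M j i * g i)) := by
  let J : Ideal (On n) := Ideal.span (Set.range fun j => ∑ i, M j i * g i)
  let T₀ : (Fin p → On n) →ₗ[On n] On n := Fintype.linearCombination (On n) g
  let T : (Fin p → On n) →ₗ[ℂ] (On n ⧸ J) := (J.mkQ.comp T₀).restrictScalars ℂ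
  let N := Submodule.span (On n) (Set.range (koszulCols M g))
  have hT₀ : ∀ v, T₀ v = ∑ i, v i * g i := fun v => by
    simp [T₀, Fintype.linearCombination_apply]
  have hTv : ∀ v, T v = Ideal.Quotient.mk J (T₀ v) := fun v => rfl
  have hker : N.restrictScalars ℂ = LinearMap.ker T := by
    apply le_antisymm
    · have : N ≤ LinearMap.ker (J.mkQ.comp T₀) := by
        rw [Submodule.span_le]
        rintro _ ⟨s, rfl⟩
        rw [SetLike.mem_coe, LinearMap.mem_ker]
        refine (Ideal.Quotient.eq_zero_iff_mem (I := J)).2 ?_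
        rw [hT₀]
        rcases s with j | ⟨i, k⟩
        · exact Ideal.subset_span ⟨j, rfl⟩
        · have : ∑ x, koszulCols M g (.inr (i, k)) x * g x = 0 := by
            simp only [koszulCols, Sum.elim_inr, Pi.sub_apply, sub_mul, Finset.sum_sub_distrib,
              Pi.single_apply, ite_mul, zero_mul, Finset.sum_ite_eq', Finset.mem_univ, if_true]
            ring
          rw [this]
          exact zero_mem _
      exact this
    · intro v hv
      rw [LinearMap.mem_ker, hTv, Ideal.Quotient.eq_zero_iff_mem] at hv
      obtain ⟨w, hw⟩ := On.exists_lift_span hv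
      have h1 : ∑ i, (v i - ∑ j, w j * M j i) * g i = 0 := by
        rw [hT₀] at hw
        simp only [sub_mul, Finset.sum_sub_distrib, Finset.sum_mul]
        rw [← hw, sub_eq_zero]
        simp only [Finset.mul_sum]
        rw [Finset.sum_comm]
        exact Finset.sum_congr rfl fun i _ => Finset.sum_congr rfl fun j _ => (mul_assoc _ _ _).symm
      obtain ⟨A, hA, hs⟩ := hK _ h1
      have h2 : v = (fun i => v i - ∑ j, w j * M j i) + ∑ j, w j • koszulCols M g (.inl j) := by
        funext i
        rw [Pi.add_apply, Finset.sum_apply]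
        simp [koszulCols]
      change v ∈ N
      rw [h2]
      exact N.add_mem (koszul_mem_span hA hs)
        (N.sum_mem fun j _ => N.smul_mem _ (Submodule.subset_span ⟨_, rfl⟩))
  have hrange : LinearMap.range T = quotIJ (Ideal.span (Set.range g)) J := by
    ext x
    constructor
    · rintro ⟨v, rfl⟩
      rw [hTv, hT₀]
      refine Ideal.mem_map_of_mem (Ideal.Quotient.mk J) ?_
      exact Ideal.sum_mem _ fun i _ => Ideal.mul_mem_left _ _ (Ideal.subset_span ⟨i, rfl⟩)
    · intro hx
      have hx' : x ∈ (Ideal.span (Set.range g)).map (Ideal.Quotient.mk J) := hx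
      obtain ⟨y, hy, rfl⟩ := (Ideal.mem_map_iff_of_surjective _ Ideal.Quotient.mk_surjective).1 hx'
      obtain ⟨w, rfl⟩ := On.exists_lift_span (n := n) hy
      exact ⟨w, by rw [hTv, hT₀]⟩
  exact ((Submodule.Quotient.restrictScalarsEquiv ℂ N).symm.trans
    (Submodule.quotEquivOfEq _ _ hker)).trans (T.quotKerEquivRange.trans (LinearEquiv.ofEq _ _ hrange))

end QuotientComparison

/-! ### Differentiable branches of the spectrum -/

section Branches

open PolydiscAlg

lemma hasStrictFDerivAt_eval {n : ℕ} (q : MvPolynomial (Fin n) ℂ) (x : Cn n) :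
    HasStrictFDerivAt (fun y : Cn n => MvPolynomial.eval y q)
      (fderiv ℂ (fun y : Cn n => MvPolynomial.eval y q) x) x :=
  (AnalyticOnNhd.eval_mvPolynomial (𝕜 := ℂ) q x (Set.mem_univ _)).hasStrictFDerivAt

/-- Points depending continuously on a parameter are differentiable functions of it as soon as
their weighted power sums are. -/
lemma differentiableAt_of_weighted_sums {n : ℕ} {T : Type*} [NormedAddCommGroup T]
    [NormedSpace ℂ T] {t₀ : T} (S : Finset (Cn n)) {m : Cn n → ℕ} (hm : ∀ x ∈ S, m x ≠ 0)
    {y : Cn n → T → Cn n} (hy : ∀ x ∈ S, ContinuousAt (y x) t₀) (hy₀ : ∀ x ∈ S, y x t₀ = x)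
    (htr : ∀ q : MvPolynomial (Fin n) ℂ, ∃ F : T → ℂ, DifferentiableAt ℂ F t₀ ∧
      ∀ᶠ t in 𝓝 t₀, F t = ∑ x ∈ S, (m x : ℂ) * MvPolynomial.eval (y x t) q) :
    ∀ x ∈ S, DifferentiableAt ℂ (y x) t₀ := by
  classical
  have h1 : ∀ x : Cn n, ∃ η : MvPolynomial (Fin n) ℂ, ∀ z ∈ S,
      MvPolynomial.eval z η = if z = x then 1 else 0 :=
    fun x => exists_eval_eq S fun z => if z = x then 1 else 0
  choose η hη using h1
  let q : Cn n → Fin n → MvPolynomial (Fin n) ℂ := fun x i =>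
    (MvPolynomial.X i - MvPolynomial.C (x i)) * (η x * η x)
  have hq : ∀ x, ∀ z ∈ S, ∀ i, HasStrictFDerivAt (fun y : Cn n => MvPolynomial.eval y (q x i))
      ((if z = x then (1 : ℂ) else 0) •
        ContinuousLinearMap.proj (R := ℂ) (φ := fun _ : Fin n => ℂ) i) z := by
    intro x z hz i
    have h2 := hasStrictFDerivAt_eval (η x) z
    have h3 : HasStrictFDerivAt (fun y : Cn n => y i - x i)
        (ContinuousLinearMap.proj (R := ℂ) (φ := fun _ : Fin n => ℂ) i) z :=
      (ContinuousLinearMap.hasStrictFDerivAt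
        (ContinuousLinearMap.proj (R := ℂ) (φ := fun _ : Fin n => ℂ) i)).sub_const (x i)
    have h4 := h3.mul (h2.mul h2)
    refine (h4.congr_fderiv ?_).congr_of_eventuallyEq (Eventually.of_forall fun y => by simp [q])
    have hηz := hη x z hz
    refine ContinuousLinearMap.ext fun w => ?_
    by_cases hzx : z = x
    · subst hzx
      rw [if_pos rfl] at hηz
      simp [hηz]
    · rw [if_neg hzx] at hηz
      simp [hηz, hzx]
  let Ξ : (S → Cn n) → (S → Cn n) := fun Y x i =>
    (m x : ℂ)⁻¹ * ∑ x' : S, (m x' : ℂ) * MvPolynomial.eval (Y x') (q x i)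
  have hΞ : HasStrictFDerivAt Ξ
      ((ContinuousLinearEquiv.refl ℂ (S → Cn n) : (S → Cn n) ≃L[ℂ] (S → Cn n)) :
        (S → Cn n) →L[ℂ] (S → Cn n)) (fun x : S => (x : Cn n)) := by
    rw [hasStrictFDerivAt_pi']
    intro x
    rw [hasStrictFDerivAt_pi']
    intro i
    have h2 : ∀ x' : S, HasStrictFDerivAt
        (fun Y : S → Cn n => (m x' : ℂ) * MvPolynomial.eval (Y x') (q x i))
        ((m x' : ℂ) • (((if (x' : Cn n) = x then (1 : ℂ) else 0) •
          ContinuousLinearMap.proj (R := ℂ) (φ := fun _ : Fin n => ℂ) i).comp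
          (ContinuousLinearMap.proj (R := ℂ) (φ := fun _ : S => Cn n) x')))
          (fun x : S => (x : Cn n)) := by
      intro x'
      refine HasStrictFDerivAt.const_mul ?_ _
      exact HasStrictFDerivAt.comp (g := fun y : Cn n => MvPolynomial.eval y (q x i))
        (f := fun Y : S → Cn n => Y x') (fun x : S => (x : Cn n)) (hq x x' x'.2 i)
        (ContinuousLinearMap.hasStrictFDerivAt
          (ContinuousLinearMap.proj (R := ℂ) (φ := fun _ : S => Cn n) x'))
    have h3 := (HasStrictFDerivAt.fun_sum (u := Finset.univ) fun x' _ => h2 x').const_mul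
      (m x : ℂ)⁻¹
    refine h3.congr_fderiv ?_
    refine ContinuousLinearMap.ext fun Y => ?_
    have hmx : (m x : ℂ) ≠ 0 := by exact_mod_cast hm x x.2
    have h4 : ∑ x' : S, (m x' : ℂ) * ((if (x' : Cn n) = x then (1 : ℂ) else 0) * Y x' i) =
        m x * Y x i := by
      rw [Finset.sum_eq_single x]
      · rw [if_pos rfl, one_mul]
      · intro b _ hb
        rw [if_neg fun h => hb (Subtype.ext h), zero_mul, mul_zero]
      · exact fun h => absurd (Finset.mem_univ _) h
    have h5 : (m x : ℂ)⁻¹ * ∑ x' : S, (m x' : ℂ) *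
        ((if (x' : Cn n) = x then (1 : ℂ) else 0) * Y x' i) = Y x i := by
      rw [h4, inv_mul_cancel_left₀ hmx]
    simp only [smul_eq_mul, smul_apply, sum_apply,
      ContinuousLinearMap.comp_apply, ContinuousLinearMap.proj_apply]
    exact h5
  let y' : T → S → Cn n := fun t x => y x t
  have hy'c : ContinuousAt y' t₀ := continuousAt_pi.2 fun x => hy x x.2
  have hy'0 : y' t₀ = fun x : S => (x : Cn n) := funext fun x => hy₀ x x.2
  have hd : DifferentiableAt ℂ (fun t => Ξ (y' t)) t₀ := by
    refine differentiableAt_pi.2 fun x => differentiableAt_pi.2 fun i => ?_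
    obtain ⟨F, hF, hFe⟩ := htr (q x i)
    refine (hF.const_mul (m x : ℂ)⁻¹).congr_of_eventuallyEq ?_
    filter_upwards [hFe] with t ht
    rw [ht, ← Finset.sum_coe_sort S]
  have hinv : DifferentiableAt ℂ y' t₀ := by
    have h4 := hΞ.to_localInverse.hasFDerivAt.differentiableAt
    have h5 : DifferentiableAt ℂ (fun t => hΞ.localInverse Ξ _ _ (Ξ (y' t))) t₀ := by
      refine DifferentiableAt.comp (g := hΞ.localInverse Ξ _ _) t₀ ?_ hd
      rw [hy'0]
      exact h4
    refine h5.congr_of_eventuallyEq ?_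
    have h6 : Tendsto y' (𝓝 t₀) (𝓝 fun x : S => (x : Cn n)) := hy'0 ▸ hy'c
    filter_upwards [h6.eventually hΞ.eventually_left_inverse] with t ht
    exact ht.symm
  intro x hx
  exact (differentiableAt_pi.1 hinv) ⟨x, hx⟩

variable {n p : ℕ} {r : ℝ} {ι κ : Type*} [Fintype ι] [Fintype κ]

lemma clusterMult_eq_mult (hr : 0 ≤ r) {a : κ → Fin p → PolydiscAlg n r} {S : Set (Cn n)}
    {x : Cn n} (hx : x ∈ S) (h : ∀ y ∈ S, y ∈ cokerPts a → y = x) :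
    clusterMult a S = mult a x := by
  have : clusterMult a S = ∑ᶠ y ∈ ({x} : Set (Cn n)), mult a y := by
    rw [clusterMult, finsum_mem_def, finsum_mem_def]
    congr 1
    funext y
    by_cases hy : y = x
    · subst hy
      simp [hx]
    · rw [Set.indicator_of_notMem (show y ∉ ({x} : Set (Cn n)) from hy)]
      refine Set.indicator_apply_eq_zero.2 fun hyS => ?_
      by_contra h0
      exact hy (h y hyS (support_mult_subset hr a h0))
  rw [this, finsum_mem_singleton]

/-- Where the number of spectrum points is locally maximal, the points are differentiable
functions of the parameter. -/
theorem exists_branches {T : Type*} [NormedAddCommGroup T] [NormedSpace ℂ T] (hr : 0 ≤ r)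
    {E : ι → Fin p → PolydiscAlg n r} {a : T → κ → Fin p → PolydiscAlg n r} {t₀ : T}
    (ha : DifferentiableAt ℂ a t₀) (h : HasRI E (a t₀)) (hI : ∀ᶠ t in 𝓝 t₀, IndepMod E (a t))
    (hmax : ∀ᶠ t in 𝓝 t₀, (cokerPts (a t)).ncard ≤ (cokerPts (a t₀)).ncard) :
    ∃ y : Cn n → T → Cn n, (∀ x ∈ cokerPts (a t₀), DifferentiableAt ℂ (y x) t₀ ∧ y x t₀ = x) ∧
      ∀ᶠ t in 𝓝 t₀, cokerPts (a t) = (fun x => y x t) '' cokerPts (a t₀) ∧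
        Set.InjOn (fun x => y x t) (cokerPts (a t₀)) := by
  classical
  set X₀ := cokerPts (a t₀) with hX₀
  have hfin : X₀.Finite := finite_cokerPts hr h
  obtain ⟨U, hU, hdisj⟩ := hfin.t2_separation
  have hc := ha.continuousAt
  have hI₀ := hI.self_of_nhds
  have hsub : X₀ ⊆ ⋃ x ∈ X₀, U x := fun x hx => Set.mem_biUnion hx (hU x).1
  have hfr : ∀ x ∈ X₀, ∀ x' ∈ X₀, x' ∉ frontier (U x) := by
    intro x hx x' hx' hf
    rw [(hU x).2.frontier_eq] at hf
    by_cases hxx : x' = x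
    · exact hf.2 (hxx ▸ (hU x).1)
    · have := (hdisj hx' hx hxx).closure_right (hU x').2
      exact Set.disjoint_left.1 this (hU x').1 hf.1
  have hcl : ∀ᶠ t in 𝓝 t₀, ∀ x ∈ X₀, clusterMult (a t) (U x) = mult (a t₀) x := by
    have := (eventually_all_finset hfin.toFinset).2 fun x hx =>
      hc.eventually (eventually_clusterMult_eq hr h hI₀ (hfr x (by simpa using hx)))
    filter_upwards [this, hI] with t ht hIt x hx
    rw [ht x (by simpa using hx) hIt]
    refine clusterMult_eq_mult hr (hU x).1 fun y hy hy' => ?_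
    by_contra hne
    exact Set.disjoint_left.1 (hdisj hy' hx hne) (hU y).1 hy
  let P : T → Cn n → Cn n → Prop := fun t x z => z ∈ cokerPts (a t) ∧ z ∈ U x
  let y : Cn n → T → Cn n := fun x t =>
    if t = t₀ then x else if H : ∃ z, P t x z then H.choose else x
  have hy₀ : ∀ x, y x t₀ = x := fun x => by simp [y]
  have hyP : ∀ᶠ t in 𝓝 t₀, ∀ x ∈ X₀, P t x (y x t) := by
    filter_upwards [hcl] with t ht x hx
    by_cases htt : t = t₀
    · subst htt
      rw [hy₀]
      exact ⟨hx, (hU x).1⟩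
    · have H : ∃ z, P t x z := by
        by_contra hno
        have h0 : clusterMult (a t) (U x) = 0 := by
          rw [clusterMult, finsum_mem_eq_zero_of_forall_eq_zero]
          intro z hz
          by_contra hne
          exact hno ⟨z, support_mult_subset hr _ hne, hz⟩
        have := mult_pos hr h hx
        rw [← ht x hx, h0] at this
        exact lt_irrefl _ this
      have : y x t = H.choose := by simp only [y, if_neg htt, dif_pos H]
      rw [this]
      exact H.choose_spec
  have hmain : ∀ᶠ t in 𝓝 t₀, cokerPts (a t) = (fun x => y x t) '' X₀ ∧
      Set.InjOn (fun x => y x t) X₀ := by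
    filter_upwards [hyP, hmax, hc.eventually (eventually_hasRI h)] with t ht hm hR
    have hinj : Set.InjOn (fun x => y x t) X₀ := by
      intro x hx x' hx' hxx
      by_contra hne
      refine Set.disjoint_left.1 (hdisj hx hx' hne) (ht x hx).2 ?_
      have := (ht x' hx').2
      simp only at hxx
      rwa [hxx]
    refine ⟨(Set.eq_of_subset_of_ncard_le ?_ ?_ (finite_cokerPts hr hR)).symm, hinj⟩
    · rintro _ ⟨x, hx, rfl⟩
      exact (ht x hx).1
    · rwa [hinj.ncard_image]
  have hycont : ∀ x ∈ X₀, ContinuousAt (y x) t₀ := by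
    intro x hx
    rw [ContinuousAt, hy₀]
    intro O hO
    let W : Set (Cn n) := interior O ∪ ⋃ x' ∈ X₀ \ {x}, U x'
    have hW : IsOpen W :=
      isOpen_interior.union (isOpen_biUnion fun x' _ => (hU x').2)
    have hWX : X₀ ⊆ W := by
      intro x' hx'
      by_cases hxx : x' = x
      · exact .inl (hxx ▸ mem_interior_iff_mem_nhds.2 hO)
      · exact .inr (Set.mem_biUnion (show x' ∈ X₀ \ {x} from ⟨hx', hxx⟩) (hU x').1)
    rw [mem_map]
    filter_upwards [hc.eventually (eventually_cokerPts_subset hW hWX), hyP] with t ht hPt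
    rcases ht (hPt x hx).1 with h1 | h1
    · exact (interior_subset h1 : y x t ∈ O)
    · obtain ⟨x', hx', hz⟩ := Set.mem_iUnion₂.1 h1
      exact absurd hz (Set.disjoint_left.1 (hdisj hx hx'.1 (Ne.symm hx'.2)) (hPt x hx).2)
  refine ⟨y, fun x hx => ⟨?_, hy₀ x⟩, hmain⟩
  refine differentiableAt_of_weighted_sums hfin.toFinset (m := mult (a t₀))
    (fun x hx => (mult_pos hr h (by simpa using hx)).ne')
    (fun x hx => hycont x (by simpa using hx)) (fun x _ => hy₀ x) (fun q => ?_) x (by simpa using hx)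
  obtain ⟨F, hF, hFe⟩ := exists_analytic_trace hr h q
  refine ⟨fun t => F (a t), DifferentiableAt.comp (g := F) t₀ hF.differentiableAt ha, ?_⟩
  filter_upwards [hc.eventually hFe, hI, hmain, hc.eventually (eventually_hasRI h), hcl, hyP]
    with t hFt hIt hmt hR hclt hPt
  have himg : (finite_cokerPts hr hR).toFinset = hfin.toFinset.image fun x => y x t := by
    ext z
    rw [Set.Finite.mem_toFinset, hmt.1]
    simp
  rw [hFt hIt, finsum_mult_eq hr hR, himg, Finset.sum_image]
  · refine Finset.sum_congr rfl fun x hx => ?_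
    have hx' : x ∈ X₀ := by simpa using hx
    rw [← hclt x hx', clusterMult_eq_mult hr (hPt x hx').2]
    intro z hz hz'
    rw [hmt.1] at hz'
    obtain ⟨x', hx'', rfl⟩ := hz'
    by_contra hne
    have hne' : x' ≠ x := fun h => hne (by rw [h])
    exact Set.disjoint_left.1 (hdisj hx'' hx' hne') (hPt x' hx'').2 hz
  · rw [Set.Finite.coe_toFinset]
    exact hmt.2

end Branches

/-! ### The family of pairs attached to a smoothing -/

/-- Parameters of a smoothing. -/
abbrev UB (n p : ℕ) : Type := (Fin p → ℂ) × (Fin p → Fin n → ℂ)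

section Family

open PolydiscAlg

variable {n p : ℕ} {r : ℝ} (γ : Fin p → PolydiscAlg n r) (dγ : Fin n → Fin p → PolydiscAlg n r)

/-- The functions `gᵢ - uᵢ`. -/
def famVec (ub : UB n p) (i : Fin p) : PolydiscAlg n r := γ i - algebraMap ℂ _ (ub.1 i)

/-- The functions `1 + ∑ bᵢⱼ zⱼ`. -/
def famBet (ub : UB n p) (i : Fin p) : PolydiscAlg n r := 1 + ∑ j, ub.2 i j • X j

/-- The pair whose vector is `gᵢ - uᵢ` and whose product is the gradient of the smoothing. -/
def famMap (ub : UB n p) : PairSp n p (PolydiscAlg n r) :=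
  (fun j i => ub.2 i j • famVec γ ub i + (2 : ℂ) • (famBet ub i * dγ j i), famVec γ ub)

variable {γ dγ}

lemma ev_famVec {x : Cn n} (hx : x ∈ Metric.closedBall (0 : Cn n) r) (ub : UB n p) (i : Fin p) :
    ev x (famVec γ ub i) = ev x (γ i) - ub.1 i := by
  rw [famVec, map_sub, ev_algebraMap hx]

lemma ev_famBet {x : Cn n} (hx : x ∈ Metric.closedBall (0 : Cn n) r) (ub : UB n p) (i : Fin p) :
    ev x (famBet ub i : PolydiscAlg n r) = 1 + ∑ j, ub.2 i j * x j := by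
  simp only [famBet, map_add, map_sum, ev_one hx, map_smul, ev_X hx, smul_eq_mul]

lemma ev_famMap {x : Cn n} (hx : x ∈ Metric.closedBall (0 : Cn n) r) (ub : UB n p) (j : Fin n)
    (i : Fin p) : ev x ((famMap γ dγ ub).1 j i) = ub.2 i j * ev x (famVec γ ub i) +
      2 * (ev x (famBet ub i : PolydiscAlg n r) * ev x (dγ j i)) := by
  simp only [famMap, map_add, map_smul, ev_mul hx, smul_eq_mul]

lemma hasDerivAt_famVec (ub v : UB n p) (i : Fin p) :
    HasDerivAt (fun s : ℂ => famVec γ (ub + s • v) i) (-algebraMap ℂ _ (v.1 i)) 0 := by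
  have h : (fun s : ℂ => famVec γ (ub + s • v) i) =
      fun s : ℂ => famVec γ ub i + s • (-algebraMap ℂ (PolydiscAlg n r) (v.1 i)) := by
    funext s
    change γ i - algebraMap ℂ _ (ub.1 i + s * v.1 i) = γ i - algebraMap ℂ _ (ub.1 i) + _
    rw [map_add, map_mul, Algebra.smul_def]
    ring
  rw [h]
  simpa using ((hasDerivAt_id (0 : ℂ)).smul_const
    (-algebraMap ℂ (PolydiscAlg n r) (v.1 i))).const_add (famVec γ ub i)

lemma hasDerivAt_famBet (ub v : UB n p) (i : Fin p) :
    HasDerivAt (fun s : ℂ => (famBet (ub + s • v) i : PolydiscAlg n r))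
      (∑ j, v.2 i j • X j) 0 := by
  have h : (fun s : ℂ => (famBet (ub + s • v) i : PolydiscAlg n r)) =
      fun s : ℂ => famBet ub i + s • ∑ j, v.2 i j • (X j : PolydiscAlg n r) := by
    funext s
    simp only [famBet, Prod.snd_add, Prod.smul_snd, Pi.add_apply, Pi.smul_apply, add_smul,
      Finset.sum_add_distrib, smul_eq_mul, mul_smul, Finset.smul_sum, add_assoc]
  rw [h]
  simpa using ((hasDerivAt_id (0 : ℂ)).smul_const
    (∑ j, v.2 i j • (X j : PolydiscAlg n r))).const_add (famBet ub i)

lemma hasDerivAt_famMap (ub v : UB n p) (j : Fin n) (i : Fin p) :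
    HasDerivAt (fun s : ℂ => (famMap γ dγ (ub + s • v)).1 j i)
      (ub.2 i j • (-algebraMap ℂ _ (v.1 i)) + v.2 i j • famVec γ ub i +
        (2 : ℂ) • ((∑ j, v.2 i j • X j) * dγ j i)) 0 := by
  have h1 : HasDerivAt (fun s : ℂ => (ub + s • v).2 i j) (v.2 i j) 0 := by
    simpa using ((hasDerivAt_id (0 : ℂ)).mul_const (v.2 i j)).const_add (ub.2 i j)
  have h2 := h1.smul (hasDerivAt_famVec (γ := γ) ub v i)
  have h3 := ((hasDerivAt_famBet (r := r) ub v i).mul_const (dγ j i)).const_smul (2 : ℂ)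
  have h4 := h2.add h3
  simp only [zero_smul, add_zero] at h4
  exact h4

lemma differentiable_famMap : Differentiable ℂ (famMap γ dγ : UB n p → _) := by
  have h1 : ∀ i, Differentiable ℂ fun ub : UB n p => famVec γ ub i := by
    intro i
    have : (fun ub : UB n p => famVec γ ub i) =
        fun ub : UB n p => γ i - ub.1 i • (1 : PolydiscAlg n r) := by
      funext ub
      rw [famVec, Algebra.algebraMap_eq_smul_one]
    rw [this]
    fun_prop
  have h2 : ∀ i, Differentiable ℂ fun ub : UB n p => (famBet ub i : PolydiscAlg n r) := by
    intro i
    unfold famBet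
    fun_prop
  refine Differentiable.prodMk ?_ (differentiable_pi.2 h1)
  refine differentiable_pi.2 fun j => differentiable_pi.2 fun i => ?_
  have h3 : Differentiable ℂ fun ub : UB n p => ub.2 i j := by fun_prop
  exact (h3.smul (h1 i)).add (((h2 i).mul_const (dγ j i)).const_smul (2 : ℂ))

lemma hasDerivAt_pairVec_famMap (ub v : UB n p) (j : Fin n) :
    HasDerivAt (fun s : ℂ => pairVec (famMap γ dγ (ub + s • v)) j)
      (∑ i, ((-algebraMap ℂ _ (v.1 i)) * (famMap γ dγ ub).1 j i +
        famVec γ ub i * (ub.2 i j • (-algebraMap ℂ _ (v.1 i)) + v.2 i j • famVec γ ub i +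
        (2 : ℂ) • ((∑ j, v.2 i j • X j) * dγ j i)))) 0 := by
  have h := HasDerivAt.fun_sum (u := Finset.univ) fun i (_ : i ∈ Finset.univ) =>
    (hasDerivAt_famVec (γ := γ) ub v i).fun_mul (hasDerivAt_famMap (γ := γ) (dγ := dγ) ub v j i)
  simpa [pairVec, famMap] using h

/-- Coefficient vector of a cokernel point of the family. -/
lemma exists_coeff_of_mem_cokerPts {l : PairSp n p (PolydiscAlg n r)} {x : Cn n}
    (hx : x ∈ cokerPts (pairCols l)) : ∃ c : Fin p → ℂ, c ≠ 0 ∧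
      (∀ j, ∑ i, c i * ev x (l.1 j i) = 0) ∧ ∀ i k, c k * ev x (l.2 i) = c i * ev x (l.2 k) := by
  obtain ⟨hxr, c, hc, h⟩ := hx
  rw [← evFun_mem_ann hxr, evFun_mem_ann_pairCols hxr] at h
  exact ⟨c, hc, h⟩

lemma pairVec_eq_zero_of_mem_cokerPts {l : PairSp n p (PolydiscAlg n r)} {x : Cn n}
    (hx : x ∈ cokerPts (pairCols l)) (hh : (fun i => ev x (l.2 i)) ≠ (0 : Fin p → ℂ)) (j : Fin n) :
    ev x (pairVec l j) = 0 := by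
  obtain ⟨c, hc, h1, h2⟩ := exists_coeff_of_mem_cokerPts hx
  obtain ⟨s, rfl⟩ := exists_smul_of_koszul hh h2
  have hs : s ≠ 0 := fun h => hc (by simp [h])
  have h3 := h1 j
  simp only [Pi.smul_apply, smul_eq_mul, mul_assoc, ← Finset.mul_sum] at h3
  rw [pairVec, map_sum]
  simpa [ev_mul hx.1] using (mul_eq_zero.1 h3).resolve_left hs

lemma hasDerivAt_ev_comp {x : Cn n} (hx : x ∈ Metric.ball (0 : Cn n) r) {y : ℂ → Cn n} {y' : Cn n}
    (hy : HasDerivAt y y' 0) (hy₀ : y 0 = x) {w : ℂ → PolydiscAlg n r} {w' : PolydiscAlg n r}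
    (hw : HasDerivAt w w' 0) :
    HasDerivAt (fun s => ev (y s) (w s)) (dev x y' (w 0) + ev x w') 0 := by
  have h1 : HasFDerivAt (fun z => (ev z : PolydiscAlg n r →L[ℂ] ℂ))
      (fderiv ℂ (fun z => (ev z : PolydiscAlg n r →L[ℂ] ℂ)) x) (y 0) := by
    rw [hy₀]
    exact (analyticAt_ev hx).differentiableAt.hasFDerivAt
  have h2 := (h1.comp_hasDerivAt (0 : ℂ) hy).clm_apply hw
  have h3 : dev x y' (w 0) = fderiv ℂ (fun z => (ev z : PolydiscAlg n r →L[ℂ] ℂ)) x y' (w 0) := by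
    have h4 := ((analyticAt_ev (r := r) hx).differentiableAt.hasFDerivAt.clm_apply
      (hasFDerivAt_const (w 0) x)).fderiv
    rw [dev, h4]
    simp
  rw [h3]
  simpa [hy₀] using h2

/-- Linearity in the direction. -/
lemma dev_eq_sum_single (x d : Cn n) (v : PolydiscAlg n r) :
    dev x d v = ∑ i, d i * dev x (Pi.single i 1) v := by
  conv_lhs => rw [← Finset.univ_sum_single d]
  rw [dev, map_sum]
  refine Finset.sum_congr rfl fun i _ => ?_
  rw [dev, ← smul_eq_mul, ← map_smul, ← Pi.single_smul, smul_eq_mul, mul_one]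

/-- If the value of the vector at a moving point does not vanish, then the freedom in the
parameters makes the Hessian surjective. -/
lemma nondegenerate_of_branch {ub : UB n p} {x : Cn n} (hx : x ∈ Metric.ball (0 : Cn n) r)
    {y : UB n p → Cn n} (hy : DifferentiableAt ℂ y ub) (hy₀ : y ub = x)
    (hz : ∀ᶠ t in 𝓝 ub, ∀ j, ev (y t) (pairVec (famMap γ dγ t) j) = 0) {i₀ : Fin p}
    (hh : ev x (famVec γ ub i₀) ≠ 0) (hβ : 1 - ∑ j, ub.2 i₀ j * x j ≠ 0) (d : Cn n)
    (hd : ∀ j, dev x d (pairVec (famMap γ dγ ub) j) = 0) : d = 0 := by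
  classical
  have hxc := Metric.ball_subset_closedBall hx
  let L : Cn n →ₗ[ℂ] Cn n :=
    { toFun := fun d j => dev x d (pairVec (famMap γ dγ ub) j)
      map_add' := fun a b => funext fun j => by simp [dev]
      map_smul' := fun c a => funext fun j => by simp [dev] }
  have hsurj : Function.Surjective L := by
    intro w
    set h := ev x (famVec γ ub i₀) with hhd
    set B := ∑ j, ub.2 i₀ j * x j with hB
    set υ : ℂ := (∑ j, w j * x j) / (h * (1 - B)) with hυ
    let β' : Fin n → ℂ := fun j => (w j + 2 * υ * ub.2 i₀ j * h) / h ^ 2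
    let v : UB n p := (Pi.single i₀ υ, Pi.single i₀ β')
    have hline : HasDerivAt (fun s : ℂ => ub + s • v) v 0 := by
      simpa using ((hasDerivAt_id (0 : ℂ)).smul_const v).const_add ub
    have hy' : HasDerivAt (fun s : ℂ => y (ub + s • v)) (fderiv ℂ y ub v) 0 := by
      refine HasFDerivAt.comp_hasDerivAt (l := y) (l' := fderiv ℂ y ub) (0 : ℂ) ?_ hline
      simpa using hy.hasFDerivAt
    refine ⟨-fderiv ℂ y ub v, funext fun j => ?_⟩
    have h1 := hasDerivAt_ev_comp hx hy' (by simpa using hy₀)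
      (hasDerivAt_pairVec_famMap (γ := γ) (dγ := dγ) ub v j)
    have h2 : (fun s : ℂ => ev (y (ub + s • v)) (pairVec (famMap γ dγ (ub + s • v)) j)) =ᶠ[𝓝 0]
        fun _ => (0 : ℂ) := by
      have hc : Tendsto (fun s : ℂ => ub + s • v) (𝓝 0) (𝓝 ub) := by
        simpa using hline.continuousAt.tendsto
      filter_upwards [hc.eventually hz] with s hs
      exact hs j
    have h3 := h1.unique ((hasDerivAt_const (0 : ℂ) (0 : ℂ)).congr_of_eventuallyEq h2)
    have h4 : L (-fderiv ℂ y ub v) j = -dev x (fderiv ℂ y ub v) (pairVec (famMap γ dγ ub) j) := by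
      simp [L, dev]
    rw [h4]
    simp only [zero_smul, add_zero] at h3
    rw [eq_neg_of_add_eq_zero_left h3, neg_neg, map_sum, Finset.sum_eq_single i₀]
    · simp only [map_add, map_sum, map_smul, map_neg, ev_mul hxc, ev_algebraMap hxc, ev_famMap hxc,
        ev_famBet hxc, ev_X hxc, smul_eq_mul, v, Pi.single_eq_same, ← hhd, ← hB]
      have h5 : ∑ j, β' j * x j = υ * (1 + B) / h := by
        have h6 : ∑ j, β' j * x j = ((∑ j, w j * x j) + 2 * υ * h * B) / h ^ 2 := by
          rw [hB, Finset.mul_sum, ← Finset.sum_add_distrib, Finset.sum_div]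
          refine Finset.sum_congr rfl fun j _ => ?_
          simp only [β']
          ring
        have h7 : ∑ j, w j * x j = υ * (h * (1 - B)) := by
          rw [hυ, div_mul_cancel₀]
          exact mul_ne_zero hh hβ
        rw [h6, h7]
        field_simp
        ring
      rw [h5]
      simp only [β']
      field_simp
      ring
    · intro b _ hb
      simp [v, hb]
    · exact fun h => absurd (Finset.mem_univ _) h
  have hinj := LinearMap.injective_iff_surjective.2 hsurj
  exact hinj (by rw [map_zero]; exact funext hd)

/-- The vector cannot vanish identically along a branch. -/
lemma false_of_branch {ub : UB n p} {x : Cn n} (hx : x ∈ Metric.ball (0 : Cn n) r)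
    (hmem : x ∈ cokerPts (pairCols (famMap γ dγ ub)))
    (hdγ : ∀ j i, ev x (dγ j i) = dev x (Pi.single j 1) (γ i))
    {y : UB n p → Cn n} (hy : DifferentiableAt ℂ y ub) (hy₀ : y ub = x)
    (hz : ∀ᶠ t in 𝓝 ub, ∀ i, ev (y t) (famVec γ t i) = 0)
    (hβ : ∀ i, 1 + ∑ j, ub.2 i j * x j ≠ 0) : False := by
  classical
  have hxc := Metric.ball_subset_closedBall hx
  have hz₀ : ∀ i, ev x (famVec γ ub i) = 0 := by
    have := hz.self_of_nhds
    rwa [hy₀] at this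
  obtain ⟨c, hc, h1, -⟩ := exists_coeff_of_mem_cokerPts hmem
  apply hc
  funext k
  let v : UB n p := (Pi.single k 1, 0)
  have hline : HasDerivAt (fun s : ℂ => ub + s • v) v 0 := by
    simpa using ((hasDerivAt_id (0 : ℂ)).smul_const v).const_add ub
  have hy' : HasDerivAt (fun s : ℂ => y (ub + s • v)) (fderiv ℂ y ub v) 0 := by
    refine HasFDerivAt.comp_hasDerivAt (l := y) (l' := fderiv ℂ y ub) (0 : ℂ) ?_ hline
    simpa using hy.hasFDerivAt
  have h2 : ∀ i, dev x (fderiv ℂ y ub v) (γ i) = v.1 i := by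
    intro i
    have h3 := hasDerivAt_ev_comp hx hy' (by simpa using hy₀)
      (hasDerivAt_famVec (γ := γ) ub v i)
    have h4 : (fun s : ℂ => ev (y (ub + s • v)) (famVec γ (ub + s • v) i)) =ᶠ[𝓝 0]
        fun _ => (0 : ℂ) := by
      have hcc : Tendsto (fun s : ℂ => ub + s • v) (𝓝 0) (𝓝 ub) := by
        simpa using hline.continuousAt.tendsto
      filter_upwards [hcc.eventually hz] with s hs
      exact hs i
    have h5 := h3.unique ((hasDerivAt_const (0 : ℂ) (0 : ℂ)).congr_of_eventuallyEq h4)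
    rw [map_neg, ev_algebraMap hxc, ← sub_eq_add_neg, sub_eq_zero] at h5
    rw [← h5]
    have h6 := dev_add hx (fderiv ℂ y ub v) (famVec γ ub i) (algebraMap ℂ _ (ub.1 i))
    rw [dev_algebraMap hx, add_zero, famVec, sub_add_cancel] at h6
    rw [h6]
    simp [famVec]
  have h7 : ∀ j, ∑ i, c i * ((1 + ∑ j, ub.2 i j * x j) * dev x (Pi.single j 1) (γ i)) = 0 := by
    intro j
    have h8 := h1 j
    simp only [ev_famMap hxc, hz₀, mul_zero, zero_add, ev_famBet hxc, hdγ] at h8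
    have h9 : ∑ i, c i * (2 * ((1 + ∑ j, ub.2 i j * x j) * dev x (Pi.single j 1) (γ i))) =
        2 * ∑ i, c i * ((1 + ∑ j, ub.2 i j * x j) * dev x (Pi.single j 1) (γ i)) := by
      rw [Finset.mul_sum]
      exact Finset.sum_congr rfl fun i _ => by ring
    rw [h9] at h8
    exact (mul_eq_zero.1 h8).resolve_left two_ne_zero
  have h10 : ∑ i, c i * ((1 + ∑ j, ub.2 i j * x j) * dev x (fderiv ℂ y ub v) (γ i)) = 0 := by
    have h11 : ∑ j, (fderiv ℂ y ub v) j *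
        ∑ i, c i * ((1 + ∑ j, ub.2 i j * x j) * dev x (Pi.single j 1) (γ i)) = 0 :=
      Finset.sum_eq_zero fun j _ => by rw [h7, mul_zero]
    simp only [Finset.mul_sum] at h11
    rw [Finset.sum_comm] at h11
    rw [← h11]
    refine Finset.sum_congr rfl fun i _ => ?_
    rw [dev_eq_sum_single, Finset.mul_sum, Finset.mul_sum]
    exact Finset.sum_congr rfl fun j _ => by ring
  simp only [h2] at h10
  rw [Finset.sum_eq_single k] at h10
  · simp only [v, Pi.single_eq_same, mul_one] at h10
    exact (mul_eq_zero.1 h10).resolve_right (hβ k)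
  · intro b _ hb
    simp [v, hb]
  · exact fun h => absurd (Finset.mem_univ _) h

end Family

/-! ### Generic parameters -/

section Generic

open PolydiscAlg

lemma exists_max_of_bounded {α : Type*} {S : Set α} (hS : S.Nonempty) (f : α → ℕ) {B : ℕ}
    (hB : ∀ a ∈ S, f a ≤ B) : ∃ a ∈ S, ∀ b ∈ S, f b ≤ f a := by
  have hb : BddAbove (f '' S) := ⟨B, by rintro _ ⟨a, ha, rfl⟩; exact hB a ha⟩
  obtain ⟨a, ha, h⟩ := Nat.sSup_mem (hS.image f) hb
  exact ⟨a, ha, fun b hb' => h ▸ le_csSup hb ⟨b, hb', rfl⟩⟩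

variable {n p : ℕ} {r : ℝ} {ι : Type*} [Fintype ι]

lemma ncard_cokerPts_le {κ : Type*} [Fintype κ] (hr : 0 ≤ r) {E : ι → Fin p → PolydiscAlg n r}
    {a : κ → Fin p → PolydiscAlg n r} (h : HasRI E a) (hI : IndepMod E a) :
    (cokerPts a).ncard ≤ Fintype.card ι := by
  rw [← finrank_ann_eq hI h, ← sum_mult hr h, Set.ncard_eq_toFinset_card _ (finite_cokerPts hr h),
    Finset.card_eq_sum_ones]
  exact Finset.sum_le_sum fun x hx => mult_pos hr h (by simpa using hx)

variable {γ : Fin p → PolydiscAlg n r} {dγ : Fin n → Fin p → PolydiscAlg n r}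

/-- The condition that a point is a nondegenerate critical point off the zero set. -/
def GoodPt (γ : Fin p → PolydiscAlg n r) (dγ : Fin n → Fin p → PolydiscAlg n r) (ub : UB n p)
    (x : Cn n) : Prop :=
  (fun i => ev x (famVec γ ub i)) ≠ (0 : Fin p → ℂ) ∧
    ∀ d, (∀ j, dev x d (pairVec (famMap γ dγ ub) j) = 0) → d = 0

/-- Good parameters are dense. -/
theorem exists_good_param (hr : 0 ≤ r) {E : ι → Fin p → PolydiscAlg n r}
    {V : Set (UB n p)} (hV : IsOpen V) (hne : V.Nonempty)
    (hRI : ∀ ub ∈ V, HasRI E (pairCols (famMap γ dγ ub)) ∧ IndepMod E (pairCols (famMap γ dγ ub)))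
    (hX : ∀ ub ∈ V, cokerPts (pairCols (famMap γ dγ ub)) ⊆ Metric.ball 0 r)
    (hβ : ∀ ub ∈ V, ∀ x ∈ Metric.ball (0 : Cn n) r, ∀ i,
      1 + ∑ j, ub.2 i j * x j ≠ 0 ∧ 1 - ∑ j, ub.2 i j * x j ≠ 0)
    (hdγ : ∀ x ∈ Metric.ball (0 : Cn n) r, ∀ j i, ev x (dγ j i) = dev x (Pi.single j 1) (γ i)) :
    ∃ ub ∈ V, ∀ x ∈ cokerPts (pairCols (famMap γ dγ ub)), GoodPt γ dγ ub x := by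
  classical
  let X : UB n p → Set (Cn n) := fun ub => cokerPts (pairCols (famMap γ dγ ub))
  let Y : UB n p → Set (Cn n) := fun ub =>
    {x ∈ X ub | (fun i => ev x (famVec γ ub i)) ≠ (0 : Fin p → ℂ)}
  have hXfin : ∀ ub ∈ V, (X ub).Finite := fun ub hub => finite_cokerPts hr (hRI ub hub).1
  obtain ⟨u₁, hu₁, hmax₁⟩ := exists_max_of_bounded hne (fun ub => (X ub).ncard)
    fun ub hub => ncard_cokerPts_le hr (hRI ub hub).1 (hRI ub hub).2
  let V₁ : Set (UB n p) := {ub ∈ V | (X ub).ncard = (X u₁).ncard}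
  obtain ⟨ub, ⟨hub, hub1⟩, hmax₂⟩ := exists_max_of_bounded (S := V₁) ⟨u₁, hu₁, rfl⟩
    (fun ub => (Y ub).ncard) (B := (X u₁).ncard) fun ub hub => by
      rw [← hub.2]
      exact Set.ncard_le_ncard (Set.sep_subset _ _) (hXfin ub hub.1)
  refine ⟨ub, hub, ?_⟩
  have hVn : ∀ᶠ t in 𝓝 ub, t ∈ V := hV.mem_nhds hub
  have hlamd : DifferentiableAt ℂ (fun t => pairCols (famMap γ dγ t)) ub :=
    DifferentiableAt.comp (g := pairCols) ub
      (analyticAt_pairCols _).differentiableAt (differentiable_famMap ub)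
  obtain ⟨y, hy, hyX⟩ := exists_branches hr hlamd (hRI ub hub).1
    (hVn.mono fun t ht => (hRI t ht).2) (hVn.mono fun t ht => by
      change (X t).ncard ≤ (X ub).ncard
      rw [hub1]
      exact hmax₁ t ht)
  have hfc : ∀ i, ContinuousAt (fun t : UB n p => famVec γ t i) ub := fun i =>
    ((continuous_apply i).comp (continuous_snd.comp
      (differentiable_famMap (γ := γ) (dγ := dγ)).continuous)).continuousAt
  have hevc : ∀ x ∈ X ub, ∀ i, Tendsto (fun t => ev (y x t) (famVec γ t i)) (𝓝 ub)
      (𝓝 (ev x (famVec γ ub i))) := by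
    intro x hx i
    have hc := (hy x hx).1.continuousAt
    rw [ContinuousAt, (hy x hx).2] at hc
    refine tendsto_ev (hfc i) hc ?_ hx.1
    filter_upwards [hc.eventually (Metric.isOpen_ball.mem_nhds (hX ub hub hx))] with t ht
    exact Metric.ball_subset_closedBall ht
  have hY : ∀ᶠ t in 𝓝 ub, ∀ x ∈ Y ub, y x t ∈ Y t := by
    have hYf : (Y ub).Finite := (hXfin ub hub).subset (Set.sep_subset _ _)
    have h1 := (eventually_all_finset (p := fun x t =>
      (fun i => ev (y x t) (famVec γ t i)) ≠ (0 : Fin p → ℂ)) hYf.toFinset (l := 𝓝 ub)).2 fun x hx => by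
        have hx' : x ∈ Y ub := by simpa using hx
        exact (tendsto_pi_nhds.2 (hevc x hx'.1)).eventually_ne hx'.2
    filter_upwards [h1, hyX] with t ht htX x hx
    refine ⟨?_, ht x (by simpa using hx)⟩
    change y x t ∈ cokerPts _
    rw [htX.1]
    exact ⟨x, hx.1, rfl⟩
  have hYe : ∀ᶠ t in 𝓝 ub, Y t = (fun x => y x t) '' Y ub := by
    filter_upwards [hY, hyX, hVn] with t ht htX htV
    have hinj := htX.2.mono (Set.sep_subset _ _ : Y ub ⊆ X ub)
    have hYt : (Y t).Finite := (hXfin t htV).subset (Set.sep_subset _ _)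
    refine (Set.eq_of_subset_of_ncard_le ?_ ?_ hYt).symm
    · rintro _ ⟨x, hx, rfl⟩
      exact ht x hx
    · rw [hinj.ncard_image]
      refine hmax₂ t ⟨htV, ?_⟩
      rw [← hub1]
      change (cokerPts _).ncard = _
      rw [htX.1, htX.2.ncard_image]
  intro x hx
  have hxb := hX ub hub hx
  have hne : (fun i => ev x (famVec γ ub i)) ≠ (0 : Fin p → ℂ) := by
    intro h0
    refine false_of_branch hxb hx (hdγ x hxb) (hy x hx).1 (hy x hx).2 ?_
      fun i => (hβ ub hub x hxb i).1
    filter_upwards [hYe, hyX] with t ht htX i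
    by_contra hne
    have h1 : y x t ∈ Y t := by
      refine ⟨?_, fun h => hne (congrFun h i)⟩
      change y x t ∈ cokerPts _
      rw [htX.1]
      exact ⟨x, hx, rfl⟩
    rw [ht] at h1
    obtain ⟨x', hx', he⟩ := h1
    have := htX.2 hx'.1 hx he
    subst this
    exact hx'.2 h0
  refine ⟨hne, fun d hd => ?_⟩
  obtain ⟨i₀, hi₀⟩ := Function.ne_iff.1 hne
  refine nondegenerate_of_branch hxb (hy x hx).1 (hy x hx).2 ?_ hi₀ (hβ ub hub x hxb i₀).2 d hd
  filter_upwards [hY] with t ht j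
  have h1 := ht x ⟨hx, hne⟩
  exact pairVec_eq_zero_of_mem_cokerPts h1.1 h1.2 j

/-- The matrix of second derivatives. -/
def hessMat (γ : Fin p → PolydiscAlg n r) (dγ : Fin n → Fin p → PolydiscAlg n r) (ub : UB n p)
    (x : Cn n) : Matrix (Fin n) (Fin n) ℂ :=
  Matrix.of fun i j => dev x (Pi.single i 1) (pairVec (famMap γ dγ ub) j)

lemma goodPt_iff (ub : UB n p) (x : Cn n) : GoodPt γ dγ ub x ↔
    (fun i => ev x (famVec γ ub i)) ≠ (0 : Fin p → ℂ) ∧ (hessMat γ dγ ub x).det ≠ 0 := by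
  have h : ∀ d j, dev x d (pairVec (famMap γ dγ ub) j) =
      (Matrix.vecMul d (hessMat γ dγ ub x)) j := by
    intro d j
    rw [dev_eq_sum_single]
    rfl
  refine and_congr_right fun _ => ?_
  rw [Ne, ← Matrix.exists_vecMul_eq_zero_iff]
  constructor
  · rintro H ⟨d, hd, h0⟩
    exact hd (H d fun j => by rw [h, h0]; rfl)
  · intro H d hd
    by_contra hne
    exact H ⟨d, hne, funext fun j => by rw [← h, hd]; rfl⟩

lemma continuousAt_dev {x d : Cn n} (hx : x ∈ Metric.ball (0 : Cn n) r) {T : Type*}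
    [TopologicalSpace T] {w : T → PolydiscAlg n r} {t : T} (hw : ContinuousAt w t) :
    ContinuousAt (fun q : T × Cn n => dev q.2 d (w q.1)) (t, x) := by
  have h1 : ContinuousAt (fderiv ℂ fun z => (ev z : PolydiscAlg n r →L[ℂ] ℂ)) x :=
    (analyticAt_ev hx).fderiv.continuousAt
  have h2 : ContinuousAt (fun q : T × Cn n =>
      fderiv ℂ (fun z => (ev z : PolydiscAlg n r →L[ℂ] ℂ)) q.2) (t, x) :=
    ContinuousAt.comp (g := fderiv ℂ fun z => (ev z : PolydiscAlg n r →L[ℂ] ℂ))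
      (f := Prod.snd) h1 continuousAt_snd
  have h3 : ContinuousAt (fun q : T × Cn n => w q.1) (t, x) :=
    ContinuousAt.comp (g := w) (f := Prod.fst) hw continuousAt_fst
  have h4 := (h2.clm_apply continuousAt_const (g := fun _ => d)).clm_apply h3
  refine h4.congr ?_
  have h5 : ∀ᶠ q : T × Cn n in 𝓝 (t, x), q.2 ∈ Metric.ball (0 : Cn n) r :=
    continuousAt_snd.eventually (Metric.isOpen_ball.mem_nhds hx)
  filter_upwards [h5] with q hq
  have h6 := ((analyticAt_ev (r := r) hq).differentiableAt.hasFDerivAt.clm_apply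
    (hasFDerivAt_const (w q.1) q.2)).fderiv
  rw [dev, h6]
  simp

/-- The set of good parameters is open. -/
lemma eventually_goodPt {ub : UB n p} (hX : cokerPts (pairCols (famMap γ dγ ub)) ⊆ Metric.ball 0 r)
    (h : ∀ x ∈ cokerPts (pairCols (famMap γ dγ ub)), GoodPt γ dγ ub x) :
    ∀ᶠ t in 𝓝 ub, ∀ x ∈ cokerPts (pairCols (famMap γ dγ t)), GoodPt γ dγ t x := by
  have hlam : Continuous (famMap γ dγ : UB n p → _) := differentiable_famMap.continuous
  have key : ∀ᶠ t in 𝓝 ub, ∀ x ∈ Metric.closedBall (0 : Cn n) r,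
      x ∈ cokerPts (pairCols (famMap γ dγ t)) → GoodPt γ dγ t x := by
    refine (isCompact_closedBall (0 : Cn n) r).eventually_forall_of_forall_eventually
      fun x hx => ?_
    by_cases hxX : x ∈ cokerPts (pairCols (famMap γ dγ ub))
    · have hxb := hX hxX
      obtain ⟨h1, h2⟩ := (goodPt_iff ub x).1 (h x hxX)
      have hc1 : ContinuousAt (fun q : UB n p × Cn n => fun i => ev q.2 (famVec γ q.1 i))
          (ub, x) := by
        refine continuousAt_pi.2 fun i => ?_
        refine tendsto_ev ?_ continuousAt_snd ?_ hx
        · exact (((continuous_apply i).comp (continuous_snd.comp hlam)).comp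
            continuous_fst).continuousAt
        · filter_upwards [continuousAt_snd.eventually (Metric.isOpen_ball.mem_nhds hxb)] with q hq
          exact Metric.ball_subset_closedBall hq
      have hc2 : ContinuousAt (fun q : UB n p × Cn n => (hessMat γ dγ q.1 q.2).det) (ub, x) := by
        have hm : ContinuousAt (fun q : UB n p × Cn n => hessMat γ dγ q.1 q.2) (ub, x) := by
          refine continuousAt_pi.2 fun i => continuousAt_pi.2 fun j => ?_
          exact continuousAt_dev hxb
            ((analyticAt_pairVec _ j).continuousAt.comp hlam.continuousAt)
        exact (continuous_id.matrix_det.continuousAt).comp hm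
      filter_upwards [hc1.eventually_ne h1, hc2.eventually_ne h2] with q hq1 hq2 _
      exact (goodPt_iff _ _).2 ⟨hq1, hq2⟩
    · have hcont : Continuous fun q : UB n p × Cn n => (pairCols (famMap γ dγ q.1), q.2) :=
        ((pairCols.continuous.comp hlam).comp continuous_fst).prodMk continuous_snd
      have := hcont.continuousAt (x := (ub, x)).eventually
        (isClosed_cokerGraph.isOpen_compl.mem_nhds hxX)
      filter_upwards [this] with q hq hq'
      exact absurd hq' hq
  filter_upwards [key] with t ht x hx
  exact ht x hx.1 hx

/-- At good parameters there are as many points as the rank. -/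
lemma ncard_cokerPts_of_good (hr : 0 ≤ r) {E : ι → Fin p → PolydiscAlg n r} {ub : UB n p}
    (hRI : HasRI E (pairCols (famMap γ dγ ub))) (hI : IndepMod E (pairCols (famMap γ dγ ub)))
    (hX : cokerPts (pairCols (famMap γ dγ ub)) ⊆ Metric.ball 0 r)
    (h : ∀ x ∈ cokerPts (pairCols (famMap γ dγ ub)), GoodPt γ dγ ub x) :
    (cokerPts (pairCols (famMap γ dγ ub))).ncard = Fintype.card ι := by
  rw [← finrank_ann_eq hI hRI, ← sum_mult hr hRI,
    Set.ncard_eq_toFinset_card _ (finite_cokerPts hr hRI), Finset.card_eq_sum_ones]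
  refine Finset.sum_congr rfl fun x hx => ?_
  have hx' : x ∈ cokerPts (pairCols (famMap γ dγ ub)) := by simpa using hx
  refine le_antisymm (mult_pos hr hRI hx') ?_
  refine mult_pairCols_le_one _ (hX hx') (h x hx').1 (fun j => ?_) (h x hx').2
  have := pairVec_eq_zero_of_mem_cokerPts hx' (h x hx').1 j
  rw [pairVec, map_sum] at this
  simpa only [ev_mul hx'.1] using this

end Generic

/-! ### Critical points of the smoothing -/

section Smoothing

open PolydiscAlg

variable {n p : ℕ}

/-- The smoothing of `∑ gᵢ²`. -/
def smoothing (g : Fin p → Cn n → ℂ) (ub : UB n p) (z : Cn n) : ℂ :=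
  ∑ i, (1 + ∑ j, ub.2 i j * z j) * (g i z - ub.1 i) ^ 2

lemma pder_smoothing {g : Fin p → Cn n → ℂ} {z : Cn n}
    (hg : ∀ i, DifferentiableAt ℂ (g i) z) (ub : UB n p) (j : Fin n) :
    pder (smoothing g ub) j z = ∑ i, (g i z - ub.1 i) * (ub.2 i j * (g i z - ub.1 i) +
      2 * ((1 + ∑ k, ub.2 i k * z k) * pder (g i) j z)) := by
  have h1 : ∀ i, HasFDerivAt (fun z : Cn n => 1 + ∑ k, ub.2 i k * z k)
      (∑ k, ub.2 i k • (ContinuousLinearMap.proj k : Cn n →L[ℂ] ℂ)) z := fun i =>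
    (HasFDerivAt.fun_sum fun k _ =>
      ((ContinuousLinearMap.proj k : Cn n →L[ℂ] ℂ).hasFDerivAt.const_mul (ub.2 i k))).const_add 1
  have h2 : ∀ i, HasFDerivAt (fun z => g i z - ub.1 i) (fderiv ℂ (g i) z) z := fun i =>
    (hg i).hasFDerivAt.sub_const _
  have h3 := HasFDerivAt.fun_sum (u := Finset.univ) fun i (_ : i ∈ Finset.univ) =>
    (h1 i).mul ((h2 i).pow 2)
  have h4 : fderiv ℂ (smoothing g ub) z = _ := HasFDerivAt.fderiv h3
  rw [pder, h4, sum_apply]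
  refine Finset.sum_congr rfl fun i _ => ?_
  simp [sum_apply, smul_apply, Pi.single_apply, pder]
  ring

lemma eventually_weight_ne_zero (r : ℝ) : ∀ᶠ ub : UB n p in 𝓝 0,
    ∀ x ∈ Metric.closedBall (0 : Cn n) r, ∀ i,
      1 + ∑ j, ub.2 i j * x j ≠ 0 ∧ 1 - ∑ j, ub.2 i j * x j ≠ 0 := by
  refine (isCompact_closedBall (0 : Cn n) r).eventually_forall_of_forall_eventually fun x _ => ?_
  refine eventually_all.2 fun i => ?_
  have hc : Continuous fun q : UB n p × Cn n => ∑ j, q.1.2 i j * q.2 j := by fun_prop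
  have h1 := (continuous_const (y := (1 : ℂ))).add hc |>.continuousAt (x := ((0 : UB n p), x))
  have h2 := (continuous_const (y := (1 : ℂ))).sub hc |>.continuousAt (x := ((0 : UB n p), x))
  exact (h1.eventually_ne (by simp)).and (h2.eventually_ne (by simp))

lemma fderiv_eq_zero_iff_pder {f : Cn n → ℂ} {z : Cn n} :
    fderiv ℂ f z = 0 ↔ ∀ j, pder f j z = 0 := by
  refine ⟨fun h j => by rw [pder, h]; rfl, fun h => ?_⟩
  refine ContinuousLinearMap.ext fun d => ?_
  rw [← Finset.univ_sum_single d, map_sum]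
  refine (Finset.sum_eq_zero fun i _ => ?_).trans (zero_apply _).symm
  have h1 : (Pi.single i (d i) : Cn n) = d i • Pi.single i 1 := by
    rw [← Pi.single_smul, smul_eq_mul, mul_one]
  rw [h1, map_smul]
  simp only [pder] at h
  rw [h i, smul_zero]

variable {r : ℝ} {γ : Fin p → PolydiscAlg n r} {dγ : Fin n → Fin p → PolydiscAlg n r}
  {g : Fin p → Cn n → ℂ}

lemma pder_smoothing_eq_ev (hγ : ∀ i, IsRep r (g i) (γ i))
    (hdγ : ∀ j i, IsRep r (pder (g i) j) (dγ j i)) {z : Cn n}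
    (hzc : z ∈ Metric.closedBall (0 : Cn n) r) (hg : ∀ i, DifferentiableAt ℂ (g i) z) (ub : UB n p) (j : Fin n) :
    pder (smoothing g ub) j z = ev z (pairVec (famMap γ dγ ub) j) := by
  rw [pder_smoothing hg, pairVec, map_sum]
  refine Finset.sum_congr rfl fun i _ => ?_
  rw [ev_mul hzc, ev_famMap hzc, ev_famBet hzc, hdγ j i z hzc]
  change _ = ev z (famVec γ ub i) * _
  rw [ev_famVec hzc, hγ i z hzc]

/-- Local form of the counting theorem, for functions on a polydisc. -/
theorem exists_generic_smoothing {ι : Type*} [Fintype ι] (hr : 0 < r)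
    (hg : ∀ x ∈ Metric.ball (0 : Cn n) r, ∀ i, DifferentiableAt ℂ (g i) x)
    (hγ : ∀ i, IsRep r (g i) (γ i)) (hdγ : ∀ j i, IsRep r (pder (g i) j) (dγ j i))
    {E : ι → Fin p → PolydiscAlg n r}
    (hE : ∀ᶠ l in 𝓝 (famMap γ dγ 0), HasRI E (pairCols l) ∧ IndepMod E (pairCols l))
    (hX : cokerPts (pairCols (famMap γ dγ 0)) ⊆ Metric.ball 0 r) :
    ∃ δ > (0 : ℝ), ∃ U : Set (UB n p),
      U ⊆ Metric.ball 0 δ ∧ IsOpen U ∧ Metric.ball 0 δ ⊆ closure U ∧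
      ∀ ub ∈ U,
        ({z ∈ Metric.ball (0 : Cn n) r | fderiv ℂ (smoothing g ub) z = 0 ∧
          (fun i => g i z) ≠ ub.1}).Finite ∧
        (∀ z ∈ Metric.ball (0 : Cn n) r, fderiv ℂ (smoothing g ub) z = 0 →
          (fun i => g i z) ≠ ub.1 →
          (Matrix.of fun i j : Fin n =>
            fderiv ℂ (pder (smoothing g ub) j) z (Pi.single i 1)).det ≠ 0) ∧
        ({z ∈ Metric.ball (0 : Cn n) r | fderiv ℂ (smoothing g ub) z = 0 ∧
          (fun i => g i z) ≠ ub.1}).ncard = Fintype.card ι := by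
  have hlam : Continuous (famMap γ dγ : UB n p → _) := differentiable_famMap.continuous
  have hdγ' : ∀ x ∈ Metric.ball (0 : Cn n) r, ∀ j i,
      ev x (dγ j i) = dev x (Pi.single j 1) (γ i) := by
    intro x hx j i
    rw [hdγ j i x (Metric.ball_subset_closedBall hx), pder, dev]
    refine congrArg (fun L : Cn n →L[ℂ] ℂ => L (Pi.single j 1)) (EventuallyEq.fderiv_eq ?_)
    filter_upwards [Metric.isOpen_ball.mem_nhds hx] with y hy
    exact (hγ i y (Metric.ball_subset_closedBall hy)).symm
  have h1 : ∀ᶠ ub : UB n p in 𝓝 0,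
      HasRI E (pairCols (famMap γ dγ ub)) ∧ IndepMod E (pairCols (famMap γ dγ ub)) :=
    hlam.continuousAt.eventually hE
  have h2 : ∀ᶠ ub : UB n p in 𝓝 0,
      cokerPts (pairCols (famMap γ dγ ub)) ⊆ Metric.ball 0 r :=
    (pairCols.continuous.comp hlam).continuousAt.eventually
      (eventually_cokerPts_subset Metric.isOpen_ball hX)
  obtain ⟨δ, hδ, hB⟩ := Metric.eventually_nhds_iff_ball.1
    ((h1.and h2).and (eventually_weight_ne_zero (n := n) (p := p) r))
  refine ⟨δ, hδ, {ub ∈ Metric.ball 0 δ |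
    ∀ x ∈ cokerPts (pairCols (famMap γ dγ ub)), GoodPt γ dγ ub x}, Set.sep_subset _ _, ?_, ?_, ?_⟩
  · rw [isOpen_iff_mem_nhds]
    rintro ub ⟨hub, hgood⟩
    exact inter_mem (Metric.isOpen_ball.mem_nhds hub) (eventually_goodPt (hB ub hub).1.2 hgood)
  · intro ub hub
    rw [mem_closure_iff]
    intro o ho huo
    obtain ⟨t, ht, hgood⟩ := exists_good_param (γ := γ) (dγ := dγ) (E := E)
      (V := o ∩ Metric.ball 0 δ) hr.le
      (ho.inter Metric.isOpen_ball) ⟨ub, huo, hub⟩ (fun t ht => (hB t ht.2).1.1)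
      (fun t ht => (hB t ht.2).1.2)
      (fun t ht x hx i => (hB t ht.2).2 x (Metric.ball_subset_closedBall hx) i) hdγ'
    exact ⟨t, ht.1, ht.2, hgood⟩
  rintro ub ⟨hub, hgood⟩
  obtain ⟨⟨⟨hRI, hI⟩, hXr⟩, -⟩ := hB ub hub
  have hne : ∀ z ∈ Metric.ball (0 : Cn n) r, ((fun i => ev z (famVec γ ub i)) ≠ (0 : Fin p → ℂ) ↔
      (fun i => g i z) ≠ ub.1) := by
    intro z hz
    have hzc := Metric.ball_subset_closedBall hz
    have : (fun i => ev z (famVec γ ub i)) = (fun i => g i z) - ub.1 := by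
      funext i
      rw [ev_famVec hzc, hγ i z hzc]
      rfl
    rw [this, Ne, sub_eq_zero]
  have hset : {z ∈ Metric.ball (0 : Cn n) r | fderiv ℂ (smoothing g ub) z = 0 ∧
      (fun i => g i z) ≠ ub.1} = cokerPts (pairCols (famMap γ dγ ub)) := by
    ext z
    constructor
    · rintro ⟨hz, h0, hz1⟩
      refine mem_cokerPts_of_pairVec (Metric.ball_subset_closedBall hz) ((hne z hz).2 hz1)
        fun j => ?_
      rw [← pder_smoothing_eq_ev hγ hdγ (Metric.ball_subset_closedBall hz) (hg z hz)]
      exact fderiv_eq_zero_iff_pder.1 h0 j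
    · intro hzX
      have hz := hXr hzX
      refine ⟨hz, fderiv_eq_zero_iff_pder.2 fun j => ?_, (hne z hz).1 (hgood z hzX).1⟩
      rw [pder_smoothing_eq_ev hγ hdγ (Metric.ball_subset_closedBall hz) (hg z hz)]
      exact pairVec_eq_zero_of_mem_cokerPts hzX (hgood z hzX).1 j
  refine ⟨?_, ?_, ?_⟩
  · rw [hset]
    exact finite_cokerPts hr.le hRI
  · intro z hz h0 hz1
    have hzX : z ∈ cokerPts (pairCols (famMap γ dγ ub)) := hset ▸ ⟨hz, h0, hz1⟩
    have hmat : (Matrix.of fun i j : Fin n =>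
        fderiv ℂ (pder (smoothing g ub) j) z (Pi.single i 1)) = hessMat γ dγ ub z := by
      ext i j
      simp only [hessMat, Matrix.of_apply, dev]
      refine congrArg (fun L : Cn n →L[ℂ] ℂ => L (Pi.single i 1)) (EventuallyEq.fderiv_eq ?_)
      filter_upwards [Metric.isOpen_ball.mem_nhds hz] with y hy
      exact pder_smoothing_eq_ev hγ hdγ (Metric.ball_subset_closedBall hy) (hg y hy) ub j
    rw [hmat]
    exact ((goodPt_iff ub z).1 (hgood z hzX)).2
  · rw [hset]
    exact ncard_cokerPts_of_good hr.le hRI hI hXr hgood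

end Smoothing

/-! ### The main theorem -/

section OriginFiber

open PolydiscAlg

lemma analyticAt_pder {n : ℕ} {f : Cn n → ℂ} {z : Cn n} (hf : AnalyticAt ℂ f z) (j : Fin n) :
    AnalyticAt ℂ (pder f j) z :=
  AnalyticAt.comp (g := ContinuousLinearMap.apply ℂ ℂ (Pi.single j 1 : Cn n)) (f := fderiv ℂ f)
    (ContinuousLinearMap.analyticAt _ _) hf.fderiv

lemma smoothing_zero {n p : ℕ} (g : Fin p → Cn n → ℂ) :
    smoothing g 0 = fun z => ∑ i, (g i z) ^ 2 := by
  funext z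
  simp [smoothing]

/-- At the parameter `0` the only possible point of the cokernel is the origin. -/
lemma cokerPts_famMap_zero_subset {n p : ℕ} {r : ℝ} {g : Fin p → Cn n → ℂ}
    {γ : Fin p → PolydiscAlg n r} {dγ : Fin n → Fin p → PolydiscAlg n r}
    (hg : ∀ x ∈ Metric.closedBall (0 : Cn n) r, ∀ i, DifferentiableAt ℂ (g i) x)
    (hγ : ∀ i, IsRep r (g i) (γ i)) (hdγ : ∀ j i, IsRep r (pder (g i) j) (dγ j i))
    (hsurj : ∀ x ∈ Metric.closedBall (0 : Cn n) r, (fun i => g i x) = 0 → x ≠ 0 →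
      Function.Surjective (fderiv ℂ (fun z i => g i z) x))
    (hcrit : ∀ x ∈ Metric.closedBall (0 : Cn n) r,
      fderiv ℂ (fun z => ∑ i, (g i z) ^ 2) x = 0 → (fun i => g i x) = 0) :
    cokerPts (pairCols (famMap γ dγ 0)) ⊆ {0} := by
  intro x hx
  have hxc := hx.1
  have hev : (fun i => ev x (famVec γ (0 : UB n p) i)) = fun i => g i x := by
    funext i
    rw [ev_famVec hxc, hγ i x hxc]
    simp
  have hG : (fun i => g i x) = 0 := by
    by_contra hne
    refine hne (hcrit x hxc ?_)
    rw [← smoothing_zero, fderiv_eq_zero_iff_pder]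
    intro j
    rw [pder_smoothing_eq_ev hγ hdγ hxc (hg x hxc)]
    exact pairVec_eq_zero_of_mem_cokerPts hx (hev ▸ hne) j
  by_contra hx0
  obtain ⟨c, hc, h1, -⟩ := exists_coeff_of_mem_cokerPts hx
  refine hc (funext fun k => ?_)
  obtain ⟨d, hd⟩ := hsurj x hxc hG hx0 (Pi.single k 1)
  have hd' : ∀ i, fderiv ℂ (g i) x d = (Pi.single k 1 : Fin p → ℂ) i := by
    intro i
    rw [← hd, fderiv_pi (hg x hxc)]
    rfl
  have h2 : ∀ j, ∑ i, c i * pder (g i) j x = 0 := by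
    intro j
    have h3 := h1 j
    have h4 : ∀ i, ev x ((famMap γ dγ 0).1 j i) = 2 * pder (g i) j x := by
      intro i
      rw [ev_famMap hxc, ev_famBet hxc, hdγ j i x hxc]
      simp
    simp only [h4, mul_left_comm (c _), ← Finset.mul_sum] at h3
    exact (mul_eq_zero.1 h3).resolve_left two_ne_zero
  have h5 : ∑ i, c i * fderiv ℂ (g i) x d = 0 := by
    have h6 : ∀ i, fderiv ℂ (g i) x d = ∑ j, d j * pder (g i) j x := by
      intro i
      conv_lhs => rw [← Finset.univ_sum_single d]
      rw [map_sum]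
      refine Finset.sum_congr rfl fun j _ => ?_
      rw [pder, ← smul_eq_mul, ← map_smul, ← Pi.single_smul, smul_eq_mul, mul_one]
    simp only [h6, Finset.mul_sum]
    rw [Finset.sum_comm]
    refine Finset.sum_eq_zero fun j _ => ?_
    simp only [mul_left_comm (c _), ← Finset.mul_sum, h2, mul_zero]
  simpa [hd', Pi.single_apply] using h5

end OriginFiber

/-- **Theorem 3.11.** Let `Σ = G⁻¹(0)` be a `d`-dimensional ICIS (`d > 1`),
`f = Σᵢ gᵢ²` with critical locus `G⁻¹(0)` and `j(f) = dim_ℂ I/J(f) < ∞`.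
Then in the smoothing `F(u,b,z) = Σᵢ (1 + Σⱼ bᵢⱼ zⱼ)(gᵢ(z) - uᵢ)²`, for all
sufficiently small `ε` and generic small `(u,b)`, the critical points of
`f_{u,b}` off `G⁻¹(u)` in the `ε`-ball are finitely many nondegenerate (`A₁`)
points, and their number is `j(f)`:  `j(f) = dim_ℂ I/J(f) = #A₁(f)`. -/
theorem theorem_3_11 (n p : ℕ) (hp : 1 ≤ p) (hpn : p < n)
    (d : ℕ) (hd : d = n - p) (hd1 : 1 < d)
    (Ω : Set (Cn n)) (hΩ : IsOpen Ω) (h0Ω : (0 : Cn n) ∈ Ω)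
    (g : Fin p → Cn n → ℂ) (hg : ∀ i, AnalyticOnNhd ℂ (g i) Ω)
    (hg0 : ∀ i, g i 0 = 0)
    (G : Cn n → (Fin p → ℂ)) (hG : G = fun z i => g i z)
    (I : Ideal (On n)) (hI : I = idealOfFuns (Set.range g))
    (hdim : ringKrullDim ((On n) ⧸ I) = d)
    (hICIS : ∀ᶠ z in 𝓝 (0 : Cn n), G z = 0 → z ≠ 0 →
      Function.Surjective (fderiv ℂ G z))
    (f : Cn n → ℂ) (hf : f = fun z => ∑ i, (g i z) ^ 2)
    (hSf : ∀ᶠ z in 𝓝 (0 : Cn n), (fderiv ℂ f z = 0 ↔ G z = 0))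
    (hjf : Module.Finite ℂ (quotIJ I (jacobianIdeal f)))
    (F : (Fin p → ℂ) × (Fin p → Fin n → ℂ) → Cn n → ℂ)
    (hF : F = fun ub z => ∑ i, (1 + ∑ j, ub.2 i j * z j) * (g i z - ub.1 i) ^ 2) :
    ∃ ε₀ > (0 : ℝ), ∀ ε ∈ Set.Ioc (0 : ℝ) ε₀, ∃ δ > (0 : ℝ),
      ∃ U : Set ((Fin p → ℂ) × (Fin p → Fin n → ℂ)),
        U ⊆ Metric.ball 0 δ ∧ IsOpen U ∧ Metric.ball 0 δ ⊆ closure U ∧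
        ∀ ub ∈ U,
          ({z ∈ Metric.ball (0 : Cn n) ε | fderiv ℂ (F ub) z = 0 ∧ G z ≠ ub.1}).Finite ∧
          (∀ z ∈ Metric.ball (0 : Cn n) ε, fderiv ℂ (F ub) z = 0 → G z ≠ ub.1 →
            (Matrix.of fun i j : Fin n =>
              fderiv ℂ (pder (F ub) j) z (Pi.single i 1)).det ≠ 0) ∧
          ({z ∈ Metric.ball (0 : Cn n) ε | fderiv ℂ (F ub) z = 0 ∧ G z ≠ ub.1}).ncard
            = Module.finrank ℂ (quotIJ I (jacobianIdeal f)) := by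
  subst hF hG hI
  have hga : ∀ i, AnalyticAt ℂ (g i) 0 := fun i => hg i 0 h0Ω
  have hda : ∀ j i, AnalyticAt ℂ (fun z => 2 * pder (g i) j z) 0 := fun j i =>
    analyticAt_const.mul (analyticAt_pder (hga i) j)
  let γg : Fin p → On n := fun i => On.mk (g i) (hga i)
  let M : Fin n → Fin p → On n := fun j i => On.mk _ (hda j i)
  have hIspan : idealOfFuns (Set.range g) = Ideal.span (Set.range γg) := idealOfFuns_range g hga
  have hfa : AnalyticAt ℂ f 0 := by
    rw [hf]
    exact Finset.analyticAt_fun_sum _ fun i _ => (hga i).pow 2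
  have hJspan : jacobianIdeal f = Ideal.span (Set.range fun j => ∑ i, M j i * γg i) := by
    rw [jacobianIdeal, idealOfFuns_range (pder f) fun j => analyticAt_pder hfa j]
    refine congrArg (fun q : Fin n → On n => Ideal.span (Set.range q)) (funext fun j => ?_)
    have h1 : ∀ i, M j i * γg i = On.mk (fun z => 2 * pder (g i) j z * g i z)
        ((hda j i).mul (hga i)) := fun i => On.mk_mul _ _
    rw [Finset.sum_congr rfl fun i _ => h1 i, On.sum_mk, On.mk_eq_mk]
    filter_upwards [hΩ.mem_nhds h0Ω] with z hz
    rw [hf, ← smoothing_zero, pder_smoothing fun i => (hg i z hz).differentiableAt]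
    refine Finset.sum_congr rfl fun i _ => ?_
    simp
    ring
  have hpn' : p ≤ n := hpn.le
  rw [hIspan] at hdim hjf ⊢
  rw [hJspan] at hjf ⊢
  obtain ⟨φ, hφ0, hφg, K, hK⟩ := On.exists_parameters γg (fun i => hg0 i) hdim (by omega) hpn'
  let Θ := koszulCokerEquiv M γg fun s hs => by
    obtain ⟨A, -, hA, hA'⟩ := On.exists_koszul hpn' hφ0 K hK s (by simpa only [hφg] using hs)
    exact ⟨A, hA, by simpa only [hφg] using hA'⟩
  have hfin : Module.Finite ℂ (KoszulCoker M γg) := Module.Finite.equiv Θ.symm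
  obtain ⟨ρ, hρ, hfree⟩ := exists_free_presentation hpn' M γg
  choose ρ₁ hρ₁ hrep₁ using fun i => PolydiscAlg.exists_isRep (hga i)
  choose ρ₂ hρ₂ hrep₂ using fun q : Fin n × Fin p => PolydiscAlg.exists_isRep (analyticAt_pder (hga q.2) q.1)
  obtain ⟨ρ₃, hρ₃, hball⟩ := Metric.nhds_basis_closedBall.eventually_iff.1
    ((hΩ.eventually_mem h0Ω |>.and hICIS).and hSf)
  have hev : ∀ᶠ ε in 𝓝[>] (0 : ℝ), ε ≤ ρ ∧ (∀ i, ε ≤ ρ₁ i) ∧ (∀ q, ε ≤ ρ₂ q) ∧ ε ≤ ρ₃ := by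
    refine nhdsWithin_le_nhds ?_
    exact (eventually_le_nhds hρ).and ((eventually_all.2 fun i => eventually_le_nhds (hρ₁ i)).and
      ((eventually_all.2 fun q => eventually_le_nhds (hρ₂ q)).and (eventually_le_nhds hρ₃)))
  obtain ⟨ε₀, ⟨h₀, h₁, h₂, h₃⟩, hε₀⟩ := (hev.and self_mem_nhdsWithin).exists
  refine ⟨ε₀, hε₀, fun ε hε => ?_⟩
  have hεp : 0 < ε := hε.1
  choose γ hγ using fun i => hrep₁ i ε (hε.2.trans (h₁ i))
  choose dγ' hdγ' using fun q => hrep₂ q ε (hε.2.trans (h₂ q))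
  let dγ : Fin n → Fin p → PolydiscAlg n ε := fun j i => dγ' (j, i)
  have hdγ : ∀ j i, PolydiscAlg.IsRep ε (pder (g i) j) (dγ j i) := fun j i => hdγ' (j, i)
  have hin : ∀ x ∈ Metric.closedBall (0 : Cn n) ε, x ∈ Metric.closedBall (0 : Cn n) ρ₃ :=
    fun x hx => Metric.closedBall_subset_closedBall (hε.2.trans h₃) hx
  have hgd : ∀ x ∈ Metric.closedBall (0 : Cn n) ε, ∀ i, DifferentiableAt ℂ (g i) x :=
    fun x hx i => (hg i x (hball (hin x hx)).1.1).differentiableAt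
  obtain ⟨E, hE⟩ := hfree ε hεp (hε.2.trans h₀) (famMap γ dγ 0)
    (fun j i => by
      rw [PolydiscAlg.germ_eq_mk_iff]
      filter_upwards [Metric.closedBall_mem_nhds 0 hεp] with z hz
      rw [ev_famMap hz, ev_famBet hz, hdγ j i z hz]
      simp)
    (fun i => by
      rw [PolydiscAlg.germ_eq_mk_iff]
      filter_upwards [Metric.closedBall_mem_nhds 0 hεp] with z hz
      change PolydiscAlg.ev z (famVec γ 0 i) = _
      rw [ev_famVec hz, hγ i z hz]
      simp)
  have hX : cokerPts (pairCols (famMap γ dγ 0)) ⊆ Metric.ball 0 ε := by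
    refine (cokerPts_famMap_zero_subset hgd hγ hdγ (fun x hx => (hball (hin x hx)).1.2)
      fun x hx h => ?_).trans (Set.singleton_subset_iff.2 (Metric.mem_ball_self hεp))
    exact (hball (hin x hx)).2.1 (hf ▸ h)
  obtain ⟨δ, hδ, U, hUδ, hUo, hUd, hU⟩ := exists_generic_smoothing hεp
    (fun x hx => hgd x (Metric.ball_subset_closedBall hx)) hγ hdγ hE hX
  refine ⟨δ, hδ, U, hUδ, hUo, hUd, fun ub hub => ?_⟩
  rw [← Θ.finrank_eq, ← Fintype.card_fin (Module.finrank ℂ (KoszulCoker M γg))]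
  exact hU ub hub

end
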